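/- With S, f, w as in the stated setup and S*, f*, w* the dual surface, dual function and dual weight (w* = w ∘ (∇f)^{-1}): if for all Q* ≥ 1 and δ* ∈ (0,1/2] one has N_{S*}^{w*}(Q*,δ*) ≤ A(δ*(Q*)^n + (Q*)^{β*}) for some β* > n−1 and A ≥ 1, then for all Q ≥ 2 and δ ∈ (0,1/2]: N_S^w(Q,δ) ≤ C₀ δ Q^n + C A max{Q^β, Q^{n-1} log Q}, where β := n − (n−1)/(2β* − n + 1) and the positive constants C₀, C depend only on S and w. -/

import Mathlib

open MeasureTheory

/-- Distance from a real number to the nearest integer. -/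
noncomputable def nint (θ : ℝ) : ℝ := |θ - round θ|

/-- Gradient of `f` at `x`. -/
noncomputable def gradv {m : ℕ} (f : (Fin m → ℝ) → ℝ) (x : Fin m → ℝ) : Fin m → ℝ :=
  fun i => fderiv ℝ f x (Pi.single i 1)

/-- Hessian matrix of `f` at `x`. -/
noncomputable def hess {m : ℕ} (f : (Fin m → ℝ) → ℝ) (x : Fin m → ℝ) :
    Matrix (Fin m) (Fin m) ℝ :=
  Matrix.of fun i j => fderiv ℝ (fun y => fderiv ℝ f y (Pi.single j 1)) x (Pi.single i 1)

/-- The weighted counting function `N_S^w(Q,δ)`. -/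
noncomputable def NSw {m : ℕ} (f w : (Fin m → ℝ) → ℝ) (Q δ : ℝ) : ℝ :=
  ∑ᶠ (q : ℤ) (a : Fin m → ℤ),
    if 1 ≤ q ∧ (q : ℝ) ≤ Q ∧ nint ((q : ℝ) * f (fun i => (a i : ℝ) / (q : ℝ))) < δ
      then w (fun i => (a i : ℝ) / (q : ℝ)) else 0

/-! ### Elementary sums over boxes of integer points -/

lemma sum_natDist_le (ψ : ℕ → ℝ) (hψ : ∀ j, 0 ≤ ψ j) {N i₀ : ℕ} (hi₀ : i₀ < N) :
    ∑ i ∈ Finset.range N, ψ (Nat.dist i i₀) ≤ 2 * ∑ j ∈ Finset.range N, ψ j := by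
  have hmaps : ∀ i ∈ Finset.range N, Nat.dist i i₀ ∈ Finset.range N := by
    intro i hi
    simp only [Finset.mem_range, Nat.dist] at *
    omega
  rw [← Finset.sum_fiberwise_of_maps_to hmaps, Finset.mul_sum]
  refine Finset.sum_le_sum fun j _ => ?_
  have h1 : ∑ i ∈ Finset.range N with Nat.dist i i₀ = j, ψ (Nat.dist i i₀)
      = ((Finset.range N).filter fun i => Nat.dist i i₀ = j).card * ψ j := by
    rw [← nsmul_eq_mul, ← Finset.sum_const]
    refine Finset.sum_congr rfl fun i hi => ?_
    rw [(Finset.mem_filter.1 hi).2]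
  have h2 : ((Finset.range N).filter fun i => Nat.dist i i₀ = j).card ≤ 2 := by
    have : ((Finset.range N).filter fun i => Nat.dist i i₀ = j) ⊆ {i₀ - j, i₀ + j} := by
      intro i hi
      have h := (Finset.mem_filter.1 hi).2
      simp only [Nat.dist] at h
      simp only [Finset.mem_insert, Finset.mem_singleton]
      omega
    exact (Finset.card_le_card this).trans Finset.card_le_two
  rw [h1]
  exact mul_le_mul_of_nonneg_right (by exact_mod_cast h2) (hψ j)

lemma natDist_cast (i j : ℕ) : ((Nat.dist i j : ℕ) : ℝ) = |(i : ℝ) - j| := by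
  rcases le_total i j with h | h
  · rw [Nat.dist_eq_sub_of_le h, Nat.cast_sub h, abs_sub_comm, abs_of_nonneg]
    simpa using h
  · rw [Nat.dist_eq_sub_of_le_right h, Nat.cast_sub h, abs_of_nonneg]
    simpa using h

/-- Summing a decreasing function over well-separated reals. -/
lemma sum_antitone_of_separated (N : ℕ) (g : ℕ → ℝ) {c : ℝ} (hc : 0 ≤ c)
    (hg : ∀ i < N, ∀ j < N, c * |(i : ℝ) - j| ≤ |g i - g j|) (φ : ℝ → ℝ)
    (hφ : ∀ a b, 0 ≤ a → a ≤ b → φ b ≤ φ a) (hφ0 : ∀ a, 0 ≤ a → 0 ≤ φ a) :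
    ∑ i ∈ Finset.range N, φ |g i| ≤ 2 * ∑ i ∈ Finset.range N, φ (c * i / 2) := by
  rcases Nat.eq_zero_or_pos N with rfl | hN
  · simp
  obtain ⟨i₀, hi₀, hmin⟩ := Finset.exists_min_image (Finset.range N) (fun i => |g i|)
    ⟨0, Finset.mem_range.2 hN⟩
  rw [Finset.mem_range] at hi₀
  refine le_trans (Finset.sum_le_sum fun i hi => ?_)
    (sum_natDist_le (fun j => φ (c * j / 2)) (fun j => hφ0 _ (by positivity)) hi₀)
  refine hφ _ _ (by positivity) ?_
  rw [natDist_cast]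
  have h1 := hg i (Finset.mem_range.1 hi) i₀ hi₀
  have h2 := hmin i hi
  have h3 := abs_sub (g i) (g i₀)
  linarith

lemma sum_inv_one_add_le (N : ℕ) :
    ∑ i ∈ Finset.range N, 1 / (1 + (i : ℝ)) ≤ 2 * Real.sqrt N := by
  induction N with
  | zero => simp
  | succ n ih =>
    rw [Finset.sum_range_succ]
    have h1 : 1 / (1 + (n : ℝ)) ≤ 2 * Real.sqrt (n + 1) - 2 * Real.sqrt n := by
      have ha : 0 ≤ Real.sqrt n := Real.sqrt_nonneg _
      have hb : 0 < Real.sqrt (n + 1) := Real.sqrt_pos.2 (by positivity)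
      have hab : Real.sqrt n ≤ Real.sqrt (n + 1) := Real.sqrt_le_sqrt (by linarith)
      have ha2 : Real.sqrt n ^ 2 = n := Real.sq_sqrt (by positivity)
      have hb2 : Real.sqrt (n + 1) ^ 2 = n + 1 := Real.sq_sqrt (by positivity)
      have hb1 : 1 ≤ Real.sqrt (n + 1) := by
        rw [Real.one_le_sqrt]; linarith [(Nat.cast_nonneg n : (0 : ℝ) ≤ n)]
      rw [div_le_iff₀ (by positivity), add_comm (1 : ℝ)]
      generalize Real.sqrt (n + 1) = b at *
      generalize Real.sqrt n = a at *
      rw [← hb2]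
      have h3 : (b - a) * (b + a) = 1 := by nlinarith
      nlinarith [mul_nonneg (sub_nonneg.2 hab) (sub_nonneg.2 hab)]
    push_cast
    linarith

lemma sum_inv_sqrt_le (N : ℕ) :
    ∑ i ∈ Finset.range N, 1 / Real.sqrt (1 + (i : ℝ)) ≤ 2 * Real.sqrt N := by
  induction N with
  | zero => simp
  | succ n ih =>
    rw [Finset.sum_range_succ]
    have h1 : 1 / Real.sqrt (1 + (n : ℝ)) ≤ 2 * Real.sqrt (n + 1) - 2 * Real.sqrt n := by
      have ha : 0 ≤ Real.sqrt n := Real.sqrt_nonneg _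
      have hb : 0 < Real.sqrt (n + 1) := Real.sqrt_pos.2 (by positivity)
      have hab : Real.sqrt n ≤ Real.sqrt (n + 1) := Real.sqrt_le_sqrt (by linarith)
      have ha2 : Real.sqrt n ^ 2 = n := Real.sq_sqrt (by positivity)
      have hb2 : Real.sqrt (n + 1) ^ 2 = n + 1 := Real.sq_sqrt (by positivity)
      rw [add_comm (1 : ℝ), div_le_iff₀ hb]
      nlinarith [mul_nonneg ha hb.le]
    push_cast
    linarith

lemma sum_inv_one_add_sq_le (N : ℕ) :
    ∑ i ∈ Finset.range N, 1 / (1 + (i : ℝ)) ^ 2 ≤ 2 - 1 / (N : ℝ) := by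
  induction N with
  | zero => simp
  | succ n ih =>
    rw [Finset.sum_range_succ]
    rcases Nat.eq_zero_or_pos n with rfl | hn
    · norm_num
    have hn' : (0 : ℝ) < n := by exact_mod_cast hn
    have h1 : 1 / (1 + (n : ℝ)) ^ 2 ≤ 1 / (n : ℝ) - 1 / ((n : ℝ) + 1) := by
      rw [div_sub_div _ _ hn'.ne' (by positivity), div_le_div_iff₀ (by positivity) (by positivity)]
      nlinarith
    push_cast
    linarith

/-- The box `[0, N)^m` of integer points. -/
def cube (m N : ℕ) : Finset (Fin m → ℕ) := Fintype.piFinset fun _ => Finset.range N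

lemma mem_cube {m N : ℕ} {t : Fin m → ℕ} : t ∈ cube m N ↔ ∀ i, t i < N := by
  simp [cube]

lemma card_cube (m N : ℕ) : (cube m N).card = N ^ m := by
  simp [cube]

/-- A box splits into sub-boxes. -/
lemma sum_cube_mul {α : Type*} [AddCommMonoid α] (m M N : ℕ) (F : (Fin m → ℕ) → α) :
    ∑ r ∈ cube m (M * N), F r
      = ∑ r ∈ cube m M, ∑ t ∈ cube m N, F (fun i => N * r i + t i) := by
  rw [← Finset.sum_product']
  symm
  refine Finset.sum_bij' (fun p _ => fun i => N * p.1 i + p.2 i)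
    (fun r _ => (fun i => r i / N, fun i => r i % N)) ?_ ?_ ?_ ?_ ?_
  · intro p hp
    simp only [Finset.mem_product, mem_cube] at hp ⊢
    intro i
    calc N * p.1 i + p.2 i < N * p.1 i + N := by have := hp.2 i; omega
      _ = N * (p.1 i + 1) := by ring
      _ ≤ N * M := Nat.mul_le_mul_left _ (hp.1 i)
      _ = M * N := mul_comm _ _
  · intro r hr
    simp only [Finset.mem_product, mem_cube] at hr ⊢
    refine ⟨fun i => Nat.div_lt_of_lt_mul (by rw [mul_comm]; exact hr i), fun i => ?_⟩
    refine Nat.mod_lt _ (Nat.pos_of_ne_zero ?_)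
    rintro rfl
    simpa using hr i
  · intro p hp
    simp only [Finset.mem_product, mem_cube] at hp
    ext i
    · have := hp.2 i
      simp [Nat.mul_add_div (Nat.zero_lt_of_lt this), Nat.div_eq_of_lt this]
    · simp [Nat.mod_eq_of_lt (hp.2 i)]
  · intro r _
    ext i
    exact Nat.div_add_mod _ _
  · intro p _
    rfl

/-- Summation over a box along lines in a coordinate direction. -/
lemma sum_cube_le_of_line {m N : ℕ} (e : Fin m) (F : (Fin m → ℕ) → ℝ) {S : ℝ}
    (hF : ∀ t ∈ cube m N, ∑ i ∈ Finset.range N, F (Function.update t e i) ≤ S) :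
    (N : ℝ) * ∑ t ∈ cube m N, F t ≤ N ^ m * S := by
  have h1 : ∑ t ∈ cube m N, ∑ i ∈ Finset.range N, F (Function.update t e i)
      = (N : ℝ) * ∑ t ∈ cube m N, F t := by
    rw [← Finset.sum_product', Finset.mul_sum]
    have : ∀ t ∈ cube m N, (N : ℝ) * F t = ∑ i ∈ Finset.range N, F t := by
      intro t _; simp
    rw [Finset.sum_congr rfl this, ← Finset.sum_product']
    refine Finset.sum_bij' (fun p _ => (Function.update p.1 e p.2, p.1 e))
      (fun p _ => (Function.update p.1 e p.2, p.1 e)) ?_ ?_ ?_ ?_ ?_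
    · intro p hp
      simp only [Finset.mem_product, mem_cube, Finset.mem_range] at hp ⊢
      refine ⟨fun i => ?_, hp.1 e⟩
      by_cases h : i = e
      · subst h; simpa using hp.2
      · simpa [h] using hp.1 i
    · intro p hp
      simp only [Finset.mem_product, mem_cube, Finset.mem_range] at hp ⊢
      refine ⟨fun i => ?_, hp.1 e⟩
      by_cases h : i = e
      · subst h; simpa using hp.2
      · simpa [h] using hp.1 i
    · intro p _; simp
    · intro p _; simp
    · intro p _; rfl
  rw [← h1]
  calc _ ≤ ∑ t ∈ cube m N, S := Finset.sum_le_sum hF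
    _ = _ := by simp [card_cube]

lemma sum_cube_inv_dist_le {m N : ℕ} (hm : 2 ≤ m) {t₀ : Fin m → ℕ} (ht₀ : t₀ ∈ cube m N) :
    (N : ℝ) * ∑ t ∈ cube m N, 1 / (1 + ‖fun i => (t i : ℝ) - t₀ i‖) ≤ 16 * N ^ m := by
  have hN : 0 < N := Nat.zero_lt_of_lt (mem_cube.1 ht₀ ⟨0, by omega⟩)
  set s : Finset (Fin m) := {⟨0, by omega⟩, ⟨1, by omega⟩} with hs
  have hcard : s.card = 2 := by
    rw [hs, Finset.card_pair]; simp
  set g : Fin m → ℕ → ℝ := fun i j =>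
    if i ∈ s then 1 / Real.sqrt (1 + (Nat.dist j (t₀ i) : ℕ)) else 1 with hg
  have hle : ∀ t ∈ cube m N, 1 / (1 + ‖fun i => (t i : ℝ) - t₀ i‖) ≤ ∏ i, g i (t i) := by
    intro t _
    set R := ‖fun i => (t i : ℝ) - t₀ i‖ with hR
    have hR0 : 0 ≤ R := norm_nonneg _
    have h1 : ∀ i, (if i ∈ s then 1 / Real.sqrt (1 + R) else 1) ≤ g i (t i) := by
      intro i
      simp only [hg]
      split_ifs
      · have h2 : ((Nat.dist (t i) (t₀ i) : ℕ) : ℝ) ≤ R := by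
          rw [natDist_cast, ← Real.norm_eq_abs]
          exact norm_le_pi_norm (fun i => (t i : ℝ) - t₀ i) i
        gcongr
      · exact le_rfl
    calc 1 / (1 + R) = ∏ i, (if i ∈ s then 1 / Real.sqrt (1 + R) else 1) := by
          rw [Finset.prod_ite, Finset.prod_const, Finset.prod_const_one, mul_one,
            Finset.filter_mem_eq_inter, Finset.univ_inter, hcard, div_pow,
            Real.sq_sqrt (by positivity), one_pow]
      _ ≤ _ := Finset.prod_le_prod (fun i _ => by split_ifs <;> positivity) fun i _ => h1 i
  have hsum : ∑ t ∈ cube m N, ∏ i, g i (t i) ≤ (4 * Real.sqrt N) ^ 2 * (N : ℝ) ^ (m - 2) := by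
    rw [cube, ← Finset.prod_univ_sum]
    calc ∏ i, ∑ j ∈ Finset.range N, g i j ≤ ∏ i, (if i ∈ s then 4 * Real.sqrt N else (N : ℝ)) := by
          refine Finset.prod_le_prod (fun i _ => Finset.sum_nonneg fun j _ => ?_) fun i _ => ?_
          · simp only [hg]; split_ifs <;> positivity
          · simp only [hg]
            split_ifs
            · have h1 := sum_natDist_le (fun j => 1 / Real.sqrt (1 + (j : ℝ)))
                (fun j => by positivity) (mem_cube.1 ht₀ i)
              have h2 := sum_inv_sqrt_le N
              linarith
            · simp
      _ = _ := by
          rw [Finset.prod_ite, Finset.prod_const, Finset.prod_const,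
            Finset.filter_mem_eq_inter, Finset.univ_inter, hcard]
          congr 2
          rw [Finset.filter_notMem_eq_sdiff, Finset.card_sdiff_of_subset (Finset.subset_univ _),
            hcard]
          simp
  have h3 : (N : ℝ) ^ m = N ^ 2 * N ^ (m - 2) := by rw [← pow_add]; congr 1; omega
  calc _ ≤ (N : ℝ) * ((4 * Real.sqrt N) ^ 2 * (N : ℝ) ^ (m - 2)) := by
        gcongr; exact (Finset.sum_le_sum hle).trans hsum
    _ = _ := by
        rw [mul_pow, Real.sq_sqrt (Nat.cast_nonneg N), h3]; ring

/-! ### Integer vectors, frames, and adapted families of frames -/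

/-- Integer vectors `(s, t, r)` in `ℤ × ℤ^m × ℤ`. -/
abbrev IVec (m : ℕ) := ℤ × (Fin m → ℤ) × ℤ

/-- Parameters of a unipotent change of coordinates on `ℝ × ℝ^m × ℝ`. -/
structure Frame (m : ℕ) where
  xi : Fin m → ℝ
  eta : Fin m → ℝ
  zeta : ℝ

namespace Frame

variable {m : ℕ}

/-- The middle coordinates of a vector in a frame. -/
def horiz (P : Frame m) (v : IVec m) : Fin m → ℝ := fun i => v.2.1 i + v.1 * P.xi i

/-- The last coordinate of a vector in a frame. -/
def vert (P : Frame m) (v : IVec m) : ℝ :=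
  v.2.2 + v.1 * P.zeta + (fun i => (v.2.1 i : ℝ)) ⬝ᵥ P.eta

/-- The norm of a vector in a frame, rescaled by `diag(1/T, 1, T)`. -/
noncomputable def size (P : Frame m) (T : ℝ) (v : IVec m) : ℝ :=
  |(v.1 : ℝ)| / T + ‖P.horiz v‖ + T * |P.vert v|

/-- The dual frame. -/
def dual (P : Frame m) : Frame m := ⟨-P.eta, -P.xi, P.xi ⬝ᵥ P.eta - P.zeta⟩

lemma size_nonneg (P : Frame m) {T : ℝ} (hT : 0 < T) (v : IVec m) : 0 ≤ P.size T v := by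
  unfold size; positivity

lemma abs_div_le_size (P : Frame m) {T : ℝ} (hT : 0 < T) (v : IVec m) :
    |(v.1 : ℝ)| / T ≤ P.size T v := by
  unfold size
  have : 0 ≤ T * |P.vert v| := by positivity
  have := norm_nonneg (P.horiz v)
  linarith

lemma horiz_le_size (P : Frame m) {T : ℝ} (hT : 0 < T) (v : IVec m) :
    ‖P.horiz v‖ ≤ P.size T v := by
  unfold size
  have : 0 ≤ T * |P.vert v| := by positivity
  have : 0 ≤ |(v.1 : ℝ)| / T := by positivity
  linarith

lemma vert_le_size (P : Frame m) {T : ℝ} (hT : 0 < T) (v : IVec m) :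
    T * |P.vert v| ≤ P.size T v := by
  unfold size
  have := norm_nonneg (P.horiz v)
  have : 0 ≤ |(v.1 : ℝ)| / T := by positivity
  linarith

lemma horiz_sub (P P' : Frame m) (v : IVec m) :
    P'.horiz v - P.horiz v = (v.1 : ℝ) • (P'.xi - P.xi) := by
  ext i
  simp only [horiz, Pi.sub_apply, Pi.smul_apply, smul_eq_mul]
  ring

lemma vert_sub (P P' : Frame m) (v : IVec m) :
    P'.vert v - P.vert v = P.horiz v ⬝ᵥ (P'.eta - P.eta)
      + v.1 * (P'.zeta - P.zeta - P.xi ⬝ᵥ (P'.eta - P.eta)) := by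
  have : P.horiz v = (fun i => (v.2.1 i : ℝ)) + (v.1 : ℝ) • P.xi := by
    ext i; simp [horiz]
  rw [this, add_dotProduct, smul_dotProduct, dotProduct_sub, dotProduct_sub]
  simp only [vert, smul_eq_mul]
  ring

end Frame

lemma abs_dotProduct_le {m : ℕ} (a b : Fin m → ℝ) : |a ⬝ᵥ b| ≤ m * (‖a‖ * ‖b‖) := by
  calc |a ⬝ᵥ b| ≤ ∑ i, |a i * b i| := Finset.abs_sum_le_sum_abs _ _
    _ ≤ ∑ _i : Fin m, ‖a‖ * ‖b‖ := by
        refine Finset.sum_le_sum fun i _ => ?_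
        rw [abs_mul]
        exact mul_le_mul (norm_le_pi_norm a i) (norm_le_pi_norm b i) (abs_nonneg _)
          (norm_nonneg _)
    _ = _ := by simp

lemma error_terms_le {m K a h σ θ : ℝ} (hm : 1 ≤ m) (hK : 1 ≤ K) (ha : 0 ≤ a) (hh : 0 ≤ h)
    (hσ : 0 ≤ σ) (hθ : 0 ≤ θ) (hθ' : θ * (16 * m * K) ≤ 1) (hs : σ * (16 * m * K ^ 3) ≤ a) :
    K * (m * (2 * K * σ * (K * h)) + m * ((a + 2 * K * σ) * (θ * h)) + K * σ * h)
      ≤ 3 / 8 * (a * h) := by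
  have hK0 : 0 ≤ K := zero_le_one.trans hK
  have hK3 : 0 ≤ K ^ 3 := by positivity
  have hKK : K * K ≤ m * K ^ 3 := by
    have h2 : K * K ≤ K ^ 3 := by
      have : K ^ 3 = K * K * K := by ring
      rw [this]; nlinarith [mul_nonneg hK0 hK0]
    nlinarith
  have hK1 : K ≤ m * K ^ 3 := le_trans (by nlinarith) hKK
  have u1 : K * (m * (2 * K * σ * (K * h))) ≤ a * h / 8 := by
    have : K * (m * (2 * K * σ * (K * h))) = (σ * (16 * m * K ^ 3)) * h / 8 := by ring
    rw [this]; gcongr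
  have hKσ : 2 * K * σ ≤ a := by nlinarith
  have u2 : K * (m * ((a + 2 * K * σ) * (θ * h))) ≤ a * h / 8 := by
    calc K * (m * ((a + 2 * K * σ) * (θ * h))) ≤ K * (m * ((a + a) * (θ * h))) := by gcongr
      _ = (θ * (16 * m * K)) * (a * h) / 8 := by ring
      _ ≤ 1 * (a * h) / 8 := by gcongr
      _ = _ := by ring
  have u3 : K * (K * σ * h) ≤ a * h / 8 := by
    have : K * K * σ ≤ a / 8 := by nlinarith
    nlinarith
  linarith

/-- A family of frames over `U` which is close to being linear with invertible linear part. -/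
structure AdaptedFrames {m : ℕ} (P : (Fin m → ℝ) → Frame m) (U : Set (Fin m → ℝ)) (K θ : ℝ)
    (B' B : (Fin m → ℝ) →ₗ[ℝ] (Fin m → ℝ)) : Prop where
  one_le : 1 ≤ K
  theta_nonneg : 0 ≤ θ
  theta_le : θ * (16 * m * K) ≤ 1
  xi_approx : ∀ x ∈ U, ∀ y ∈ U, ‖(P y).xi - (P x).xi - B' (y - x)‖ ≤ θ * ‖y - x‖
  eta_approx : ∀ x ∈ U, ∀ y ∈ U, ‖(P y).eta - (P x).eta - B (y - x)‖ ≤ θ * ‖y - x‖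
  zeta_approx : ∀ x ∈ U, ∀ y ∈ U,
    |(P y).zeta - (P x).zeta - (P x).xi ⬝ᵥ ((P y).eta - (P x).eta)| ≤ K * ‖y - x‖ ^ 2
  xi_le : ∀ h, ‖B' h‖ ≤ K * ‖h‖
  eta_le : ∀ h, ‖B h‖ ≤ K * ‖h‖
  xi_ge : ∀ h, ‖h‖ ≤ K * ‖B' h‖
  eta_dual : ∀ a, ∃ e, ‖a‖ ≤ K * |a ⬝ᵥ B (Pi.single e 1)|

/-- Grid points `x + h t`. -/
def gridPt {m : ℕ} (x : Fin m → ℝ) (h : ℝ) (t : Fin m → ℕ) : Fin m → ℝ := fun i => x i + h * t i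

lemma gridPt_gridPt {m : ℕ} (x : Fin m → ℝ) (h : ℝ) (N : ℕ) (r t : Fin m → ℕ) :
    gridPt (gridPt x (h * N) r) h t = gridPt x h (fun i => N * r i + t i) := by
  ext i; simp only [gridPt]; push_cast; ring

lemma gridPt_sub {m : ℕ} (x : Fin m → ℝ) (h : ℝ) (t t' : Fin m → ℕ) :
    gridPt x h t - gridPt x h t' = h • fun i => (t i : ℝ) - t' i := by
  ext i; simp only [gridPt, Pi.sub_apply, Pi.smul_apply, smul_eq_mul]; ring

lemma norm_gridPt_sub_le {m N : ℕ} (x : Fin m → ℝ) {h : ℝ} (hh : 0 ≤ h) {t : Fin m → ℕ}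
    (ht : t ∈ cube m N) : ‖gridPt x h t - x‖ ≤ h * N := by
  rw [pi_norm_le_iff_of_nonneg (by positivity)]
  intro i
  have : (t i : ℝ) ≤ N := by exact_mod_cast (mem_cube.1 ht i).le
  simp only [gridPt, Pi.sub_apply, add_sub_cancel_left, Real.norm_eq_abs]
  rw [abs_of_nonneg (by positivity)]
  gcongr

namespace AdaptedFrames

variable {m : ℕ} {P : (Fin m → ℝ) → Frame m} {U : Set (Fin m → ℝ)} {K θ : ℝ}
  {B' B : (Fin m → ℝ) →ₗ[ℝ] (Fin m → ℝ)}

lemma theta_mul_le (F : AdaptedFrames P U K θ B' B) (hm : 1 ≤ m) : θ * K ≤ 1 / 16 := by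
  have h1 := F.theta_le
  have h2 : (1 : ℝ) ≤ m := by exact_mod_cast hm
  have h3 := mul_nonneg F.theta_nonneg (zero_le_one.trans F.one_le)
  nlinarith

lemma theta_le_one (F : AdaptedFrames P U K θ B' B) (hm : 1 ≤ m) : θ ≤ 1 := by
  have h1 := F.theta_mul_le hm
  have h2 := F.one_le
  have h3 := F.theta_nonneg
  nlinarith

lemma xi_lip (F : AdaptedFrames P U K θ B' B) (hm : 1 ≤ m) {x y : Fin m → ℝ} (hx : x ∈ U)
    (hy : y ∈ U) : ‖(P y).xi - (P x).xi‖ ≤ 2 * K * ‖y - x‖ := by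
  have h1 := F.xi_approx x hx y hy
  have h2 := F.xi_le (y - x)
  have h3 := norm_add_le ((P y).xi - (P x).xi - B' (y - x)) (B' (y - x))
  rw [sub_add_cancel] at h3
  have h4 := F.theta_le_one hm
  have h5 := F.one_le
  have h6 := norm_nonneg (y - x)
  nlinarith

lemma eta_lip (F : AdaptedFrames P U K θ B' B) (hm : 1 ≤ m) {x y : Fin m → ℝ} (hx : x ∈ U)
    (hy : y ∈ U) : ‖(P y).eta - (P x).eta‖ ≤ 2 * K * ‖y - x‖ := by
  have h1 := F.eta_approx x hx y hy
  have h2 := F.eta_le (y - x)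
  have h3 := norm_add_le ((P y).eta - (P x).eta - B (y - x)) (B (y - x))
  rw [sub_add_cancel] at h3
  have h4 := F.theta_le_one hm
  have h5 := F.one_le
  have h6 := norm_nonneg (y - x)
  nlinarith

lemma xi_expand (F : AdaptedFrames P U K θ B' B) (hm : 1 ≤ m) {x y : Fin m → ℝ} (hx : x ∈ U)
    (hy : y ∈ U) : ‖y - x‖ ≤ 2 * K * ‖(P y).xi - (P x).xi‖ := by
  have h1 := F.xi_approx x hx y hy
  have h2 := F.xi_ge (y - x)
  have h3 := norm_sub_le ((P y).xi - (P x).xi) ((P y).xi - (P x).xi - B' (y - x))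
  rw [sub_sub_cancel] at h3
  have h4 := F.theta_mul_le hm
  have h5 := F.one_le
  have h6 := norm_nonneg (y - x)
  have h7 : K * ‖B' (y - x)‖ ≤ K * (‖(P y).xi - (P x).xi‖ + θ * ‖y - x‖) := by
    gcongr; linarith
  nlinarith [norm_nonneg ((P y).xi - (P x).xi)]

lemma norm_horiz_sub_le (F : AdaptedFrames P U K θ B' B) (hm : 1 ≤ m) {x y : Fin m → ℝ}
    (hx : x ∈ U) (hy : y ∈ U) (v : IVec m) :
    ‖(P y).horiz v - (P x).horiz v‖ ≤ 2 * K * (|(v.1 : ℝ)| * ‖y - x‖) := by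
  rw [Frame.horiz_sub, norm_smul, Real.norm_eq_abs]
  have := mul_le_mul_of_nonneg_left (F.xi_lip hm hx hy) (abs_nonneg (v.1 : ℝ))
  linarith

lemma le_norm_horiz_sub (F : AdaptedFrames P U K θ B' B) (hm : 1 ≤ m) {x y : Fin m → ℝ}
    (hx : x ∈ U) (hy : y ∈ U) (v : IVec m) :
    |(v.1 : ℝ)| * ‖y - x‖ ≤ 2 * K * ‖(P y).horiz v - (P x).horiz v‖ := by
  rw [Frame.horiz_sub, norm_smul, Real.norm_eq_abs]
  have := mul_le_mul_of_nonneg_left (F.xi_expand hm hx hy) (abs_nonneg (v.1 : ℝ))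
  linarith

lemma abs_vert_sub_le (F : AdaptedFrames P U K θ B' B) (hm : 1 ≤ m) {x y : Fin m → ℝ}
    (hx : x ∈ U) (hy : y ∈ U) (v : IVec m) :
    |(P y).vert v - (P x).vert v|
      ≤ 2 * m * K * (‖(P x).horiz v‖ * ‖y - x‖) + K * (|(v.1 : ℝ)| * ‖y - x‖ ^ 2) := by
  rw [Frame.vert_sub]
  refine (abs_add_le _ _).trans (add_le_add ?_ ?_)
  · refine (abs_dotProduct_le _ _).trans ?_
    have := mul_le_mul_of_nonneg_left (F.eta_lip hm hx hy) (norm_nonneg ((P x).horiz v))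
    have h2 := mul_le_mul_of_nonneg_left this (Nat.cast_nonneg (α := ℝ) m)
    linarith
  · rw [abs_mul]
    have := mul_le_mul_of_nonneg_left (F.zeta_approx x hx y hy) (abs_nonneg (v.1 : ℝ))
    linarith

/-- Along a well-chosen coordinate direction the last coordinate grows linearly. -/
lemma exists_vert_expand (F : AdaptedFrames P U K θ B' B) (hm : 1 ≤ m) {x₀ : Fin m → ℝ}
    (hx₀ : x₀ ∈ U) (v : IVec m) {R : ℝ}
    (hs : |(v.1 : ℝ)| * R * (16 * m * K ^ 3) ≤ ‖(P x₀).horiz v‖) :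
    ∃ e : Fin m, ∀ x ∈ U, ∀ y ∈ U, ∀ h : ℝ, ‖x - x₀‖ ≤ R → |h| ≤ R →
      y - x = h • Pi.single e 1 →
      |h| * ‖(P x₀).horiz v‖ ≤ 2 * K * |(P y).vert v - (P x).vert v| := by
  obtain ⟨e, he⟩ := F.eta_dual ((P x₀).horiz v)
  refine ⟨e, fun x hx y hy h hxR hhR hxy => ?_⟩
  set A₀ := (P x₀).horiz v with hA₀
  set A := (P x).horiz v with hA
  have hK := F.one_le
  have hm' : (1 : ℝ) ≤ m := by exact_mod_cast hm
  have hθ := F.theta_nonneg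
  have hnorm : ‖y - x‖ = |h| := by
    rw [hxy, norm_smul, Pi.norm_single]; simp
  have hB : B (y - x) = h • B (Pi.single e 1) := by rw [hxy, map_smul]
  set E := (P y).eta - (P x).eta - B (y - x) with hE
  have hE' : ‖E‖ ≤ θ * |h| := hnorm ▸ F.eta_approx x hx y hy
  set Z := (P y).zeta - (P x).zeta - (P x).xi ⬝ᵥ ((P y).eta - (P x).eta) with hZ
  have hZ' : |Z| ≤ K * |h| ^ 2 := hnorm ▸ F.zeta_approx x hx y hy
  have hdec : (P y).vert v - (P x).vert v
      = h * (A₀ ⬝ᵥ B (Pi.single e 1)) + (A - A₀) ⬝ᵥ B (y - x) + A ⬝ᵥ E + v.1 * Z := by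
    rw [Frame.vert_sub, sub_dotProduct, hE, dotProduct_sub A, hB, dotProduct_smul,
      dotProduct_smul, smul_eq_mul, smul_eq_mul, ← hZ, dotProduct_sub A, dotProduct_sub A,
      dotProduct_smul, smul_eq_mul]
    ring
  have hR0 : 0 ≤ R := (abs_nonneg h).trans hhR
  have hAA : ‖A - A₀‖ ≤ 2 * K * (|(v.1 : ℝ)| * R) := by
    refine (F.norm_horiz_sub_le hm hx₀ hx v).trans ?_
    gcongr
  set a := ‖A₀‖ with ha
  have ha0 : 0 ≤ a := norm_nonneg _
  set σ := |(v.1 : ℝ)| * R with hσ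
  have hσ0 : 0 ≤ σ := by positivity
  have hAn : ‖A‖ ≤ a + 2 * K * σ := by
    have := norm_add_le (A - A₀) A₀
    rw [sub_add_cancel] at this
    linarith
  have hh0 := abs_nonneg h
  have t1 : |(A - A₀) ⬝ᵥ B (y - x)| ≤ m * (2 * K * σ * (K * |h|)) := by
    refine (abs_dotProduct_le _ _).trans ?_
    have := F.eta_le (y - x)
    rw [hnorm] at this
    gcongr
  have t2 : |A ⬝ᵥ E| ≤ m * ((a + 2 * K * σ) * (θ * |h|)) := by
    refine (abs_dotProduct_le _ _).trans ?_
    gcongr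
  have t3 : |(v.1 : ℝ) * Z| ≤ K * σ * |h| := by
    rw [abs_mul]
    calc |(v.1 : ℝ)| * |Z| ≤ |(v.1 : ℝ)| * (K * |h| ^ 2) := by gcongr
      _ = K * (|(v.1 : ℝ)| * |h|) * |h| := by ring
      _ ≤ _ := by rw [hσ]; gcongr
  have t0 : |h| * a ≤ K * |h * (A₀ ⬝ᵥ B (Pi.single e 1))| := by
    rw [abs_mul]
    have := mul_le_mul_of_nonneg_left he hh0
    linarith
  have key : |h * (A₀ ⬝ᵥ B (Pi.single e 1))| ≤ |(P y).vert v - (P x).vert v|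
      + (|(A - A₀) ⬝ᵥ B (y - x)| + |A ⬝ᵥ E| + |(v.1 : ℝ) * Z|) := by
    have e1 : h * (A₀ ⬝ᵥ B (Pi.single e 1)) = ((P y).vert v - (P x).vert v)
      - ((A - A₀) ⬝ᵥ B (y - x) + A ⬝ᵥ E + v.1 * Z) := by rw [hdec]; ring
    rw [e1]
    refine (abs_sub _ _).trans ?_
    gcongr
    exact abs_add_three _ _ _
  have hK0 : 0 ≤ K := zero_le_one.trans hK
  have hnum := error_terms_le hm' hK ha0 hh0 hσ0 hθ F.theta_le hs
  have v0 := mul_le_mul_of_nonneg_left (key.trans (add_le_add_right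
    (add_le_add (add_le_add t1 t2) t3) _)) hK0
  have v4 : 0 ≤ a * |h| := by positivity
  clear_value a σ
  linarith

end AdaptedFrames

lemma Frame.size_pos {m : ℕ} (P : Frame m) {T : ℝ} (hT : 0 < T) {v : IVec m} (hv : v ≠ 0) :
    0 < P.size T v := by
  refine lt_of_le_of_ne (P.size_nonneg hT v) fun h => hv ?_
  have h1 : |(v.1 : ℝ)| / T = 0 := le_antisymm (h ▸ P.abs_div_le_size hT v) (by positivity)
  have h2 : ‖P.horiz v‖ = 0 := le_antisymm (h ▸ P.horiz_le_size hT v) (norm_nonneg _)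
  have h3 : T * |P.vert v| = 0 := le_antisymm (h ▸ P.vert_le_size hT v) (by positivity)
  have hs : (v.1 : ℝ) = 0 := by simpa [hT.ne'] using h1
  have ht : v.2.1 = 0 := by
    ext i
    have := congrFun (norm_eq_zero.1 h2) i
    simp only [Frame.horiz, hs, zero_mul, add_zero, Pi.zero_apply] at this
    exact_mod_cast this
  have hr : v.2.2 = 0 := by
    have : P.vert v = 0 := by simpa [hT.ne'] using h3
    simp only [Frame.vert, hs, ht, Pi.zero_apply] at this
    have h0 : (fun _ : Fin m => ((0 : ℤ) : ℝ)) = 0 := by ext; simp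
    rw [h0, zero_dotProduct] at this
    simpa using this
  exact Prod.ext (by exact_mod_cast hs) (Prod.ext ht hr)

lemma card_filter_dist_le {m N : ℕ} (t₀ : Fin m → ℕ) (k : ℕ) :
    ((cube m N).filter fun t => ‖fun i => (t i : ℝ) - t₀ i‖ ≤ k).card ≤ (2 * k + 1) ^ m := by
  have hsub : ((cube m N).filter fun t => ‖fun i => (t i : ℝ) - t₀ i‖ ≤ k)
      ⊆ Fintype.piFinset fun i => Finset.Icc (t₀ i - k) (t₀ i + k) := by
    intro t ht
    rw [Fintype.mem_piFinset]
    intro i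
    have h := (norm_le_pi_norm (fun i => (t i : ℝ) - t₀ i) i).trans (Finset.mem_filter.1 ht).2
    rw [Real.norm_eq_abs, ← natDist_cast] at h
    have h' : Nat.dist (t i) (t₀ i) ≤ k := by exact_mod_cast h
    simp only [Nat.dist] at h'
    rw [Finset.mem_Icc]
    omega
  refine (Finset.card_le_card hsub).trans ?_
  rw [Fintype.card_piFinset]
  calc _ ≤ ∏ _i : Fin m, (2 * k + 1) := Finset.prod_le_prod' fun i _ => by
        rw [Nat.card_Icc]; omega
    _ = _ := by simp

lemma gridPt_mem_closedBall {m N : ℕ} (x : Fin m → ℝ) {ρ T : ℝ} (hρ : 0 ≤ ρ) (hT : 0 < T)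
    {t : Fin m → ℕ} (ht : t ∈ cube m N) :
    gridPt x (ρ / (T * N)) t ∈ Metric.closedBall x (ρ / T) := by
  rw [mem_closedBall_iff_norm]
  refine (norm_gridPt_sub_le x (by positivity) ht).trans ?_
  rcases Nat.eq_zero_or_pos N with rfl | hN
  · simp; positivity
  · have : (N : ℝ) ≠ 0 := by positivity
    rw [div_mul_eq_mul_div, mul_comm T, mul_comm ρ, mul_div_mul_left _ _ this]

lemma closedBall_gridPt_subset {m N : ℕ} (x : Fin m → ℝ) {ρ T : ℝ} (hρ : 0 ≤ ρ) (hT : 0 < T)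
    {t : Fin m → ℕ} (ht : t ∈ cube m N) :
    Metric.closedBall (gridPt x (ρ / (T * N)) t) (ρ / (T * N)) ⊆ Metric.closedBall x (ρ / T) := by
  intro y hy
  rw [mem_closedBall_iff_norm] at *
  rw [pi_norm_le_iff_of_nonneg (by positivity)] at *
  intro i
  have h1 := hy i
  have h2 : ((t i + 1 : ℕ) : ℝ) ≤ N := by exact_mod_cast mem_cube.1 ht i
  have hN : (0 : ℝ) < N := by
    have := Nat.zero_lt_of_lt (mem_cube.1 ht i)
    exact_mod_cast this
  simp only [gridPt, Pi.sub_apply, Real.norm_eq_abs, abs_le] at *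
  set h := ρ / (T * N) with hh
  have h0 : 0 ≤ h := by positivity
  have h3 : h * N = ρ / T := by rw [hh]; field_simp
  have h4 : h * ((t i + 1 : ℕ) : ℝ) ≤ ρ / T := by rw [← h3]; gcongr
  push_cast at h4
  have h5 : 0 ≤ h * t i := by positivity
  constructor <;> nlinarith

/-- The sum of `1 / s` along a line on which `s` dominates `|g|` with `g` well-separated. -/
lemma sum_inv_line_le {N : ℕ} {g s : ℕ → ℝ} {a c : ℝ} (hc : 0 < c) (hca : c / 2 ≤ a)
    (hsep : ∀ i < N, ∀ j < N, c * |(i : ℝ) - j| ≤ |g i - g j|)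
    (hlow : ∀ i < N, a + |g i| ≤ s i) :
    ∑ i ∈ Finset.range N, 1 / s i ≤ 8 / c * Real.sqrt N := by
  have ha : 0 < a := by linarith
  calc ∑ i ∈ Finset.range N, 1 / s i ≤ ∑ i ∈ Finset.range N, 1 / (a + |g i|) := by
        refine Finset.sum_le_sum fun i hi => ?_
        exact one_div_le_one_div_of_le (by positivity) (hlow i (Finset.mem_range.1 hi))
    _ ≤ 2 * ∑ i ∈ Finset.range N, 1 / (a + c * i / 2) := by
        refine sum_antitone_of_separated N g hc.le hsep (fun u => 1 / (a + u))
          (fun b d hb hbd => ?_) (fun b hb => by positivity)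
        exact one_div_le_one_div_of_le (by positivity) (by linarith)
    _ ≤ 2 * ∑ i ∈ Finset.range N, 2 / c * (1 / (1 + (i : ℝ))) := by
        gcongr with i hi
        rw [div_mul_div_comm, div_le_div_iff₀ (by positivity) (by positivity)]
        nlinarith
    _ = 2 * (2 / c * ∑ i ∈ Finset.range N, 1 / (1 + (i : ℝ))) := by
        rw [← Finset.mul_sum (a := 2 / c)]
    _ ≤ 2 * (2 / c * (2 * Real.sqrt N)) := by gcongr; exact sum_inv_one_add_le N
    _ = _ := by ring

lemma update_mem_cube {m N i : ℕ} {t : Fin m → ℕ} (ht : t ∈ cube m N) (e : Fin m) (hi : i < N) :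
    Function.update t e i ∈ cube m N := by
  rw [mem_cube] at *
  intro j
  by_cases hj : j = e
  · subst hj; simpa using hi
  · simpa [hj] using ht j

lemma gridPt_update_sub {m : ℕ} (x : Fin m → ℝ) (h : ℝ) (t : Fin m → ℕ) (e : Fin m) (i j : ℕ) :
    gridPt x h (Function.update t e i) - gridPt x h (Function.update t e j)
      = (h * ((i : ℝ) - j)) • Pi.single e 1 := by
  rw [gridPt_sub, mul_smul]
  congr 1
  ext k
  by_cases hk : k = e
  · subst hk; simp
  · simp [hk]

lemma abs_step_le {N i j : ℕ} {ρ T : ℝ} (hρ : 0 ≤ ρ) (hT : 0 < T) (hi : i < N) (hj : j < N) :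
    |ρ / (T * N) * ((i : ℝ) - j)| ≤ ρ / T := by
  have hN : (0 : ℝ) < N := by exact_mod_cast Nat.zero_lt_of_lt hi
  rw [abs_mul, abs_of_nonneg (by positivity : (0 : ℝ) ≤ ρ / (T * N))]
  have : |(i : ℝ) - j| ≤ N := by
    have h1 : (i : ℝ) ≤ N := by exact_mod_cast hi.le
    have h2 : (j : ℝ) ≤ N := by exact_mod_cast hj.le
    rw [abs_le]
    constructor <;> linarith [(Nat.cast_nonneg i : (0 : ℝ) ≤ i), (Nat.cast_nonneg j : (0 : ℝ) ≤ j)]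
  calc _ ≤ ρ / (T * N) * N := by gcongr
    _ = ρ / T := by field_simp

namespace AdaptedFrames

variable {m : ℕ} {P : (Fin m → ℝ) → Frame m} {U : Set (Fin m → ℝ)} {K θ : ℝ}
  {B' B : (Fin m → ℝ) →ₗ[ℝ] (Fin m → ℝ)}

set_option maxHeartbeats 1000000 in
/-- Averages of `1 / size` when the first coordinate is not dominant. -/
lemma sum_inv_size_le_of_small (F : AdaptedFrames P U K θ B' B) (hm : 1 ≤ m) {ρ : ℝ}
    (hρ : 0 < ρ) (hρ1 : ρ ≤ 1) {x : Fin m → ℝ} {T : ℝ} (hT : 0 < T)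
    (hU : Metric.closedBall x (ρ / T) ⊆ U) {v : IVec m} (hv : v ≠ 0)
    (hs : |(v.1 : ℝ)| / T * (256 * m ^ 2 * K ^ 4) ≤ (P x).size T v) {N : ℕ} (hN : 1 ≤ N) :
    Real.sqrt N * ∑ t ∈ cube m N, 1 / (P (gridPt x (ρ / (T * N)) t)).size (T * N) v
      ≤ 256 * m * K ^ 2 / ρ * N ^ m / (P x).size T v := by
  have hK := F.one_le
  have hK0 : 0 < K := zero_lt_one.trans_le hK
  have hm' : (1 : ℝ) ≤ m := by exact_mod_cast hm
  have hN' : (1 : ℝ) ≤ N := by exact_mod_cast hN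
  have hN0 : (0 : ℝ) < N := by linarith
  have hx : x ∈ U := hU (Metric.mem_closedBall_self (by positivity))
  have hmem : ∀ t ∈ cube m N, gridPt x (ρ / (T * N)) t ∈ U := fun t ht =>
    hU (gridPt_mem_closedBall x hρ.le hT ht)
  have hdist : ∀ t ∈ cube m N, ‖gridPt x (ρ / (T * N)) t - x‖ ≤ ρ / T := fun t ht =>
    mem_closedBall_iff_norm.1 (gridPt_mem_closedBall x hρ.le hT ht)
  set V := (P x).size T v with hV
  have hV0 : 0 < V := (P x).size_pos hT hv
  have hTN : 0 < T * N := by positivity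
  set S := |(v.1 : ℝ)| / T with hS
  have hS0 : 0 ≤ S := by positivity
  have hSv : |(v.1 : ℝ)| = S * T := by rw [hS]; field_simp
  set a := ‖(P x).horiz v‖ with ha
  have ha0 : 0 ≤ a := norm_nonneg _
  have hsqrt1 : 1 ≤ Real.sqrt N := by rw [Real.one_le_sqrt]; exact hN'
  have hsq : Real.sqrt N * Real.sqrt N = N := Real.mul_self_sqrt hN0.le
  have hK2 : K ^ 2 ≥ 1 := one_le_pow₀ hK
  have hK4 : 1 ≤ K ^ 3 := one_le_pow₀ hK
  by_cases hcase : a * (16 * m * K) ≤ V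
  · -- the last coordinate is dominant
    have hvert : V / 2 ≤ T * |(P x).vert v| := by
      have h1 : V = S + a + T * |(P x).vert v| := rfl
      have h2 : S * 16 ≤ V := le_trans (by
        apply mul_le_mul_of_nonneg_left _ hS0
        have : 1 ≤ (m : ℝ) ^ 2 * K ^ 4 := one_le_mul_of_one_le_of_one_le
          (one_le_pow₀ hm') (one_le_pow₀ hK)
        nlinarith) hs
      have h3 : a * 16 ≤ V := le_trans (by
        apply mul_le_mul_of_nonneg_left _ ha0
        nlinarith) hcase
      linarith
    have hbound : ∀ t ∈ cube m N,
        1 / (P (gridPt x (ρ / (T * N)) t)).size (T * N) v ≤ 4 / (N * V) := by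
      intro t ht
      set y := gridPt x (ρ / (T * N)) t
      have h1 := F.abs_vert_sub_le hm hx (hmem t ht) v
      have h2 := hdist t ht
      have h3 : T * |(P y).vert v - (P x).vert v| ≤ V / 4 := by
        have hd : T * ‖y - x‖ ≤ 1 := by
          calc T * ‖y - x‖ ≤ T * (ρ / T) := by gcongr
            _ = ρ := by field_simp
            _ ≤ 1 := hρ1
        have hd0 : 0 ≤ T * ‖y - x‖ := by positivity
        have e1 : T * |(P y).vert v - (P x).vert v| ≤ 2 * m * K * a * (T * ‖y - x‖)
            + K * S * (T * ‖y - x‖) ^ 2 := by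
          refine (mul_le_mul_of_nonneg_left h1 hT.le).trans (le_of_eq ?_)
          rw [hSv]; ring
        have e2 : 2 * m * K * a * (T * ‖y - x‖) ≤ 2 * m * K * a * 1 := by gcongr
        have e3 : K * S * (T * ‖y - x‖) ^ 2 ≤ K * S * 1 := by
          gcongr; exact pow_le_one₀ hd0 hd
        have e4 : K * S * 256 ≤ V := le_trans (by
          have : K ≤ (m : ℝ) ^ 2 * K ^ 4 := by
            have q1 : K ≤ K ^ 4 := le_self_pow₀ hK (by norm_num)
            have q2 : 1 ≤ (m : ℝ) ^ 2 := one_le_pow₀ hm'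
            nlinarith
          nlinarith) hs
        linarith
      have h4 : V / 4 ≤ T * |(P y).vert v| := by
        have := abs_sub_abs_le_abs_sub ((P x).vert v) ((P y).vert v)
        rw [abs_sub_comm] at this
        have := mul_le_mul_of_nonneg_left this hT.le
        linarith
      have h5 := (P y).vert_le_size hTN v
      have h6 : N * V / 4 ≤ (P y).size (T * N) v := by
        have := mul_le_mul_of_nonneg_left h4 hN0.le
        linarith
      rw [div_le_div_iff₀ ((P y).size_pos hTN hv) (by positivity)]
      linarith
    have hsum : ∑ t ∈ cube m N, 1 / (P (gridPt x (ρ / (T * N)) t)).size (T * N) v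
        ≤ N ^ m * (4 / (N * V)) := by
      refine (Finset.sum_le_card_nsmul _ _ _ hbound).trans (le_of_eq ?_)
      rw [card_cube]; simp
    calc _ ≤ Real.sqrt N * (N ^ m * (4 / (N * V))) := by gcongr
      _ = (Real.sqrt N * 4 / N) * N ^ m / V := by field_simp
      _ ≤ _ := by
        have q0 : Real.sqrt N * 4 / N ≤ 256 * m * K ^ 2 / ρ := ?_
        · gcongr
        rw [div_le_div_iff₀ hN0 hρ]
        have q1 : 4 ≤ 256 * m * K ^ 2 := by nlinarith
        have q2 : Real.sqrt N ≤ N := by nlinarith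
        have q3 : Real.sqrt N * ρ ≤ N := by nlinarith
        nlinarith
  · push Not at hcase
    have ha1 : 0 < a := by
      by_contra h
      have : a = 0 := le_antisymm (not_lt.1 h) ha0
      rw [this] at hcase; linarith
    have hSa : S * (16 * m * K ^ 3) ≤ a := by
      have h1 : (S * (16 * m * K ^ 3)) * (16 * m * K) ≤ a * (16 * m * K) := by
        calc _ = S * (256 * m ^ 2 * K ^ 4) := by ring
          _ ≤ _ := hs.trans hcase.le
      exact le_of_mul_le_mul_right h1 (by positivity)
    have hR : |(v.1 : ℝ)| * (ρ / T) * (16 * m * K ^ 3) ≤ a := by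
      calc _ = ρ * (S * (16 * m * K ^ 3)) := by rw [hS]; ring
        _ ≤ 1 * (S * (16 * m * K ^ 3)) := by gcongr
        _ ≤ a := by linarith
    obtain ⟨e, he⟩ := F.exists_vert_expand hm hx v hR
    have hline : ∀ t ∈ cube m N, ∑ i ∈ Finset.range N,
        1 / (P (gridPt x (ρ / (T * N)) (Function.update t e i))).size (T * N) v
        ≤ 16 * K * Real.sqrt N / (ρ * a) := by
      intro t ht
      have hupd : ∀ i < N, Function.update t e i ∈ cube m N := fun i hi => update_mem_cube ht e hi
      set y : ℕ → Fin m → ℝ := fun i => gridPt x (ρ / (T * N)) (Function.update t e i) with hy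
      set g : ℕ → ℝ := fun i => T * N * (P (y i)).vert v with hg
      have hsep : ∀ i < N, ∀ j < N, ρ * a / (2 * K) * |(i : ℝ) - j| ≤ |g i - g j| := by
        intro i hi j hj
        have hij := gridPt_update_sub x (ρ / (T * N)) t e i j
        have hle := abs_step_le hρ.le hT hi hj
        have := he (y j) (hmem _ (hupd j hj)) (y i) (hmem _ (hupd i hi)) _
          (hdist _ (hupd j hj)) hle hij
        rw [abs_mul, abs_of_nonneg (by positivity : (0 : ℝ) ≤ ρ / (T * N))] at this
        have e1 : |g i - g j| = T * N * |(P (y i)).vert v - (P (y j)).vert v| := by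
          rw [hg]; simp only; rw [← mul_sub, abs_mul, abs_of_pos hTN]
        rw [e1]
        calc ρ * a / (2 * K) * |(i : ℝ) - j|
            = T * N * (ρ / (T * N) * |(i : ℝ) - j| * a) / (2 * K) := by field_simp
          _ ≤ T * N * (2 * K * |(P (y i)).vert v - (P (y j)).vert v|) / (2 * K) := by gcongr
          _ = _ := by field_simp
      have hlow : ∀ i < N, a / 2 + |g i| ≤ (P (y i)).size (T * N) v := by
        intro i hi
        have h1 : |g i| = T * N * |(P (y i)).vert v| := by
          rw [hg]; simp only; rw [abs_mul, abs_of_pos hTN]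
        have h2 := F.norm_horiz_sub_le hm hx (hmem _ (hupd i hi)) v
        have h3 := hdist _ (hupd i hi)
        have h4 : |(v.1 : ℝ)| * ‖y i - x‖ ≤ S := by
          calc |(v.1 : ℝ)| * ‖y i - x‖ ≤ |(v.1 : ℝ)| * (ρ / T) := by gcongr
            _ = ρ * S := by rw [hS]; ring
            _ ≤ 1 * S := by gcongr
            _ = S := one_mul S
        have h5 : 4 * K * S ≤ a := le_trans (by
          have : K ≤ K ^ 3 := le_self_pow₀ hK (by norm_num)
          have : K ≤ m * K ^ 3 := by nlinarith
          nlinarith) hSa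
        have h6 := norm_sub_norm_le ((P x).horiz v) ((P (y i)).horiz v)
        rw [norm_sub_rev] at h6
        have h7 : 0 ≤ |(v.1 : ℝ)| / (T * N) := by positivity
        have h8 : 2 * K * (|(v.1 : ℝ)| * ‖y i - x‖) ≤ 2 * K * S := by gcongr
        rw [h1, Frame.size]
        change a - ‖(P (y i)).horiz v‖ ≤ _ at h6
        linarith
      refine (sum_inv_line_le (g := g) (a := a / 2) (c := ρ * a / (2 * K)) (by positivity) ?_
        hsep hlow).trans (le_of_eq (by field_simp; ring))
      rw [div_div, div_le_div_iff₀ (by positivity) (by norm_num)]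
      nlinarith
    have hfin := sum_cube_le_of_line e
      (fun t => 1 / (P (gridPt x (ρ / (T * N)) t)).size (T * N) v) hline
    have hVa : 1 / a ≤ 16 * m * K / V := by
      rw [div_le_div_iff₀ ha1 hV0]; linarith
    refine le_of_mul_le_mul_left ?_ (zero_lt_one.trans_le hsqrt1)
    calc _ = (N : ℝ) * ∑ t ∈ cube m N, 1 / (P (gridPt x (ρ / (T * N)) t)).size (T * N) v := by
          rw [← mul_assoc, hsq]
      _ ≤ N ^ m * (16 * K * Real.sqrt N / (ρ * a)) := hfin
      _ = N ^ m * (16 * K * Real.sqrt N / ρ) * (1 / a) := by field_simp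
      _ ≤ N ^ m * (16 * K * Real.sqrt N / ρ) * (16 * m * K / V) := by gcongr
      _ = _ := by ring

/-- If the first coordinate dominates, the size grows linearly away from some grid point. -/
lemma exists_size_ge (F : AdaptedFrames P U K θ B' B) (hm : 1 ≤ m) {ρ : ℝ}
    (hρ : 0 < ρ) (hρ1 : ρ ≤ 1) {x : Fin m → ℝ} {T : ℝ} (hT : 0 < T)
    (hU : Metric.closedBall x (ρ / T) ⊆ U) (v : IVec m) {N : ℕ} (hN : 1 ≤ N) :
    ∃ t₀ ∈ cube m N, ∀ t ∈ cube m N,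
      |(v.1 : ℝ)| * ρ / (4 * K * (T * N)) * (1 + ‖fun i => (t i : ℝ) - t₀ i‖)
        ≤ (P (gridPt x (ρ / (T * N)) t)).size (T * N) v := by
  have hK := F.one_le
  have hN0 : (0 : ℝ) < N := by exact_mod_cast hN
  have hmem : ∀ t ∈ cube m N, gridPt x (ρ / (T * N)) t ∈ U := fun t ht =>
    hU (gridPt_mem_closedBall x hρ.le hT ht)
  have hTN : 0 < T * N := by positivity
  obtain ⟨t₀, ht₀, hmin⟩ := Finset.exists_min_image (cube m N)
    (fun t => ‖(P (gridPt x (ρ / (T * N)) t)).horiz v‖)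
    ⟨fun _ => 0, mem_cube.2 fun _ => hN⟩
  refine ⟨t₀, ht₀, fun t ht => ?_⟩
  have h1 := F.le_norm_horiz_sub hm (hmem t₀ ht₀) (hmem t ht) v
  have h2 := hmin t ht
  have h3 := norm_sub_le ((P (gridPt x (ρ / (T * N)) t)).horiz v)
    ((P (gridPt x (ρ / (T * N)) t₀)).horiz v)
  rw [gridPt_sub, norm_smul, Real.norm_eq_abs,
    abs_of_nonneg (by positivity : (0 : ℝ) ≤ ρ / (T * N))] at h1
  set D := ‖fun i => (t i : ℝ) - t₀ i‖
  have h4 : |(v.1 : ℝ)| * ρ / (4 * K * (T * N)) * D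
      ≤ ‖(P (gridPt x (ρ / (T * N)) t)).horiz v‖ := by
    have e1 : |(v.1 : ℝ)| * ρ / (4 * K * (T * N)) * D
        = |(v.1 : ℝ)| * (ρ / (T * N) * D) / (4 * K) := by field_simp
    rw [e1, div_le_iff₀ (by positivity)]
    nlinarith
  have h5 : |(v.1 : ℝ)| * ρ / (4 * K * (T * N)) ≤ |(v.1 : ℝ)| / (T * N) := by
    rw [div_le_div_iff₀ (by positivity) hTN]
    have : ρ * (T * N) ≤ 4 * K * (T * N) := by gcongr; linarith
    have := mul_le_mul_of_nonneg_left this (abs_nonneg (v.1 : ℝ))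
    linarith
  have h6 : 0 ≤ T * N * |(P (gridPt x (ρ / (T * N)) t)).vert v| := by positivity
  rw [Frame.size, mul_add, mul_one]
  linarith

end AdaptedFrames

namespace AdaptedFrames

variable {m : ℕ} {P : (Fin m → ℝ) → Frame m} {U : Set (Fin m → ℝ)} {K θ : ℝ}
  {B' B : (Fin m → ℝ) →ₗ[ℝ] (Fin m → ℝ)}

/-- Averages of `1 / size` when the first coordinate is dominant. -/
lemma sum_inv_size_le_of_large (F : AdaptedFrames P U K θ B' B) (hm : 2 ≤ m) {ρ : ℝ}
    (hρ : 0 < ρ) (hρ1 : ρ ≤ 1) {x : Fin m → ℝ} {T : ℝ} (hT : 0 < T)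
    (hU : Metric.closedBall x (ρ / T) ⊆ U) {v : IVec m} (hv : v ≠ 0) {H : ℝ}
    (hs : (P x).size T v ≤ |(v.1 : ℝ)| / T * H) {N : ℕ} (hN : 1 ≤ N) :
    ∑ t ∈ cube m N, 1 / (P (gridPt x (ρ / (T * N)) t)).size (T * N) v
      ≤ 64 * K * H / ρ * N ^ m / (P x).size T v := by
  have hK := F.one_le
  have hN0 : (0 : ℝ) < N := by exact_mod_cast hN
  have hV0 := (P x).size_pos hT hv
  have hs0 : 0 < |(v.1 : ℝ)| := by
    by_contra h
    have : |(v.1 : ℝ)| = 0 := le_antisymm (not_lt.1 h) (abs_nonneg _)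
    rw [this] at hs; simp at hs; linarith
  have hH0 : 0 ≤ H := by
    by_contra h
    have : |(v.1 : ℝ)| / T * H ≤ 0 := mul_nonpos_of_nonneg_of_nonpos (by positivity)
      (not_le.1 h).le
    linarith
  obtain ⟨t₀, ht₀, h⟩ := F.exists_size_ge (by omega) hρ hρ1 hT hU v hN
  have h1 := sum_cube_inv_dist_le hm ht₀
  calc ∑ t ∈ cube m N, 1 / (P (gridPt x (ρ / (T * N)) t)).size (T * N) v
      ≤ ∑ t ∈ cube m N, 4 * K * (T * N) / (|(v.1 : ℝ)| * ρ)
          * (1 / (1 + ‖fun i => (t i : ℝ) - t₀ i‖)) := by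
        refine Finset.sum_le_sum fun t ht => ?_
        refine (one_div_le_one_div_of_le ?_ (h t ht)).trans (le_of_eq ?_)
        · have := norm_nonneg fun i => (t i : ℝ) - t₀ i
          positivity
        · have := norm_nonneg fun i => (t i : ℝ) - t₀ i
          field_simp
    _ = 4 * K * T / (|(v.1 : ℝ)| * ρ) * (N * ∑ t ∈ cube m N,
          1 / (1 + ‖fun i => (t i : ℝ) - t₀ i‖)) := by
        rw [← Finset.mul_sum]; ring
    _ ≤ 4 * K * T / (|(v.1 : ℝ)| * ρ) * (16 * N ^ m) := by gcongr
    _ = 64 * K / ρ * N ^ m * (T / |(v.1 : ℝ)|) := by field_simp; ring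
    _ ≤ 64 * K / ρ * N ^ m * (H / (P x).size T v) := by
        refine mul_le_mul_of_nonneg_left ?_ (by positivity)
        rw [div_le_div_iff₀ hs0 hV0]
        have := mul_le_mul_of_nonneg_left hs hT.le
        field_simp at this
        linarith
    _ = _ := by ring

/-- Averages of `1 / size` over refined grids are bounded, and contract when the refinement
is large. -/
theorem exists_sum_inv_size_le (F : AdaptedFrames P U K θ B' B) (hm : 2 ≤ m) {ρ : ℝ}
    (hρ : 0 < ρ) (hρ1 : ρ ≤ 1) : ∃ C : ℝ, 1 ≤ C ∧ ∀ (x : Fin m → ℝ) (T : ℝ), 0 < T →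
      Metric.closedBall x (ρ / T) ⊆ U → ∀ v : IVec m, v ≠ 0 →
      (∀ N : ℕ, 1 ≤ N → ∑ t ∈ cube m N, 1 / (P (gridPt x (ρ / (T * N)) t)).size (T * N) v
        ≤ C * N ^ m / (P x).size T v) ∧
      (∀ M : ℕ, 1 ≤ M → Real.sqrt M * ∑ t ∈ cube m (M * M),
        1 / (P (gridPt x (ρ / (T * (M * M : ℕ))) t)).size (T * (M * M : ℕ)) v
        ≤ C * ((M * M : ℕ) : ℝ) ^ m / (P x).size T v) := by
  have hK := F.one_le
  have hK0 : 0 < K := by linarith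
  have hm' : (1 : ℝ) ≤ m := by exact_mod_cast (by omega : 1 ≤ m)
  set H : ℝ := 256 * m ^ 2 * K ^ 4 with hH
  have hH1 : 1 ≤ H := by
    have : 1 ≤ (m : ℝ) ^ 2 * K ^ 4 := one_le_mul_of_one_le_of_one_le
      (one_le_pow₀ hm') (one_le_pow₀ hK)
    linarith
  set C₁ : ℝ := 256 * m * K ^ 2 / ρ with hC₁
  set C₂ : ℝ := 64 * K * H / ρ with hC₂
  have hC₁0 : 0 ≤ C₁ := by positivity
  have hC₂1 : 1 ≤ C₂ := by
    rw [hC₂, one_le_div hρ]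
    nlinarith
  obtain ⟨k, hk⟩ := exists_nat_ge (4 * K * H / ρ)
  set Cb : ℝ := ((2 * k + 1 : ℕ) : ℝ) ^ m with hCb
  have hCb0 : 0 ≤ Cb := by positivity
  have unif : ∀ (x : Fin m → ℝ) (T : ℝ), 0 < T →
      Metric.closedBall x (ρ / T) ⊆ U → ∀ v : IVec m, v ≠ 0 → ∀ N : ℕ, 1 ≤ N →
      ∑ t ∈ cube m N, 1 / (P (gridPt x (ρ / (T * N)) t)).size (T * N) v
        ≤ (C₁ + C₂) * N ^ m / (P x).size T v := by
    intro x T hT hU v hv N hN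
    have hV0 := (P x).size_pos hT hv
    rw [add_mul, add_div]
    have q1 : 0 ≤ C₁ * N ^ m / (P x).size T v := by positivity
    have q2 : 0 ≤ C₂ * N ^ m / (P x).size T v := by positivity
    rcases le_total (|(v.1 : ℝ)| / T * H) ((P x).size T v) with h | h
    · have h1 := F.sum_inv_size_le_of_small (by omega) hρ hρ1 hT hU hv h hN
      have h2 : 0 ≤ ∑ t ∈ cube m N, 1 / (P (gridPt x (ρ / (T * N)) t)).size (T * N) v :=
        Finset.sum_nonneg fun t _ => by
          have := ((P (gridPt x (ρ / (T * N)) t)).size_nonneg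
            (T := T * N) (by positivity) v)
          positivity
      have h3 : 1 ≤ Real.sqrt N := by rw [Real.one_le_sqrt]; exact_mod_cast hN
      nlinarith
    · have := F.sum_inv_size_le_of_large hm hρ hρ1 hT hU hv h hN
      linarith
  obtain ⟨Ct, hCt⟩ : ∃ Ct, Ct = C₁ + C₂ + (C₁ * (C₁ + C₂) + Cb * (C₁ + C₂) * H) := ⟨_, rfl⟩
  have hCq : 0 ≤ C₁ * (C₁ + C₂) + Cb * (C₁ + C₂) * H := by positivity
  have hCt1 : C₁ + C₂ ≤ Ct := by linarith
  have hCt2 : C₁ ≤ Ct := by linarith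
  have hCt3 : C₁ * (C₁ + C₂) + Cb * (C₁ + C₂) * H ≤ Ct := by linarith
  refine ⟨Ct, by linarith, ?_⟩
  intro x T hT hU v hv
  have hV0 := (P x).size_pos hT hv
  set V := (P x).size T v with hV
  refine ⟨fun N hN => (unif x T hT hU v hv N hN).trans ?_, fun M hM => ?_⟩
  · gcongr
  have hM0 : (1 : ℝ) ≤ M := by exact_mod_cast hM
  have hsM : 1 ≤ Real.sqrt M := by rw [Real.one_le_sqrt]; exact hM0
  have hsM2 : Real.sqrt M * Real.sqrt M = M := Real.mul_self_sqrt (by positivity)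
  have hsMM : Real.sqrt M ≤ M := by nlinarith
  rcases le_total (|(v.1 : ℝ)| / T * H) V with h | h
  · have h1 := F.sum_inv_size_le_of_small (by omega) hρ hρ1 hT hU hv h
      (N := M * M) (Nat.mul_pos hM hM)
    have h2 : Real.sqrt ((M * M : ℕ) : ℝ) = M := by
      push_cast; exact Real.sqrt_mul_self (by positivity)
    have h3 : 0 ≤ ∑ t ∈ cube m (M * M),
        1 / (P (gridPt x (ρ / (T * (M * M : ℕ))) t)).size (T * (M * M : ℕ)) v :=
      Finset.sum_nonneg fun t _ => by
        have := ((P (gridPt x (ρ / (T * (M * M : ℕ))) t)).size_nonneg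
          (T := T * (M * M : ℕ)) (by positivity) v)
        positivity
    rw [h2] at h1
    refine (mul_le_mul_of_nonneg_right hsMM h3).trans (h1.trans ?_)
    rw [← hV]
    gcongr
  -- split into the `M^m` boxes at scale `T M`
  have hTM : 0 < T * M := by positivity
  have hball : ∀ r ∈ cube m M, Metric.closedBall (gridPt x (ρ / (T * M)) r) (ρ / (T * M)) ⊆ U :=
    fun r hr => (closedBall_gridPt_subset x hρ.le hT hr).trans hU
  have hsplit : ∑ t ∈ cube m (M * M),
      1 / (P (gridPt x (ρ / (T * (M * M : ℕ))) t)).size (T * (M * M : ℕ)) v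
      = ∑ r ∈ cube m M, ∑ t ∈ cube m M,
        1 / (P (gridPt (gridPt x (ρ / (T * M)) r) (ρ / (T * M * M)) t)).size (T * M * M) v := by
    rw [sum_cube_mul]
    refine Finset.sum_congr rfl fun r _ => Finset.sum_congr rfl fun t _ => ?_
    have e1 : ρ / (T * M) = ρ / (T * M * M) * (M : ℕ) := by field_simp
    have e2 : T * ((M * M : ℕ) : ℝ) = T * M * M := by push_cast; ring
    rw [e1, gridPt_gridPt, e2]
  obtain ⟨t₀, ht₀, hgrow⟩ := F.exists_size_ge (by omega) hρ hρ1 hT hU v hM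
  have hs0 : 0 < |(v.1 : ℝ)| := by
    by_contra h'
    have : |(v.1 : ℝ)| = 0 := le_antisymm (not_lt.1 h') (abs_nonneg _)
    rw [this] at h; simp at h; linarith
  set W : (Fin m → ℕ) → ℝ := fun r => (P (gridPt x (ρ / (T * M)) r)).size (T * M) v with hW
  have hW0 : ∀ r, 0 < W r := fun r => Frame.size_pos _ hTM hv
  set bad := (cube m M).filter fun t => ‖fun i => (t i : ℝ) - t₀ i‖ ≤ k with hbad
  have hbadcard : (bad.card : ℝ) ≤ Cb := by
    have := card_filter_dist_le (m := m) (N := M) t₀ k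
    rw [hCb]
    exact (Nat.cast_le.2 this).trans (le_of_eq (by push_cast; rfl))
  have hbox : ∀ r ∈ cube m M, Real.sqrt M * ∑ t ∈ cube m M,
        1 / (P (gridPt (gridPt x (ρ / (T * M)) r) (ρ / (T * M * M)) t)).size (T * M * M) v
      ≤ C₁ * M ^ m * (1 / W r)
        + if r ∈ bad then Real.sqrt M * ((C₁ + C₂) * M ^ m * (H * M / V)) else 0 := by
    intro r hr
    have q1 : 0 ≤ C₁ * M ^ m * (1 / W r) := by have := hW0 r; positivity
    split_ifs with hb
    · have h1 := unif _ _ hTM (hball r hr) v hv M hM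
      have h2 : 1 / W r ≤ H * M / V := by
        rw [div_le_div_iff₀ (hW0 r) hV0]
        have h3 : |(v.1 : ℝ)| / (T * M) ≤ W r := Frame.abs_div_le_size _ hTM v
        calc 1 * V ≤ |(v.1 : ℝ)| / T * H := by linarith
          _ = H * M * (|(v.1 : ℝ)| / (T * M)) := by field_simp
          _ ≤ H * M * W r := by gcongr
      have h4 : (C₁ + C₂) * M ^ m / W r ≤ (C₁ + C₂) * M ^ m * (H * M / V) := by
        rw [div_eq_mul_one_div]; gcongr
      have h5 := mul_le_mul_of_nonneg_left (h1.trans h4) (Real.sqrt_nonneg M)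
      linarith
    · rw [add_zero, mul_one_div]
      refine F.sum_inv_size_le_of_small (by omega) hρ hρ1 hTM (hball r hr) hv ?_ hM
      have hfar : (k : ℝ) < ‖fun i => (r i : ℝ) - t₀ i‖ := by
        by_contra h'
        exact hb (Finset.mem_filter.2 ⟨hr, not_lt.1 h'⟩)
      refine le_trans ?_ (hgrow r hr)
      calc |(v.1 : ℝ)| / (T * M) * H
          = |(v.1 : ℝ)| * ρ / (4 * K * (T * M)) * (4 * K * H / ρ) := by field_simp
        _ ≤ _ := mul_le_mul_of_nonneg_left (by linarith) (by positivity)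
  rw [hsplit, Finset.mul_sum]
  refine (Finset.sum_le_sum hbox).trans ?_
  rw [Finset.sum_add_distrib, ← Finset.mul_sum, ← Finset.sum_filter, Finset.sum_const,
    nsmul_eq_mul]
  have hfilter : (cube m M).filter (fun r => r ∈ bad) = bad := by
    ext r; simp only [hbad, Finset.mem_filter]; tauto
  rw [hfilter]
  have hsumW := unif x T hT hU v hv M hM
  have hMM : ((M * M : ℕ) : ℝ) ^ m = M ^ m * M ^ m := by push_cast; rw [mul_pow]
  have hMm : Real.sqrt M * M ≤ M ^ m := by
    have : (M : ℝ) ^ 2 ≤ M ^ m := pow_le_pow_right₀ hM0 hm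
    nlinarith
  calc _ ≤ C₁ * M ^ m * ((C₁ + C₂) * M ^ m / V)
        + Cb * (Real.sqrt M * ((C₁ + C₂) * M ^ m * (H * M / V))) := by gcongr
    _ = C₁ * (C₁ + C₂) * (M ^ m * M ^ m) / V
        + Cb * (C₁ + C₂) * H * (M ^ m * (Real.sqrt M * M)) / V := by ring
    _ ≤ C₁ * (C₁ + C₂) * (M ^ m * M ^ m) / V
        + Cb * (C₁ + C₂) * H * (M ^ m * M ^ m) / V := by gcongr
    _ = (C₁ * (C₁ + C₂) + Cb * (C₁ + C₂) * H) * (M ^ m * M ^ m) / V := by ring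
    _ ≤ _ := by
        rw [hMM]; gcongr

end AdaptedFrames

/-! ### A large sieve transference inequality -/

namespace LargeSieve

variable {ι : Type*} [Fintype ι]

/-- The character `ξ ↦ exp(2πi v·ξ)`. -/
noncomputable def chr (v : ι → ℤ) (ξ : ι → ℝ) : ℂ :=
  ∏ i, Complex.exp (2 * Real.pi * Complex.I * v i * ξ i)

lemma chr_eq_exp (v : ι → ℤ) (ξ : ι → ℝ) :
    chr v ξ = Complex.exp ((2 * Real.pi * ((fun i => (v i : ℝ)) ⬝ᵥ ξ) : ℝ) * Complex.I) := by
  rw [chr, ← Complex.exp_sum]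
  congr 1
  rw [dotProduct]
  push_cast
  rw [Finset.mul_sum, Finset.sum_mul]
  exact Finset.sum_congr rfl fun i _ => by ring

lemma chr_re (v : ι → ℤ) (ξ : ι → ℝ) :
    (chr v ξ).re = Real.cos (2 * Real.pi * ((fun i => (v i : ℝ)) ⬝ᵥ ξ)) := by
  rw [chr_eq_exp, Complex.exp_ofReal_mul_I_re]

lemma chr_mul_conj (v v' : ι → ℤ) (ξ : ι → ℝ) :
    chr v ξ * (starRingEnd ℂ) (chr v' ξ) = chr (v - v') ξ := by
  rw [chr_eq_exp, chr_eq_exp, chr_eq_exp, ← Complex.exp_conj, ← Complex.exp_add]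
  congr 1
  simp only [map_mul, Complex.conj_ofReal, Complex.conj_I, Pi.sub_apply]
  have : (fun i => ((v i - v' i : ℤ) : ℝ)) = (fun i => (v i : ℝ)) - fun i => (v' i : ℝ) := by
    ext i; simp
  rw [this, sub_dotProduct]
  push_cast
  ring

lemma chr_add_int (v u : ι → ℤ) (ξ : ι → ℝ) :
    chr v ((fun i => (u i : ℝ)) + ξ) = chr v ξ := by
  unfold chr
  refine Finset.prod_congr rfl fun i _ => ?_
  rw [Complex.exp_eq_exp_iff_exists_int]
  refine ⟨v i * u i, ?_⟩
  simp only [Pi.add_apply]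
  push_cast
  ring

@[fun_prop]
lemma continuous_chr (v : ι → ℤ) : Continuous (chr v) := by
  unfold chr
  fun_prop

lemma integral_chr (w : ι → ℤ) :
    ∫ ξ in Set.univ.pi fun _ : ι => Set.Ico (0 : ℝ) 1, chr w ξ = if w = 0 then 1 else 0 := by
  have hone : ∀ n : ℤ, ∫ x in Set.Ico (0 : ℝ) 1, Complex.exp (2 * Real.pi * Complex.I * n * x)
      = if n = 0 then 1 else 0 := by
    intro n
    rw [integral_Ico_eq_integral_Ioc, ← intervalIntegral.integral_of_le zero_le_one]
    split_ifs with h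
    · simp [h]
    · have h2 : (2 * Real.pi * Complex.I * n : ℂ) ≠ 0 := by
        simp [h, Real.pi_ne_zero]
      rw [integral_exp_mul_complex h2]
      have : Complex.exp (2 * Real.pi * Complex.I * n * (1 : ℝ)) = 1 := by
        rw [Complex.exp_eq_one_iff]; exact ⟨n, by push_cast; ring⟩
      rw [this]; simp
  unfold chr
  rw [volume_pi, Measure.restrict_pi_pi,
    integral_fintype_prod_eq_prod (𝕜 := ℂ)
      (fun i (x : ℝ) => Complex.exp (2 * Real.pi * Complex.I * w i * x))]
  simp_rw [hone]
  split_ifs with h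
  · simp [h]
  · obtain ⟨i, hi⟩ := Function.ne_iff.1 h
    exact Finset.prod_eq_zero (Finset.mem_univ i) (by simpa using hi)

lemma integral_normSq_sum (V : Finset (ι → ℤ)) :
    ∫ ξ in Set.univ.pi fun _ : ι => Set.Ico (0 : ℝ) 1, ‖∑ v ∈ V, chr v ξ‖ ^ 2 = V.card := by
  have hchr : ∀ w : ι → ℤ, IntegrableOn (chr w)
      (Set.univ.pi fun _ : ι => Set.Ico (0 : ℝ) 1) := by
    intro w
    have hc : IsCompact (Set.univ.pi fun _ : ι => Set.Icc (0 : ℝ) 1) :=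
      isCompact_univ_pi fun _ => isCompact_Icc
    exact ((continuous_chr w).continuousOn.integrableOn_compact hc).mono_set
      (Set.pi_mono fun _ _ => Set.Ico_subset_Icc_self)
  have key : ∀ ξ : ι → ℝ, ((‖∑ v ∈ V, chr v ξ‖ ^ 2 : ℝ) : ℂ)
      = ∑ v ∈ V, ∑ v' ∈ V, chr (v - v') ξ := by
    intro ξ
    push_cast
    rw [← Complex.mul_conj', map_sum, Finset.sum_mul_sum]
    simp_rw [chr_mul_conj]
  have : ((∫ ξ in Set.univ.pi fun _ : ι => Set.Ico (0 : ℝ) 1,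
      ‖∑ v ∈ V, chr v ξ‖ ^ 2 : ℝ) : ℂ) = V.card := by
    rw [← integral_complex_ofReal]
    simp_rw [key]
    rw [integral_finsetSum _ fun v _ => integrable_finsetSum _ fun v' _ => hchr _]
    simp_rw [integral_finsetSum V fun v' _ => hchr _, integral_chr, sub_eq_zero]
    simp
  exact_mod_cast this

/-- Transference: many small integer points for a lattice force many small integer points for
the dual lattice. -/
theorem card_mul_le (N : (ι → ℝ) →ₗ[ℝ] (ι → ℝ)) (hN : |LinearMap.det N| = 1) {κ : ℝ}
    (hκ : 0 ≤ κ) (V X : Finset (ι → ℤ))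
    (hV : ∀ v ∈ V, ∀ ξ, ‖N ξ‖ ≤ κ → |(fun i => (v i : ℝ)) ⬝ᵥ ξ| ≤ 1 / 8)
    (hX : ∀ u : ι → ℤ, ‖N (fun i => (u i : ℝ))‖ ≤ 2 * κ → u ∈ X) :
    (V.card : ℝ) * (2 * κ) ^ Fintype.card ι ≤ 2 * X.card := by
  classical
  rcases V.eq_empty_or_nonempty with rfl | hVne
  · simp
  have hVc : (0 : ℝ) < V.card := by exact_mod_cast hVne.card_pos
  set E : Set (ι → ℝ) := N ⁻¹' Metric.closedBall 0 κ with hE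
  have hEmem : ∀ ξ, ξ ∈ E ↔ ‖N ξ‖ ≤ κ := by intro ξ; simp [hE]
  have hNc : Continuous N := N.continuous_of_finiteDimensional
  have hEmeas : MeasurableSet E := (Metric.isClosed_closedBall.preimage hNc).measurableSet
  have hvol : volume E = ENNReal.ofReal ((2 * κ) ^ Fintype.card ι) := by
    rw [hE, Measure.addHaar_preimage_linearMap _ (by intro h; simp [h] at hN),
      Real.volume_pi_closedBall _ hκ, abs_inv, hN]
    simp
  set D : (ι → ℝ) → ℝ := fun ξ => ‖∑ v ∈ V, chr v ξ‖ ^ 2 with hD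
  have hDc : Continuous D := by
    have : Continuous fun ξ => ∑ v ∈ V, chr v ξ :=
      continuous_finsetSum _ fun v _ => continuous_chr v
    exact (this.norm).pow 2
  have hDlow : ∀ ξ ∈ E, (V.card : ℝ) ^ 2 / 2 ≤ D ξ := by
    intro ξ hξ
    have h1 : ∀ v ∈ V, Real.sqrt 2 / 2 ≤ (chr v ξ).re := by
      intro v hv
      have h2 := hV v hv ξ ((hEmem ξ).1 hξ)
      rw [chr_re, ← Real.cos_abs, ← Real.cos_pi_div_four]
      have hpi := Real.pi_pos
      have h3 : |2 * Real.pi * ((fun i => (v i : ℝ)) ⬝ᵥ ξ)| ≤ Real.pi / 4 := by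
        rw [abs_mul, abs_of_pos (by positivity)]
        nlinarith
      exact Real.cos_le_cos_of_nonneg_of_le_pi (abs_nonneg _) (by linarith) h3
    have h4 : V.card * (Real.sqrt 2 / 2) ≤ ‖∑ v ∈ V, chr v ξ‖ := by
      refine le_trans ?_ (Complex.re_le_norm _)
      rw [Complex.re_sum, ← nsmul_eq_mul]
      exact Finset.card_nsmul_le_sum _ _ _ h1
    calc (V.card : ℝ) ^ 2 / 2 = (V.card * (Real.sqrt 2 / 2)) ^ 2 := by
          rw [mul_pow, div_pow, Real.sq_sqrt (by norm_num)]; ring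
      _ ≤ D ξ := by
          exact pow_le_pow_left₀ (by positivity) h4 2
  have hlow : ENNReal.ofReal ((V.card : ℝ) ^ 2 / 2) * volume E
      ≤ ∫⁻ ξ, E.indicator (fun ξ => ENNReal.ofReal (D ξ)) ξ := by
    rw [lintegral_indicator hEmeas, ← setLIntegral_const]
    exact setLIntegral_mono (by fun_prop) fun ξ hξ => ENNReal.ofReal_le_ofReal (hDlow ξ hξ)
  set I : Set (ι → ℝ) := Set.univ.pi fun _ : ι => Set.Ico (0 : ℝ) 1 with hI
  have hintI : ∫⁻ ξ in I, ENNReal.ofReal (D ξ) = ENNReal.ofReal V.card := by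
    rw [← integral_normSq_sum V, ofReal_integral_eq_lintegral_ofReal]
    · have hc : IsCompact (Set.univ.pi fun _ : ι => Set.Icc (0 : ℝ) 1) :=
        isCompact_univ_pi fun _ => isCompact_Icc
      exact (hDc.continuousOn.integrableOn_compact hc).mono_set
        (Set.pi_mono fun _ _ => Set.Ico_subset_Icc_self)
    · exact Filter.Eventually.of_forall fun ξ => by positivity
  let L := Submodule.span ℤ (Set.range (Pi.basisFun ℝ ι)) |>.toAddSubgroup
  have hfd : IsAddFundamentalDomain L I (volume : Measure (ι → ℝ)) := by
    have := ZSpan.isAddFundamentalDomain' (Pi.basisFun ℝ ι) (volume : Measure (ι → ℝ))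
    rwa [ZSpan.fundamentalDomain_pi_basisFun] at this
  have hL : ∀ g : L, ∃ u : ι → ℤ, (g : ι → ℝ) = fun i => (u i : ℝ) := by
    intro g
    have := (Module.Basis.mem_span_iff_repr_mem ℤ (Pi.basisFun ℝ ι) (g : ι → ℝ)).1 g.2
    simp only [Pi.basisFun_repr, Set.mem_range, algebraMap_int_eq, eq_intCast] at this
    choose u hu using this
    exact ⟨u, by ext i; rw [hu]⟩
  choose U hU using hL
  have hUinj : Function.Injective U := fun g g' h => Subtype.ext (by rw [hU g, hU g', h])
  have : Countable L := hUinj.countable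
  have hcount : ∀ ξ : ι → ℝ, ∀ s : Finset L,
      ((s.filter fun g : L => (g : ι → ℝ) + ξ ∈ E).card) ≤ X.card := by
    intro ξ s
    rcases (s.filter fun g : L => (g : ι → ℝ) + ξ ∈ E).eq_empty_or_nonempty with h0 | ⟨g₀, hg₀⟩
    · simp [h0]
    · refine Finset.card_le_card_of_injOn (fun g => U g - U g₀) ?_ ?_
      · intro g hg
        have h1 := (hEmem _).1 (Finset.mem_filter.1 hg).2
        have h2 := (hEmem _).1 (Finset.mem_filter.1 hg₀).2
        refine hX _ ?_
        have e : (fun i => (((U g - U g₀) i : ℤ) : ℝ)) =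
            ((g : ι → ℝ) + ξ) - ((g₀ : ι → ℝ) + ξ) := by
          rw [hU g, hU g₀]; ext i; simp
        rw [e, map_sub]
        exact (norm_sub_le _ _).trans (by linarith)
      · intro g _ g' _ h
        exact hUinj (by simpa using h)
  have hupp : ∫⁻ ξ, E.indicator (fun ξ => ENNReal.ofReal (D ξ)) ξ
      ≤ X.card * ENNReal.ofReal V.card := by
    rw [hfd.lintegral_eq_tsum'', ← lintegral_tsum]
    · rw [← hintI, ← lintegral_const_mul _ (by fun_prop)]
      refine lintegral_mono fun ξ => ?_
      rw [ENNReal.tsum_eq_iSup_sum]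
      refine iSup_le fun s => ?_
      have hper : ∀ g : L, D (g +ᵥ ξ) = D ξ := by
        intro g
        change D ((g : ι → ℝ) + ξ) = D ξ
        rw [hU g]
        simp only [hD, chr_add_int]
      calc ∑ g ∈ s, E.indicator (fun ξ => ENNReal.ofReal (D ξ)) (g +ᵥ ξ)
          = ∑ g ∈ s, if (g : ι → ℝ) + ξ ∈ E then ENNReal.ofReal (D ξ) else 0 := by
            refine Finset.sum_congr rfl fun g _ => ?_
            rw [Set.indicator_apply, hper]; rfl
        _ = (s.filter fun g : L => (g : ι → ℝ) + ξ ∈ E).card * ENNReal.ofReal (D ξ) := by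
            rw [← Finset.sum_filter, Finset.sum_const, nsmul_eq_mul]
        _ ≤ _ := by
            gcongr
            exact_mod_cast hcount ξ s
    · intro g
      refine Measurable.aemeasurable ?_
      refine Measurable.comp (g := E.indicator fun ξ => ENNReal.ofReal (D ξ)) ?_
        (measurable_const_vadd g)
      exact Measurable.indicator (by fun_prop) hEmeas
  have hfin := hlow.trans hupp
  rw [hvol, ← ENNReal.ofReal_mul (by positivity), ← ENNReal.ofReal_natCast,
    ← ENNReal.ofReal_mul (by positivity), ENNReal.ofReal_le_ofReal_iff (by positivity)] at hfin
  have : (V.card : ℝ) * (V.card * (2 * κ) ^ Fintype.card ι) ≤ V.card * (2 * X.card) := by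
    nlinarith
  exact le_of_mul_le_mul_left this hVc

end LargeSieve
namespace Frame

variable {m : ℕ}

lemma finite_size_le (P : Frame m) {T : ℝ} (hT : 0 < T) (R : ℝ) :
    {v : IVec m | P.size T v ≤ R}.Finite := by
  set S : ℝ := T * R with hS
  set A : ℝ := R + S * ‖P.xi‖ with hA
  set r : ℝ := R / T + S * |P.zeta| + m * (A * ‖P.eta‖) with hr
  refine ((Set.finite_Icc (-⌈S⌉) ⌈S⌉).prod ((Set.finite_Icc (fun _ : Fin m => -⌈A⌉)
    (fun _ => ⌈A⌉)).prod (Set.finite_Icc (-⌈r⌉) ⌈r⌉))).subset ?_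
  rintro ⟨s, t, z⟩ h
  have h : P.size T (s, t, z) ≤ R := h
  have h1 := (P.abs_div_le_size hT (s, t, z)).trans h
  have h2 := (P.horiz_le_size hT (s, t, z)).trans h
  have h3 := (P.vert_le_size hT (s, t, z)).trans h
  have hs : |(s : ℝ)| ≤ S := by
    rw [div_le_iff₀ hT] at h1; simp only at h1; linarith
  have ht : ∀ i, |(t i : ℝ)| ≤ A := by
    intro i
    have h4 := (norm_le_pi_norm (P.horiz (s, t, z)) i).trans h2
    have e : (t i : ℝ) = P.horiz (s, t, z) i - s * P.xi i := by simp [horiz]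
    rw [e]
    refine (abs_sub _ _).trans ?_
    rw [abs_mul]
    have h5 := norm_le_pi_norm P.xi i
    have h6 : |(s : ℝ)| * |P.xi i| ≤ S * ‖P.xi‖ :=
      mul_le_mul hs h5 (abs_nonneg _) ((abs_nonneg _).trans hs)
    rw [Real.norm_eq_abs] at h4
    linarith
  have hR : 0 ≤ R := (norm_nonneg _).trans h2
  have hA0 : 0 ≤ A := by positivity
  have hz : |(z : ℝ)| ≤ r := by
    have e : (z : ℝ) = P.vert (s, t, z) - s * P.zeta - (fun i => (t i : ℝ)) ⬝ᵥ P.eta := by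
      simp only [vert]; ring
    rw [e]
    refine (abs_sub _ _).trans ?_
    have h4 := abs_sub (P.vert (s, t, z)) (s * P.zeta)
    have h5 : |P.vert (s, t, z)| ≤ R / T := by
      rw [le_div_iff₀ hT]; linarith
    have h6 : |s * P.zeta| ≤ S * |P.zeta| := by rw [abs_mul]; gcongr
    have h7 := abs_dotProduct_le (fun i => (t i : ℝ)) P.eta
    have h8 : ‖fun i => (t i : ℝ)‖ ≤ A := (pi_norm_le_iff_of_nonneg hA0).2 ht
    have h9 : (m : ℝ) * (‖fun i => (t i : ℝ)‖ * ‖P.eta‖) ≤ m * (A * ‖P.eta‖) := by gcongr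
    linarith
  have hc : ∀ (a : ℤ) (B : ℝ), |(a : ℝ)| ≤ B → -⌈B⌉ ≤ a ∧ a ≤ ⌈B⌉ := by
    intro a B h
    have h' : |a| ≤ ⌈B⌉ := by
      have := h.trans (Int.le_ceil B)
      exact_mod_cast this
    exact abs_le.1 h'
  exact ⟨hc _ _ hs, ⟨fun i => (hc _ _ (ht i)).1, fun i => (hc _ _ (ht i)).2⟩, hc _ _ hz⟩

/-- The finite set of integer vectors of size at most `R`. -/
noncomputable def sizeBall (P : Frame m) (T R : ℝ) : Finset (IVec m) :=
  open Classical in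
  if hT : 0 < T then (P.finite_size_le hT R).toFinset else ∅

lemma mem_sizeBall {P : Frame m} {T R : ℝ} (hT : 0 < T) {v : IVec m} :
    v ∈ P.sizeBall T R ↔ P.size T v ≤ R := by
  simp [sizeBall, hT]

lemma dual_dual (P : Frame m) : P.dual.dual = P := by
  cases P
  simp [dual, dotProduct_comm]

/-- The index type of the coordinates of `ℤ × ℤ^m × ℤ`. -/
abbrev Idx (m : ℕ) := Unit ⊕ (Fin m ⊕ Unit)

/-- The rescaled change of coordinates as a matrix. -/
noncomputable def mat (P : Frame m) (T : ℝ) : Matrix (Idx m) (Idx m) ℝ :=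
  Matrix.fromBlocks (Matrix.of fun _ _ => 1 / T) 0
    (Matrix.of fun i _ => Sum.elim P.xi (fun _ => T * P.zeta) i)
    (Matrix.fromBlocks 1 0 (Matrix.of fun _ j => T * P.eta j) (Matrix.of fun _ _ => T))

lemma det_mat (P : Frame m) {T : ℝ} (hT : 0 < T) : (P.mat T).det = 1 := by
  rw [mat, Matrix.det_fromBlocks_zero₁₂, Matrix.det_fromBlocks_zero₁₂]
  simp [hT.ne']

lemma mat_mulVec (P : Frame m) (T : ℝ) (x : ℝ) (y : Fin m → ℝ) (z : ℝ) :
    (P.mat T).mulVec (Sum.elim (fun _ => x) (Sum.elim y fun _ => z))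
      = Sum.elim (fun _ => x / T) (Sum.elim (fun i => y i + x * P.xi i)
        fun _ => T * (z + x * P.zeta + y ⬝ᵥ P.eta)) := by
  ext (i | i | i)
  · simp [mat, Matrix.mulVec, dotProduct]; ring
  · simp [mat, Matrix.mulVec, dotProduct, Fintype.sum_sum_type, Matrix.one_apply]; ring
  · simp [mat, Matrix.mulVec, dotProduct, Fintype.sum_sum_type]
    rw [mul_add, mul_add, Finset.mul_sum]
    have : ∀ j, T * (y j * P.eta j) = T * P.eta j * y j := fun j => by ring
    simp_rw [this]
    ring

/-- Coordinates of an integer vector in reversed order. -/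
def toFunRev (v : IVec m) : Idx m → ℤ := Sum.elim (fun _ => v.2.2) (Sum.elim v.2.1 fun _ => v.1)

lemma toFunRev_injective : Function.Injective (toFunRev (m := m)) := by
  rintro ⟨s, t, r⟩ ⟨s', t', r'⟩ h
  have h1 := congrFun h (Sum.inl ())
  have h2 := fun i => congrFun h (Sum.inr (Sum.inl i))
  have h3 := congrFun h (Sum.inr (Sum.inr ()))
  simp only [toFunRev, Sum.elim_inl, Sum.elim_inr] at h1 h2 h3
  rw [h1, h3, funext h2]

/-- The integer vector with given coordinates. -/
def ofFun (u : Idx m → ℤ) : IVec m :=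
  (u (Sum.inl ()), fun i => u (Sum.inr (Sum.inl i)), u (Sum.inr (Sum.inr ())))

lemma pairing_eq (P : Frame m) (s : ℝ) (t : Fin m → ℝ) (r x : ℝ) (y : Fin m → ℝ) (z : ℝ) :
    s * x + t ⬝ᵥ y + r * z
      = s * (x + z * P.dual.zeta + y ⬝ᵥ P.dual.eta)
        + (t + s • P.xi) ⬝ᵥ (y + z • P.dual.xi)
        + (r + s * P.zeta + t ⬝ᵥ P.eta) * z := by
  simp only [dual, add_dotProduct, dotProduct_add, smul_dotProduct, dotProduct_smul,
    dotProduct_neg, smul_eq_mul]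
  rw [dotProduct_comm y P.xi]
  ring

/-- Transference between a frame and its dual. -/
theorem card_sizeBall_le (hm : 1 ≤ m) (P : Frame m) {T R : ℝ} (hT : 0 < T) (hR : 0 < R) :
    ((P.sizeBall T R).card : ℝ)
      ≤ 2 * (4 * m * R) ^ (m + 2) * (P.dual.sizeBall T (1 / R)).card := by
  classical
  have hm' : (1 : ℝ) ≤ m := by exact_mod_cast hm
  set κ : ℝ := 1 / (8 * m * R) with hκ
  have hκ0 : 0 < κ := by positivity
  have hsplit : ∀ ξ : Idx m → ℝ, ξ = Sum.elim (fun _ => ξ (Sum.inl ()))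
      (Sum.elim (fun i => ξ (Sum.inr (Sum.inl i))) fun _ => ξ (Sum.inr (Sum.inr ()))) := by
    intro ξ; ext (i | i | i) <;> rfl
  let e : IVec m ↪ (Idx m → ℤ) := ⟨toFunRev, toFunRev_injective⟩
  have hdet : |LinearMap.det (Matrix.toLin' (P.dual.mat T))| = 1 := by
    rw [LinearMap.det_toLin', det_mat _ hT, abs_one]
  let emb : IVec m → (Idx m → ℤ) :=
    fun u => Sum.elim (fun _ => u.1) (Sum.elim u.2.1 fun _ => u.2.2)
  have main := LargeSieve.card_mul_le _ hdet hκ0.le ((P.sizeBall T R).map e)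
    ((P.dual.sizeBall T (1 / R)).image emb) ?_ ?_
  · rw [Finset.card_map] at main
    have hc : Fintype.card (Idx m) = m + 2 := by
      simp only [Fintype.card_sum, Fintype.card_unit, Fintype.card_fin]; omega
    have hcard : (((P.dual.sizeBall T (1 / R)).image emb).card : ℝ)
        ≤ (P.dual.sizeBall T (1 / R)).card := by exact_mod_cast Finset.card_image_le
    rw [hc] at main
    have h2 : 2 * κ * (4 * m * R) = 1 := by rw [hκ]; field_simp; norm_num
    calc ((P.sizeBall T R).card : ℝ)
        = (P.sizeBall T R).card * (2 * κ) ^ (m + 2) * (4 * m * R) ^ (m + 2) := by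
          rw [mul_assoc, ← mul_pow, h2, one_pow, mul_one]
      _ ≤ 2 * (P.dual.sizeBall T (1 / R)).card * (4 * m * R) ^ (m + 2) := by
          refine mul_le_mul_of_nonneg_right ?_ (by positivity)
          exact main.trans (mul_le_mul_of_nonneg_left hcard zero_le_two)
      _ = _ := by ring
  · intro w hw ξ hξ
    obtain ⟨v, hv, rfl⟩ := Finset.mem_map.1 hw
    have hv := (mem_sizeBall hT).1 hv
    obtain ⟨z, y, x, rfl⟩ : ∃ (z : ℝ) (y : Fin m → ℝ) (x : ℝ),
      ξ = Sum.elim (fun _ => z) (Sum.elim y fun _ => x) := ⟨_, _, _, hsplit ξ⟩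
    rw [Matrix.toLin'_apply, mat_mulVec] at hξ
    have c1 := (norm_le_pi_norm _ (Sum.inl ())).trans hξ
    have c2 := fun i => (norm_le_pi_norm _ (Sum.inr (Sum.inl i))).trans hξ
    have c3 := (norm_le_pi_norm _ (Sum.inr (Sum.inr ()))).trans hξ
    simp only [Sum.elim_inl, Sum.elim_inr, Real.norm_eq_abs] at c1 c2 c3
    rw [abs_div, abs_of_pos hT] at c1
    rw [abs_mul, abs_of_pos hT] at c3
    have e1 : (fun i => ((e v i : ℤ) : ℝ)) ⬝ᵥ (Sum.elim (fun _ => z) (Sum.elim y fun _ => x))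
        = (v.1 : ℝ) * x + (fun i => (v.2.1 i : ℝ)) ⬝ᵥ y + v.2.2 * z := by
      simp [e, toFunRev, dotProduct, Fintype.sum_sum_type]; ring
    rw [e1, pairing_eq P]
    have d2 : ‖y + z • P.dual.xi‖ ≤ κ := (pi_norm_le_iff_of_nonneg hκ0.le).2 fun i => by
      simpa using c2 i
    have b1 : |(v.1 : ℝ) * (x + z * P.dual.zeta + y ⬝ᵥ P.dual.eta)|
        ≤ |(v.1 : ℝ)| / T * κ := by
      rw [abs_mul, div_mul_eq_mul_div, le_div_iff₀ hT]
      nlinarith [abs_nonneg (v.1 : ℝ)]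
    have b2 : |((fun i => (v.2.1 i : ℝ)) + (v.1 : ℝ) • P.xi) ⬝ᵥ (y + z • P.dual.xi)|
        ≤ m * (‖P.horiz v‖ * κ) := by
      refine (abs_dotProduct_le _ _).trans ?_
      have : (fun i => (v.2.1 i : ℝ)) + (v.1 : ℝ) • P.xi = P.horiz v := by
        ext i; simp [horiz]
      rw [this]; gcongr
    have b3 : |((v.2.2 : ℝ) + v.1 * P.zeta + (fun i => (v.2.1 i : ℝ)) ⬝ᵥ P.eta) * z|
        ≤ T * |P.vert v| * κ := by
      rw [abs_mul]
      rw [div_le_iff₀ hT] at c1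
      have : |(v.2.2 : ℝ) + v.1 * P.zeta + (fun i => (v.2.1 i : ℝ)) ⬝ᵥ P.eta| = |P.vert v| := rfl
      rw [this]
      nlinarith [abs_nonneg (P.vert v)]
    have hsz : |(v.1 : ℝ)| / T * κ + m * (‖P.horiz v‖ * κ) + T * |P.vert v| * κ
        ≤ m * R * κ := by
      have p1 : 0 ≤ |(v.1 : ℝ)| / T := by positivity
      have p2 : 0 ≤ T * |P.vert v| := by positivity
      have : |(v.1 : ℝ)| / T + m * ‖P.horiz v‖ + T * |P.vert v| ≤ m * P.size T v := by
        unfold size; nlinarith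
      have h4 : m * P.size T v ≤ m * R := by gcongr
      nlinarith
    have h8 : m * R * κ = 1 / 8 := by rw [hκ]; field_simp
    refine (abs_add_three _ _ _).trans ?_
    linarith
  · intro u hu
    refine Finset.mem_image.2 ⟨ofFun u, ?_, ?_⟩
    · rw [mem_sizeBall hT]
      have e2 : (fun i => (u i : ℝ)) = Sum.elim (fun _ => (u (Sum.inl ()) : ℝ))
          (Sum.elim (fun i => (u (Sum.inr (Sum.inl i)) : ℝ))
            fun _ => (u (Sum.inr (Sum.inr ())) : ℝ)) := hsplit _
      rw [e2, Matrix.toLin'_apply, mat_mulVec] at hu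
      have c1 := (norm_le_pi_norm _ (Sum.inl ())).trans hu
      have c2 := fun i => (norm_le_pi_norm _ (Sum.inr (Sum.inl i))).trans hu
      have c3 := (norm_le_pi_norm _ (Sum.inr (Sum.inr ()))).trans hu
      simp only [Sum.elim_inl, Sum.elim_inr, Real.norm_eq_abs] at c1 c2 c3
      rw [abs_div, abs_of_pos hT] at c1
      rw [abs_mul, abs_of_pos hT] at c3
      have d2 : ‖P.dual.horiz (ofFun u)‖ ≤ 2 * κ :=
        (pi_norm_le_iff_of_nonneg (by positivity)).2 fun i => c2 i
      have c3' : T * |P.dual.vert (ofFun u)| ≤ 2 * κ := c3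
      have h6 : 6 * κ ≤ 1 / R := by
        rw [hκ, mul_one_div, div_le_div_iff₀ (by positivity) hR]
        nlinarith
      have c1' : |((ofFun u).1 : ℝ)| / T ≤ 2 * κ := c1
      unfold size
      linarith
    · ext (i | i | i) <;> rfl

end Frame

/-! ### Frames attached to a graph -/

/-- The frame at `x` for integer vectors near the graph of `f`. -/
noncomputable def vecFrame {m : ℕ} (f : (Fin m → ℝ) → ℝ) (x : Fin m → ℝ) : Frame m :=
  ⟨-x, -gradv f x, -(f x - x ⬝ᵥ gradv f x)⟩

/-- The dual frame at `x`, for integer covectors near the tangent hyperplanes. -/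
noncomputable def covecFrame {m : ℕ} (f : (Fin m → ℝ) → ℝ) (x : Fin m → ℝ) : Frame m :=
  ⟨gradv f x, x, f x⟩

lemma vecFrame_dual {m : ℕ} (f : (Fin m → ℝ) → ℝ) (x : Fin m → ℝ) :
    (vecFrame f x).dual = covecFrame f x := by
  simp [vecFrame, covecFrame, Frame.dual]

lemma fderiv_eq_gradv_dotProduct {m : ℕ} (f : (Fin m → ℝ) → ℝ) (x h : Fin m → ℝ) :
    fderiv ℝ f x h = gradv f x ⬝ᵥ h := by
  have : h = ∑ i, h i • (Pi.single i 1 : Fin m → ℝ) := by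
    ext j; simp [Finset.sum_apply, Pi.single_apply]
  conv_lhs => rw [this]
  simp [map_sum, gradv, dotProduct, mul_comm]

lemma exists_norm_le_mulVec {m : ℕ} {A : Matrix (Fin m) (Fin m) ℝ} (hA : A.det ≠ 0) :
    ∃ C : ℝ, ∀ h : Fin m → ℝ, ‖h‖ ≤ C * ‖A.mulVec h‖ := by
  refine ⟨‖(Matrix.toLin' A⁻¹).toContinuousLinearMap‖, fun h => ?_⟩
  have := (Matrix.toLin' A⁻¹).toContinuousLinearMap.le_opNorm (A.mulVec h)
  simpa [Matrix.mulVec_mulVec, Matrix.nonsing_inv_mul A (isUnit_iff_ne_zero.2 hA)] using this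

lemma exists_norm_eq_abs {m : ℕ} (hm : 1 ≤ m) (a : Fin m → ℝ) : ∃ e, ‖a‖ = |a e| := by
  have : Nonempty (Fin m) := ⟨⟨0, hm⟩⟩
  by_contra! h
  have h1 : ∀ i, ‖a i‖ < ‖a‖ := fun i => lt_of_le_of_ne (norm_le_pi_norm a i) (h i).symm
  have hpos : 0 < ‖a‖ := (norm_nonneg _).trans_lt (h1 (Classical.arbitrary _))
  exact lt_irrefl _ ((pi_norm_lt_iff hpos).2 h1)

theorem exists_local_frames {m : ℕ} (hm : 1 ≤ m) {D : Set (Fin m → ℝ)} (hD : IsOpen D)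
    {f : (Fin m → ℝ) → ℝ} (hf : ContDiffOn ℝ 2 f D) {x₀ : Fin m → ℝ} (hx₀ : x₀ ∈ D)
    (hdet : (hess f x₀).det ≠ 0) :
    ∃ r > 0, ∃ (K θ : ℝ) (B : (Fin m → ℝ) →ₗ[ℝ] (Fin m → ℝ)),
      Metric.ball x₀ r ⊆ D ∧
      AdaptedFrames (vecFrame f) (Metric.ball x₀ r) K θ (-LinearMap.id) (-B) ∧
      AdaptedFrames (covecFrame f) (Metric.ball x₀ r) K θ B LinearMap.id ∧
      ∀ h k, B h ⬝ᵥ k = h ⬝ᵥ B k := by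
  have hfd : ContDiffOn ℝ 1 (fderiv ℝ f) D :=
    hf.fderiv_of_isOpen hD (by norm_num)
  have hfa : ContDiffAt ℝ 1 (fderiv ℝ f) x₀ := hfd.contDiffAt (hD.mem_nhds hx₀)
  have hga : ContDiffAt ℝ 1 (gradv f) x₀ := by
    refine contDiffAt_pi.2 fun i => ?_
    exact hfa.clm_apply contDiffAt_const
  have hstrict := hga.hasStrictFDerivAt (by norm_num)
  set g' := fderiv ℝ (gradv f) x₀ with hg'
  have hhess : ∀ i j, hess f x₀ i j = g' (Pi.single i 1) j := by
    intro i j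
    have h1 : HasFDerivAt (fun y => gradv f y j)
        ((ContinuousLinearMap.proj j).comp g') x₀ :=
      hasFDerivAt_pi'.1 hstrict.hasFDerivAt j
    have h2 : hess f x₀ i j = fderiv ℝ (fun y => gradv f y j) x₀ (Pi.single i 1) := rfl
    rw [h2, h1.fderiv]; rfl
  have hg'v : ∀ h, g' h = (hess f x₀).transpose.mulVec h := by
    intro h
    have : h = ∑ i, h i • (Pi.single i 1 : Fin m → ℝ) := by
      ext j; simp [Finset.sum_apply, Pi.single_apply]
    conv_lhs => rw [this]
    ext j
    simp [map_sum, Matrix.mulVec, dotProduct, hhess, mul_comm]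
  have hsymm : ∀ i j, hess f x₀ i j = hess f x₀ j i := by
    have hfa2 : ContDiffAt ℝ 2 f x₀ := hf.contDiffAt (hD.mem_nhds hx₀)
    have hs : IsSymmSndFDerivAt ℝ f x₀ := hfa2.isSymmSndFDerivAt (by simp)
    have h3 : ∀ i j, hess f x₀ i j
        = fderiv ℝ (fderiv ℝ f) x₀ (Pi.single i 1) (Pi.single j 1) := by
      intro i j
      have hd : HasFDerivAt (fderiv ℝ f) (fderiv ℝ (fderiv ℝ f) x₀) x₀ :=
        (hfa.differentiableAt (by norm_num)).hasFDerivAt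
      have := (hd.clm_apply (hasFDerivAt_const (Pi.single j (1 : ℝ) : Fin m → ℝ) x₀)).fderiv
      simp only [hess, Matrix.of_apply]
      rw [this]; simp
    intro i j
    rw [h3, h3]; exact hs _ _
  obtain ⟨C₂, hC₂⟩ := exists_norm_le_mulVec (A := (hess f x₀).transpose)
    (by rwa [Matrix.det_transpose])
  set K : ℝ := 1 + |C₂| + m * (‖g'‖ + 1) with hK
  have hm' : (1 : ℝ) ≤ m := by exact_mod_cast hm
  have hK1 : 1 ≤ K := by have : 0 ≤ m * (‖g'‖ + 1) := by positivity
                         have := abs_nonneg C₂; linarith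
  have hKC₂ : C₂ ≤ K := by
    have : 0 ≤ m * (‖g'‖ + 1) := by positivity
    have := le_abs_self C₂; linarith
  have hKm : m * (‖g'‖ + 1) ≤ K := by
    have := abs_nonneg C₂; linarith
  have hKg : ‖g'‖ ≤ K := le_trans (by nlinarith [norm_nonneg g']) hKm
  set θ : ℝ := 1 / (16 * m * K) with hθ
  have hK0 : 0 < K := by linarith
  have hθ0 : 0 < θ := by positivity
  have hθ1 : θ ≤ 1 := by
    rw [hθ, div_le_one (by positivity)]; nlinarith
  have happ := hstrict.approximates_deriv_on_nhds (c := ⟨θ, hθ0.le⟩) (Or.inr (by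
    exact_mod_cast hθ0))
  obtain ⟨s, hs, happ⟩ := happ
  obtain ⟨r, hr, hball⟩ := Metric.mem_nhds_iff.1 (Filter.inter_mem hs (hD.mem_nhds hx₀))
  set U := Metric.ball x₀ r with hU
  have hUD : U ⊆ D := fun y hy => (hball hy).2
  have hGapp : ∀ x ∈ U, ∀ y ∈ U, ‖gradv f y - gradv f x - g' (y - x)‖ ≤ θ * ‖y - x‖ :=
    fun x hx y hy => happ _ (hball hy).1 _ (hball hx).1
  have hGlip : ∀ x ∈ U, ∀ y ∈ U, ‖gradv f y - gradv f x‖ ≤ (‖g'‖ + 1) * ‖y - x‖ := by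
    intro x hx y hy
    have h1 := hGapp x hx y hy
    have h2 := g'.le_opNorm (y - x)
    have h3 := norm_add_le (gradv f y - gradv f x - g' (y - x)) (g' (y - x))
    rw [sub_add_cancel] at h3
    nlinarith [norm_nonneg (y - x)]
  have hTaylor : ∀ x ∈ U, ∀ y ∈ U, |f y - f x - gradv f x ⬝ᵥ (y - x)| ≤ K * ‖y - x‖ ^ 2 := by
    intro x hx y hy
    have hseg : segment ℝ x y ⊆ U := (convex_ball x₀ r).segment_subset hx hy
    have hd : ∀ z ∈ segment ℝ x y, HasFDerivWithinAt f (fderiv ℝ f z) (segment ℝ x y) z := by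
      intro z hz
      have := (hf.contDiffAt (hD.mem_nhds (hUD (hseg hz)))).differentiableAt (by norm_num)
      exact this.hasFDerivAt.hasFDerivWithinAt
    have hb : ∀ z ∈ segment ℝ x y, ‖fderiv ℝ f z - fderiv ℝ f x‖ ≤ K * ‖y - x‖ := by
      intro z hz
      refine ContinuousLinearMap.opNorm_le_bound _ (by positivity) fun h => ?_
      rw [sub_apply, fderiv_eq_gradv_dotProduct, fderiv_eq_gradv_dotProduct,
        ← sub_dotProduct]
      have h1 := hGlip x hx z (hseg hz)
      have h2 : ‖z - x‖ ≤ ‖y - x‖ := by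
        rw [segment_eq_image'] at hz
        obtain ⟨c, hc, rfl⟩ := hz
        rw [add_sub_cancel_left, norm_smul, Real.norm_eq_abs, abs_of_nonneg hc.1]
        exact mul_le_of_le_one_left (norm_nonneg _) hc.2
      calc |(gradv f z - gradv f x) ⬝ᵥ h| ≤ m * (‖gradv f z - gradv f x‖ * ‖h‖) :=
            abs_dotProduct_le _ _
        _ ≤ m * (((‖g'‖ + 1) * ‖y - x‖) * ‖h‖) := by
            gcongr; exact h1.trans (by gcongr)
        _ = (m * (‖g'‖ + 1)) * ‖y - x‖ * ‖h‖ := by ring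
        _ ≤ _ := by gcongr
    have := (convex_segment x y).norm_image_sub_le_of_norm_hasFDerivWithin_le' hd hb
      (left_mem_segment ℝ x y) (right_mem_segment ℝ x y)
    rw [fderiv_eq_gradv_dotProduct, Real.norm_eq_abs] at this
    linarith [this, sq (‖y - x‖), mul_assoc K ‖y - x‖ ‖y - x‖]
  set B : (Fin m → ℝ) →ₗ[ℝ] (Fin m → ℝ) := g'.toLinearMap with hB
  have hBg : ∀ h, B h = g' h := fun _ => rfl
  have hBle : ∀ h, ‖B h‖ ≤ K * ‖h‖ := fun h => (g'.le_opNorm h).trans (by gcongr)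
  have hBge : ∀ h, ‖h‖ ≤ K * ‖B h‖ := fun h => by
    rw [hBg, hg'v]; exact (hC₂ h).trans (by gcongr)
  have hBsymm : ∀ h k, B h ⬝ᵥ k = h ⬝ᵥ B k := by
    intro h k
    have : (hess f x₀).transpose = hess f x₀ := by ext i j; exact hsymm j i
    rw [hBg, hBg, hg'v, hg'v, this, Matrix.dotProduct_mulVec]
    conv_rhs => rw [← this, Matrix.vecMul_transpose]
  have hBdual : ∀ a, ∃ e, ‖a‖ ≤ K * |a ⬝ᵥ B (Pi.single e 1)| := by
    intro a
    obtain ⟨e, he⟩ := exists_norm_eq_abs hm (B a)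
    refine ⟨e, (hBge a).trans ?_⟩
    rw [he, ← hBsymm]
    simp
  have hIdual : ∀ a : Fin m → ℝ, ∃ e, ‖a‖ ≤ K * |a ⬝ᵥ (Pi.single e (1 : ℝ) : Fin m → ℝ)| := by
    intro a
    obtain ⟨e, he⟩ := exists_norm_eq_abs hm a
    refine ⟨e, ?_⟩
    rw [he]
    simpa using le_mul_of_one_le_left (abs_nonneg (a e)) hK1
  have hI : ∀ h : Fin m → ℝ, ‖h‖ ≤ K * ‖h‖ := fun h => le_mul_of_one_le_left (norm_nonneg h) hK1
  have hθK : θ * (16 * m * K) ≤ 1 := by rw [hθ]; field_simp; exact le_rfl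
  refine ⟨r, hr, K, θ, B, hUD, ?_, ?_, hBsymm⟩
  · refine ⟨hK1, hθ0.le, hθK, ?_, ?_, ?_, ?_, ?_, ?_, ?_⟩
    · intro x _ y _
      have : (vecFrame f y).xi - (vecFrame f x).xi - (-LinearMap.id : (Fin m → ℝ) →ₗ[ℝ] _) (y - x)
          = 0 := by
        simp [vecFrame]; abel
      rw [this, norm_zero]; positivity
    · intro x hx y hy
      have : (vecFrame f y).eta - (vecFrame f x).eta - (-B) (y - x)
          = -(gradv f y - gradv f x - g' (y - x)) := by
        simp only [vecFrame, LinearMap.neg_apply, hBg]; abel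
      rw [this, norm_neg]; exact hGapp x hx y hy
    · intro x hx y hy
      have h := hTaylor y hy x hx
      rw [norm_sub_rev] at h
      have e : (vecFrame f y).zeta - (vecFrame f x).zeta
          - (vecFrame f x).xi ⬝ᵥ ((vecFrame f y).eta - (vecFrame f x).eta)
          = f x - f y - gradv f y ⬝ᵥ (x - y) := by
        simp only [vecFrame, neg_dotProduct, dotProduct_sub, dotProduct_neg]
        rw [dotProduct_comm y, dotProduct_comm x, dotProduct_comm x]; ring
      rw [e]; exact h
    · simpa using hI
    · simpa using hBle
    · simpa using hI
    · simpa using hBdual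
  · refine ⟨hK1, hθ0.le, hθK, ?_, ?_, ?_, ?_, ?_, ?_, ?_⟩
    · intro x hx y hy
      exact hGapp x hx y hy
    · intro x _ y _
      have : (covecFrame f y).eta - (covecFrame f x).eta
          - (LinearMap.id : (Fin m → ℝ) →ₗ[ℝ] _) (y - x) = 0 := by
        simp [covecFrame]
      rw [this, norm_zero]; positivity
    · intro x hx y hy
      exact hTaylor x hx y hy
    · exact hBle
    · simpa using hI
    · exact hBge
    · simpa using hIdual

/-! ### Counting small vectors over a nested family of grids -/

/-- The point of index `r` in the level `k` grid of mesh `ρ / Λ^k`. -/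
noncomputable def node {m : ℕ} (x : Fin m → ℝ) (ρ : ℝ) (Λ k : ℕ) (r : Fin m → ℕ) : Fin m → ℝ :=
  gridPt x (ρ / (Λ : ℝ) ^ k) r

lemma node_add {m : ℕ} (x : Fin m → ℝ) (ρ : ℝ) {Λ : ℕ} (hΛ : 0 < Λ) (k j : ℕ)
    (r t : Fin m → ℕ) :
    node x ρ Λ (k + j) (fun i => Λ ^ j * r i + t i)
      = gridPt (node x ρ Λ k r) (ρ / ((Λ : ℝ) ^ k * (Λ ^ j : ℕ))) t := by
  have hΛ' : (0 : ℝ) < Λ := by exact_mod_cast hΛ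
  have e : ρ / (Λ : ℝ) ^ k = ρ / ((Λ : ℝ) ^ k * (Λ ^ j : ℕ)) * (Λ ^ j : ℕ) := by
    push_cast; field_simp
  rw [node, node, e, gridPt_gridPt, pow_add]
  push_cast
  rfl

lemma sum_cube_pow_add {α : Type*} [AddCommMonoid α] (m Λ k j : ℕ) (F : (Fin m → ℕ) → α) :
    ∑ r ∈ cube m (Λ ^ (k + j)), F r
      = ∑ r ∈ cube m (Λ ^ k), ∑ t ∈ cube m (Λ ^ j), F (fun i => Λ ^ j * r i + t i) := by
  rw [pow_add, sum_cube_mul]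

/-- A family of adapted frames on a box, together with a refinement factor for which the averages
of `1 / size` contract. -/
structure GridFrames {m : ℕ} (P : (Fin m → ℝ) → Frame m) (U : Set (Fin m → ℝ)) (K θ : ℝ)
    (B' B : (Fin m → ℝ) →ₗ[ℝ] (Fin m → ℝ)) (x : Fin m → ℝ) (ρ : ℝ) (Λ : ℕ) : Prop
    extends AdaptedFrames P U K θ B' B where
  two_le_dim : 2 ≤ m
  rho_pos : 0 < ρ
  rho_le : ρ ≤ 1
  two_le : 2 ≤ Λ
  ball_sub : Metric.closedBall x ρ ⊆ U
  contract : ∀ (y : Fin m → ℝ) (T : ℝ), 0 < T → Metric.closedBall y (ρ / T) ⊆ U →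
    ∀ v : IVec m, v ≠ 0 → ∑ t ∈ cube m Λ, 1 / (P (gridPt y (ρ / (T * Λ)) t)).size (T * Λ) v
      ≤ 1 / 2 * (Λ : ℝ) ^ m / (P y).size T v

namespace AdaptedFrames

variable {m : ℕ} {P : (Fin m → ℝ) → Frame m} {U : Set (Fin m → ℝ)} {K θ : ℝ}
  {B' B : (Fin m → ℝ) →ₗ[ℝ] (Fin m → ℝ)}

lemma exists_contract (F : AdaptedFrames P U K θ B' B) (hm : 2 ≤ m) {ρ : ℝ}
    (hρ : 0 < ρ) (hρ1 : ρ ≤ 1) : ∃ M₀ : ℕ, 2 ≤ M₀ ∧ ∀ M : ℕ, M₀ ≤ M →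
      ∀ (y : Fin m → ℝ) (T : ℝ), 0 < T → Metric.closedBall y (ρ / T) ⊆ U →
      ∀ v : IVec m, v ≠ 0 →
        ∑ t ∈ cube m (M * M), 1 / (P (gridPt y (ρ / (T * (M * M : ℕ))) t)).size (T * (M * M : ℕ)) v
          ≤ 1 / 2 * ((M * M : ℕ) : ℝ) ^ m / (P y).size T v := by
  obtain ⟨C, hC, h⟩ := F.exists_sum_inv_size_le hm hρ hρ1
  obtain ⟨M₀, hM₀⟩ := exists_nat_ge ((2 * C) ^ 2)
  refine ⟨max 2 M₀, le_max_left _ _, fun M hM y T hT hU v hv => ?_⟩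
  have hM2 : 1 ≤ M := by have := (le_max_left _ _).trans hM; omega
  have h1 := (h y T hT hU v hv).2 M hM2
  have hsq : 2 * C ≤ Real.sqrt M := by
    refine Real.le_sqrt_of_sq_le (hM₀.trans ?_)
    exact_mod_cast (le_max_right _ _).trans hM
  have hV0 := (P y).size_pos hT hv
  have h0 : 0 ≤ ∑ t ∈ cube m (M * M),
      1 / (P (gridPt y (ρ / (T * (M * M : ℕ))) t)).size (T * (M * M : ℕ)) v :=
    Finset.sum_nonneg fun t _ => by
      have := ((P (gridPt y (ρ / (T * (M * M : ℕ))) t)).size_nonneg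
        (T := T * (M * M : ℕ)) (by
          have : (0 : ℝ) < (M * M : ℕ) := by exact_mod_cast Nat.mul_pos hM2 hM2
          positivity) v)
      positivity
  have h2 := (mul_le_mul_of_nonneg_right hsq h0).trans h1
  have h3 : C * ((M * M : ℕ) : ℝ) ^ m / (P y).size T v
      = 2 * C * (1 / 2 * ((M * M : ℕ) : ℝ) ^ m / (P y).size T v) := by ring
  rw [h3] at h2
  exact le_of_mul_le_mul_left h2 (by linarith)

/-- Comparison of sizes at nearby points and different scales. -/
lemma size_le_of_near (F : AdaptedFrames P U K θ B' B) (hm : 1 ≤ m) {x y : Fin m → ℝ}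
    (hx : x ∈ U) (hy : y ∈ U) {T T' R S : ℝ} (hT' : 0 < T') (hTT : T' ≤ T)
    (hxy : ‖y - x‖ ≤ 1 / T') {v : IVec m} (hR : (P x).size T v ≤ R)
    (hS : |(v.1 : ℝ)| ≤ S * T') : (P y).size T' v ≤ 6 * m * K * (R + S) := by
  have hK := F.one_le
  have hK0 : 0 ≤ K := by linarith
  have hm' : (1 : ℝ) ≤ m := by exact_mod_cast hm
  have hT : 0 < T := hT'.trans_le hTT
  have hS0 : 0 ≤ S := nonneg_of_mul_nonneg_left ((abs_nonneg _).trans hS) hT'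
  have hR0 : 0 ≤ R := ((P x).size_nonneg hT v).trans hR
  have h1 := F.norm_horiz_sub_le hm hx hy v
  have h2 := F.abs_vert_sub_le hm hx hy v
  have h3 := ((P x).horiz_le_size hT v).trans hR
  have h4 := ((P x).vert_le_size hT v).trans hR
  have a1 : |(v.1 : ℝ)| / T' ≤ S := by rwa [div_le_iff₀ hT']
  have hn := norm_nonneg (y - x)
  have hTn : T' * ‖y - x‖ ≤ 1 := by
    rw [le_div_iff₀ hT'] at hxy; linarith
  have a2 : |(v.1 : ℝ)| * ‖y - x‖ ≤ S := by
    calc |(v.1 : ℝ)| * ‖y - x‖ ≤ S * T' * ‖y - x‖ := by gcongr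
      _ = S * (T' * ‖y - x‖) := by ring
      _ ≤ S * 1 := by gcongr
      _ = S := mul_one S
  have b1 : ‖(P y).horiz v‖ ≤ R + 2 * K * S := by
    have := norm_add_le ((P y).horiz v - (P x).horiz v) ((P x).horiz v)
    rw [sub_add_cancel] at this
    have : 2 * K * (|(v.1 : ℝ)| * ‖y - x‖) ≤ 2 * K * S := by gcongr
    linarith
  have b2 : T' * |(P y).vert v| ≤ R + 2 * m * K * R + K * S := by
    have e1 : |(P y).vert v| ≤ |(P y).vert v - (P x).vert v| + |(P x).vert v| := by
      have := abs_add_le ((P y).vert v - (P x).vert v) ((P x).vert v)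
      rwa [sub_add_cancel] at this
    have e2 : T' * |(P x).vert v| ≤ R := le_trans (by gcongr) h4
    have e3 : T' * (2 * m * K * (‖(P x).horiz v‖ * ‖y - x‖)) ≤ 2 * m * K * R := by
      calc T' * (2 * m * K * (‖(P x).horiz v‖ * ‖y - x‖))
          = 2 * m * K * (‖(P x).horiz v‖ * (T' * ‖y - x‖)) := by ring
        _ ≤ 2 * m * K * (R * 1) := by gcongr
        _ = _ := by ring
    have e4 : T' * (K * (|(v.1 : ℝ)| * ‖y - x‖ ^ 2)) ≤ K * S := by
      calc T' * (K * (|(v.1 : ℝ)| * ‖y - x‖ ^ 2))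
          = K * ((|(v.1 : ℝ)| * ‖y - x‖) * (T' * ‖y - x‖)) := by ring
        _ ≤ K * (S * 1) := by gcongr
        _ = _ := by ring
    calc T' * |(P y).vert v| ≤ T' * (2 * m * K * (‖(P x).horiz v‖ * ‖y - x‖)
          + K * (|(v.1 : ℝ)| * ‖y - x‖ ^ 2) + |(P x).vert v|) := by gcongr; linarith
      _ = T' * (2 * m * K * (‖(P x).horiz v‖ * ‖y - x‖))
          + T' * (K * (|(v.1 : ℝ)| * ‖y - x‖ ^ 2)) + T' * |(P x).vert v| := by ring
      _ ≤ _ := by linarith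
  unfold Frame.size
  have hmK : 1 ≤ m * K := one_le_mul_of_one_le_of_one_le hm' hK
  have hKmK : K ≤ m * K := le_mul_of_one_le_left hK0 hm'
  have c1 : R ≤ m * K * R := le_mul_of_one_le_left hR0 hmK
  have c2 : S ≤ m * K * S := le_mul_of_one_le_left hS0 hmK
  have c3 : K * S ≤ m * K * S := by gcongr
  calc _ ≤ S + (R + 2 * K * S) + (R + 2 * m * K * R + K * S) := by linarith
    _ ≤ _ := by linarith

/-- Only few grid points have a small horizontal part. -/
lemma card_filter_horiz_le (F : AdaptedFrames P U K θ B' B) (hm : 1 ≤ m) {x : Fin m → ℝ} {ρ : ℝ}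
    (hρ : 0 < ρ) (hU : Metric.closedBall x ρ ⊆ U) {N : ℕ} (hN : 1 ≤ N) {v : IVec m} {R : ℝ}
    {D : ℕ} (hD : 4 * K * R * N ≤ D * (ρ * |(v.1 : ℝ)|)) (hv : v.1 ≠ 0) :
    ((cube m N).filter fun r => ‖(P (gridPt x (ρ / N) r)).horiz v‖ ≤ R).card
      ≤ (2 * D + 1) ^ m := by
  rcases ((cube m N).filter fun r => ‖(P (gridPt x (ρ / N) r)).horiz v‖ ≤ R).eq_empty_or_nonempty
    with h0 | ⟨r₀, hr₀⟩
  · simp [h0]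
  have hN0 : (0 : ℝ) < N := by exact_mod_cast hN
  have hv0 : 0 < |(v.1 : ℝ)| := by simpa using hv
  have hK := F.one_le
  have hmem : ∀ r ∈ cube m N, gridPt x (ρ / N) r ∈ U := by
    intro r hr
    refine hU ?_
    have := gridPt_mem_closedBall x hρ.le one_pos hr
    simpa using this
  refine le_trans (Finset.card_le_card ?_) (card_filter_dist_le (N := N) r₀ D)
  intro r hr
  obtain ⟨hr1, hr2⟩ := Finset.mem_filter.1 hr
  obtain ⟨hr3, hr4⟩ := Finset.mem_filter.1 hr₀
  refine Finset.mem_filter.2 ⟨hr1, ?_⟩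
  have h1 := F.le_norm_horiz_sub hm (hmem _ hr3) (hmem _ hr1) v
  rw [gridPt_sub, norm_smul, Real.norm_eq_abs, abs_of_pos (show 0 < ρ / N by positivity)] at h1
  have h2 := norm_sub_le ((P (gridPt x (ρ / N) r)).horiz v) ((P (gridPt x (ρ / N) r₀)).horiz v)
  have h3 : |(v.1 : ℝ)| * (ρ / N * ‖fun i => (r i : ℝ) - r₀ i‖) ≤ 4 * K * R := by
    refine h1.trans ?_
    calc _ ≤ 2 * K * (R + R) := by gcongr; linarith
      _ = _ := by ring
  have h4 : (ρ * |(v.1 : ℝ)|) * ‖fun i => (r i : ℝ) - r₀ i‖ ≤ (ρ * |(v.1 : ℝ)|) * D := by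
    calc (ρ * |(v.1 : ℝ)|) * ‖fun i => (r i : ℝ) - r₀ i‖
        = (|(v.1 : ℝ)| * (ρ / N * ‖fun i => (r i : ℝ) - r₀ i‖)) * N := by field_simp
      _ ≤ 4 * K * R * N := by gcongr
      _ ≤ _ := by linarith
  exact le_of_mul_le_mul_left h4 (by positivity)

end AdaptedFrames

namespace GridFrames

variable {m : ℕ} {P : (Fin m → ℝ) → Frame m} {U : Set (Fin m → ℝ)} {K θ : ℝ}
  {B' B : (Fin m → ℝ) →ₗ[ℝ] (Fin m → ℝ)} {x : Fin m → ℝ} {ρ : ℝ} {Λ : ℕ}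

lemma scale_pos (G : GridFrames P U K θ B' B x ρ Λ) : (0 : ℝ) < Λ := by
  have := G.two_le
  exact_mod_cast (by omega : 0 < Λ)

lemma one_le_scale_pow (G : GridFrames P U K θ B' B x ρ Λ) (k : ℕ) : (1 : ℝ) ≤ (Λ : ℝ) ^ k := by
  have := G.two_le
  exact one_le_pow₀ (by exact_mod_cast (by omega : 1 ≤ Λ))

lemma closedBall_node_subset (G : GridFrames P U K θ B' B x ρ Λ) {k : ℕ} {r : Fin m → ℕ}
    (hr : r ∈ cube m (Λ ^ k)) :
    Metric.closedBall (node x ρ Λ k r) (ρ / (Λ : ℝ) ^ k) ⊆ U := by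
  have := closedBall_gridPt_subset x G.rho_pos.le one_pos hr
  rw [node]
  push_cast at this
  simp only [one_mul, div_one] at this
  exact this.trans G.ball_sub

lemma node_mem (G : GridFrames P U K θ B' B x ρ Λ) {k : ℕ} {r : Fin m → ℕ}
    (hr : r ∈ cube m (Λ ^ k)) : node x ρ Λ k r ∈ U := by
  refine G.closedBall_node_subset hr (Metric.mem_closedBall_self ?_)
  have := G.rho_pos
  positivity

lemma node_sub_le (G : GridFrames P U K θ B' B x ρ Λ) {k j : ℕ} (r : Fin m → ℕ)
    {t : Fin m → ℕ} (ht : t ∈ cube m (Λ ^ j)) :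
    ‖node x ρ Λ (k + j) (fun i => Λ ^ j * r i + t i) - node x ρ Λ k r‖ ≤ 1 / (Λ : ℝ) ^ k := by
  have hΛ := G.scale_pos
  have hΛ1 : 0 < Λ := by exact_mod_cast hΛ
  rw [node_add _ _ hΛ1]
  have := gridPt_mem_closedBall (node x ρ Λ k r) (T := (Λ : ℝ) ^ k) G.rho_pos.le
    (by positivity) ht
  rw [mem_closedBall_iff_norm] at this
  exact this.trans (by gcongr; exact G.rho_le)

lemma _root_.child_mem_cube {m Λ k j : ℕ} {r t : Fin m → ℕ}
    (hr : r ∈ cube m (Λ ^ k)) (ht : t ∈ cube m (Λ ^ j)) :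
    (fun i => Λ ^ j * r i + t i) ∈ cube m (Λ ^ (k + j)) := by
  rw [mem_cube] at *
  intro i
  have h1 := hr i
  have h2 := ht i
  calc Λ ^ j * r i + t i < Λ ^ j * r i + Λ ^ j := by omega
    _ = Λ ^ j * (r i + 1) := by ring
    _ ≤ Λ ^ j * Λ ^ k := Nat.mul_le_mul_left _ h1
    _ = _ := by rw [pow_add, mul_comm]

lemma exists_parent (G : GridFrames P U K θ B' B x ρ Λ) {k j : ℕ} {r : Fin m → ℕ}
    (hr : r ∈ cube m (Λ ^ (k + j))) : ∃ r' ∈ cube m (Λ ^ k), ∃ t ∈ cube m (Λ ^ j),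
      r = fun i => Λ ^ j * r' i + t i := by
  have hΛ : 0 < Λ := by have := G.two_le; omega
  have hp : 0 < Λ ^ j := pow_pos hΛ j
  refine ⟨fun i => r i / Λ ^ j, ?_, fun i => r i % Λ ^ j, ?_, ?_⟩
  · rw [mem_cube] at *
    intro i
    rw [Nat.div_lt_iff_lt_mul hp, ← pow_add]
    exact hr i
  · rw [mem_cube]
    exact fun i => Nat.mod_lt _ hp
  · ext i
    exact (Nat.div_add_mod _ _).symm

lemma sum_inv_size_pow_le (G : GridFrames P U K θ B' B x ρ Λ) {k : ℕ} {r : Fin m → ℕ}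
    (hr : r ∈ cube m (Λ ^ k)) {v : IVec m} (hv : v ≠ 0) (j : ℕ) :
    ∑ t ∈ cube m (Λ ^ j),
      1 / (P (node x ρ Λ (k + j) fun i => Λ ^ j * r i + t i)).size ((Λ : ℝ) ^ (k + j)) v
      ≤ (1 / 2) ^ j * ((Λ : ℝ) ^ j) ^ m / (P (node x ρ Λ k r)).size ((Λ : ℝ) ^ k) v := by
  have hΛ := G.scale_pos
  have hΛ1 : 0 < Λ := by exact_mod_cast hΛ
  induction j with
  | zero =>
    have h1 : cube m (Λ ^ 0) = {0} := by
      ext t; simp [mem_cube, funext_iff]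
    rw [h1]; simp
  | succ j ih =>
    rw [sum_cube_pow_add]
    have h2 : ∀ s ∈ cube m (Λ ^ j), ∑ t ∈ cube m (Λ ^ 1),
        1 / (P (node x ρ Λ (k + (j + 1)) fun i => Λ ^ (j + 1) * r i + (Λ ^ 1 * s i + t i))).size
          ((Λ : ℝ) ^ (k + (j + 1))) v
        ≤ 1 / 2 * (Λ : ℝ) ^ m *
          (1 / (P (node x ρ Λ (k + j) fun i => Λ ^ j * r i + s i)).size ((Λ : ℝ) ^ (k + j)) v) := by
      intro s hs
      have h3 := G.contract _ ((Λ : ℝ) ^ (k + j)) (by positivity)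
        (G.closedBall_node_subset (child_mem_cube hr hs)) v hv
      rw [mul_one_div]
      refine le_trans (le_of_eq ?_) h3
      rw [pow_one]
      refine Finset.sum_congr rfl fun t _ => ?_
      have h4 := node_add x ρ hΛ1 (k + j) 1 (fun i => Λ ^ j * r i + s i) t
      rw [pow_one] at h4
      rw [← h4]
      have h5 : (fun i => Λ ^ (j + 1) * r i + (Λ * s i + t i))
          = fun i => Λ * (Λ ^ j * r i + s i) + t i := by ext i; ring
      rw [h5, ← add_assoc, pow_succ]
    refine (Finset.sum_le_sum h2).trans ?_
    rw [← Finset.mul_sum]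
    calc _ ≤ 1 / 2 * (Λ : ℝ) ^ m * ((1 / 2) ^ j * ((Λ : ℝ) ^ j) ^ m
          / (P (node x ρ Λ k r)).size ((Λ : ℝ) ^ k) v) := by gcongr
      _ = _ := by rw [pow_succ (1 / 2 : ℝ), pow_succ (Λ : ℝ), mul_pow]; ring

end GridFrames

/-- The integer vectors of height about `Λ^l` which are small at some node of level `l`. -/
noncomputable def nearVecs {m : ℕ} (P : (Fin m → ℝ) → Frame m) (x : Fin m → ℝ) (ρ : ℝ) (Λ : ℕ)
    (R : ℝ) (l : ℕ) : Finset (IVec m) :=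
  ((cube m (Λ ^ l)).biUnion fun r => (P (node x ρ Λ l r)).sizeBall ((Λ : ℝ) ^ l) R).filter
    fun v => |v.1| ≤ (Λ : ℤ) ^ l ∧ (Λ : ℤ) ^ l < Λ * |v.1|

lemma exists_pow_near {Λ : ℕ} (hΛ : 2 ≤ Λ) {s : ℤ} (hs : s ≠ 0) :
    ∃ l : ℕ, |s| ≤ (Λ : ℤ) ^ l ∧ (Λ : ℤ) ^ l < Λ * |s| := by
  classical
  have h1 : ∃ l : ℕ, s.natAbs ≤ Λ ^ l := ⟨s.natAbs, (Nat.lt_pow_self (by omega)).le⟩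
  have h2 := Nat.find_spec h1
  have h3 : Λ ^ Nat.find h1 < Λ * s.natAbs := by
    rcases h : Nat.find h1 with _ | j
    · have := Int.natAbs_pos.2 hs
      simp only [pow_zero]
      nlinarith
    · have := Nat.find_min h1 (m := j) (by omega)
      rw [pow_succ, mul_comm]
      exact Nat.mul_lt_mul_of_pos_left (by omega) (by omega)
  refine ⟨Nat.find h1, ?_, ?_⟩
  · rw [Int.abs_eq_natAbs]; exact_mod_cast h2
  · rw [Int.abs_eq_natAbs]; exact_mod_cast h3

lemma Frame.one_le_size_of_fst_eq_zero {m : ℕ} (P : Frame m) {T : ℝ} (hT : 1 ≤ T) {v : IVec m}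
    (hv : v ≠ 0) (h0 : v.1 = 0) : 1 ≤ P.size T v := by
  have hT0 : 0 < T := by linarith
  by_cases h1 : v.2.1 = 0
  · have h2 : v.2.2 ≠ 0 := by
      intro h2
      exact hv (Prod.ext h0 (Prod.ext h1 h2))
    have h3 := P.vert_le_size hT0 v
    have h4 : |P.vert v| = |(v.2.2 : ℝ)| := by simp [Frame.vert, h0, h1, dotProduct]
    have h5 : (1 : ℝ) ≤ |(v.2.2 : ℝ)| := by exact_mod_cast Int.one_le_abs h2
    rw [h4] at h3
    nlinarith
  · obtain ⟨i, hi⟩ := Function.ne_iff.1 h1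
    have h3 := (norm_le_pi_norm (P.horiz v) i).trans (P.horiz_le_size hT0 v)
    have h5 : (1 : ℝ) ≤ |(v.2.1 i : ℝ)| := by exact_mod_cast Int.one_le_abs hi
    simp only [Frame.horiz, h0, Int.cast_zero, zero_mul, add_zero, Real.norm_eq_abs] at h3
    linarith

namespace GridFrames

variable {m : ℕ} {P : (Fin m → ℝ) → Frame m} {U : Set (Fin m → ℝ)} {K θ : ℝ}
  {B' B : (Fin m → ℝ) →ₗ[ℝ] (Fin m → ℝ)} {x : Fin m → ℝ} {ρ : ℝ} {Λ : ℕ}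

lemma exists_near_node (G : GridFrames P U K θ B' B x ρ Λ) {k l : ℕ} (hl : l ≤ k)
    {r : Fin m → ℕ} (hr : r ∈ cube m (Λ ^ k)) :
    ∃ r' ∈ cube m (Λ ^ l), ‖node x ρ Λ l r' - node x ρ Λ k r‖ ≤ 1 / (Λ : ℝ) ^ l := by
  obtain ⟨j, rfl⟩ := Nat.exists_eq_add_of_le hl
  obtain ⟨r', hr', t, ht, rfl⟩ := G.exists_parent hr
  refine ⟨r', hr', ?_⟩
  rw [norm_sub_rev]
  exact G.node_sub_le r' ht

lemma card_filter_size_le (G : GridFrames P U K θ B' B x ρ Λ) {D : ℕ}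
    (hD : 4 * K * (1 + 2 * K) * Λ ≤ D * ρ) {l g j : ℕ} {v : IVec m}
    (hv1 : |(v.1 : ℝ)| ≤ (Λ : ℝ) ^ l) (hv2 : (Λ : ℝ) ^ l < Λ * |(v.1 : ℝ)|) :
    (((cube m (Λ ^ (l + g + j))).filter fun r =>
      (P (node x ρ Λ (l + g + j) r)).size ((Λ : ℝ) ^ (l + g + j)) v ≤ 1 / (Λ : ℝ) ^ g).card : ℝ)
      ≤ (2 * D + 1) ^ m * Λ * ((1 / 2) ^ j * ((Λ : ℝ) ^ j) ^ m) := by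
  have hm : 1 ≤ m := by have := G.two_le_dim; omega
  have hΛ := G.scale_pos
  have hΛ1 : 1 ≤ Λ := by have := G.two_le; omega
  have hK := G.one_le
  have hρ := G.rho_pos
  have hs0 : 0 < |(v.1 : ℝ)| := by
    have : 0 < (Λ : ℝ) ^ l := by positivity
    by_contra h
    have : |(v.1 : ℝ)| = 0 := le_antisymm (not_lt.1 h) (abs_nonneg _)
    rw [this] at hv2; linarith
  have hv0 : v.1 ≠ 0 := by
    intro h; simp [h] at hs0
  have hvne : v ≠ 0 := by rintro rfl; exact hv0 rfl
  set S := (cube m (Λ ^ (l + g))).filter fun r =>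
    ‖(P (node x ρ Λ (l + g) r)).horiz v‖ ≤ (1 + 2 * K) / (Λ : ℝ) ^ g with hS
  have hScard : S.card ≤ (2 * D + 1) ^ m := by
    have h := G.card_filter_horiz_le hm hρ G.ball_sub (N := Λ ^ (l + g)) (Nat.one_le_pow _ _ hΛ1)
      (v := v) (R := (1 + 2 * K) / (Λ : ℝ) ^ g) (D := D) ?_ hv0
    · exact (Finset.card_le_card fun r hr => by
        have h' := Finset.mem_filter.1 hr
        refine Finset.mem_filter.2 ⟨h'.1, ?_⟩
        simpa [node] using h'.2).trans h
    · have e : 4 * K * ((1 + 2 * K) / (Λ : ℝ) ^ g) * (Λ ^ (l + g) : ℕ)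
          = 4 * K * (1 + 2 * K) * (Λ : ℝ) ^ l := by
        push_cast; rw [pow_add]; field_simp
      rw [e]
      calc 4 * K * (1 + 2 * K) * (Λ : ℝ) ^ l ≤ 4 * K * (1 + 2 * K) * (Λ * |(v.1 : ℝ)|) := by
            gcongr
        _ = 4 * K * (1 + 2 * K) * Λ * |(v.1 : ℝ)| := by ring
        _ ≤ D * ρ * |(v.1 : ℝ)| := by gcongr
        _ = _ := by ring
  have hcard : (((cube m (Λ ^ (l + g + j))).filter fun r =>
      (P (node x ρ Λ (l + g + j) r)).size ((Λ : ℝ) ^ (l + g + j)) v ≤ 1 / (Λ : ℝ) ^ g).card : ℝ)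
      = ∑ r ∈ cube m (Λ ^ (l + g)), ∑ t ∈ cube m (Λ ^ j),
        if (P (node x ρ Λ (l + g + j) fun i => Λ ^ j * r i + t i)).size
          ((Λ : ℝ) ^ (l + g + j)) v ≤ 1 / (Λ : ℝ) ^ g then (1 : ℝ) else 0 := by
    rw [Finset.card_filter, sum_cube_pow_add]
    push_cast
    rfl
  rw [hcard]
  have hinner : ∀ r ∈ cube m (Λ ^ (l + g)), (∑ t ∈ cube m (Λ ^ j),
        if (P (node x ρ Λ (l + g + j) fun i => Λ ^ j * r i + t i)).size
          ((Λ : ℝ) ^ (l + g + j)) v ≤ 1 / (Λ : ℝ) ^ g then (1 : ℝ) else 0)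
      ≤ if r ∈ S then Λ * ((1 / 2) ^ j * ((Λ : ℝ) ^ j) ^ m) else 0 := by
    intro r hr
    split_ifs with hrS
    · have h1 := G.sum_inv_size_pow_le hr hvne j
      have h2 : (Λ : ℝ)⁻¹ / (Λ : ℝ) ^ g ≤
          (P (node x ρ Λ (l + g) r)).size ((Λ : ℝ) ^ (l + g)) v := by
        refine le_trans ?_ ((P (node x ρ Λ (l + g) r)).abs_div_le_size (by positivity) v)
        rw [pow_add, div_le_div_iff₀ (by positivity) (by positivity)]
        have : (Λ : ℝ)⁻¹ * (Λ : ℝ) ^ l ≤ |(v.1 : ℝ)| := by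
          rw [inv_mul_le_iff₀ hΛ]; exact hv2.le
        calc (Λ : ℝ)⁻¹ * ((Λ : ℝ) ^ l * (Λ : ℝ) ^ g)
            = ((Λ : ℝ)⁻¹ * (Λ : ℝ) ^ l) * (Λ : ℝ) ^ g := by ring
          _ ≤ _ := by gcongr
      calc _ ≤ ∑ t ∈ cube m (Λ ^ j), 1 / (Λ : ℝ) ^ g *
            (1 / (P (node x ρ Λ (l + g + j) fun i => Λ ^ j * r i + t i)).size
              ((Λ : ℝ) ^ (l + g + j)) v) := by
            refine Finset.sum_le_sum fun t _ => ?_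
            have hp := (P (node x ρ Λ (l + g + j) fun i => Λ ^ j * r i + t i)).size_pos
              (T := (Λ : ℝ) ^ (l + g + j)) (by positivity) hvne
            split_ifs with h
            · rw [mul_one_div, le_div_iff₀ hp, one_mul]; exact h
            · positivity
        _ ≤ 1 / (Λ : ℝ) ^ g * ((1 / 2) ^ j * ((Λ : ℝ) ^ j) ^ m
              / (P (node x ρ Λ (l + g) r)).size ((Λ : ℝ) ^ (l + g)) v) := by
            rw [← Finset.mul_sum]; gcongr
        _ ≤ 1 / (Λ : ℝ) ^ g * ((1 / 2) ^ j * ((Λ : ℝ) ^ j) ^ m / ((Λ : ℝ)⁻¹ / (Λ : ℝ) ^ g)) := by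
            gcongr
        _ = _ := by field_simp
    · refine le_of_eq (Finset.sum_eq_zero fun t ht => if_neg fun h => hrS ?_)
      refine Finset.mem_filter.2 ⟨hr, ?_⟩
      have h1 := G.norm_horiz_sub_le hm (G.node_mem (child_mem_cube hr ht)) (G.node_mem hr) v
      have h2 := ((P (node x ρ Λ (l + g + j) fun i => Λ ^ j * r i + t i)).horiz_le_size
        (by positivity) v).trans h
      have h3 := G.node_sub_le (k := l + g) r ht
      rw [norm_sub_rev] at h3
      have h4 : |(v.1 : ℝ)| * ‖node x ρ Λ (l + g) r
          - node x ρ Λ (l + g + j) fun i => Λ ^ j * r i + t i‖ ≤ 1 / (Λ : ℝ) ^ g := by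
        calc _ ≤ (Λ : ℝ) ^ l * (1 / (Λ : ℝ) ^ (l + g)) := by gcongr
          _ = _ := by rw [pow_add]; field_simp
      have h5 := norm_add_le ((P (node x ρ Λ (l + g) r)).horiz v
        - (P (node x ρ Λ (l + g + j) fun i => Λ ^ j * r i + t i)).horiz v)
        ((P (node x ρ Λ (l + g + j) fun i => Λ ^ j * r i + t i)).horiz v)
      rw [sub_add_cancel] at h5
      have h6 : 2 * K * (|(v.1 : ℝ)| * ‖node x ρ Λ (l + g) r
          - node x ρ Λ (l + g + j) fun i => Λ ^ j * r i + t i‖) ≤ 2 * K * (1 / (Λ : ℝ) ^ g) := by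
        gcongr
      calc _ ≤ 2 * K * (1 / (Λ : ℝ) ^ g) + 1 / (Λ : ℝ) ^ g := by linarith
        _ = _ := by ring
  refine (Finset.sum_le_sum hinner).trans ?_
  rw [← Finset.sum_filter, Finset.sum_const, nsmul_eq_mul]
  have hfS : ((cube m (Λ ^ (l + g))).filter fun r => r ∈ S).card ≤ (2 * D + 1) ^ m := by
    refine le_trans (Finset.card_le_card fun r hr => (Finset.mem_filter.1 hr).2) hScard
  have hfS' : (((cube m (Λ ^ (l + g))).filter fun r => r ∈ S).card : ℝ) ≤ (2 * D + 1) ^ m := by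
    exact_mod_cast hfS
  calc _ ≤ (2 * (D : ℝ) + 1) ^ m * (Λ * ((1 / 2) ^ j * ((Λ : ℝ) ^ j) ^ m)) := by gcongr
    _ = _ := by ring

lemma mem_nearVecs (G : GridFrames P U K θ B' B x ρ Λ) {R : ℝ} (hR : 12 * m * K ≤ R)
    {k g : ℕ} (hg : 1 ≤ g) {r : Fin m → ℕ} (hr : r ∈ cube m (Λ ^ k)) {v : IVec m} (hv : v ≠ 0)
    (hs : (P (node x ρ Λ k r)).size ((Λ : ℝ) ^ k) v ≤ 1 / (Λ : ℝ) ^ g) :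
    ∃ l, l + g ≤ k ∧ v ∈ nearVecs P x ρ Λ R l := by
  have hm : 1 ≤ m := by have := G.two_le_dim; omega
  have hΛ := G.scale_pos
  have hΛ2 : (2 : ℝ) ≤ Λ := by exact_mod_cast G.two_le
  have hT : (0 : ℝ) < (Λ : ℝ) ^ k := by positivity
  have hg1 : 1 / (Λ : ℝ) ^ g < 1 := by
    rw [div_lt_one (by positivity)]
    exact one_lt_pow₀ (by linarith) (by omega)
  have h0 : v.1 ≠ 0 := by
    intro h0
    have := (P (node x ρ Λ k r)).one_le_size_of_fst_eq_zero (G.one_le_scale_pow k) hv h0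
    linarith
  obtain ⟨l, hl1, hl2⟩ := exists_pow_near G.two_le h0
  have hl1' : |(v.1 : ℝ)| ≤ (Λ : ℝ) ^ l := by exact_mod_cast hl1
  have hl2' : (Λ : ℝ) ^ l < Λ * |(v.1 : ℝ)| := by exact_mod_cast hl2
  have hlg : l + g ≤ k := by
    have h1 := ((P (node x ρ Λ k r)).abs_div_le_size hT v).trans hs
    rw [div_le_div_iff₀ hT (by positivity), one_mul] at h1
    have h2 : (Λ : ℝ) ^ (l + g) < (Λ : ℝ) ^ (k + 1) := by
      calc (Λ : ℝ) ^ (l + g) = (Λ : ℝ) ^ l * (Λ : ℝ) ^ g := pow_add _ _ _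
        _ < Λ * |(v.1 : ℝ)| * (Λ : ℝ) ^ g := by gcongr
        _ = Λ * (|(v.1 : ℝ)| * (Λ : ℝ) ^ g) := by ring
        _ ≤ Λ * (Λ : ℝ) ^ k := by gcongr
        _ = _ := by ring
    have := (pow_lt_pow_iff_right₀ (by linarith : (1 : ℝ) < Λ)).1 h2
    omega
  refine ⟨l, hlg, ?_⟩
  obtain ⟨r', hr', hd⟩ := G.exists_near_node (by omega : l ≤ k) hr
  refine Finset.mem_filter.2 ⟨Finset.mem_biUnion.2 ⟨r', hr', ?_⟩, hl1, hl2⟩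
  rw [Frame.mem_sizeBall (by positivity)]
  have h3 := G.size_le_of_near hm (G.node_mem hr) (G.node_mem hr') (T := (Λ : ℝ) ^ k)
    (T' := (Λ : ℝ) ^ l) (by positivity) (pow_le_pow_right₀ (by linarith) (by omega)) hd
    (hs.trans hg1.le) (S := 1) (by simpa using hl1')
  linarith

lemma sum_card_sizeBall_le (G : GridFrames P U K θ B' B x ρ Λ) {D : ℕ}
    (hD : 4 * K * (1 + 2 * K) * Λ ≤ D * ρ) {R : ℝ} (hR : 12 * m * K ≤ R) {b : ℝ} (hb : 0 ≤ b)
    {k g : ℕ} (hg : 1 ≤ g)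
    (hN : ∀ l, l + g ≤ k → ((nearVecs P x ρ Λ R l).card : ℝ) ≤ b * ((Λ : ℝ) ^ l) ^ m) :
    ∑ r ∈ cube m (Λ ^ k),
      (((P (node x ρ Λ k r)).sizeBall ((Λ : ℝ) ^ k) (1 / (Λ : ℝ) ^ g)).card : ℝ)
      ≤ ((Λ : ℝ) ^ k) ^ m
        + 2 * ((2 * D + 1) ^ m * Λ) * b * ((Λ : ℝ) ^ k / (Λ : ℝ) ^ g) ^ m := by
  classical
  have hΛ := G.scale_pos
  have hT : (0 : ℝ) < (Λ : ℝ) ^ k := by positivity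
  set L := (Finset.range (k + 1)).filter fun l => l + g ≤ k with hL
  have h1 : ∀ r ∈ cube m (Λ ^ k),
      (((P (node x ρ Λ k r)).sizeBall ((Λ : ℝ) ^ k) (1 / (Λ : ℝ) ^ g)).card : ℝ)
      ≤ 1 + ∑ l ∈ L, ∑ v ∈ nearVecs P x ρ Λ R l,
        if (P (node x ρ Λ k r)).size ((Λ : ℝ) ^ k) v ≤ 1 / (Λ : ℝ) ^ g then (1 : ℝ) else 0 := by
    intro r hr
    have hsub : (P (node x ρ Λ k r)).sizeBall ((Λ : ℝ) ^ k) (1 / (Λ : ℝ) ^ g)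
        ⊆ insert 0 (L.biUnion fun l => (nearVecs P x ρ Λ R l).filter fun v =>
          (P (node x ρ Λ k r)).size ((Λ : ℝ) ^ k) v ≤ 1 / (Λ : ℝ) ^ g) := by
      intro v hv
      rw [Frame.mem_sizeBall hT] at hv
      rw [Finset.mem_insert]
      by_cases hv0 : v = 0
      · exact Or.inl hv0
      · obtain ⟨l, hl, hv'⟩ := G.mem_nearVecs hR hg hr hv0 hv
        refine Or.inr (Finset.mem_biUnion.2 ⟨l, ?_, Finset.mem_filter.2 ⟨hv', hv⟩⟩)
        rw [hL, Finset.mem_filter, Finset.mem_range]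
        omega
    have h2 := (Finset.card_le_card hsub).trans
      ((Finset.card_insert_le _ _).trans (Nat.add_le_add_right Finset.card_biUnion_le 1))
    calc _ ≤ ((∑ l ∈ L, ((nearVecs P x ρ Λ R l).filter fun v =>
          (P (node x ρ Λ k r)).size ((Λ : ℝ) ^ k) v ≤ 1 / (Λ : ℝ) ^ g).card + 1 : ℕ) : ℝ) := by
          exact_mod_cast h2
      _ = _ := by
          push_cast [Finset.card_filter]
          ring
  refine (Finset.sum_le_sum h1).trans ?_
  rw [Finset.sum_add_distrib, Finset.sum_const, card_cube, nsmul_eq_mul, mul_one]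
  push_cast
  have h3 : ∀ l ∈ L, ∑ r ∈ cube m (Λ ^ k), ∑ v ∈ nearVecs P x ρ Λ R l,
        (if (P (node x ρ Λ k r)).size ((Λ : ℝ) ^ k) v ≤ 1 / (Λ : ℝ) ^ g then (1 : ℝ) else 0)
      ≤ (2 * D + 1) ^ m * Λ * b * ((Λ : ℝ) ^ k / (Λ : ℝ) ^ g) ^ m * (1 / 2) ^ (k - g - l) := by
    intro l hl
    have hlk : l + g ≤ k := (Finset.mem_filter.1 hl).2
    rw [Finset.sum_comm]
    have hv : ∀ v ∈ nearVecs P x ρ Λ R l, (∑ r ∈ cube m (Λ ^ k),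
        if (P (node x ρ Λ k r)).size ((Λ : ℝ) ^ k) v ≤ 1 / (Λ : ℝ) ^ g then (1 : ℝ) else 0)
        ≤ (2 * D + 1) ^ m * Λ * ((1 / 2) ^ (k - g - l) * ((Λ : ℝ) ^ (k - g - l)) ^ m) := by
      intro v hv
      obtain ⟨-, hv1, hv2⟩ := Finset.mem_filter.1 hv
      have h := G.card_filter_size_le hD (l := l) (g := g) (j := k - g - l) (v := v)
        (by exact_mod_cast hv1) (by exact_mod_cast hv2)
      rw [show l + g + (k - g - l) = k by omega, Finset.card_filter] at h
      push_cast at h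
      exact h
    refine (Finset.sum_le_sum hv).trans ?_
    rw [Finset.sum_const, nsmul_eq_mul]
    calc _ ≤ b * ((Λ : ℝ) ^ l) ^ m
          * ((2 * D + 1) ^ m * Λ * ((1 / 2) ^ (k - g - l) * ((Λ : ℝ) ^ (k - g - l)) ^ m)) := by
          gcongr; exact hN l hlk
      _ = (2 * D + 1) ^ m * Λ * b * ((Λ : ℝ) ^ l * (Λ : ℝ) ^ (k - g - l)) ^ m
          * (1 / 2) ^ (k - g - l) := by rw [mul_pow]; ring
      _ = _ := by
          have e : (Λ : ℝ) ^ l * (Λ : ℝ) ^ (k - g - l) = (Λ : ℝ) ^ k / (Λ : ℝ) ^ g := by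
            rw [← pow_add, eq_div_iff (by positivity), ← pow_add]
            congr 1; omega
          rw [e]
  rw [Finset.sum_comm]
  have h4 := Finset.sum_le_sum h3
  have h5 : ∑ l ∈ L, (1 / 2 : ℝ) ^ (k - g - l) ≤ 2 := by
    have hsub : L ⊆ Finset.range (k - g + 1) := by
      intro l hl
      have := (Finset.mem_filter.1 hl).2
      rw [Finset.mem_range]; omega
    refine (Finset.sum_le_sum_of_subset_of_nonneg hsub fun _ _ _ => by positivity).trans ?_
    rw [show (∑ l ∈ Finset.range (k - g + 1), (1 / 2 : ℝ) ^ (k - g - l))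
      = ∑ l ∈ Finset.range (k - g + 1), (1 / 2 : ℝ) ^ l by
        simpa using Finset.sum_range_reflect (fun l => (1 / 2 : ℝ) ^ l) (k - g + 1)]
    exact sum_geometric_two_le _
  have h6 : ∑ l ∈ L, (2 * (D : ℝ) + 1) ^ m * Λ * b * ((Λ : ℝ) ^ k / (Λ : ℝ) ^ g) ^ m
      * (1 / 2) ^ (k - g - l)
      ≤ 2 * ((2 * D + 1) ^ m * Λ) * b * ((Λ : ℝ) ^ k / (Λ : ℝ) ^ g) ^ m := by
    rw [← Finset.mul_sum]
    calc _ ≤ (2 * (D : ℝ) + 1) ^ m * Λ * b * ((Λ : ℝ) ^ k / (Λ : ℝ) ^ g) ^ m * 2 := by gcongr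
      _ = _ := by ring
  linarith

end GridFrames

lemma Frame.sizeBall_mono {m : ℕ} (P : Frame m) {T R R' : ℝ} (hT : 0 < T) (h : R ≤ R') :
    P.sizeBall T R ⊆ P.sizeBall T R' := by
  intro v hv
  rw [Frame.mem_sizeBall hT] at *
  exact hv.trans h

namespace GridFrames

variable {m : ℕ} {P P' : (Fin m → ℝ) → Frame m} {U : Set (Fin m → ℝ)} {K θ : ℝ}
  {B₁ B₂ B₃ B₄ : (Fin m → ℝ) →ₗ[ℝ] (Fin m → ℝ)} {x : Fin m → ℝ} {ρ : ℝ} {Λ : ℕ}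

lemma sum_card_sizeBall_le_dual (G : GridFrames P U K θ B₁ B₂ x ρ Λ)
    (hd : ∀ y, (P y).dual = P' y) {κ κ' : ℝ} (hκ : 0 < κ') (hκκ : κ' ≤ κ) (k : ℕ) :
    ∑ r ∈ cube m (Λ ^ k), (((P (node x ρ Λ k r)).sizeBall ((Λ : ℝ) ^ k) κ).card : ℝ)
      ≤ 2 * (4 * m * κ) ^ (m + 2) * ∑ r ∈ cube m (Λ ^ k),
        (((P' (node x ρ Λ k r)).sizeBall ((Λ : ℝ) ^ k) (1 / κ')).card : ℝ) := by
  have hm : 1 ≤ m := by have := G.two_le_dim; omega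
  have hΛ := G.scale_pos
  have hκ0 : 0 < κ := hκ.trans_le hκκ
  rw [Finset.mul_sum]
  refine Finset.sum_le_sum fun r _ => ?_
  have h := Frame.card_sizeBall_le hm (P (node x ρ Λ k r)) (T := (Λ : ℝ) ^ k) (by positivity) hκ0
  rw [hd] at h
  refine h.trans ?_
  have h2 := Finset.card_le_card ((P' (node x ρ Λ k r)).sizeBall_mono (T := (Λ : ℝ) ^ k)
    (by positivity) (one_div_le_one_div_of_le hκ hκκ))
  gcongr

lemma card_nearVecs_le (G : GridFrames P U K θ B₁ B₂ x ρ Λ) (G' : GridFrames P' U K θ B₃ B₄ x ρ Λ)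
    (hd : ∀ y, (P y).dual = P' y) {D : ℕ}
    (hD : 4 * K * (1 + 2 * K) * Λ ≤ D * ρ) {R : ℝ} (hR : 12 * m * K ≤ R) {b : ℝ} (hb : 0 ≤ b)
    {j h : ℕ} (hh : 1 ≤ h)
    (hN : ∀ l, l + h ≤ j → ((nearVecs P' x ρ Λ R l).card : ℝ) ≤ b * ((Λ : ℝ) ^ l) ^ m) :
    ((nearVecs P x ρ Λ R (j + h)).card : ℝ)
      ≤ 2 * (4 * m * (6 * m * K * (R + 1) * (Λ : ℝ) ^ h)) ^ (m + 2) * (((Λ : ℝ) ^ j) ^ m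
        + 2 * ((2 * D + 1) ^ m * Λ) * b * ((Λ : ℝ) ^ j / (Λ : ℝ) ^ h) ^ m) := by
  have hm : 1 ≤ m := by have := G.two_le_dim; omega
  have hm' : (1 : ℝ) ≤ m := by exact_mod_cast hm
  have hΛ := G.scale_pos
  have hΛ2 : (2 : ℝ) ≤ Λ := by exact_mod_cast G.two_le
  have hK := G.one_le
  have hR0 : 0 ≤ R := le_trans (by positivity) hR
  have hC : 1 ≤ 6 * m * K * (R + 1) := by
    have : 1 ≤ m * K := one_le_mul_of_one_le_of_one_le hm' hK
    nlinarith
  have hsub : nearVecs P x ρ Λ R (j + h) ⊆ (cube m (Λ ^ j)).biUnion fun r =>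
      (P (node x ρ Λ j r)).sizeBall ((Λ : ℝ) ^ j) (6 * m * K * (R + 1) * (Λ : ℝ) ^ h) := by
    intro v hv
    obtain ⟨hv0, hv1, hv2⟩ := Finset.mem_filter.1 hv
    obtain ⟨r, hr, hvr⟩ := Finset.mem_biUnion.1 hv0
    rw [Frame.mem_sizeBall (by positivity)] at hvr
    obtain ⟨r', hr', hdist⟩ := G.exists_near_node (by omega : j ≤ j + h) hr
    refine Finset.mem_biUnion.2 ⟨r', hr', ?_⟩
    rw [Frame.mem_sizeBall (by positivity)]
    have h1 : |(v.1 : ℝ)| ≤ (Λ : ℝ) ^ h * (Λ : ℝ) ^ j := by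
      rw [← pow_add, add_comm]; exact_mod_cast hv1
    have h3 := G.size_le_of_near hm (G.node_mem hr) (G.node_mem hr') (T := (Λ : ℝ) ^ (j + h))
      (T' := (Λ : ℝ) ^ j) (by positivity) (pow_le_pow_right₀ (by linarith) (by omega)) hdist
      hvr h1
    refine h3.trans ?_
    rw [mul_assoc (6 * m * K)]
    have : R ≤ R * (Λ : ℝ) ^ h := le_mul_of_one_le_right hR0 (G.one_le_scale_pow h)
    gcongr
    linarith
  have h1 : ((nearVecs P x ρ Λ R (j + h)).card : ℝ) ≤ ∑ r ∈ cube m (Λ ^ j),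
      (((P (node x ρ Λ j r)).sizeBall ((Λ : ℝ) ^ j)
        (6 * m * K * (R + 1) * (Λ : ℝ) ^ h)).card : ℝ) := by
    exact_mod_cast (Finset.card_le_card hsub).trans Finset.card_biUnion_le
  refine h1.trans ((G.sum_card_sizeBall_le_dual hd (κ' := (Λ : ℝ) ^ h) (by positivity)
    (le_mul_of_one_le_left (by positivity) hC) j).trans ?_)
  gcongr
  exact G'.sum_card_sizeBall_le hD hR hb hh hN

lemma card_nearVecs_step (G : GridFrames P U K θ B₁ B₂ x ρ Λ)
    (G' : GridFrames P' U K θ B₃ B₄ x ρ Λ) (hd : ∀ y, (P y).dual = P' y) (hm3 : 3 ≤ m) {D : ℕ}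
    (hD : 4 * K * (1 + 2 * K) * Λ ≤ D * ρ) {R : ℝ} (hR : 12 * m * K ≤ R) {b : ℝ} (hb : 0 ≤ b)
    {j h : ℕ} (hh : 1 ≤ h)
    (hh' : 2 * (4 * m * (6 * m * K * (R + 1))) ^ (m + 2) * (2 * ((2 * D + 1) ^ m * Λ)) * 2
      ≤ (Λ : ℝ) ^ h)
    (hb' : 2 * (4 * m * (6 * m * K * (R + 1))) ^ (m + 2) * ((Λ : ℝ) ^ h) ^ 2 * 2 ≤ b)
    (hN : ∀ l, l + h ≤ j → ((nearVecs P' x ρ Λ R l).card : ℝ) ≤ b * ((Λ : ℝ) ^ l) ^ m) :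
    ((nearVecs P x ρ Λ R (j + h)).card : ℝ) ≤ b * ((Λ : ℝ) ^ (j + h)) ^ m := by
  have hΛ := G.scale_pos
  refine (G.card_nearVecs_le G' hd hD hR hb hh hN).trans ?_
  set c := 4 * m * (6 * m * K * (R + 1)) with hc
  set A := 2 * ((2 * (D : ℝ) + 1) ^ m * Λ) with hA
  set Y := (Λ : ℝ) ^ h with hY
  set X := (Λ : ℝ) ^ j with hX
  have hY1 : 1 ≤ Y := G.one_le_scale_pow h
  have hY0 : 0 < Y := by linarith
  have hX0 : 0 < X := by positivity
  have hc0 : 0 ≤ c := by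
    have := G.one_le
    have : 0 ≤ R := le_trans (by positivity) hR
    positivity
  rw [pow_add (Λ : ℝ) j h, show 4 * m * (6 * m * K * (R + 1) * Y) = c * Y by rw [hc]; ring,
    ← hX, ← hY]
  have e1 : 2 * (c ^ (m + 2) * Y ^ (m + 2)) * (X ^ m + A * b * (X / Y) ^ m)
      = (2 * c ^ (m + 2) * Y ^ 2) * (X * Y) ^ m
        + (2 * c ^ (m + 2) * A) * b * Y ^ 2 * X ^ m := by
    rw [div_pow, mul_pow X Y, pow_add Y]; field_simp
  rw [mul_pow c Y, e1]
  have h1 : (2 * c ^ (m + 2) * Y ^ 2) * (X * Y) ^ m ≤ b / 2 * (X * Y) ^ m := by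
    gcongr; linarith
  have h2 : (2 * c ^ (m + 2) * A) * b * Y ^ 2 * X ^ m ≤ b / 2 * (X * Y) ^ m := by
    have hY3 : Y ^ 3 ≤ Y ^ m := pow_le_pow_right₀ hY1 hm3
    calc (2 * c ^ (m + 2) * A) * b * Y ^ 2 * X ^ m ≤ (Y / 2) * b * Y ^ 2 * X ^ m := by
          gcongr; linarith
      _ = b / 2 * (X ^ m * Y ^ 3) := by ring
      _ ≤ b / 2 * (X ^ m * Y ^ m) := by gcongr
      _ = _ := by rw [mul_pow]
  linarith

/-- In dimension at least three, the number of vectors which are small at some node of level `l`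
is bounded by the number of nodes. -/
lemma exists_card_nearVecs_le (G : GridFrames P U K θ B₁ B₂ x ρ Λ)
    (G' : GridFrames P' U K θ B₃ B₄ x ρ Λ) (hd : ∀ y, (P y).dual = P' y) (hm3 : 3 ≤ m) {D : ℕ}
    (hD : 4 * K * (1 + 2 * K) * Λ ≤ D * ρ) {R : ℝ} (hR : 12 * m * K ≤ R) :
    ∃ b : ℝ, 0 ≤ b ∧ ∀ l, ((nearVecs P x ρ Λ R l).card : ℝ) ≤ b * ((Λ : ℝ) ^ l) ^ m ∧
      ((nearVecs P' x ρ Λ R l).card : ℝ) ≤ b * ((Λ : ℝ) ^ l) ^ m := by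
  have hΛ := G.scale_pos
  have hΛ2 : (2 : ℝ) ≤ Λ := by exact_mod_cast G.two_le
  have hd' : ∀ y, (P' y).dual = P y := fun y => by rw [← hd, Frame.dual_dual]
  have hR0 : 0 ≤ R := le_trans (by have := G.one_le; positivity) hR
  have hK0 : 0 ≤ K := zero_le_one.trans G.one_le
  obtain ⟨h₀, hh₀⟩ := pow_unbounded_of_one_lt
    (2 * (4 * m * (6 * m * K * (R + 1))) ^ (m + 2) * (2 * ((2 * (D : ℝ) + 1) ^ m * Λ)) * 2)
    (by linarith : (1 : ℝ) < Λ)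
  set h := h₀ + 1 with hh
  have hh' : 2 * (4 * m * (6 * m * K * (R + 1))) ^ (m + 2) * (2 * ((2 * (D : ℝ) + 1) ^ m * Λ)) * 2
      ≤ (Λ : ℝ) ^ h := hh₀.le.trans (pow_le_pow_right₀ (by linarith) (by omega))
  set b : ℝ := 2 * (4 * m * (6 * m * K * (R + 1))) ^ (m + 2) * ((Λ : ℝ) ^ h) ^ 2 * 2
    + ∑ i ∈ Finset.range h, (((nearVecs P x ρ Λ R i).card : ℝ) + (nearVecs P' x ρ Λ R i).card)
    with hb
  have hs0 : 0 ≤ ∑ i ∈ Finset.range h, (((nearVecs P x ρ Λ R i).card : ℝ)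
      + (nearVecs P' x ρ Λ R i).card) :=
    Finset.sum_nonneg fun i _ => add_nonneg (Nat.cast_nonneg _) (Nat.cast_nonneg _)
  have hc0 : 0 ≤ 2 * (4 * m * (6 * m * K * (R + 1))) ^ (m + 2) * ((Λ : ℝ) ^ h) ^ 2 * 2 := by
    positivity
  have hb0 : 0 ≤ b := add_nonneg hc0 hs0
  have hbb : 2 * (4 * m * (6 * m * K * (R + 1))) ^ (m + 2) * ((Λ : ℝ) ^ h) ^ 2 * 2 ≤ b := by
    exact le_add_of_nonneg_right hs0
  refine ⟨b, hb0, fun l => ?_⟩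
  induction l using Nat.strong_induction_on with
  | _ l ih =>
    rcases lt_or_ge l h with hl | hl
    · have h1 : ((nearVecs P x ρ Λ R l).card : ℝ) + (nearVecs P' x ρ Λ R l).card ≤ b := by
        have := Finset.single_le_sum (f := fun i => (((nearVecs P x ρ Λ R i).card : ℝ)
          + (nearVecs P' x ρ Λ R i).card))
          (fun _ _ => add_nonneg (Nat.cast_nonneg _) (Nat.cast_nonneg _))
          (Finset.mem_range.2 hl)
        exact this.trans (le_add_of_nonneg_left hc0)
      have h2 : b ≤ b * ((Λ : ℝ) ^ l) ^ m :=
        le_mul_of_one_le_right hb0 (one_le_pow₀ (G.one_le_scale_pow l))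
      have h3 : (0 : ℝ) ≤ (nearVecs P x ρ Λ R l).card := Nat.cast_nonneg _
      have h4 : (0 : ℝ) ≤ (nearVecs P' x ρ Λ R l).card := Nat.cast_nonneg _
      constructor <;> linarith
    · obtain ⟨j, rfl⟩ := Nat.exists_eq_add_of_le' hl
      exact ⟨G.card_nearVecs_step G' hd hm3 hD hR hb0 (by omega) hh' hbb
          fun i hi => (ih i (by omega)).2,
        G'.card_nearVecs_step G hd' hm3 hD hR hb0 (by omega) hh' hbb
          fun i hi => (ih i (by omega)).1⟩

theorem exists_sum_card_le_of_three_le (G : GridFrames P U K θ B₁ B₂ x ρ Λ)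
    (G' : GridFrames P' U K θ B₃ B₄ x ρ Λ) (hd : ∀ y, (P y).dual = P' y) (hm3 : 3 ≤ m) :
    ∃ C : ℝ, 0 ≤ C ∧ ∀ (k : ℕ) (κ : ℝ), 1 ≤ κ →
      ∑ r ∈ cube m (Λ ^ k), (((P (node x ρ Λ k r)).sizeBall ((Λ : ℝ) ^ k) κ).card : ℝ)
        ≤ C * (((Λ : ℝ) ^ k) ^ m * (κ ^ (m + 2) + (1 + k) * κ ^ 2)) := by
  have hΛ := G.scale_pos
  have hΛ2 : (2 : ℝ) ≤ Λ := by exact_mod_cast G.two_le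
  have hρ := G.rho_pos
  obtain ⟨D, hD'⟩ := exists_nat_ge (4 * K * (1 + 2 * K) * Λ / ρ)
  have hD : 4 * K * (1 + 2 * K) * Λ ≤ D * ρ := by rwa [div_le_iff₀ hρ] at hD'
  obtain ⟨b, hb, hN⟩ := G.exists_card_nearVecs_le G' hd hm3 hD le_rfl
  set A := 2 * ((2 * (D : ℝ) + 1) ^ m * Λ) with hA
  have hA0 : 0 ≤ A := by positivity
  refine ⟨2 * (4 * m * Λ) ^ (m + 2) * (1 + A * b), by positivity, fun k κ hκ => ?_⟩
  have hκ0 : 0 < κ := by linarith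
  obtain ⟨n, hn1, hn2⟩ := exists_nat_pow_near hκ (by linarith : (1 : ℝ) < Λ)
  have hg1 : (Λ : ℝ) ^ (n + 1) ≤ Λ * κ := by rw [pow_succ']; gcongr
  have hκΛ : κ ≤ Λ * κ := le_mul_of_one_le_left hκ0.le (by linarith)
  have h1 : ∑ r ∈ cube m (Λ ^ k), (((P (node x ρ Λ k r)).sizeBall ((Λ : ℝ) ^ k) κ).card : ℝ)
      ≤ ∑ r ∈ cube m (Λ ^ k), (((P (node x ρ Λ k r)).sizeBall ((Λ : ℝ) ^ k) (Λ * κ)).card : ℝ) := by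
    refine Finset.sum_le_sum fun r _ => ?_
    exact_mod_cast Finset.card_le_card
      (Frame.sizeBall_mono _ (T := (Λ : ℝ) ^ k) (by positivity) hκΛ)
  have h2 := G.sum_card_sizeBall_le_dual hd (κ' := (Λ : ℝ) ^ (n + 1)) (by positivity) hg1 k
  have h3 := G'.sum_card_sizeBall_le hD le_rfl hb (k := k) (g := n + 1) (by omega)
    fun l _ => (hN l).2
  have h4 : ((Λ : ℝ) ^ k / (Λ : ℝ) ^ (n + 1)) ^ m ≤ ((Λ : ℝ) ^ k / κ) ^ m := by
    gcongr
  refine h1.trans (h2.trans ?_)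
  calc _ ≤ 2 * (4 * m * (Λ * κ)) ^ (m + 2)
        * (((Λ : ℝ) ^ k) ^ m + A * b * ((Λ : ℝ) ^ k / κ) ^ m) := by
        refine mul_le_mul_of_nonneg_left (h3.trans ?_) (by positivity)
        gcongr
    _ = 2 * (4 * m * Λ) ^ (m + 2) * (((Λ : ℝ) ^ k) ^ m * (κ ^ (m + 2) + A * b * κ ^ 2)) := by
        rw [show 4 * m * (Λ * κ) = 4 * m * Λ * κ by ring, mul_pow _ κ, div_pow, pow_add κ]
        field_simp
    _ ≤ 2 * (4 * m * Λ) ^ (m + 2) * (((Λ : ℝ) ^ k) ^ m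
          * ((1 + A * b) * (κ ^ (m + 2) + (1 + k) * κ ^ 2))) := by
        have e1 : κ ^ 2 ≤ (1 + k) * κ ^ 2 :=
          le_mul_of_one_le_left (by positivity) (by linarith [Nat.cast_nonneg (α := ℝ) k])
        have e2 : A * b * κ ^ 2 ≤ A * b * ((1 + k) * κ ^ 2) := by gcongr
        have e3 : 0 ≤ A * b * κ ^ (m + 2) := by positivity
        have e4 : κ ^ (m + 2) + A * b * κ ^ 2
            ≤ (1 + A * b) * (κ ^ (m + 2) + (1 + k) * κ ^ 2) := by
          have : (0 : ℝ) ≤ (1 + k) * κ ^ 2 := by positivity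
          nlinarith
        gcongr
    _ = _ := by ring

end GridFrames

/-! ### Integer bivectors in dimension four -/

/-- Rotation of the plane by a right angle. -/
def rot {R : Type*} [Neg R] (a : Fin 2 → R) : Fin 2 → R := ![-a 1, a 0]

@[simp] lemma rot_zero {R : Type*} [Neg R] (a : Fin 2 → R) : rot a 0 = -a 1 := rfl

@[simp] lemma rot_one {R : Type*} [Neg R] (a : Fin 2 → R) : rot a 1 = a 0 := rfl

lemma norm_fin_two (a : Fin 2 → ℝ) : ‖a‖ = max |a 0| |a 1| := by
  apply le_antisymm
  · rw [pi_norm_le_iff_of_nonneg (le_max_of_le_left (abs_nonneg _))]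
    intro i; fin_cases i <;> simp
  · exact max_le (norm_le_pi_norm a 0) (norm_le_pi_norm a 1)

lemma norm_rot (a : Fin 2 → ℝ) : ‖rot a‖ = ‖a‖ := by
  simp [norm_fin_two, max_comm]

/-- Integer bivectors in coordinates `(d, c, r, p)`. -/
abbrev Biv := (Fin 2 → ℤ) × ℤ × ℤ × (Fin 2 → ℤ)

namespace Biv

/-- Decomposability of a bivector. -/
def Dec (l : Biv) : Prop := l.1 0 * l.2.2.2 1 - l.1 1 * l.2.2.2 0 = l.2.2.1 * l.2.1

/-- The first block of coordinates as a real vector. -/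
def d (l : Biv) : Fin 2 → ℝ := fun i => l.1 i

/-- The wedge product of two integer vectors. -/
def wedge (v w : IVec 2) : Biv :=
  (fun i => v.1 * w.2.1 i - w.1 * v.2.1 i, v.2.1 0 * w.2.1 1 - v.2.1 1 * w.2.1 0,
    v.1 * w.2.2 - w.1 * v.2.2, fun i => v.2.2 * w.2.1 i - w.2.2 * v.2.1 i)

/-- The Hodge star, identifying bivectors with dual bivectors. -/
def star (l : Biv) : Biv := (rot l.1, -l.2.2.1, l.2.1, -rot l.2.2.2)

lemma dec_wedge (v w : IVec 2) : (wedge v w).Dec := by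
  simp only [Dec, wedge]; ring

lemma Dec.star {l : Biv} (h : l.Dec) : l.star.Dec := by
  simp only [Dec, Biv.star, Pi.neg_apply, rot_zero, rot_one] at *; linarith

lemma wedge_sub (v w w' : IVec 2) : wedge v (w - w') = wedge v w - wedge v w' := by
  simp only [wedge]
  ext i <;> simp <;> ring

/-- Two bivectors are parallel. -/
def Par (l l' : Biv) : Prop := ∃ a b : ℤ, a ≠ 0 ∧ b ≠ 0 ∧ a • l = b • l'

end Biv

namespace Frame

variable (P P' : Frame 2)

/-- The `c`-coordinate of a bivector in a frame. -/
def bivC (l : Biv) : ℝ := l.2.1 + rot P.xi ⬝ᵥ l.d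

/-- The `r`-coordinate of a bivector in a frame. -/
def bivR (l : Biv) : ℝ := l.2.2.1 + P.eta ⬝ᵥ l.d

/-- The `p`-coordinates of a bivector in a frame. -/
def bivP (l : Biv) : Fin 2 → ℝ := fun i => l.2.2.2 i - l.2.2.1 * P.xi i + l.2.1 * rot P.eta i
  + P.zeta * l.d i - (P.eta ⬝ᵥ l.d) * P.xi i

/-- The norm of a bivector in a frame, rescaled by the exterior square of `diag(1/T, 1, T)`. -/
noncomputable def bsize (T : ℝ) (l : Biv) : ℝ :=
  ‖l.d‖ / T + |P.bivC l| + |P.bivR l| + T * ‖P.bivP l‖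

variable {P P'} {T : ℝ}

lemma bsize_nonneg (hT : 0 < T) (l : Biv) : 0 ≤ P.bsize T l := by
  unfold bsize; positivity

lemma bivC_sub (l : Biv) : P'.bivC l = P.bivC l + rot (P'.xi - P.xi) ⬝ᵥ l.d := by
  simp [bivC, dotProduct, Fin.sum_univ_two]; ring

lemma bivR_sub (l : Biv) : P'.bivR l = P.bivR l + (P'.eta - P.eta) ⬝ᵥ l.d := by
  simp [bivR, sub_dotProduct]

lemma bivP_sub (l : Biv) : P'.bivP l = P.bivP l - P.bivR l • (P'.xi - P.xi)
    + P.bivC l • rot (P'.eta - P.eta) - ((P'.eta - P.eta) ⬝ᵥ l.d) • (P'.xi - P.xi)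
    + (P'.zeta - P.zeta - P.xi ⬝ᵥ (P'.eta - P.eta)) • l.d := by
  ext i
  fin_cases i <;>
    simp [bivP, bivC, bivR, dotProduct, Fin.sum_univ_two] <;> ring

lemma bivR_mul_bivC {l : Biv} (hl : l.Dec) : P.bivR l * P.bivC l = rot l.d ⬝ᵥ P.bivP l := by
  have h : (l.1 0 : ℝ) * l.2.2.2 1 - l.1 1 * l.2.2.2 0 = l.2.2.1 * l.2.1 := by exact_mod_cast hl
  simp [bivP, bivC, bivR, dotProduct, Fin.sum_univ_two, Biv.d]
  linear_combination -h

lemma abs_bivR_mul_bivC_le {l : Biv} (hl : l.Dec) :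
    |P.bivR l| * |P.bivC l| ≤ 2 * (‖l.d‖ * ‖P.bivP l‖) := by
  rw [← abs_mul, bivR_mul_bivC hl]
  have := abs_dotProduct_le (rot l.d) (P.bivP l)
  rw [norm_rot] at this
  exact_mod_cast this

lemma bsize_smul (a : ℤ) (l : Biv) : P.bsize T (a • l) = |(a : ℝ)| * P.bsize T l := by
  have h0 : Biv.d (a • l) = (a : ℝ) • l.d := by ext i; simp [Biv.d]
  have h1 : P.bivC (a • l) = a * P.bivC l := by simp [bivC, Biv.d, dotProduct]; ring
  have h2 : P.bivR (a • l) = a * P.bivR l := by simp [bivR, Biv.d, dotProduct]; ring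
  have h3 : P.bivP (a • l) = (a : ℝ) • P.bivP l := by
    ext i; simp [bivP, Biv.d, dotProduct]; ring
  simp only [bsize, h0, h1, h2, h3, norm_smul, abs_mul, Real.norm_eq_abs]
  ring

lemma bsize_star (l : Biv) : P.bsize T l.star = P.dual.bsize T l := by
  have h0 : l.star.d = rot l.d := by ext i; fin_cases i <;> simp [Biv.d, Biv.star]
  have h1 : P.bivC l.star = - P.dual.bivR l := by
    simp [bivC, bivR, Biv.d, dual, dotProduct, Fin.sum_univ_two, Biv.star]; ring
  have h2 : P.bivR l.star = P.dual.bivC l := by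
    simp [bivC, bivR, Biv.d, dual, dotProduct, Fin.sum_univ_two, Biv.star]; ring
  have h3 : P.bivP l.star = - rot (P.dual.bivP l) := by
    ext i
    fin_cases i <;>
      simp [bivP, Biv.d, dual, dotProduct, Fin.sum_univ_two, Biv.star] <;> ring
  simp only [bsize, h0, h1, h2, h3, norm_rot, abs_neg, norm_neg]
  ring

lemma bsize_wedge_le (hT : 0 < T) (v w : IVec 2) :
    P.bsize T (Biv.wedge v w) ≤ 4 * (P.size T v * P.size T w) := by
  set S := |(v.1 : ℝ)| / T with hS
  set S' := |(w.1 : ℝ)| / T with hS'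
  set A := P.horiz v with hA
  set A' := P.horiz w with hA'
  set p := P.vert v with hp
  set p' := P.vert w with hp'
  have hS0 : 0 ≤ S := by positivity
  have hS0' : 0 ≤ S' := by positivity
  have h1 : ‖(Biv.wedge v w).d‖ / T ≤ S * ‖A'‖ + S' * ‖A‖ := by
    have : (Biv.wedge v w).d = (v.1 : ℝ) • A' - (w.1 : ℝ) • A := by
      ext i; simp [Biv.d, Biv.wedge, hA, hA', horiz]; ring
    rw [this, div_le_iff₀ hT]
    refine (norm_sub_le _ _).trans ?_
    rw [norm_smul, norm_smul, Real.norm_eq_abs, Real.norm_eq_abs, hS, hS']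
    apply le_of_eq; field_simp
  have h2 : |P.bivC (Biv.wedge v w)| ≤ 2 * (‖A‖ * ‖A'‖) := by
    have : P.bivC (Biv.wedge v w) = rot A ⬝ᵥ A' := by
      simp [bivC, Biv.d, Biv.wedge, hA, hA', horiz, dotProduct, Fin.sum_univ_two]; ring
    rw [this]
    have := abs_dotProduct_le (rot A) A'
    rw [norm_rot] at this
    exact_mod_cast this
  have h3 : |P.bivR (Biv.wedge v w)| ≤ S * (T * |p'|) + S' * (T * |p|) := by
    have : P.bivR (Biv.wedge v w) = v.1 * p' - w.1 * p := by
      simp [bivR, Biv.d, Biv.wedge, hp, hp', vert, dotProduct, Fin.sum_univ_two]; ring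
    rw [this]
    refine (abs_sub _ _).trans ?_
    rw [abs_mul, abs_mul, hS, hS']
    apply le_of_eq; field_simp
  have h4 : T * ‖P.bivP (Biv.wedge v w)‖ ≤ (T * |p|) * ‖A'‖ + (T * |p'|) * ‖A‖ := by
    have : P.bivP (Biv.wedge v w) = p • A' - p' • A := by
      ext i
      fin_cases i <;> simp [bivP, Biv.d, Biv.wedge, hp, hp', hA, hA', vert, horiz, dotProduct,
        Fin.sum_univ_two] <;> ring
    rw [this]
    have := norm_sub_le (p • A') (p' • A)
    rw [norm_smul, norm_smul, Real.norm_eq_abs, Real.norm_eq_abs] at this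
    nlinarith
  have e1 : P.size T v = S + ‖A‖ + T * |p| := rfl
  have e2 : P.size T w = S' + ‖A'‖ + T * |p'| := rfl
  have e3 : P.bsize T (Biv.wedge v w) = _ := rfl
  rw [e1, e2, bsize]
  have hp0 : 0 ≤ T * |p| := by positivity
  have hp0' : 0 ≤ T * |p'| := by positivity
  have := norm_nonneg A
  have := norm_nonneg A'
  nlinarith [mul_nonneg hS0 hS0', mul_nonneg hp0 hp0', mul_nonneg hS0 (norm_nonneg A'),
    mul_nonneg hS0' (norm_nonneg A), mul_nonneg hp0 (norm_nonneg A'),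
    mul_nonneg hp0' (norm_nonneg A), mul_nonneg (norm_nonneg A) (norm_nonneg A'),
    mul_nonneg hS0 hp0', mul_nonneg hS0' hp0]

lemma norm_d_le_bsize (hT : 0 < T) (l : Biv) : ‖l.d‖ / T ≤ P.bsize T l := by
  unfold bsize
  have : 0 ≤ T * ‖P.bivP l‖ := by positivity
  linarith [abs_nonneg (P.bivC l), abs_nonneg (P.bivR l)]

lemma bivC_le_bsize (hT : 0 < T) (l : Biv) : |P.bivC l| ≤ P.bsize T l := by
  unfold bsize
  have : 0 ≤ T * ‖P.bivP l‖ := by positivity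
  have : 0 ≤ ‖l.d‖ / T := by positivity
  linarith [abs_nonneg (P.bivR l)]

lemma bivR_le_bsize (hT : 0 < T) (l : Biv) : |P.bivR l| ≤ P.bsize T l := by
  unfold bsize
  have : 0 ≤ T * ‖P.bivP l‖ := by positivity
  have : 0 ≤ ‖l.d‖ / T := by positivity
  linarith [abs_nonneg (P.bivC l)]

lemma bivP_le_bsize (hT : 0 < T) (l : Biv) : T * ‖P.bivP l‖ ≤ P.bsize T l := by
  unfold bsize
  have : 0 ≤ ‖l.d‖ / T := by positivity
  linarith [abs_nonneg (P.bivC l), abs_nonneg (P.bivR l)]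

/-- The integer coordinates of a bivector are bounded in terms of its norm. -/
lemma exists_abs_le_bsize (P : Frame 2) (hT : 0 < T) : ∃ H : ℝ, 0 < H ∧ ∀ l : Biv,
    ‖l.d‖ ≤ H * P.bsize T l ∧ |(l.2.1 : ℝ)| ≤ H * P.bsize T l ∧
      |(l.2.2.1 : ℝ)| ≤ H * P.bsize T l ∧ ∀ i, |(l.2.2.2 i : ℝ)| ≤ H * P.bsize T l := by
  set O : Frame 2 := ⟨0, 0, 0⟩
  set E := |O.zeta - P.zeta - P.xi ⬝ᵥ (O.eta - P.eta)|
  refine ⟨T + (1 + 2 * ‖P.xi‖ * T) + (1 + 2 * ‖P.eta‖ * T) + (1 / T + ‖P.xi‖ + ‖P.eta‖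
    + 2 * ‖P.eta‖ * T * ‖P.xi‖ + E * T), by positivity, fun l => ?_⟩
  have hV := P.bsize_nonneg hT l
  set V := P.bsize T l with hVd
  have h1 : ‖l.d‖ ≤ V * T := (div_le_iff₀ hT).1 (P.norm_d_le_bsize hT l)
  have h2 : |P.bivC l| ≤ V := bivC_le_bsize hT l
  have h3 : |P.bivR l| ≤ V := bivR_le_bsize hT l
  have h4 : ‖P.bivP l‖ ≤ V / T := by
    rw [le_div_iff₀ hT, mul_comm]; exact bivP_le_bsize hT l
  have hx := norm_nonneg P.xi
  have he := norm_nonneg P.eta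
  have hd := norm_nonneg l.d
  have hE : 0 ≤ E := abs_nonneg _
  have k1 : |rot (O.xi - P.xi) ⬝ᵥ l.d| ≤ 2 * ‖P.xi‖ * T * V := by
    refine (abs_dotProduct_le _ _).trans ?_
    rw [norm_rot]
    simp only [O, zero_sub, norm_neg]
    push_cast
    nlinarith
  have k2 : |(O.eta - P.eta) ⬝ᵥ l.d| ≤ 2 * ‖P.eta‖ * T * V := by
    refine (abs_dotProduct_le _ _).trans ?_
    simp only [O, zero_sub, norm_neg]
    push_cast
    nlinarith
  have c1 : |(l.2.1 : ℝ)| ≤ (1 + 2 * ‖P.xi‖ * T) * V := by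
    have e : (l.2.1 : ℝ) = O.bivC l := by simp [bivC, O, dotProduct]
    rw [e, bivC_sub (P := P)]
    refine (abs_add_le _ _).trans ?_
    linarith
  have c2 : |(l.2.2.1 : ℝ)| ≤ (1 + 2 * ‖P.eta‖ * T) * V := by
    have e : (l.2.2.1 : ℝ) = O.bivR l := by simp [bivR, O, dotProduct]
    rw [e, bivR_sub (P := P)]
    refine (abs_add_le _ _).trans ?_
    linarith
  have c3 : ∀ i, |(l.2.2.2 i : ℝ)| ≤ (1 / T + ‖P.xi‖ + ‖P.eta‖
      + 2 * ‖P.eta‖ * T * ‖P.xi‖ + E * T) * V := by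
    intro i
    have e : (l.2.2.2 i : ℝ) = O.bivP l i := by
      simp only [bivP, O, dotProduct]
      fin_cases i <;> simp
    rw [e]
    refine (norm_le_pi_norm (O.bivP l) i).trans ?_
    rw [bivP_sub (P := P)]
    refine (norm_add_le _ _).trans ?_
    have n1 := norm_sub_le (P.bivP l - P.bivR l • (O.xi - P.xi) + P.bivC l • rot (O.eta - P.eta))
      (((O.eta - P.eta) ⬝ᵥ l.d) • (O.xi - P.xi))
    have n2 := norm_add_le (P.bivP l - P.bivR l • (O.xi - P.xi)) (P.bivC l • rot (O.eta - P.eta))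
    have n3 := norm_sub_le (P.bivP l) (P.bivR l • (O.xi - P.xi))
    rw [norm_smul, Real.norm_eq_abs] at n1 n2 n3 ⊢
    rw [norm_rot] at n2
    have x1 : ‖O.xi - P.xi‖ = ‖P.xi‖ := by simp [O]
    have x2 : ‖O.eta - P.eta‖ = ‖P.eta‖ := by simp [O]
    rw [x1] at n1 n3
    rw [x2] at n2
    have m1 : |P.bivR l| * ‖P.xi‖ ≤ V * ‖P.xi‖ := by gcongr
    have m2 : |P.bivC l| * ‖P.eta‖ ≤ V * ‖P.eta‖ := by gcongr
    have m3 : |(O.eta - P.eta) ⬝ᵥ l.d| * ‖P.xi‖ ≤ 2 * ‖P.eta‖ * T * V * ‖P.xi‖ := by gcongr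
    have m4 : E * ‖l.d‖ ≤ E * (V * T) := by gcongr
    have m5 : V / T = 1 / T * V := by ring
    linarith
  have p1 : 0 ≤ ‖P.xi‖ * T := by positivity
  have p2 : 0 ≤ ‖P.eta‖ * T := by positivity
  have p3 : 0 ≤ ‖P.eta‖ * T * ‖P.xi‖ := by positivity
  have p4 : 0 ≤ E * T := by positivity
  have p5 : 0 ≤ 1 / T := by positivity
  refine ⟨?_, ?_, ?_, fun i => ?_⟩
  · refine h1.trans ?_
    rw [mul_comm]
    exact mul_le_mul_of_nonneg_right (by linarith) hV
  · refine c1.trans (mul_le_mul_of_nonneg_right (by linarith) hV)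
  · refine c2.trans (mul_le_mul_of_nonneg_right (by linarith) hV)
  · refine (c3 i).trans (mul_le_mul_of_nonneg_right (by linarith) hV)

lemma bsize_pos (hT : 0 < T) {l : Biv} (hl : l ≠ 0) : 0 < P.bsize T l := by
  refine (P.bsize_nonneg hT l).lt_of_ne fun h => hl ?_
  obtain ⟨H, -, hH⟩ := P.exists_abs_le_bsize hT
  obtain ⟨h1, h2, h3, h4⟩ := hH l
  rw [← h, mul_zero] at h1 h2 h3 h4
  have h1' : l.d = 0 := norm_le_zero_iff.1 h1
  ext i
  · have := congrFun h1' i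
    simpa [Biv.d] using this
  · simpa using h2
  · simpa using h3
  · simpa using h4 i

lemma finite_bsize_le (P : Frame 2) (hT : 0 < T) (R : ℝ) : {l : Biv | P.bsize T l ≤ R}.Finite := by
  obtain ⟨H, hH0, hH⟩ := P.exists_abs_le_bsize hT
  set A := ⌈H * R⌉ with hA
  have hc : ∀ a : ℤ, |(a : ℝ)| ≤ H * R → -A ≤ a ∧ a ≤ A := by
    intro a h
    have h' : |a| ≤ A := by
      have := h.trans (Int.le_ceil (H * R))
      exact_mod_cast this
    exact abs_le.1 h'
  refine (((Set.finite_Icc (fun _ : Fin 2 => -A) fun _ => A)).prod ((Set.finite_Icc (-A) A).prod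
    ((Set.finite_Icc (-A) A).prod (Set.finite_Icc (fun _ : Fin 2 => -A) fun _ => A)))).subset ?_
  intro l hl
  obtain ⟨h1, h2, h3, h4⟩ := hH l
  have hR : H * P.bsize T l ≤ H * R := mul_le_mul_of_nonneg_left hl hH0.le
  have h1' : ∀ i, -A ≤ l.1 i ∧ l.1 i ≤ A := fun i =>
    hc _ (((norm_le_pi_norm (Biv.d l) i).trans h1).trans hR)
  have h4' : ∀ i, -A ≤ l.2.2.2 i ∧ l.2.2.2 i ≤ A := fun i => hc _ ((h4 i).trans hR)
  exact ⟨⟨fun i => (h1' i).1, fun i => (h1' i).2⟩, hc _ (h2.trans hR), hc _ (h3.trans hR),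
    ⟨fun i => (h4' i).1, fun i => (h4' i).2⟩⟩

lemma exists_min_size {m : ℕ} (P : Frame m) (hT : 0 < T) :
    ∃ v : IVec m, v ≠ 0 ∧ ∀ w ≠ 0, P.size T v ≤ P.size T w := by
  obtain ⟨v, ⟨hv, hv'⟩, hmin⟩ := Set.exists_min_image
    ({v | P.size T v ≤ P.size T (1, 0, 0)} ∩ {v | v ≠ 0}) (P.size T)
    ((P.finite_size_le hT _).inter_of_left _) ⟨(1, 0, 0), Set.mem_ofPred.2 le_rfl, by simp⟩
  refine ⟨v, hv', fun w hw => ?_⟩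
  by_cases h : P.size T w ≤ P.size T (1, 0, 0)
  · exact hmin w ⟨h, hw⟩
  · exact (show P.size T v ≤ _ from hv).trans (not_le.1 h).le

lemma exists_min_bsize (P : Frame 2) (hT : 0 < T) :
    ∃ l : Biv, (l.Dec ∧ l ≠ 0) ∧ ∀ l' : Biv, l'.Dec → l' ≠ 0 → P.bsize T l ≤ P.bsize T l' := by
  set l₁ : Biv := (0, 1, 0, 0)
  obtain ⟨v, ⟨hv, hv'⟩, hmin⟩ := Set.exists_min_image
    ({l | P.bsize T l ≤ P.bsize T l₁} ∩ {l : Biv | l.Dec ∧ l ≠ 0}) (P.bsize T)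
    ((P.finite_bsize_le hT _).inter_of_left _)
      ⟨l₁, Set.mem_ofPred.2 le_rfl, by simp [Biv.Dec, l₁], by simp [l₁]⟩
  refine ⟨v, hv', fun w hw hw0 => ?_⟩
  by_cases h : P.bsize T w ≤ P.bsize T l₁
  · exact hmin w ⟨h, hw, hw0⟩
  · exact (show P.bsize T v ≤ _ from hv).trans (not_le.1 h).le

end Frame

/-! ### Incidence of decomposable bivectors -/

section Rank

variable {ι R : Type*} [Fintype ι] [CommRing R] [IsDomain R] [CharZero R]

/-- The product of the matrices of two decomposable orthogonal bivectors has rank at most one. -/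
lemma mul_minor_eq_zero {A U : Matrix ι ι R}
    (hA : ∀ i k p q, A i p * A k q - A i q * A k p = A i k * A p q)
    (hU : ∀ i k p q, U i p * U k q - U i q * U k p = U i k * U p q)
    (ha : ∀ p q, U q p = -U p q) (hAU : ∑ p, ∑ q, A p q * U p q = 0) (i j k l : ι) :
    (A * U) i j * (A * U) k l = (A * U) i l * (A * U) k j := by
  have h1 : (A * U) i j * (A * U) k l - (A * U) i l * (A * U) k j
      = U j l * ∑ p, ∑ q, A i p * A k q * U p q := by
    simp only [Matrix.mul_apply, Finset.sum_mul_sum]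
    simp only [Finset.mul_sum, ← Finset.sum_sub_distrib]
    refine Finset.sum_congr rfl fun p _ => Finset.sum_congr rfl fun q _ => ?_
    linear_combination A i p * A k q * hU p q j l
  have h2 : ∑ p, ∑ q, A i p * A k q * U p q = ∑ p, ∑ q, A i q * A k p * U q p := by
    rw [Finset.sum_comm]
  have h3 : (2 : R) * ∑ p, ∑ q, A i p * A k q * U p q = 0 := by
    rw [two_mul]
    nth_rewrite 2 [h2]
    simp only [← Finset.sum_add_distrib]
    have : ∀ p q, A i p * A k q * U p q + A i q * A k p * U q p = A i k * (A p q * U p q) := by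
      intro p q
      rw [ha p q]
      linear_combination U p q * hA i k p q
    simp only [this, ← Finset.mul_sum, hAU, mul_zero]
  have h4 := (mul_eq_zero.1 h3).resolve_left two_ne_zero
  rw [h4, mul_zero] at h1
  exact sub_eq_zero.1 h1

end Rank

/-- A nonzero integer matrix of rank at most one is an outer product of integer vectors. -/
lemma exists_outer_product {ι κ : Type*} [Fintype ι] (M : Matrix ι κ ℤ)
    (hM : ∀ i j k l, M i j * M k l = M i l * M k j) (h0 : M ≠ 0) :
    ∃ (v : ι → ℤ) (u : κ → ℤ), v ≠ 0 ∧ u ≠ 0 ∧ ∀ i j, M i j = v i * u j := by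
  have : ∃ i j, M i j ≠ 0 := by
    by_contra! h
    exact h0 (Matrix.ext h)
  obtain ⟨i₀, j₀, hij⟩ := this
  obtain ⟨v, hv, hg⟩ := Finset.univ.extract_gcd (fun i => M i j₀) ⟨i₀, Finset.mem_univ _⟩
  set g := Finset.univ.gcd fun i => M i j₀
  have hg0 : g ≠ 0 := by
    rintro h
    have := hv i₀ (Finset.mem_univ _)
    rw [h, zero_mul] at this
    exact hij this
  obtain ⟨b, hb⟩ := Finset.gcd_eq_sum_mul Finset.univ v
  rw [hg] at hb
  have hvM : ∀ i k l, v i * M k l = v k * M i l := by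
    intro i k l
    have h := hM i j₀ k l
    rw [hv i (Finset.mem_univ _), hv k (Finset.mem_univ _)] at h
    exact mul_left_cancel₀ hg0 (by linear_combination h)
  have hMeq : ∀ i j, M i j = v i * ∑ k, b k * M k j := by
    intro i j
    rw [Finset.mul_sum]
    calc M i j = (∑ k, v k * b k) * M i j := by rw [← hb, one_mul]
      _ = ∑ k, v i * (b k * M k j) := by
        rw [Finset.sum_mul]
        refine Finset.sum_congr rfl fun k _ => ?_
        linear_combination b k * hvM k i j
  refine ⟨v, fun j => ∑ k, b k * M k j, ?_, ?_, hMeq⟩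
  · rintro rfl
    exact hij (by rw [hMeq]; simp)
  · intro h
    exact hij (by rw [hMeq]; simp [congrFun h j₀])

lemma exists_mul_eq_mul_of_minors {ι : Type*} {x y : ι → ℤ} (h : ∀ i j, x i * y j = x j * y i)
    (hx : x ≠ 0) (hy : y ≠ 0) : ∃ a b : ℤ, a ≠ 0 ∧ b ≠ 0 ∧ ∀ j, a * x j = b * y j := by
  obtain ⟨i, hi⟩ := Function.ne_iff.1 hx
  refine ⟨y i, x i, fun h0 => hy ?_, hi, fun j => ?_⟩
  · ext j
    have := h i j
    rw [h0, mul_zero] at this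
    exact (mul_eq_zero.1 this).resolve_left hi
  · linear_combination -(h i j)

section Matrices

variable {R : Type*} [CommRing R]

/-- The antisymmetric matrix of a bivector. -/
def amat (d : Fin 2 → R) (c r : R) (p : Fin 2 → R) : Matrix (Fin 4) (Fin 4) R :=
  !![0, d 0, d 1, r; -d 0, 0, c, -p 0; -d 1, -c, 0, -p 1; -r, p 0, p 1, 0]

/-- The antisymmetric matrix of the dual of a bivector. -/
def umat (d : Fin 2 → R) (c r : R) (p : Fin 2 → R) : Matrix (Fin 4) (Fin 4) R :=
  !![0, -p 1, p 0, c; p 1, 0, r, -d 1; -p 0, -r, 0, d 0; -c, d 1, -d 0, 0]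

lemma amat_plucker {d : Fin 2 → R} {c r : R} {p : Fin 2 → R} (h : d 0 * p 1 - d 1 * p 0 = r * c)
    (i k a b : Fin 4) : amat d c r p i a * amat d c r p k b - amat d c r p i b * amat d c r p k a
      = amat d c r p i k * amat d c r p a b := by
  fin_cases i <;> fin_cases k <;> fin_cases a <;> fin_cases b <;>
    simp [amat] <;> first | done | ring1 | linear_combination h | linear_combination -h

lemma umat_plucker {d : Fin 2 → R} {c r : R} {p : Fin 2 → R} (h : d 0 * p 1 - d 1 * p 0 = r * c)
    (i k a b : Fin 4) : umat d c r p i a * umat d c r p k b - umat d c r p i b * umat d c r p k a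
      = umat d c r p i k * umat d c r p a b := by
  fin_cases i <;> fin_cases k <;> fin_cases a <;> fin_cases b <;>
    simp [umat] <;> first | done | ring1 | linear_combination h | linear_combination -h

lemma umat_swap (d : Fin 2 → R) (c r : R) (p : Fin 2 → R) (i j : Fin 4) :
    umat d c r p j i = -umat d c r p i j := by
  fin_cases i <;> fin_cases j <;> simp [umat]

lemma trace_amat_mul_umat (d d' : Fin 2 → R) (c c' r r' : R) (p p' : Fin 2 → R) :
    (amat d c r p * umat d' c' r' p').trace
      = -∑ i, ∑ j, amat d c r p i j * umat d' c' r' p' i j := by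
  rw [← Finset.sum_neg_distrib, Matrix.trace]
  refine Finset.sum_congr rfl fun i _ => ?_
  rw [Matrix.diag_apply, Matrix.mul_apply, ← Finset.sum_neg_distrib]
  refine Finset.sum_congr rfl fun j _ => ?_
  rw [umat_swap d' c' r' p' i j]
  ring

end Matrices

namespace Biv

/-- The matrix of an integer bivector. -/
def amat (l : Biv) : Matrix (Fin 4) (Fin 4) ℤ := _root_.amat l.1 l.2.1 l.2.2.1 l.2.2.2

/-- The matrix of the dual of an integer bivector. -/
def umat (l : Biv) : Matrix (Fin 4) (Fin 4) ℤ := _root_.umat l.1 l.2.1 l.2.2.1 l.2.2.2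

/-- The list of coordinates of an integer bivector. -/
def coords (l : Biv) : Fin 6 → ℤ := ![l.1 0, l.1 1, l.2.1, l.2.2.1, l.2.2.2 0, l.2.2.2 1]

lemma coords_injective : Function.Injective coords := by
  intro l l' h
  have h' := fun i => congrFun h i
  have h0 : l.1 0 = l'.1 0 := h' 0
  have h1 : l.1 1 = l'.1 1 := h' 1
  have h2 : l.2.1 = l'.2.1 := h' 2
  have h3 : l.2.2.1 = l'.2.2.1 := h' 3
  have h4 : l.2.2.2 0 = l'.2.2.2 0 := h' 4
  have h5 : l.2.2.2 1 = l'.2.2.2 1 := h' 5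
  ext i
  · fin_cases i <;> assumption
  · exact h2
  · exact h3
  · fin_cases i <;> assumption

lemma coords_zero : coords 0 = 0 := by
  ext i; fin_cases i <;> rfl

lemma coords_smul (a : ℤ) (l : Biv) (i : Fin 6) : coords (a • l) i = a * coords l i := by
  fin_cases i <;> simp [coords]

/-- Bivectors whose incidence matrix vanishes are parallel. -/
lemma par_of_mul_eq_zero {l l' : Biv} (hl : l ≠ 0) (hl' : l' ≠ 0)
    (hM : l.amat * l'.umat = 0) : Par l l' := by
  have h := fun i j => congrFun (congrFun hM i) j
  have hc : ∀ i j, coords l i * coords l' j = coords l j * coords l' i := by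
    have h00 := h 0 0
    have h01 := h 0 1
    have h02 := h 0 2
    have h03 := h 0 3
    have h10 := h 1 0
    have h11 := h 1 1
    have h12 := h 1 2
    have h13 := h 1 3
    have h20 := h 2 0
    have h21 := h 2 1
    have h22 := h 2 2
    have h23 := h 2 3
    have h30 := h 3 0
    have h31 := h 3 1
    have h32 := h 3 2
    have h33 := h 3 3
    simp [amat, umat, _root_.amat, _root_.umat, Matrix.mul_apply, Fin.sum_univ_four]
      at h00 h01 h02 h03 h10 h11 h12 h13 h20 h21 h22 h23 h30 h31 h32 h33
    intro i j
    fin_cases i <;> fin_cases j <;> simp [coords] <;> linarith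
  obtain ⟨a, b, ha, hb, hab⟩ := exists_mul_eq_mul_of_minors hc
    (fun e => hl (coords_injective (e.trans coords_zero.symm)))
    (fun e => hl' (coords_injective (e.trans coords_zero.symm)))
  refine ⟨a, b, ha, hb, coords_injective ?_⟩
  ext j
  rw [coords_smul, coords_smul, hab]

end Biv

namespace Biv

lemma amat_map (l : Biv) : l.amat.map (Int.cast : ℤ → ℝ)
    = _root_.amat l.d l.2.1 l.2.2.1 fun i => l.2.2.2 i := by
  ext i j
  fin_cases i <;> fin_cases j <;> simp [amat, _root_.amat, d]

lemma umat_map (l : Biv) : l.umat.map (Int.cast : ℤ → ℝ)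
    = _root_.umat l.d l.2.1 l.2.2.1 fun i => l.2.2.2 i := by
  ext i j
  fin_cases i <;> fin_cases j <;> simp [umat, _root_.umat, d]

end Biv

namespace Frame

variable (P : Frame 2) (T : ℝ)

/-- The matrix of a frame. -/
noncomputable def mat₂ : Matrix (Fin 4) (Fin 4) ℝ :=
  !![1 / T, 0, 0, 0; P.xi 0, 1, 0, 0; P.xi 1, 0, 1, 0;
    T * P.zeta, T * P.eta 0, T * P.eta 1, T]

/-- The inverse of the matrix of a frame. -/
noncomputable def invMat : Matrix (Fin 4) (Fin 4) ℝ :=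
  !![T, 0, 0, 0; -T * P.xi 0, 1, 0, 0; -T * P.xi 1, 0, 1, 0;
    T * (P.xi ⬝ᵥ P.eta - P.zeta), -P.eta 0, -P.eta 1, 1 / T]

variable {P T}

lemma invMat_mul_mat₂ (hT : T ≠ 0) : P.invMat T * P.mat₂ T = 1 := by
  ext i j
  fin_cases i <;> fin_cases j <;>
    simp [mat₂, invMat, Matrix.mul_apply, Fin.sum_univ_four, dotProduct, Fin.sum_univ_two, hT] <;>
    field_simp <;> ring_nf

lemma amat_frame (hT : T ≠ 0) (l : Biv) :
    amat ((1 / T) • l.d) (P.bivC l) (P.bivR l) (T • P.bivP l)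
      = P.mat₂ T * l.amat.map (Int.cast : ℤ → ℝ) * (P.mat₂ T).transpose := by
  rw [Biv.amat_map]
  ext i j
  fin_cases i <;> fin_cases j <;>
    simp [mat₂, amat, Matrix.mul_apply, Fin.sum_univ_four, dotProduct, Fin.sum_univ_two,
      bivC, bivR, bivP, Biv.d] <;>
    field_simp <;> ring_nf

lemma umat_frame (hT : T ≠ 0) (l : Biv) :
    umat ((1 / T) • l.d) (P.bivC l) (P.bivR l) (T • P.bivP l)
      = (P.invMat T).transpose * l.umat.map (Int.cast : ℤ → ℝ) * P.invMat T := by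
  rw [Biv.umat_map]
  ext i j
  fin_cases i <;> fin_cases j <;>
    simp [invMat, umat, Matrix.mul_apply, Fin.sum_univ_four, dotProduct,
      Fin.sum_univ_two, bivC, bivR, bivP, Biv.d] <;>
    field_simp <;> ring_nf

lemma abs_amat_frame_le (hT : 0 < T) (l : Biv) (i j : Fin 4) :
    |amat ((1 / T) • l.d) (P.bivC l) (P.bivR l) (T • P.bivP l) i j| ≤ P.bsize T l
      ∧ |umat ((1 / T) • l.d) (P.bivC l) (P.bivR l) (T • P.bivP l) i j| ≤ P.bsize T l := by
  have h0 := P.bsize_nonneg hT l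
  have hd : ∀ i, T⁻¹ * |l.d i| ≤ P.bsize T l := fun i => by
    refine le_trans ?_ (norm_d_le_bsize hT l)
    rw [div_eq_inv_mul]
    exact mul_le_mul_of_nonneg_left (norm_le_pi_norm l.d i) (inv_nonneg.2 hT.le)
  have hp : ∀ i, T * |P.bivP l i| ≤ P.bsize T l := fun i =>
    (mul_le_mul_of_nonneg_left (norm_le_pi_norm (P.bivP l) i) hT.le).trans (bivP_le_bsize hT l)
  have hC := P.bivC_le_bsize hT l
  have hR := P.bivR_le_bsize hT l
  constructor <;> fin_cases i <;> fin_cases j <;>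
    simp [amat, umat, abs_mul, abs_of_pos hT] <;>
    first | assumption | exact hd 0 | exact hd 1 | exact hp 0 | exact hp 1

lemma size_le_of_mat₂_mulVec (v : IVec 2) (w : Fin 4 → ℤ) (h0 : w 0 = v.1) (h1 : w 1 = v.2.1 0)
    (h2 : w 2 = v.2.1 1) (h3 : w 3 = v.2.2) (S : ℝ) (hT : 0 < T)
    (hS : ∀ i, |∑ k, P.mat₂ T i k * w k| ≤ S) : P.size T v ≤ 3 * S := by
  have k0 := hS 0
  have k1 := hS 1
  have k2 := hS 2
  have k3 := hS 3
  simp [mat₂, Fin.sum_univ_four, h0, h1, h2, h3] at k0 k1 k2 k3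
  have e0 : |(v.1 : ℝ)| / T ≤ S := by
    rwa [abs_of_pos hT, inv_mul_eq_div] at k0
  have e1 : ‖P.horiz v‖ ≤ S := by
    rw [norm_fin_two]
    refine max_le ?_ ?_
    · rwa [show P.horiz v 0 = P.xi 0 * v.1 + v.2.1 0 by simp [horiz]; ring]
    · rwa [show P.horiz v 1 = P.xi 1 * v.1 + v.2.1 1 by simp [horiz]; ring]
  have e2 : T * |P.vert v| ≤ S := by
    rw [show T * |P.vert v| = |T * P.vert v| by rw [abs_mul, abs_of_pos hT]]
    convert k3 using 2; simp [vert, dotProduct, Fin.sum_univ_two]; ring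
  rw [size]; linarith

lemma dual_size_le_of_vecMul_invMat (v : IVec 2) (w : Fin 4 → ℤ) (h0 : w 0 = v.2.2)
    (h1 : w 1 = v.2.1 0)
    (h2 : w 2 = v.2.1 1) (h3 : w 3 = v.1) (S : ℝ) (hT : 0 < T)
    (hS : ∀ i, |∑ k, w k * P.invMat T k i| ≤ S) : P.dual.size T v ≤ 3 * S := by
  have k0 := hS 0
  have k1 := hS 1
  have k2 := hS 2
  have k3 := hS 3
  simp [invMat, Fin.sum_univ_four, h0, h1, h2, h3] at k0 k1 k2 k3
  have e0 : |(v.1 : ℝ)| / T ≤ S := by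
    rwa [abs_of_pos hT, ← div_eq_mul_inv] at k3
  have e1 : ‖P.dual.horiz v‖ ≤ S := by
    rw [norm_fin_two]
    refine max_le ?_ ?_
    · rwa [show P.dual.horiz v 0 = v.2.1 0 + -(v.1 * P.eta 0) by simp [horiz, dual]]
    · rwa [show P.dual.horiz v 1 = v.2.1 1 + -(v.1 * P.eta 1) by simp [horiz, dual]]
  have e2 : T * |P.dual.vert v| ≤ S := by
    rw [show T * |P.dual.vert v| = |T * P.dual.vert v| by rw [abs_mul, abs_of_pos hT]]
    convert k0 using 2; simp [vert, dual, dotProduct, Fin.sum_univ_two]; ring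
  rw [size]; linarith

/-- Two nonparallel decomposable bivectors of small norm meet in a short vector and span a short
dual vector. -/
lemma one_le_or_exists_size_mul_size_le {l l' : Biv} (hl : l.Dec) (hl' : l'.Dec) (hl0 : l ≠ 0)
    (hl0' : l' ≠ 0) (hpar : ¬ Biv.Par l l') (P : Frame 2) {T : ℝ} (hT : 0 < T) :
    1 ≤ 16 * (P.bsize T l * P.bsize T l') ∨ ∃ v u : IVec 2, v ≠ 0 ∧ u ≠ 0 ∧
      P.size T v * P.dual.size T u ≤ 36 * (P.bsize T l * P.bsize T l') := by
  set V := P.bsize T l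
  set V' := P.bsize T l'
  have hV : 0 ≤ V := P.bsize_nonneg hT l
  have hV' : 0 ≤ V' := P.bsize_nonneg hT l'
  set M := l.amat * l'.umat with hM
  have hfr : amat ((1 / T) • l.d) (P.bivC l) (P.bivR l) (T • P.bivP l)
      * umat ((1 / T) • l'.d) (P.bivC l') (P.bivR l') (T • P.bivP l')
      = P.mat₂ T * M.map (Int.cast : ℤ → ℝ) * P.invMat T := by
    have h1 : (P.mat₂ T).transpose * (P.invMat T).transpose = 1 := by
      rw [← Matrix.transpose_mul, invMat_mul_mat₂ hT.ne', Matrix.transpose_one]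
    have h2 : M.map (Int.cast : ℤ → ℝ)
        = l.amat.map (Int.cast : ℤ → ℝ) * l'.umat.map (Int.cast : ℤ → ℝ) :=
      Matrix.map_mul (f := Int.castRingHom ℝ)
    rw [amat_frame hT.ne', umat_frame hT.ne', h2]
    calc _ = P.mat₂ T * l.amat.map (Int.cast : ℤ → ℝ) * ((P.mat₂ T).transpose
        * (P.invMat T).transpose) * l'.umat.map (Int.cast : ℤ → ℝ) * P.invMat T := by
          simp only [Matrix.mul_assoc]
      _ = _ := by rw [h1, Matrix.mul_one]; simp only [Matrix.mul_assoc]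
  have hent : ∀ i j, |(P.mat₂ T * M.map (Int.cast : ℤ → ℝ) * P.invMat T) i j| ≤ 4 * (V * V') := by
    intro i j
    rw [← hfr, Matrix.mul_apply]
    refine (Finset.abs_sum_le_sum_abs _ _).trans ?_
    refine (Finset.sum_le_card_nsmul _ _ (V * V') fun k _ => ?_).trans (by simp)
    rw [abs_mul]
    exact mul_le_mul (abs_amat_frame_le hT l i k).1 (abs_amat_frame_le hT l' k j).2
      (abs_nonneg _) hV
  by_cases htr : M.trace = 0
  · right
    have hAU : ∑ i, ∑ j, l.amat i j * l'.umat i j = 0 := by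
      have := trace_amat_mul_umat l.1 l'.1 l.2.1 l'.2.1 l.2.2.1 l'.2.2.1 l.2.2.2 l'.2.2.2
      rw [show (amat l.1 l.2.1 l.2.2.1 l.2.2.2 * umat l'.1 l'.2.1 l'.2.2.1 l'.2.2.2) = M from rfl,
        htr] at this
      exact neg_eq_zero.1 this.symm
    have hmin : ∀ i j k l, M i j * M k l = M i l * M k j :=
      mul_minor_eq_zero (amat_plucker hl) (umat_plucker hl') (fun p q => umat_swap _ _ _ _ p q) hAU
    obtain ⟨v, u, hv, hu, hvu⟩ := exists_outer_product M hmin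
      fun h => hpar (Biv.par_of_mul_eq_zero hl0 hl0' h)
    set v' : IVec 2 := (v 0, ![v 1, v 2], v 3)
    set u' : IVec 2 := (u 3, ![u 1, u 2], u 0)
    have hprod : ∀ i j, |∑ k, P.mat₂ T i k * v k| * |∑ k, u k * P.invMat T k j|
        ≤ 4 * (V * V') := by
      intro i j
      convert hent i j using 1
      rw [← abs_mul]
      congr 1
      simp only [Matrix.mul_apply, Matrix.map_apply, hvu, Finset.sum_mul, Finset.mul_sum]
      refine Finset.sum_congr rfl fun a _ => Finset.sum_congr rfl fun b _ => ?_
      push_cast; ring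
    refine ⟨v', u', fun h => hv ?_, fun h => hu ?_, ?_⟩
    · ext i
      have h1 := congrArg Prod.fst h
      have h2 := congrArg (fun x : IVec 2 => x.2.1) h
      have h3 := congrArg (fun x : IVec 2 => x.2.2) h
      have h20 := congrFun h2 0
      have h21 := congrFun h2 1
      fin_cases i
      exacts [h1, h20, h21, h3]
    · ext i
      have h1 := congrArg Prod.fst h
      have h2 := congrArg (fun x : IVec 2 => x.2.1) h
      have h3 := congrArg (fun x : IVec 2 => x.2.2) h
      have h20 := congrFun h2 0
      have h21 := congrFun h2 1
      fin_cases i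
      exacts [h3, h20, h21, h1]
    · obtain ⟨i, -, hi⟩ := Finset.exists_max_image Finset.univ
        (fun i => |∑ k, P.mat₂ T i k * (v k : ℝ)|) ⟨0, Finset.mem_univ _⟩
      obtain ⟨j, -, hj⟩ := Finset.exists_max_image Finset.univ
        (fun j => |∑ k, (u k : ℝ) * P.invMat T k j|) ⟨0, Finset.mem_univ _⟩
      have s1 := P.size_le_of_mat₂_mulVec v' v rfl rfl rfl rfl _ hT
        fun i' => hi i' (Finset.mem_univ _)
      have s2 := P.dual_size_le_of_vecMul_invMat u' u rfl rfl rfl rfl _ hT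
        fun i' => hj i' (Finset.mem_univ _)
      have := mul_le_mul s1 s2 (P.dual.size_nonneg hT _) (by positivity)
      have := hprod i j
      linarith
  · left
    have h1 : (M.trace : ℝ) = (P.mat₂ T * M.map (Int.cast : ℤ → ℝ) * P.invMat T).trace := by
      rw [Matrix.trace_mul_comm (P.mat₂ T * _), ← Matrix.mul_assoc,
        invMat_mul_mat₂ hT.ne', Matrix.one_mul]
      simp [Matrix.trace]
    have h2 : |(M.trace : ℝ)| ≤ 16 * (V * V') := by
      rw [h1, Matrix.trace]
      refine (Finset.abs_sum_le_sum_abs _ _).trans ?_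
      refine (Finset.sum_le_card_nsmul _ _ (4 * (V * V')) fun k _ => hent k k).trans ?_
      simp; linarith
    have h3 : (1 : ℝ) ≤ |(M.trace : ℝ)| := by exact_mod_cast Int.one_le_abs htr
    exact h3.trans h2

end Frame

namespace Biv

lemma amat_wedge (v w : IVec 2) (i j : Fin 4) :
    (wedge v w).amat i j = ![v.1, v.2.1 0, v.2.1 1, v.2.2] i * ![w.1, w.2.1 0, w.2.1 1, w.2.2] j
      - ![v.1, v.2.1 0, v.2.1 1, v.2.2] j * ![w.1, w.2.1 0, w.2.1 1, w.2.2] i := by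
  fin_cases i <;> fin_cases j <;> simp [amat, _root_.amat, wedge] <;> ring

lemma umat_star_wedge (u w : IVec 2) (i j : Fin 4) :
    (wedge u w).star.umat i j =
      ![u.2.2, u.2.1 0, u.2.1 1, u.1] i * ![w.2.2, w.2.1 0, w.2.1 1, w.1] j
      - ![u.2.2, u.2.1 0, u.2.1 1, u.1] j * ![w.2.2, w.2.1 0, w.2.1 1, w.1] i := by
  fin_cases i <;> fin_cases j <;> simp [umat, _root_.umat, wedge, star] <;> ring

/-- The plane annihilated by two covectors. -/
lemma par_wedge_star_wedge {v w u u' : IVec 2} (h : wedge v w ≠ 0) (h' : wedge u u' ≠ 0)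
    (hp : ∀ x ∈ ({v, w} : Set (IVec 2)), ∀ y ∈ ({u, u'} : Set (IVec 2)),
      x.1 * y.2.2 + x.2.1 ⬝ᵥ y.2.1 + x.2.2 * y.1 = 0) :
    Par (wedge v w) (wedge u u').star := by
  apply par_of_mul_eq_zero h
  · intro h0
    apply h'
    have e := fun i => congrFun (congrArg coords h0) i
    have e0 := e 0
    have e1 := e 1
    have e2 := e 2
    have e3 := e 3
    have e4 := e 4
    have e5 := e 5
    simp [coords, star] at e0 e1 e2 e3 e4 e5
    apply coords_injective
    ext i
    fin_cases i <;> simp [coords] <;> assumption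
  · have h1 := hp v (by simp) u (by simp)
    have h2 := hp v (by simp) u' (by simp)
    have h3 := hp w (by simp) u (by simp)
    have h4 := hp w (by simp) u' (by simp)
    simp only [dotProduct, Fin.sum_univ_two] at h1 h2 h3 h4
    ext i j
    simp only [Matrix.mul_apply, amat_wedge, umat_star_wedge, Fin.sum_univ_four,
      Matrix.zero_apply]
    set vi := ![v.1, v.2.1 0, v.2.1 1, v.2.2] i
    set wi := ![w.1, w.2.1 0, w.2.1 1, w.2.2] i
    set uj := ![u.2.2, u.2.1 0, u.2.1 1, u.1] j
    set uj' := ![u'.2.2, u'.2.1 0, u'.2.1 1, u'.1] j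
    simp
    linear_combination vi * uj' * h3 - vi * uj * h4 - wi * uj' * h1 + wi * uj * h2

/-- Vectors with vanishing wedge product are parallel. -/
lemma exists_smul_eq_of_wedge_eq_zero {v w : IVec 2} (hv : v ≠ 0) (hw : w ≠ 0)
    (h : wedge v w = 0) : ∃ a b : ℤ, a ≠ 0 ∧ b ≠ 0 ∧ a • v = b • w := by
  have hM : ∀ i j, ![v.1, v.2.1 0, v.2.1 1, v.2.2] i * ![w.1, w.2.1 0, w.2.1 1, w.2.2] j
      = ![v.1, v.2.1 0, v.2.1 1, v.2.2] j * ![w.1, w.2.1 0, w.2.1 1, w.2.2] i := by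
    intro i j
    rw [← sub_eq_zero, ← amat_wedge, h]
    fin_cases i <;> fin_cases j <;> simp [amat, _root_.amat]
  have hne : ∀ x : IVec 2, x ≠ 0 → ![x.1, x.2.1 0, x.2.1 1, x.2.2] ≠ 0 := by
    intro x hx h0
    apply hx
    have e := fun i => congrFun h0 i
    ext i
    · exact e 0
    · fin_cases i
      exacts [e 1, e 2]
    · exact e 3
  obtain ⟨a, b, ha, hb, hab⟩ := exists_mul_eq_mul_of_minors hM (hne v hv) (hne w hw)
  refine ⟨a, b, ha, hb, ?_⟩
  ext i
  · exact hab 0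
  · fin_cases i
    exacts [hab 1, hab 2]
  · exact hab 3

end Biv

/-! ### Averages of norms of bivectors over refined grids -/

lemma sum_inv_one_add_sq_le_of_separated {N : ℕ} {g : ℕ → ℝ} {c : ℝ} (hc : 0 < c) (hc2 : c ≤ 2)
    (hg : ∀ i < N, ∀ j < N, c * |(i : ℝ) - j| ≤ |g i - g j|) :
    ∑ i ∈ Finset.range N, 1 / (1 + |g i|) ^ 2 ≤ 16 / c ^ 2 := by
  calc ∑ i ∈ Finset.range N, 1 / (1 + |g i|) ^ 2
      ≤ 2 * ∑ i ∈ Finset.range N, 1 / (1 + c * i / 2) ^ 2 := by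
        refine sum_antitone_of_separated N g hc.le hg (fun u => 1 / (1 + u) ^ 2)
          (fun b d hb hbd => ?_) (fun b hb => by positivity)
        exact one_div_le_one_div_of_le (by positivity) (by gcongr)
    _ ≤ 2 * ∑ i ∈ Finset.range N, 4 / c ^ 2 * (1 / (1 + (i : ℝ)) ^ 2) := by
        gcongr with i hi
        rw [div_mul_div_comm, div_le_div_iff₀ (by positivity) (by positivity)]
        have : c / 2 * (1 + i) ≤ 1 + c * i / 2 := by linarith
        have := pow_le_pow_left₀ (by positivity) this 2
        linarith
    _ = 2 * (4 / c ^ 2 * ∑ i ∈ Finset.range N, 1 / (1 + (i : ℝ)) ^ 2) := by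
        rw [Finset.mul_sum _ _ (4 / c ^ 2)]
    _ ≤ 2 * (4 / c ^ 2 * 2) := by
        gcongr
        refine (sum_inv_one_add_sq_le N).trans ?_
        have : (0 : ℝ) ≤ 1 / N := by positivity
        linarith
    _ = _ := by ring

lemma sum_inv_one_add_mul_self_le (M : ℕ) :
    ∑ i ∈ Finset.range (M * M), 1 / (1 + (i : ℝ)) ≤ 8 * Real.sqrt M := by
  have h : ∑ i ∈ Finset.range (M * M), 1 / (1 + (i : ℝ))
      ≤ 4 * ∑ i ∈ Finset.range M, 1 / (1 + (i : ℝ)) := by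
    induction M with
    | zero => simp
    | succ n ih =>
      rw [show (n + 1) * (n + 1) = n * n + (2 * n + 1) by ring, Finset.sum_range_add,
        Finset.sum_range_succ _ n, mul_add]
      refine add_le_add ih ?_
      calc ∑ x ∈ Finset.range (2 * n + 1), 1 / (1 + ((n * n + x : ℕ) : ℝ))
          ≤ ∑ x ∈ Finset.range (2 * n + 1), 1 / (1 + (n : ℝ) * n) := by
            refine Finset.sum_le_sum fun x _ => ?_
            push_cast
            exact one_div_le_one_div_of_le (by positivity) (by linarith [x.cast_nonneg (α := ℝ)])
        _ = (2 * n + 1) / (1 + (n : ℝ) * n) := by simp; ring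
        _ ≤ _ := by
            rw [mul_one_div, div_le_div_iff₀ (by positivity) (by positivity)]
            nlinarith [sq_nonneg ((n : ℝ) - 1)]
  linarith [sum_inv_one_add_le M]

lemma sum_inv_one_add_le_of_separated {M : ℕ} {g : ℕ → ℝ} {c : ℝ} (hc : 0 < c) (hc2 : c ≤ 2)
    (hg : ∀ i < M * M, ∀ j < M * M, c * |(i : ℝ) - j| ≤ |g i - g j|) :
    ∑ i ∈ Finset.range (M * M), 1 / (1 + |g i|) ≤ 32 / c * Real.sqrt M := by
  calc ∑ i ∈ Finset.range (M * M), 1 / (1 + |g i|)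
      ≤ 2 * ∑ i ∈ Finset.range (M * M), 1 / (1 + c * i / 2) := by
        refine sum_antitone_of_separated _ g hc.le hg (fun u => 1 / (1 + u))
          (fun b d hb hbd => ?_) (fun b hb => by positivity)
        exact one_div_le_one_div_of_le (by positivity) (by gcongr)
    _ ≤ 2 * ∑ i ∈ Finset.range (M * M), 2 / c * (1 / (1 + (i : ℝ))) := by
        gcongr with i hi
        rw [div_mul_div_comm, div_le_div_iff₀ (by positivity) (by positivity)]
        linarith
    _ = 2 * (2 / c * ∑ i ∈ Finset.range (M * M), 1 / (1 + (i : ℝ))) := by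
        rw [Finset.mul_sum _ _ (2 / c)]
    _ ≤ 2 * (2 / c * (8 * Real.sqrt M)) := by gcongr; exact sum_inv_one_add_mul_self_le M
    _ = _ := by ring

/-- Decomposability forces a lower bound on the norm. -/
lemma Frame.mul_le_bsize_of_dec (P : Frame 2) {T : ℝ} (hT : 0 < T) {l : Biv} (hl : l.Dec)
    (hd : 0 < ‖l.d‖) : ‖l.d‖ / T / 2 * ((1 + |P.bivC l / (‖l.d‖ / T)|)
      * (1 + |P.bivR l / (‖l.d‖ / T)|)) ≤ P.bsize T l := by
  have hδ : 0 < ‖l.d‖ / T := by positivity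
  have h := abs_bivR_mul_bivC_le (P := P) hl
  have e : |P.bivR l| * |P.bivC l| / (2 * (‖l.d‖ / T)) ≤ T * ‖P.bivP l‖ := by
    rw [div_le_iff₀ (by positivity)]
    calc _ ≤ 2 * (‖l.d‖ * ‖P.bivP l‖) := h
      _ = _ := by field_simp
  rw [abs_div _ (‖l.d‖ / T), abs_div _ (‖l.d‖ / T), abs_of_pos hδ, bsize]
  set δ := ‖l.d‖ / T
  have e2 : δ / 2 * ((1 + |P.bivC l| / δ) * (1 + |P.bivR l| / δ))
      = δ / 2 + |P.bivC l| / 2 + |P.bivR l| / 2 + |P.bivR l| * |P.bivC l| / (2 * δ) := by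
    field_simp; ring
  rw [e2]
  linarith [abs_nonneg (P.bivC l), abs_nonneg (P.bivR l)]

namespace AdaptedFrames

variable {P : (Fin 2 → ℝ) → Frame 2} {U : Set (Fin 2 → ℝ)} {K θ : ℝ}
  {B' B : (Fin 2 → ℝ) →ₗ[ℝ] (Fin 2 → ℝ)}

lemma abs_bivC_sub_le (hxi : ∀ x, (P x).xi = -x) (x y : Fin 2 → ℝ) (l : Biv) :
    |(P y).bivC l - (P x).bivC l| ≤ 2 * (‖y - x‖ * ‖l.d‖) := by
  rw [Frame.bivC_sub (P := P x), add_sub_cancel_left]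
  refine (abs_dotProduct_le _ _).trans (le_of_eq ?_)
  rw [norm_rot, hxi, hxi, neg_sub_neg, norm_sub_rev]
  norm_num

lemma abs_eta_sub_dotProduct_le (F : AdaptedFrames P U K θ B' B) {x y : Fin 2 → ℝ} (hx : x ∈ U)
    (hy : y ∈ U) (l : Biv) :
    |((P y).eta - (P x).eta) ⬝ᵥ l.d| ≤ 4 * K * (‖y - x‖ * ‖l.d‖) := by
  refine (abs_dotProduct_le _ _).trans ?_
  have := mul_le_mul_of_nonneg_right (F.eta_lip one_le_two hx hy) (norm_nonneg l.d)
  push_cast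
  linarith

lemma abs_bivR_sub_le (F : AdaptedFrames P U K θ B' B) {x y : Fin 2 → ℝ} (hx : x ∈ U)
    (hy : y ∈ U) (l : Biv) :
    |(P y).bivR l - (P x).bivR l| ≤ 4 * K * (‖y - x‖ * ‖l.d‖) := by
  rw [Frame.bivR_sub (P := P x), add_sub_cancel_left]
  exact F.abs_eta_sub_dotProduct_le hx hy l

lemma exists_bivC_expand (hxi : ∀ x, (P x).xi = -x) (l : Biv) :
    ∃ e : Fin 2, ∀ x y : Fin 2 → ℝ, ∀ s : ℝ, y - x = s • Pi.single e 1 →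
      |s| * ‖l.d‖ ≤ |(P y).bivC l - (P x).bivC l| := by
  have key : ∀ e e' : Fin 2, e ≠ e' → ∀ x y : Fin 2 → ℝ, ∀ s : ℝ, y - x = s • Pi.single e 1 →
      |s| * |l.d e'| ≤ |(P y).bivC l - (P x).bivC l| := by
    intro e e' he x y s hs
    rw [Frame.bivC_sub (P := P x), add_sub_cancel_left, hxi, hxi,
      show -y - -x = -(y - x) by abel, hs]
    fin_cases e <;> fin_cases e' <;> simp_all [dotProduct, Fin.sum_univ_two, abs_mul]
  rw [norm_fin_two]
  rcases le_total |l.d 0| |l.d 1| with h | h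
  · exact ⟨0, by rw [max_eq_right h]; exact key 0 1 (by simp)⟩
  · exact ⟨1, by rw [max_eq_left h]; exact key 1 0 (by simp)⟩

lemma exists_bivR_expand (F : AdaptedFrames P U K θ B' B) (l : Biv) :
    ∃ e : Fin 2, ∀ x ∈ U, ∀ y ∈ U, ∀ s : ℝ, y - x = s • Pi.single e 1 →
      |s| * ‖l.d‖ ≤ 2 * K * |(P y).bivR l - (P x).bivR l| := by
  obtain ⟨e, he⟩ := F.eta_dual l.d
  refine ⟨e, fun x hx y hy s hs => ?_⟩
  have hK := F.one_le
  have h1 := F.eta_approx x hx y hy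
  have h2 := abs_dotProduct_le ((P y).eta - (P x).eta - B (y - x)) l.d
  rw [Frame.bivR_sub (P := P x), add_sub_cancel_left]
  have hn : ‖y - x‖ = |s| := by rw [hs, norm_smul, Pi.norm_single]; simp
  have h3 : B (y - x) ⬝ᵥ l.d = s * (l.d ⬝ᵥ B (Pi.single e 1)) := by
    rw [hs, map_smul, smul_dotProduct, dotProduct_comm, smul_eq_mul]
  rw [sub_dotProduct ((P y).eta - (P x).eta), h3] at h2
  have h4 := abs_sub_abs_le_abs_sub (s * (l.d ⬝ᵥ B (Pi.single e 1)))
    (((P y).eta - (P x).eta) ⬝ᵥ l.d)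
  rw [abs_sub_comm, abs_mul] at h4
  rw [hn] at h1
  have h5 := mul_le_mul_of_nonneg_right h1 (norm_nonneg l.d)
  have h6 := mul_le_mul_of_nonneg_left he (abs_nonneg s)
  have h7 : 0 ≤ |s| * ‖l.d‖ := by positivity
  have h8 := F.theta_mul_le one_le_two
  push_cast at h2
  have h9 : |s| * |l.d ⬝ᵥ B (Pi.single e 1)|
      ≤ 2 * (θ * |s| * ‖l.d‖) + |((P y).eta - (P x).eta) ⬝ᵥ l.d| := by linarith
  have h10 := mul_le_mul_of_nonneg_left h9 (by linarith : 0 ≤ K)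
  have h11 : θ * K * (|s| * ‖l.d‖) ≤ 1 / 16 * (|s| * ‖l.d‖) := mul_le_mul_of_nonneg_right h8 h7
  nlinarith

section Grid

variable {ρ T : ℝ} {x : Fin 2 → ℝ} {l : Biv}

/-- Sums over grids of functions of the two middle coordinates of a bivector. -/
lemma exists_sum_bivC_le (F : AdaptedFrames P U K θ B' B) (hxi : ∀ x, (P x).xi = -x)
    (hρ : 0 < ρ) (hT : 0 < T) (hU : Metric.closedBall x (ρ / T) ⊆ U) (hd : 0 < ‖l.d‖) {N : ℕ}
    (hN : 1 ≤ N) (φ : ℝ → ℝ) {S : ℝ} (hφ : ∀ g : ℕ → ℝ, (∀ i < N, ∀ j < N,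
      ρ / (2 * K) * |(i : ℝ) - j| ≤ |g i - g j|) → ∑ i ∈ Finset.range N, φ (g i) ≤ S) :
    ∑ t ∈ cube 2 N, φ ((P (gridPt x (ρ / (T * N)) t)).bivC l / (‖l.d‖ / (T * N))) ≤ N * S ∧
    ∑ t ∈ cube 2 N, φ ((P (gridPt x (ρ / (T * N)) t)).bivR l / (‖l.d‖ / (T * N))) ≤ N * S := by
  have hK := F.one_le
  have hN0 : (0 : ℝ) < N := by exact_mod_cast hN
  have hδ : 0 < ‖l.d‖ / (T * N) := by positivity
  have hmem : ∀ t ∈ cube 2 N, gridPt x (ρ / (T * N)) t ∈ U := fun t ht =>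
    hU (gridPt_mem_closedBall x hρ.le hT ht)
  have hs : ∀ i j : ℕ, |ρ / (T * N) * ((i : ℝ) - j)| * ‖l.d‖
      = ρ * |(i : ℝ) - j| * (‖l.d‖ / (T * N)) := by
    intro i j
    rw [abs_mul, abs_of_pos (by positivity : 0 < ρ / (T * N))]; field_simp
  have hρK : ρ / (2 * K) ≤ ρ := by
    rw [div_le_iff₀ (by positivity)]; nlinarith
  constructor
  · obtain ⟨e, he⟩ := exists_bivC_expand hxi l
    have := sum_cube_le_of_line e (fun t =>
      φ ((P (gridPt x (ρ / (T * N)) t)).bivC l / (‖l.d‖ / (T * N)))) (S := S) fun t ht => by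
        refine hφ (fun i => (P (gridPt x (ρ / (T * N)) (Function.update t e i))).bivC l
          / (‖l.d‖ / (T * N))) fun i hi j hj => ?_
        have h := he _ _ _ (gridPt_update_sub x (ρ / (T * N)) t e i j)
        rw [hs] at h
        rw [← sub_div, abs_div, abs_of_pos hδ, le_div_iff₀ hδ]
        refine le_trans ?_ h
        gcongr
    have h2 : (N : ℝ) ^ 2 * S = N * (N * S) := by ring
    rw [h2] at this
    exact le_of_mul_le_mul_left this hN0
  · obtain ⟨e, he⟩ := F.exists_bivR_expand l
    have := sum_cube_le_of_line e (fun t =>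
      φ ((P (gridPt x (ρ / (T * N)) t)).bivR l / (‖l.d‖ / (T * N)))) (S := S) fun t ht => by
        refine hφ (fun i => (P (gridPt x (ρ / (T * N)) (Function.update t e i))).bivR l
          / (‖l.d‖ / (T * N))) fun i hi j hj => ?_
        have h := he _ (hmem _ (update_mem_cube ht e hj)) _ (hmem _ (update_mem_cube ht e hi)) _
          (gridPt_update_sub x (ρ / (T * N)) t e i j)
        rw [hs] at h
        rw [← sub_div, abs_div, abs_of_pos hδ, le_div_iff₀ hδ, div_mul_eq_mul_div,
          div_mul_eq_mul_div, div_le_iff₀ (by positivity)]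
        linarith
    have h2 : (N : ℝ) ^ 2 * S = N * (N * S) := by ring
    rw [h2] at this
    exact le_of_mul_le_mul_left this hN0

lemma sum_inv_bsize_le_of_large (F : AdaptedFrames P U K θ B' B) (hxi : ∀ x, (P x).xi = -x)
    (hρ : 0 < ρ) (hρ1 : ρ ≤ 1) (hT : 0 < T) (hU : Metric.closedBall x (ρ / T) ⊆ U) (hl : l.Dec)
    (hd : 0 < ‖l.d‖) {H : ℝ} (hV0 : 0 < (P x).bsize T l)
    (hV : (P x).bsize T l ≤ ‖l.d‖ / T * H) {N : ℕ} (hN : 1 ≤ N) :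
    ∑ t ∈ cube 2 N, 1 / (P (gridPt x (ρ / (T * N)) t)).bsize (T * N) l
      ≤ 128 * K ^ 2 * H / ρ ^ 2 * N ^ 2 / (P x).bsize T l := by
  have hK := F.one_le
  have hN0 : (0 : ℝ) < N := by exact_mod_cast hN
  have hδ : 0 < ‖l.d‖ / (T * N) := by positivity
  have hc2 : ρ / (2 * K) ≤ 2 := by rw [div_le_iff₀ (by positivity)]; linarith
  obtain ⟨hC, hR⟩ := F.exists_sum_bivC_le hxi hρ hT hU hd hN (fun u => 1 / (1 + |u|) ^ 2)
    (S := 16 / (ρ / (2 * K)) ^ 2)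
    fun g hg => sum_inv_one_add_sq_le_of_separated (by positivity) hc2 hg
  have hpt : ∀ t ∈ cube 2 N, 1 / (P (gridPt x (ρ / (T * N)) t)).bsize (T * N) l
      ≤ 1 / (‖l.d‖ / (T * N)) *
        (1 / (1 + |(P (gridPt x (ρ / (T * N)) t)).bivC l / (‖l.d‖ / (T * N))|) ^ 2
          + 1 / (1 + |(P (gridPt x (ρ / (T * N)) t)).bivR l / (‖l.d‖ / (T * N))|) ^ 2) := by
    intro t _
    have h := Frame.mul_le_bsize_of_dec (P (gridPt x (ρ / (T * N)) t))
      (T := T * N) (by positivity) hl hd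
    set a := |(P (gridPt x (ρ / (T * N)) t)).bivC l / (‖l.d‖ / (T * N))|
    set b := |(P (gridPt x (ρ / (T * N)) t)).bivR l / (‖l.d‖ / (T * N))|
    have ha : 0 ≤ a := abs_nonneg _
    have hb : 0 ≤ b := abs_nonneg _
    refine (one_div_le_one_div_of_le (by positivity) h).trans ?_
    have e : 1 / (‖l.d‖ / (T * N) / 2 * ((1 + a) * (1 + b)))
        = 1 / (‖l.d‖ / (T * N)) * (2 * (1 / (1 + a)) * (1 / (1 + b))) := by
      field_simp
    rw [e, ← one_div_pow, ← one_div_pow]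
    gcongr
    exact two_mul_le_add_sq _ _
  refine (Finset.sum_le_sum hpt).trans ?_
  rw [← Finset.mul_sum, Finset.sum_add_distrib]
  calc _ ≤ 1 / (‖l.d‖ / (T * N)) *
        (N * (16 / (ρ / (2 * K)) ^ 2) + N * (16 / (ρ / (2 * K)) ^ 2)) := by
        gcongr
    _ = 128 * K ^ 2 / ρ ^ 2 * N ^ 2 * (T / ‖l.d‖) := by field_simp; ring
    _ ≤ 128 * K ^ 2 / ρ ^ 2 * N ^ 2 * (H / (P x).bsize T l) := by
        refine mul_le_mul_of_nonneg_left ?_ (by positivity)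
        rw [div_le_div_iff₀ hd hV0]
        rw [div_mul_eq_mul_div, le_div_iff₀ hT] at hV
        linarith
    _ = _ := by ring

lemma sum_sqrt_inv_bsize_le_of_large (F : AdaptedFrames P U K θ B' B)
    (hxi : ∀ x, (P x).xi = -x) (hρ : 0 < ρ) (hρ1 : ρ ≤ 1) (hT : 0 < T)
    (hU : Metric.closedBall x (ρ / T) ⊆ U) (hl : l.Dec) (hd : 0 < ‖l.d‖) {H : ℝ} (hH : 1 ≤ H)
    (hV0 : 0 < (P x).bsize T l) (hV : (P x).bsize T l ≤ ‖l.d‖ / T * H) {M : ℕ} (hM : 1 ≤ M) :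
    Real.sqrt M * ∑ t ∈ cube 2 (M * M),
        Real.sqrt (1 / (P (gridPt x (ρ / (T * (M * M : ℕ))) t)).bsize (T * (M * M : ℕ)) l)
      ≤ 128 * K * H / ρ * ((M * M : ℕ) : ℝ) ^ 2 / Real.sqrt ((P x).bsize T l) := by
  have hK := F.one_le
  have hM0 : (0 : ℝ) < M := by exact_mod_cast hM
  have hNN : 1 ≤ M * M := Nat.mul_pos hM hM
  have hNe : ((M * M : ℕ) : ℝ) = M * M := by push_cast; ring
  have hN0 : (0 : ℝ) < (M * M : ℕ) := by exact_mod_cast hNN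
  have hc2 : ρ / (2 * K) ≤ 2 := by rw [div_le_iff₀ (by positivity)]; linarith
  obtain ⟨hC, hR⟩ := F.exists_sum_bivC_le hxi hρ hT hU hd hNN (fun u => 1 / (1 + |u|))
    (S := 32 / (ρ / (2 * K)) * Real.sqrt M)
    fun g hg => sum_inv_one_add_le_of_separated (by positivity) hc2 hg
  set N := M * M with hN
  have hδ : 0 < ‖l.d‖ / (T * N) := by positivity
  set δ := ‖l.d‖ / (T * N) with hδd
  have hpt : ∀ t ∈ cube 2 N, Real.sqrt (1 / (P (gridPt x (ρ / (T * N)) t)).bsize (T * N) l)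
      ≤ Real.sqrt (2 / δ) / 2 * (1 / (1 + |(P (gridPt x (ρ / (T * N)) t)).bivC l / δ|)
          + 1 / (1 + |(P (gridPt x (ρ / (T * N)) t)).bivR l / δ|)) := by
    intro t _
    have h := Frame.mul_le_bsize_of_dec (P (gridPt x (ρ / (T * N)) t))
      (T := T * N) (by positivity) hl hd
    rw [← hδd] at h
    set a := |(P (gridPt x (ρ / (T * N)) t)).bivC l / δ|
    set b := |(P (gridPt x (ρ / (T * N)) t)).bivR l / δ|
    have ha : 0 ≤ a := abs_nonneg _
    have hb : 0 ≤ b := abs_nonneg _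
    refine Real.sqrt_le_iff.2 ⟨by positivity, ?_⟩
    refine (one_div_le_one_div_of_le (by positivity) h).trans ?_
    have e : 1 / (δ / 2 * ((1 + a) * (1 + b))) = 2 / δ * ((1 / (1 + a)) * (1 / (1 + b))) := by
      field_simp
    rw [e, mul_pow, div_pow, Real.sq_sqrt (by positivity), div_mul_eq_mul_div _ (2 ^ 2 : ℝ),
      mul_div_assoc]
    refine mul_le_mul_of_nonneg_left ?_ (by positivity)
    nlinarith [sq_nonneg (1 / (1 + a) - 1 / (1 + b))]
  have hsq : Real.sqrt (2 / δ) ≤ 2 * H * M / Real.sqrt ((P x).bsize T l) := by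
    refine Real.sqrt_le_iff.2 ⟨by positivity, ?_⟩
    rw [div_pow, Real.sq_sqrt hV0.le, div_le_div_iff₀ hδ hV0]
    calc 2 * (P x).bsize T l ≤ 2 * (‖l.d‖ / T * H) := by gcongr
      _ = 2 * H * M ^ 2 * δ := by rw [hδd, hNe]; field_simp
      _ ≤ 2 * H * (2 * H) * M ^ 2 * δ := by
        have : 0 ≤ H * M ^ 2 * δ := by positivity
        nlinarith
      _ = _ := by ring
  calc _ ≤ Real.sqrt M * ∑ t ∈ cube 2 N, Real.sqrt (2 / δ) / 2
        * (1 / (1 + |(P (gridPt x (ρ / (T * N)) t)).bivC l / δ|)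
          + 1 / (1 + |(P (gridPt x (ρ / (T * N)) t)).bivR l / δ|)) :=
        mul_le_mul_of_nonneg_left (Finset.sum_le_sum hpt) (Real.sqrt_nonneg _)
    _ = Real.sqrt M * (Real.sqrt (2 / δ) / 2 * (∑ t ∈ cube 2 N,
        1 / (1 + |(P (gridPt x (ρ / (T * N)) t)).bivC l / δ|) + ∑ t ∈ cube 2 N,
        1 / (1 + |(P (gridPt x (ρ / (T * N)) t)).bivR l / δ|))) := by
        rw [← Finset.mul_sum, Finset.sum_add_distrib]
    _ ≤ Real.sqrt M * (2 * H * M / Real.sqrt ((P x).bsize T l) / 2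
        * (N * (32 / (ρ / (2 * K)) * Real.sqrt M) + N * (32 / (ρ / (2 * K)) * Real.sqrt M))) := by
        gcongr
    _ = (Real.sqrt M * Real.sqrt M) * (128 * K * H / ρ * (N * M))
        / Real.sqrt ((P x).bsize T l) := by field_simp; ring
    _ = _ := by rw [Real.mul_self_sqrt hM0.le, hNe]; ring

end Grid

end AdaptedFrames

namespace AdaptedFrames

variable {P : (Fin 2 → ℝ) → Frame 2} {U : Set (Fin 2 → ℝ)} {K θ : ℝ}
  {B' B : (Fin 2 → ℝ) →ₗ[ℝ] (Fin 2 → ℝ)}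

/-- For symmetric `B`, the matrix `r + c * rot B` has a large entry. -/
lemma exists_entry_ge (F : AdaptedFrames P U K θ B' B) (hB : ∀ h k, B h ⬝ᵥ k = h ⬝ᵥ B k)
    (r c : ℝ) : ∃ k e : Fin 2, |r| + |c|
      ≤ 3 * K * |(r • (Pi.single e 1 : Fin 2 → ℝ) + c • rot (B (Pi.single e 1))) k| := by
  have hK := F.one_le
  by_contra! h
  have h00 := h 0 0
  have h10 := h 1 0
  have h01 := h 0 1
  have h11 := h 1 1
  have hs := hB (Pi.single 0 1) (Pi.single 1 1)
  obtain ⟨e, he⟩ := F.eta_dual (Pi.single 0 1)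
  rw [Pi.norm_single, norm_one] at he
  simp at h00 h10 h01 h11 hs he
  set S := |r| + |c|
  have hS0 : 0 ≤ |r| := abs_nonneg r
  have hr : 3 * K * |r| ≤ S := by
    have h2 : 2 * |r| ≤ |r + -(c * B (Pi.single 0 1) 1)| + |r + c * B (Pi.single 1 1) 0| := by
      rw [← abs_two, ← abs_mul]
      refine le_trans (le_of_eq ?_) (abs_add_le _ _)
      rw [hs]; ring_nf
    nlinarith
  have hr3 : 3 * |r| ≤ S := by nlinarith
  fin_cases e
  · simp at he
    have : |c| ≤ K * (|c| * |B (Pi.single 0 1) 0|) := by nlinarith [abs_nonneg c]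
    have hSd : S = |r| + |c| := rfl
    linarith
  · simp at he
    have h3 : |c| * |B (Pi.single 1 1) 0| ≤ |r + c * B (Pi.single 1 1) 0| + |r| := by
      rw [← abs_mul]
      have := abs_sub (r + c * B (Pi.single 1 1) 0) r
      rwa [add_sub_cancel_left] at this
    have : |c| ≤ K * (|c| * |B (Pi.single 1 1) 0|) := by nlinarith [abs_nonneg c]
    have h4 := mul_le_mul_of_nonneg_left h3 (by linarith : 0 ≤ K)
    have hSd : S = |r| + |c| := rfl
    linarith

/-- Growth of the last coordinates of a bivector when the middle ones are dominant. -/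
lemma exists_bivP_expand (F : AdaptedFrames P U K θ (-LinearMap.id) B)
    (hB : ∀ h k, B h ⬝ᵥ k = h ⬝ᵥ B k) (hxi : ∀ x, (P x).xi = -x) {x : Fin 2 → ℝ} (hx : x ∈ U)
    (l : Biv) {R : ℝ} (hR : 1000 * K ^ 2 * (R * ‖l.d‖) ≤ |(P x).bivR l| + |(P x).bivC l|) :
    ∃ k e : Fin 2, ∀ y ∈ U, ∀ z ∈ U, ∀ s : ℝ, ‖y - x‖ ≤ R → |s| ≤ R →
      z - y = s • Pi.single e 1 → |s| * (|(P x).bivR l| + |(P x).bivC l|)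
        ≤ 4 * K * |(P z).bivP l k - (P y).bivP l k| := by
  have hK := F.one_le
  set r := (P x).bivR l
  set c := (P x).bivC l
  set D := ‖l.d‖ with hD
  obtain ⟨k, e, hke⟩ := F.exists_entry_ge hB r c
  refine ⟨k, e, fun y hy z hz s hyR hsR hs => ?_⟩
  have hn : ‖z - y‖ = |s| := by rw [hs, norm_smul, Pi.norm_single]; simp
  have hD0 : 0 ≤ D := norm_nonneg _
  have hs0 := abs_nonneg s
  set E : Fin 2 → ℝ := Pi.single e 1 with hE
  have hEk : ∀ k, |E k| ≤ 1 := fun k => by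
    have := norm_le_pi_norm E k
    rwa [hE, Pi.norm_single, norm_one] at this
  have b1 : |(P y).bivR l - r| ≤ 4 * K * (R * D) := by
    refine (F.abs_bivR_sub_le hx hy l).trans ?_
    gcongr
  have b2 : |(P y).bivC l - c| ≤ 2 * (R * D) := by
    refine (abs_bivC_sub_le hxi x y l).trans ?_
    gcongr
  have b3 : |((P z).eta - (P y).eta) ⬝ᵥ l.d| ≤ 4 * K * (R * D) := by
    refine (F.abs_eta_sub_dotProduct_le hy hz l).trans ?_
    rw [hn]; gcongr
  have b4 : |(P z).zeta - (P y).zeta - (P y).xi ⬝ᵥ ((P z).eta - (P y).eta)| ≤ K * (|s| * R) := by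
    refine (F.zeta_approx y hy z hz).trans ?_
    rw [hn, sq]; gcongr
  have b5 : ‖(P z).eta - (P y).eta‖ ≤ 2 * K * |s| := by
    have := F.eta_lip one_le_two hy hz
    rwa [hn] at this
  have b6 := F.eta_approx y hy z hz
  rw [hn] at b6
  have hBs : B (z - y) = s • B E := by rw [hs, map_smul]
  have hxs : (P z).xi - (P y).xi = -(s • E) := by rw [hxi, hxi, ← hs]; abel
  set Δη := (P z).eta - (P y).eta with hΔ
  set ε := (P z).zeta - (P y).zeta - (P y).xi ⬝ᵥ Δη with hε
  have main : s * ((r • E + c • rot (B E)) k) = ((P z).bivP l k - (P y).bivP l k)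
      - s * ((P y).bivR l - r) * E k - ((P y).bivC l - c) * rot Δη k
      - c * rot (Δη - B (z - y)) k - s * (Δη ⬝ᵥ l.d) * E k - ε * l.d k := by
    rw [Frame.bivP_sub (P := P y), ← hΔ, ← hε, hxs, hBs]
    fin_cases k <;> simp <;> ring
  have t1 : |s * ((P y).bivR l - r) * E k| ≤ |s| * (4 * K * (R * D)) := by
    rw [abs_mul, abs_mul]
    have := mul_le_mul b1 (hEk k) (abs_nonneg _) (by linarith [abs_nonneg ((P y).bivR l - r)])
    rw [mul_assoc]
    exact mul_le_mul_of_nonneg_left (by linarith) hs0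
  have t2 : |((P y).bivC l - c) * rot Δη k| ≤ 2 * (R * D) * (2 * K * |s|) := by
    rw [abs_mul]
    have : |rot Δη k| ≤ 2 * K * |s| := by
      refine (norm_le_pi_norm (rot Δη) k).trans ?_
      rwa [norm_rot]
    exact mul_le_mul b2 this (abs_nonneg _) (by linarith [abs_nonneg ((P y).bivC l - c)])
  have t3 : |c * rot (Δη - B (z - y)) k| ≤ (|r| + |c|) * (θ * |s|) := by
    rw [abs_mul]
    have : |rot (Δη - B (z - y)) k| ≤ θ * |s| := by
      refine (norm_le_pi_norm (rot (Δη - B (z - y))) k).trans ?_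
      rwa [norm_rot]
    exact mul_le_mul (by linarith [abs_nonneg r]) this (abs_nonneg _) (by positivity)
  have t4 : |s * (Δη ⬝ᵥ l.d) * E k| ≤ |s| * (4 * K * (R * D)) := by
    rw [abs_mul, abs_mul]
    have := mul_le_mul b3 (hEk k) (abs_nonneg _) (by linarith [abs_nonneg (Δη ⬝ᵥ l.d)])
    rw [mul_assoc]
    exact mul_le_mul_of_nonneg_left (by linarith) hs0
  have t5 : |ε * l.d k| ≤ K * (|s| * R) * D := by
    rw [abs_mul]
    exact mul_le_mul b4 (norm_le_pi_norm l.d k) (abs_nonneg _)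
      (by linarith [abs_nonneg ε])
  have tot : |s| * |(r • E + c • rot (B E)) k| ≤ |(P z).bivP l k - (P y).bivP l k|
      + |s| * (4 * K * (R * D)) + 2 * (R * D) * (2 * K * |s|) + (|r| + |c|) * (θ * |s|)
      + |s| * (4 * K * (R * D)) + K * (|s| * R) * D := by
    rw [← abs_mul, main]
    refine (abs_sub _ _).trans (add_le_add ?_ t5)
    refine (abs_sub _ _).trans (add_le_add ?_ t4)
    refine (abs_sub _ _).trans (add_le_add ?_ t3)
    refine (abs_sub _ _).trans (add_le_add ?_ t2)
    exact (abs_sub _ _).trans (add_le_add le_rfl t1)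
  have hS := mul_le_mul_of_nonneg_left hke hs0
  have hθ := F.theta_mul_le one_le_two
  set S := |r| + |c|
  have hS0 : 0 ≤ S := by positivity
  have tot' : |s| * |(r • E + c • rot (B E)) k| ≤ |(P z).bivP l k - (P y).bivP l k|
      + 13 * K * (R * D) * |s| + S * θ * |s| := by linarith
  have u1 := mul_le_mul_of_nonneg_left tot' (by linarith : 0 ≤ 3 * K)
  have u2 := mul_le_mul_of_nonneg_right hR hs0
  have u3 : θ * K * (S * |s|) ≤ 1 / 16 * (S * |s|) :=
    mul_le_mul_of_nonneg_right hθ (by positivity)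
  have u4 : 3 * K * (13 * K * (R * D) * |s|) = 39 / 1000 * (1000 * K ^ 2 * (R * D) * |s|) := by
    ring
  have u5 : 0 ≤ K * |(P z).bivP l k - (P y).bivP l k| := by positivity
  linarith

section Grid

variable {ρ T : ℝ} {x : Fin 2 → ℝ} {l : Biv}

lemma sum_inv_bsize_le_of_middle (F : AdaptedFrames P U K θ (-LinearMap.id) B)
    (hB : ∀ h k, B h ⬝ᵥ k = h ⬝ᵥ B k) (hxi : ∀ x, (P x).xi = -x) (hρ : 0 < ρ) (hρ1 : ρ ≤ 1)
    (hT : 0 < T) (hU : Metric.closedBall x (ρ / T) ⊆ U)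
    (hd : ‖l.d‖ / T * (16000 * K ^ 3) ≤ (P x).bsize T l)
    (hV : (P x).bsize T l ≤ 16 * K * (|(P x).bivR l| + |(P x).bivC l|))
    (hV0 : 0 < (P x).bsize T l) {N : ℕ} (hN : 1 ≤ N) :
    ∑ t ∈ cube 2 N, 1 / (P (gridPt x (ρ / (T * N)) t)).bsize (T * N) l
      ≤ 512 * K ^ 2 / ρ * (N * Real.sqrt N) / (P x).bsize T l := by
  have hK := F.one_le
  have hN0 : (0 : ℝ) < N := by exact_mod_cast hN
  set V := (P x).bsize T l
  set S := |(P x).bivR l| + |(P x).bivC l| with hS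
  have hS0 : 0 < S := by
    by_contra h
    have : 16 * K * S ≤ 0 := mul_nonpos_of_nonneg_of_nonpos (by positivity) (not_lt.1 h)
    linarith
  have hx : x ∈ U := hU (Metric.mem_closedBall_self (by positivity))
  have hmem : ∀ t ∈ cube 2 N, gridPt x (ρ / (T * N)) t ∈ U := fun t ht =>
    hU (gridPt_mem_closedBall x hρ.le hT ht)
  have hdist : ∀ t ∈ cube 2 N, ‖gridPt x (ρ / (T * N)) t - x‖ ≤ ρ / T := fun t ht =>
    mem_closedBall_iff_norm.1 (gridPt_mem_closedBall x hρ.le hT ht)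
  have hR : 1000 * K ^ 2 * (ρ / T * ‖l.d‖) ≤ S := by
    have h1 : 16 * K * (1000 * K ^ 2 * (‖l.d‖ / T)) ≤ 16 * K * S := by
      refine le_trans (le_of_eq ?_) (hd.trans hV); ring
    have h2 := le_of_mul_le_mul_left h1 (by positivity)
    have h3 : ρ / T * ‖l.d‖ ≤ ‖l.d‖ / T := by
      rw [div_mul_eq_mul_div]; gcongr; exact mul_le_of_le_one_left (norm_nonneg _) hρ1
    exact le_trans (by gcongr) h2
  obtain ⟨k, e, hke⟩ := F.exists_bivP_expand hB hxi hx l hR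
  have key := sum_cube_le_of_line (N := N) e
    (fun t => 1 / (P (gridPt x (ρ / (T * N)) t)).bsize (T * N) l)
    (S := 512 * K ^ 2 / (ρ * V) * Real.sqrt N) fun t ht => by
      have hupd : ∀ i < N, Function.update t e i ∈ cube 2 N := fun i hi => update_mem_cube ht e hi
      have hc : 0 < ρ * S / (4 * K) := by positivity
      refine (sum_inv_line_le (a := S / 2) (c := ρ * S / (4 * K)) (g := fun i =>
        T * N * (P (gridPt x (ρ / (T * N)) (Function.update t e i))).bivP l k) hc ?_ ?_ ?_).trans ?_
      · rw [div_div, div_le_div_iff₀ (by positivity) (by norm_num)]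
        nlinarith
      · intro i hi j hj
        have h := hke _ (hmem _ (hupd j hj)) _ (hmem _ (hupd i hi)) _ (hdist _ (hupd j hj))
          (abs_step_le hρ.le hT hi hj) (gridPt_update_sub x (ρ / (T * N)) t e i j)
        rw [abs_mul, abs_of_pos (by positivity : 0 < ρ / (T * N))] at h
        rw [← mul_sub, abs_mul, abs_of_pos (by positivity : 0 < T * N), div_mul_eq_mul_div,
          div_le_iff₀ (by positivity)]
        have h2 := mul_le_mul_of_nonneg_left h (by positivity : 0 ≤ T * N)
        calc ρ * S * |(i : ℝ) - j| = T * N * (ρ / (T * N) * |(i : ℝ) - j| * S) := by field_simp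
          _ ≤ _ := h2
          _ = _ := by ring
      · intro i hi
        set y := gridPt x (ρ / (T * N)) (Function.update t e i)
        have hy : ‖y - x‖ ≤ ρ / T := hdist _ (hupd i hi)
        have c1 := F.abs_bivR_sub_le hx (hmem _ (hupd i hi)) l
        have c2 := abs_bivC_sub_le hxi x y l
        have c3 : ‖y - x‖ * ‖l.d‖ ≤ ρ / T * ‖l.d‖ := by gcongr
        have c4 : 1000 * K ^ 2 * (‖y - x‖ * ‖l.d‖) ≤ S := le_trans (by gcongr) hR
        have c5 : T * N * |(P y).bivP l k| ≤ T * N * ‖(P y).bivP l‖ := by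
          gcongr; exact norm_le_pi_norm ((P y).bivP l) k
        have c6 := abs_sub_abs_le_abs_sub ((P x).bivR l) ((P y).bivR l)
        have c7 := abs_sub_abs_le_abs_sub ((P x).bivC l) ((P y).bivC l)
        rw [abs_sub_comm] at c6 c7
        have c8 : 0 ≤ ‖y - x‖ * ‖l.d‖ := by positivity
        have c9 : 0 ≤ ‖l.d‖ / (T * N) := by positivity
        have c10 : (4 * K + 2) * (‖y - x‖ * ‖l.d‖) ≤ S / 2 := by nlinarith
        rw [abs_mul, abs_of_pos (by positivity : 0 < T * N), Frame.bsize]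
        linarith
      · rw [div_div_eq_mul_div]
        refine mul_le_mul_of_nonneg_right ?_ (Real.sqrt_nonneg _)
        rw [div_le_div_iff₀ (by positivity) (by positivity)]
        have := mul_le_mul_of_nonneg_left hV (by positivity : 0 ≤ 32 * K * ρ)
        linarith
  have h2 : (N : ℝ) ^ 2 * (512 * K ^ 2 / (ρ * V) * Real.sqrt N)
      = N * (512 * K ^ 2 / ρ * (N * Real.sqrt N) / V) := by field_simp
  rw [h2] at key
  exact le_of_mul_le_mul_left key hN0

lemma sum_inv_bsize_le_of_last (F : AdaptedFrames P U K θ (-LinearMap.id) B)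
    (hxi : ∀ x, (P x).xi = -x) (hρ : 0 < ρ) (hρ1 : ρ ≤ 1)
    (hT : 0 < T) (hU : Metric.closedBall x (ρ / T) ⊆ U)
    (hd : ‖l.d‖ / T * (16000 * K ^ 3) ≤ (P x).bsize T l)
    (hS : 16 * K * (|(P x).bivR l| + |(P x).bivC l|) ≤ (P x).bsize T l)
    (hV0 : 0 < (P x).bsize T l) {N : ℕ} (hN : 1 ≤ N) :
    ∑ t ∈ cube 2 N, 1 / (P (gridPt x (ρ / (T * N)) t)).bsize (T * N) l
      ≤ 2 * (N * Real.sqrt N) / (P x).bsize T l := by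
  have hK := F.one_le
  have hN0 : (1 : ℝ) ≤ N := by exact_mod_cast hN
  have hx : x ∈ U := hU (Metric.mem_closedBall_self (by positivity))
  set V := (P x).bsize T l with hV
  have hlow : ∀ t ∈ cube 2 N, N * V / 2 ≤ (P (gridPt x (ρ / (T * N)) t)).bsize (T * N) l := by
    intro t ht
    set y := gridPt x (ρ / (T * N)) t
    have hy : y ∈ U := hU (gridPt_mem_closedBall x hρ.le hT ht)
    have hyn : T * ‖y - x‖ ≤ 1 := by
      have := mem_closedBall_iff_norm.1 (gridPt_mem_closedBall x hρ.le hT ht)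
      rw [le_div_iff₀ hT] at this
      linarith
    set h := ‖y - x‖ with hh
    have hh0 : 0 ≤ h := norm_nonneg _
    have hx1 : ‖(P x).xi - (P y).xi‖ = h := by rw [hxi, hxi, neg_sub_neg]
    have he1 : ‖(P x).eta - (P y).eta‖ ≤ 2 * K * h := by
      rw [norm_sub_rev]; exact F.eta_lip one_le_two hx hy
    have hd1 : |((P x).eta - (P y).eta) ⬝ᵥ l.d| ≤ 4 * K * (h * ‖l.d‖) := by
      have := F.abs_eta_sub_dotProduct_le hy hx l
      rwa [norm_sub_rev] at this
    have hz1 := F.zeta_approx x hx y hy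
    have hp : ‖(P x).bivP l‖ ≤ ‖(P y).bivP l‖ + |(P x).bivR l| * h + |(P x).bivC l| * (2 * K * h)
        + 4 * K * (h * ‖l.d‖) * h + K * h ^ 2 * ‖l.d‖ := by
      have e := Frame.bivP_sub (P := P x) (P' := P y) l
      have e' : (P x).bivP l = (P y).bivP l + (P x).bivR l • ((P y).xi - (P x).xi)
          - (P x).bivC l • rot ((P y).eta - (P x).eta)
          + (((P y).eta - (P x).eta) ⬝ᵥ l.d) • ((P y).xi - (P x).xi)
          - ((P y).zeta - (P x).zeta - (P x).xi ⬝ᵥ ((P y).eta - (P x).eta)) • l.d := by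
        rw [e]; abel
      rw [e']
      rw [norm_sub_rev] at hx1 he1
      have hd2 := F.abs_eta_sub_dotProduct_le hx hy l
      refine (norm_sub_le _ _).trans (add_le_add ?_ ?_)
      · refine (norm_add_le _ _).trans (add_le_add ?_ ?_)
        · refine (norm_sub_le _ _).trans (add_le_add ?_ ?_)
          · refine (norm_add_le _ _).trans (add_le_add le_rfl ?_)
            rw [norm_smul, hx1, Real.norm_eq_abs]
          · rw [norm_smul, norm_rot, Real.norm_eq_abs]
            gcongr
        · rw [norm_smul, hx1, Real.norm_eq_abs]
          gcongr
      · rw [norm_smul, Real.norm_eq_abs]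
        gcongr
    set D := ‖l.d‖ with hD
    have hDT : D = D / T * T := by field_simp
    set d := D / T with hdd
    have hd0 : 0 ≤ d := by positivity
    have hVe : V = d + |(P x).bivC l| + |(P x).bivR l| + T * ‖(P x).bivP l‖ := rfl
    have q1 := mul_le_mul_of_nonneg_left hp hT.le
    have r0 := abs_nonneg ((P x).bivR l)
    have c0 := abs_nonneg ((P x).bivC l)
    have q2 : T * (|(P x).bivR l| * h) ≤ |(P x).bivR l| := by
      calc _ = |(P x).bivR l| * (T * h) := by ring
        _ ≤ _ := mul_le_of_le_one_right r0 hyn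
    have q3 : T * (|(P x).bivC l| * (2 * K * h)) ≤ 2 * K * |(P x).bivC l| := by
      calc _ = 2 * K * |(P x).bivC l| * (T * h) := by ring
        _ ≤ _ := mul_le_of_le_one_right (by positivity) hyn
    have q4 : T * (4 * K * (h * D) * h + K * h ^ 2 * D) ≤ 5 * K * d := by
      calc _ = 5 * K * d * (T * h) ^ 2 := by rw [hDT]; ring
        _ ≤ _ := mul_le_of_le_one_right (by positivity) (pow_le_one₀ (by positivity) hyn)
    have q5 : d * (16000 * K) ≤ V := by
      refine le_trans ?_ hd
      have : K ≤ K ^ 3 := by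
        have := one_le_pow₀ hK (n := 2)
        nlinarith
      gcongr
    have q7 : |(P x).bivR l| ≤ K * |(P x).bivR l| := le_mul_of_one_le_left r0 hK
    have q8 : |(P x).bivC l| ≤ K * |(P x).bivC l| := le_mul_of_one_le_left c0 hK
    have q9 : d ≤ K * d := le_mul_of_one_le_left hd0 hK
    have q6 : V / 2 ≤ T * ‖(P y).bivP l‖ := by linarith
    refine le_trans ?_ (Frame.bivP_le_bsize (P := P y) (by positivity) l)
    calc (N : ℝ) * V / 2 = N * (V / 2) := by ring
      _ ≤ N * (T * ‖(P y).bivP l‖) := by gcongr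
      _ = _ := by ring
  calc _ ≤ ∑ t ∈ cube 2 N, 1 / (N * V / 2) := Finset.sum_le_sum fun t ht =>
        one_div_le_one_div_of_le (by positivity) (hlow t ht)
    _ = 2 * (N * 1) / V := by
        rw [Finset.sum_const, card_cube, nsmul_eq_mul]; push_cast; field_simp
    _ ≤ _ := by
        gcongr
        rw [Real.one_le_sqrt]; exact hN0

/-- Averages of negative powers of norms of bivectors over refined grids. -/
theorem exists_sum_inv_bsize_le (F : AdaptedFrames P U K θ (-LinearMap.id) B)
    (hB : ∀ h k, B h ⬝ᵥ k = h ⬝ᵥ B k) (hxi : ∀ x, (P x).xi = -x) (hρ : 0 < ρ) (hρ1 : ρ ≤ 1) :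
    ∃ C : ℝ, 1 ≤ C ∧ ∀ (x : Fin 2 → ℝ) (T : ℝ), 0 < T →
      Metric.closedBall x (ρ / T) ⊆ U → ∀ l : Biv, l.Dec → l ≠ 0 →
      (∀ N : ℕ, 1 ≤ N → ∑ t ∈ cube 2 N, 1 / (P (gridPt x (ρ / (T * N)) t)).bsize (T * N) l
        ≤ C * N ^ 2 / (P x).bsize T l) ∧
      (∀ M : ℕ, 1 ≤ M → Real.sqrt M * ∑ t ∈ cube 2 (M * M), Real.sqrt
        (1 / (P (gridPt x (ρ / (T * (M * M : ℕ))) t)).bsize (T * (M * M : ℕ)) l)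
        ≤ C * ((M * M : ℕ) : ℝ) ^ 2 / Real.sqrt ((P x).bsize T l)) := by
  have hK := F.one_le
  set H : ℝ := 16000 * K ^ 3 with hH
  have hH1 : 1 ≤ H := by
    have := one_le_pow₀ hK (n := 3)
    linarith
  set C₁ : ℝ := 512 * K ^ 2 / ρ with hC₁
  set C₂ : ℝ := 128 * K ^ 2 * H / ρ ^ 2 with hC₂
  set C₃ : ℝ := 128 * K * H / ρ with hC₃
  have hC₁1 : 2 ≤ C₁ := by
    rw [hC₁, le_div_iff₀ hρ]
    have := one_le_pow₀ hK (n := 2)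
    linarith
  have hC₂0 : 0 ≤ C₂ := by positivity
  have hC₃0 : 0 ≤ C₃ := by positivity
  refine ⟨C₁ + C₂ + C₃, by linarith, fun x T hT hU l hl hl0 => ?_⟩
  have hV0 := (P x).bsize_pos hT hl0
  set V := (P x).bsize T l with hV
  rcases le_total V (‖l.d‖ / T * H) with h | h
  · have hd : 0 < ‖l.d‖ := by
      by_contra hd
      have : ‖l.d‖ = 0 := le_antisymm (not_lt.1 hd) (norm_nonneg _)
      rw [this] at h; simp at h; linarith
    refine ⟨fun N hN => ?_, fun M hM => ?_⟩
    · refine (F.sum_inv_bsize_le_of_large hxi hρ hρ1 hT hU hl hd hV0 h hN).trans ?_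
      rw [← hV, ← hC₂]; gcongr; linarith
    · refine (F.sum_sqrt_inv_bsize_le_of_large hxi hρ hρ1 hT hU hl hd hH1 hV0 h hM).trans ?_
      rw [← hV, ← hC₃]; gcongr; linarith
  have key : ∀ N : ℕ, 1 ≤ N → ∑ t ∈ cube 2 N, 1 / (P (gridPt x (ρ / (T * N)) t)).bsize (T * N) l
      ≤ C₁ * (N * Real.sqrt N) / V := by
    intro N hN
    rcases le_total V (16 * K * (|(P x).bivR l| + |(P x).bivC l|)) with h' | h'
    · exact F.sum_inv_bsize_le_of_middle hB hxi hρ hρ1 hT hU h h' hV0 hN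
    · refine (F.sum_inv_bsize_le_of_last hxi hρ hρ1 hT hU h h' hV0 hN).trans ?_
      rw [← hV]; gcongr
  refine ⟨fun N hN => (key N hN).trans ?_, fun M hM => ?_⟩
  · have hN0 : (1 : ℝ) ≤ N := by exact_mod_cast hN
    rw [sq]
    gcongr
    · linarith
    · rw [Real.sqrt_le_left (by positivity)]; nlinarith
  · have hM0 : (1 : ℝ) ≤ M := by exact_mod_cast hM
    have hk := key (M * M) (Nat.mul_pos hM hM)
    have hNe : ((M * M : ℕ) : ℝ) = M * M := by push_cast; ring
    have hb : ∀ t ∈ cube 2 (M * M), 0 ≤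
        1 / (P (gridPt x (ρ / (T * (M * M : ℕ))) t)).bsize (T * (M * M : ℕ)) l := fun t _ => by
      have := (P (gridPt x (ρ / (T * (M * M : ℕ))) t)).bsize_nonneg
          (T := T * (M * M : ℕ)) (by positivity) l
      positivity
    set b : (Fin 2 → ℕ) → ℝ := fun t =>
      1 / (P (gridPt x (ρ / (T * (M * M : ℕ))) t)).bsize (T * (M * M : ℕ)) l with hbd
    change ∑ t ∈ cube 2 (M * M), b t ≤ _ at hk
    change ∀ t ∈ cube 2 (M * M), 0 ≤ b t at hb
    change Real.sqrt M * ∑ t ∈ cube 2 (M * M), Real.sqrt (b t) ≤ _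
    have cs : (∑ t ∈ cube 2 (M * M), Real.sqrt (b t)) ^ 2
        ≤ ((M * M : ℕ) : ℝ) ^ 2 * ∑ t ∈ cube 2 (M * M), b t := by
      refine (sq_sum_le_card_mul_sum_sq).trans (le_of_eq ?_)
      rw [card_cube]; push_cast
      congr 1
      exact Finset.sum_congr rfl fun t ht => Real.sq_sqrt (hb t ht)
    refine abs_le_of_sq_le_sq' ?_ (by positivity) |>.2
    rw [mul_pow, Real.sq_sqrt (by positivity), div_pow, Real.sq_sqrt hV0.le]
    rw [hNe] at *
    rw [Real.sqrt_mul_self (by positivity)] at hk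
    calc (M : ℝ) * (∑ t ∈ cube 2 (M * M), Real.sqrt (b t)) ^ 2
        ≤ M * (((M : ℝ) * M) ^ 2 * (C₁ * ((M : ℝ) * M * M) / V)) := by
          refine mul_le_mul_of_nonneg_left (cs.trans ?_) (by positivity)
          exact mul_le_mul_of_nonneg_left hk (by positivity)
      _ = C₁ * (((M : ℝ) * M) ^ 2) ^ 2 / V := by ring
      _ ≤ _ := by
          rw [mul_pow (C₁ + C₂ + C₃)]
          gcongr
          nlinarith

end Grid

end AdaptedFrames

/-! ### Reciprocals of minima -/

namespace Frame

/-- The reciprocal of the minimal size of a nonzero integer vector. -/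
noncomputable def alpha {m : ℕ} (P : Frame m) (T : ℝ) : ℝ :=
  1 / sInf (P.size T '' {v : IVec m | v ≠ 0})

/-- The reciprocal of the minimal size of a nonzero decomposable integer bivector. -/
noncomputable def beta (P : Frame 2) (T : ℝ) : ℝ :=
  1 / sInf (P.bsize T '' {l : Biv | l.Dec ∧ l ≠ 0})

variable {T : ℝ}

lemma exists_alpha_eq {m : ℕ} (P : Frame m) (hT : 0 < T) :
    ∃ v : IVec m, v ≠ 0 ∧ P.alpha T = 1 / P.size T v ∧ ∀ w ≠ 0, P.size T v ≤ P.size T w := by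
  obtain ⟨v, hv, h⟩ := P.exists_min_size hT
  refine ⟨v, hv, ?_, h⟩
  have : IsLeast (P.size T '' {v : IVec m | v ≠ 0}) (P.size T v) :=
    ⟨⟨v, hv, rfl⟩, by rintro _ ⟨w, hw, rfl⟩; exact h w hw⟩
  rw [alpha, this.csInf_eq]

lemma exists_beta_eq (P : Frame 2) (hT : 0 < T) :
    ∃ l : Biv, l.Dec ∧ l ≠ 0 ∧ P.beta T = 1 / P.bsize T l ∧
      ∀ l' : Biv, l'.Dec → l' ≠ 0 → P.bsize T l ≤ P.bsize T l' := by
  obtain ⟨l, ⟨hl, hl0⟩, h⟩ := P.exists_min_bsize hT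
  refine ⟨l, hl, hl0, ?_, h⟩
  have : IsLeast (P.bsize T '' {l : Biv | l.Dec ∧ l ≠ 0}) (P.bsize T l) :=
    ⟨⟨l, ⟨hl, hl0⟩, rfl⟩, by rintro _ ⟨w, hw, rfl⟩; exact h w hw.1 hw.2⟩
  rw [beta, this.csInf_eq]

lemma alpha_pos {m : ℕ} (P : Frame m) (hT : 0 < T) : 0 < P.alpha T := by
  obtain ⟨v, hv, h, -⟩ := P.exists_alpha_eq hT
  rw [h]
  exact one_div_pos.2 (P.size_pos hT hv)

lemma beta_pos (P : Frame 2) (hT : 0 < T) : 0 < P.beta T := by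
  obtain ⟨l, -, hl, h, -⟩ := P.exists_beta_eq hT
  rw [h]
  exact one_div_pos.2 (P.bsize_pos hT hl)

lemma one_div_size_le_alpha {m : ℕ} (P : Frame m) (hT : 0 < T) {v : IVec m} (hv : v ≠ 0) :
    1 / P.size T v ≤ P.alpha T := by
  obtain ⟨w, hw, h, hmin⟩ := P.exists_alpha_eq hT
  rw [h]
  exact one_div_le_one_div_of_le (P.size_pos hT hw) (hmin v hv)

lemma one_div_bsize_le_beta (P : Frame 2) (hT : 0 < T) {l : Biv} (hl : l.Dec) (hl0 : l ≠ 0) :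
    1 / P.bsize T l ≤ P.beta T := by
  obtain ⟨l', -, hl', h, hmin⟩ := P.exists_beta_eq hT
  rw [h]
  exact one_div_le_one_div_of_le (P.bsize_pos hT hl') (hmin l hl hl0)

lemma one_le_alpha_mul_size {m : ℕ} (P : Frame m) (hT : 0 < T) {v : IVec m} (hv : v ≠ 0) :
    1 ≤ P.alpha T * P.size T v := by
  have := P.one_div_size_le_alpha hT hv
  rwa [div_le_iff₀ (P.size_pos hT hv)] at this

lemma one_le_beta_mul_bsize (P : Frame 2) (hT : 0 < T) {l : Biv} (hl : l.Dec) (hl0 : l ≠ 0) :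
    1 ≤ P.beta T * P.bsize T l := by
  have := P.one_div_bsize_le_beta hT hl hl0
  rwa [div_le_iff₀ (P.bsize_pos hT hl0)] at this

lemma beta_dual_le (P : Frame 2) (hT : 0 < T) : P.dual.beta T ≤ P.beta T := by
  obtain ⟨l, hl, hl0, h, -⟩ := P.dual.exists_beta_eq hT
  rw [h, ← bsize_star]
  refine P.one_div_bsize_le_beta hT hl.star fun h0 => hl0 ?_
  have h1 := congrArg Prod.fst h0
  have h2 := congrArg (fun a => a.2.1) h0
  have h3 := congrArg (fun a => a.2.2.1) h0
  have h4 := congrArg (fun a => a.2.2.2) h0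
  simp only [Biv.star, Prod.fst_zero, Prod.snd_zero] at h1 h2 h3 h4
  refine Prod.ext ?_ (Prod.ext h3 (Prod.ext (neg_eq_zero.1 h2) ?_))
  · ext i
    have e0 := congrFun h1 0
    have e1 := congrFun h1 1
    simp at e0 e1
    fin_cases i <;> simpa
  · ext i
    have e0 := congrFun h4 0
    have e1 := congrFun h4 1
    simp at e0 e1
    fin_cases i <;> simpa

lemma size_smul {m : ℕ} (P : Frame m) (a : ℤ) (v : IVec m) :
    P.size T (a • v) = |(a : ℝ)| * P.size T v := by
  have e1 : P.horiz (a • v) = (a : ℝ) • P.horiz v := by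
    ext i; simp [horiz]; ring
  have e2 : P.vert (a • v) = a * P.vert v := by
    have : (fun i => (((a • v).2.1 i : ℤ) : ℝ)) = (a : ℝ) • fun i => ((v.2.1 i : ℤ) : ℝ) := by
      ext i; simp
    simp only [vert, this, smul_dotProduct]
    simp; ring
  rw [size, size, e1, e2, norm_smul, abs_mul, Real.norm_eq_abs]
  simp [abs_mul]; ring

/-- Sizes of proportional vectors compare in the same way in all frames. -/
lemma size_le_of_smul_eq {m : ℕ} {v w : IVec m} {a b : ℤ} (hb : b ≠ 0)
    (h : a • v = b • w) {P P' : Frame m} {T T' : ℝ} (hT : 0 < T) (hT' : 0 < T')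
    (hv : v ≠ 0) (hP : P.size T v ≤ P.size T w) : P'.size T' v ≤ P'.size T' w := by
  have h1 : |(a : ℝ)| * P.size T v = |(b : ℝ)| * P.size T w := by rw [← size_smul, h, size_smul]
  have h2 : |(a : ℝ)| * P'.size T' v = |(b : ℝ)| * P'.size T' w := by
    rw [← size_smul, h, size_smul]
  have hb0 : 0 < |(b : ℝ)| := abs_pos.2 (by exact_mod_cast hb)
  have hab : |(b : ℝ)| ≤ |(a : ℝ)| := by
    by_contra! hc
    have := mul_lt_mul_of_pos_right hc (P.size_pos hT hv)
    have := mul_le_mul_of_nonneg_left hP hb0.le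
    linarith
  have := mul_le_mul_of_nonneg_right hab (P'.size_pos hT' hv).le
  rw [h2] at this
  exact le_of_mul_le_mul_left this hb0

lemma bsize_le_of_par {l l' : Biv} (h : Biv.Par l l') {P P' : Frame 2} {T T' : ℝ} (hT : 0 < T)
    (hT' : 0 < T') (hl : l ≠ 0) (hP : P.bsize T l ≤ P.bsize T l') :
    P'.bsize T' l ≤ P'.bsize T' l' := by
  obtain ⟨a, b, -, hb, h⟩ := h
  have h1 : |(a : ℝ)| * P.bsize T l = |(b : ℝ)| * P.bsize T l' := by
    rw [← bsize_smul, h, bsize_smul]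
  have h2 : |(a : ℝ)| * P'.bsize T' l = |(b : ℝ)| * P'.bsize T' l' := by
    rw [← bsize_smul, h, bsize_smul]
  have hb0 : 0 < |(b : ℝ)| := abs_pos.2 (by exact_mod_cast hb)
  have hab : |(b : ℝ)| ≤ |(a : ℝ)| := by
    by_contra! hc
    have := mul_lt_mul_of_pos_right hc (P.bsize_pos hT hl)
    have := mul_le_mul_of_nonneg_left hP hb0.le
    linarith
  have := mul_le_mul_of_nonneg_right hab (P'.bsize_pos hT' hl).le
  rw [h2] at this
  exact le_of_mul_le_mul_left this hb0

end Frame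

namespace AdaptedFrames

variable {P : (Fin 2 → ℝ) → Frame 2} {U : Set (Fin 2 → ℝ)} {K θ : ℝ}
  {B' B : (Fin 2 → ℝ) →ₗ[ℝ] (Fin 2 → ℝ)}

/-- Comparison of the sizes of a bivector at nearby points and different scales. -/
lemma bsize_le_of_near (F : AdaptedFrames P U K θ B' B) (hxi : ∀ x, (P x).xi = -x)
    {x y : Fin 2 → ℝ} (hx : x ∈ U) (hy : y ∈ U) {T L : ℝ} (hT : 0 < T) (hL : 1 ≤ L)
    (hxy : ‖y - x‖ ≤ 1 / T) (l : Biv) :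
    (P y).bsize T l ≤ 20 * K * L * (P x).bsize (T * L) l := by
  have hK := F.one_le
  set V := (P x).bsize (T * L) l
  have hTL : 0 < T * L := by positivity
  have hV0 : 0 ≤ V := (P x).bsize_nonneg hTL l
  have hn : T * ‖y - x‖ ≤ 1 := by rw [le_div_iff₀ hT] at hxy; linarith
  have d1 : ‖l.d‖ / T ≤ L * V := by
    have := (P x).norm_d_le_bsize hTL l
    rw [div_le_iff₀ hTL] at this
    rw [div_le_iff₀ hT]; linarith
  have d2 : ‖y - x‖ * ‖l.d‖ ≤ L * V := by
    calc ‖y - x‖ * ‖l.d‖ = (T * ‖y - x‖) * (‖l.d‖ / T) := by field_simp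
      _ ≤ 1 * (L * V) := by gcongr
      _ = _ := one_mul _
  have hVL : V ≤ L * V := le_mul_of_one_le_left hV0 hL
  have hLV : 0 ≤ L * V := by positivity
  have hKV : L * V ≤ K * (L * V) := le_mul_of_one_le_left hLV hK
  have c1 := abs_bivC_sub_le hxi x y l
  have c2 := (P x).bivC_le_bsize hTL l
  have r1 := F.abs_bivR_sub_le hx hy l
  have r2 := (P x).bivR_le_bsize hTL l
  have cc : |(P y).bivC l| ≤ V + 2 * (L * V) := by
    have := abs_add_le ((P y).bivC l - (P x).bivC l) ((P x).bivC l)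
    rw [sub_add_cancel] at this
    linarith
  have rr : |(P y).bivR l| ≤ V + 4 * K * (L * V) := by
    have := abs_add_le ((P y).bivR l - (P x).bivR l) ((P x).bivR l)
    rw [sub_add_cancel] at this
    have : 4 * K * (‖y - x‖ * ‖l.d‖) ≤ 4 * K * (L * V) := by gcongr
    linarith
  have hη := F.eta_lip one_le_two hx hy
  have e1 := F.abs_eta_sub_dotProduct_le hx hy l
  have e2 := F.zeta_approx x hx y hy
  have hxin : ‖(P y).xi - (P x).xi‖ = ‖y - x‖ := by rw [hxi, hxi, neg_sub_neg, norm_sub_rev]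
  have pp : T * ‖(P y).bivP l‖ ≤ V + V + 2 * K * V + 4 * K * (L * V) + K * (L * V) := by
    have p0 : T * ‖(P x).bivP l‖ ≤ V := by
      refine le_trans ?_ ((P x).bivP_le_bsize hTL l)
      gcongr
      exact le_mul_of_one_le_right hT.le hL
    rw [Frame.bivP_sub (P := P x)]
    set Δ := (P y).xi - (P x).xi
    set Δη := (P y).eta - (P x).eta
    set ε := (P y).zeta - (P x).zeta - (P x).xi ⬝ᵥ Δη
    have t : ‖(P x).bivP l - (P x).bivR l • Δ + (P x).bivC l • rot Δη - (Δη ⬝ᵥ l.d) • Δ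
        + ε • l.d‖ ≤ ‖(P x).bivP l‖ + |(P x).bivR l| * ‖y - x‖ + |(P x).bivC l| * ‖Δη‖
          + |Δη ⬝ᵥ l.d| * ‖y - x‖ + |ε| * ‖l.d‖ := by
      refine (norm_add_le _ _).trans (add_le_add ?_ (norm_smul_le _ _))
      refine (norm_sub_le _ _).trans (add_le_add ?_ ((norm_smul_le _ _).trans (by rw [hxin]; rfl)))
      refine (norm_add_le _ _).trans (add_le_add ?_
        ((norm_smul_le _ _).trans (by rw [norm_rot]; rfl)))
      exact (norm_sub_le _ _).trans (add_le_add le_rfl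
        ((norm_smul_le _ _).trans (by rw [hxin]; rfl)))
    have t1 : T * (|(P x).bivR l| * ‖y - x‖) ≤ V := by
      calc T * (|(P x).bivR l| * ‖y - x‖) = |(P x).bivR l| * (T * ‖y - x‖) := by ring
        _ ≤ V * 1 := by gcongr
        _ = V := mul_one V
    have t2 : T * (|(P x).bivC l| * ‖Δη‖) ≤ 2 * K * V := by
      calc T * (|(P x).bivC l| * ‖Δη‖) ≤ T * (V * (2 * K * ‖y - x‖)) := by gcongr
        _ = 2 * K * V * (T * ‖y - x‖) := by ring
        _ ≤ 2 * K * V * 1 := by gcongr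
        _ = _ := mul_one _
    have t3 : T * (|Δη ⬝ᵥ l.d| * ‖y - x‖) ≤ 4 * K * (L * V) := by
      calc T * (|Δη ⬝ᵥ l.d| * ‖y - x‖) = |Δη ⬝ᵥ l.d| * (T * ‖y - x‖) := by ring
        _ ≤ 4 * K * (L * V) * 1 := by
          refine mul_le_mul (e1.trans ?_) hn (by positivity) (by positivity)
          gcongr
        _ = _ := mul_one _
    have t4 : T * (|ε| * ‖l.d‖) ≤ K * (L * V) := by
      calc T * (|ε| * ‖l.d‖) ≤ T * (K * ‖y - x‖ ^ 2 * ‖l.d‖) := by gcongr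
        _ = K * (T * ‖y - x‖ * (‖y - x‖ * ‖l.d‖)) := by ring
        _ ≤ K * (1 * (L * V)) := by gcongr
        _ = _ := by ring
    have := mul_le_mul_of_nonneg_left t hT.le
    linarith
  have hKK : K * V ≤ K * (L * V) := by gcongr
  rw [Frame.bsize]
  linarith

end AdaptedFrames

/-! ### Averages of reciprocals of minima over nested grids -/

namespace Frame

variable {T : ℝ}

/-- A bivector which is neither short nor parallel to the shortest one controls the reciprocal
minima of the vectors and of the dual vectors. -/
lemma one_le_mul_bsize_of_not_par (P : Frame 2) (hT : 0 < T) {l l' : Biv} (hl : l.Dec)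
    (hl0 : l ≠ 0) (hl' : l'.Dec) (hl0' : l' ≠ 0) (hle : P.bsize T l ≤ P.bsize T l')
    (hpar : ¬ Biv.Par l l') :
    1 ≤ 6 * (1 + P.alpha T + P.dual.alpha T) * P.bsize T l' := by
  set b := P.bsize T l
  set b' := P.bsize T l'
  set a := P.alpha T
  set a' := P.dual.alpha T
  have hb : 0 < b := P.bsize_pos hT hl0
  have hb' : 0 < b' := P.bsize_pos hT hl0'
  have ha : 0 < a := P.alpha_pos hT
  have ha' : 0 < a' := P.dual.alpha_pos hT
  have hbb : b * b' ≤ b' * b' := mul_le_mul_of_nonneg_right hle hb'.le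
  refine one_le_sq_iff₀ (by positivity) |>.1 ?_
  have hab : 0 ≤ (a + a') * (b' * b') := by positivity
  rcases one_le_or_exists_size_mul_size_le hl hl' hl0 hl0' hpar P hT with h | ⟨v, u, hv, hu, h⟩
  · have : 0 ≤ (a + a') ^ 2 * (b' * b') := by positivity
    nlinarith
  · have h1 := P.one_le_alpha_mul_size hT hv
    have h2 := P.dual.one_le_alpha_mul_size hT hu
    have h3 : 1 ≤ a * a' * (P.size T v * P.dual.size T u) := by
      calc (1 : ℝ) ≤ (a * P.size T v) * (a' * P.dual.size T u) :=
            one_le_mul_of_one_le_of_one_le h1 h2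
        _ = _ := by ring
    have h4 := mul_le_mul_of_nonneg_left (h.trans (mul_le_mul_of_nonneg_left hbb (by norm_num)))
      (by positivity : 0 ≤ a * a')
    have h5 : a * a' ≤ (1 + a + a') ^ 2 := by nlinarith
    have h6 := mul_le_mul_of_nonneg_right h5 (by positivity : 0 ≤ 36 * (b' * b'))
    calc (1 : ℝ) ≤ a * a' * (36 * (b' * b')) := h3.trans h4
      _ ≤ _ := h6
      _ = _ := by ring

end Frame

namespace GridFrames

section General

variable {m : ℕ} {P : (Fin m → ℝ) → Frame m} {U : Set (Fin m → ℝ)} {K θ : ℝ}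
  {B' B : (Fin m → ℝ) →ₗ[ℝ] (Fin m → ℝ)} {x : Fin m → ℝ} {ρ : ℝ} {Λ k : ℕ} {r t : Fin m → ℕ}

lemma node_succ_mem (G : GridFrames P U K θ B' B x ρ Λ) (hr : r ∈ cube m (Λ ^ k))
    (ht : t ∈ cube m Λ) : node x ρ Λ (k + 1) (fun i => Λ * r i + t i) ∈ U := by
  have := child_mem_cube (j := 1) hr (by rwa [pow_one])
  simp only [pow_one] at this
  exact G.node_mem this

lemma node_succ_sub_le (G : GridFrames P U K θ B' B x ρ Λ) (r : Fin m → ℕ) (ht : t ∈ cube m Λ) :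
    ‖node x ρ Λ k r - node x ρ Λ (k + 1) (fun i => Λ * r i + t i)‖ ≤ 1 / (Λ : ℝ) ^ k := by
  have := G.node_sub_le (k := k) (j := 1) r (t := t) (by rwa [pow_one])
  rw [norm_sub_rev]
  simpa only [pow_one] using this

lemma size_le_size_succ (G : GridFrames P U K θ B' B x ρ Λ) (hr : r ∈ cube m (Λ ^ k))
    (ht : t ∈ cube m Λ) (v : IVec m) : (P (node x ρ Λ k r)).size ((Λ : ℝ) ^ k) v ≤
      12 * m * K * Λ * (P (node x ρ Λ (k + 1) fun i => Λ * r i + t i)).size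
        ((Λ : ℝ) ^ (k + 1)) v := by
  have hm : 1 ≤ m := by have := G.two_le_dim; omega
  have hΛ := G.scale_pos
  have hΛ1 : (1 : ℝ) ≤ Λ := by simpa using G.one_le_scale_pow 1
  have hK := G.one_le
  set V := (P (node x ρ Λ (k + 1) fun i => Λ * r i + t i)).size ((Λ : ℝ) ^ (k + 1)) v
  have hV : 0 ≤ V := Frame.size_nonneg _ (by positivity) _
  have h1 : |(v.1 : ℝ)| ≤ Λ * V * (Λ : ℝ) ^ k := by
    have := Frame.abs_div_le_size (T := (Λ : ℝ) ^ (k + 1))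
      (P (node x ρ Λ (k + 1) fun i => Λ * r i + t i)) (by positivity) v
    rw [div_le_iff₀ (by positivity)] at this
    have e : V * (Λ : ℝ) ^ (k + 1) = Λ * V * (Λ : ℝ) ^ k := by rw [pow_succ (Λ : ℝ) k]; ring
    exact this.trans_eq e
  have h2 := G.size_le_of_near hm (G.node_succ_mem hr ht) (G.node_mem hr)
    (T := (Λ : ℝ) ^ (k + 1)) (T' := (Λ : ℝ) ^ k) (by positivity)
    (pow_le_pow_right₀ hΛ1 (by omega)) (G.node_succ_sub_le r ht) le_rfl h1
  refine h2.trans ?_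
  change 6 * m * K * (V + Λ * V) ≤ _
  have : V ≤ Λ * V := le_mul_of_one_le_left hV hΛ1
  calc 6 * m * K * (V + Λ * V) ≤ 6 * m * K * (Λ * V + Λ * V) := by gcongr
    _ = _ := by ring

lemma sum_inv_size_succ_le (G : GridFrames P U K θ B' B x ρ Λ) (hr : r ∈ cube m (Λ ^ k))
    {v : IVec m} (hv : v ≠ 0) : ∑ t ∈ cube m Λ,
      1 / (P (node x ρ Λ (k + 1) fun i => Λ * r i + t i)).size ((Λ : ℝ) ^ (k + 1)) v
      ≤ (Λ : ℝ) ^ m * (1 / 2 * (1 / (P (node x ρ Λ k r)).size ((Λ : ℝ) ^ k) v)) := by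
  have := G.sum_inv_size_pow_le hr hv 1
  simp only [pow_one] at this
  refine this.trans (le_of_eq ?_)
  ring

/-- Iteration of a contraction inequality over a nested family of grids. -/
lemma _root_.sum_cube_le_of_contract {F : ℕ → (Fin m → ℕ) → ℝ} {c C : ℝ}
    (h : ∀ k, ∀ r ∈ cube m (Λ ^ k), ∑ t ∈ cube m Λ, F (k + 1) (fun i => Λ * r i + t i)
      ≤ (Λ : ℝ) ^ m * (3 / 4 * F k r + c)) (h0 : ∑ r ∈ cube m (Λ ^ 0), F 0 r ≤ C)
    (hC : 4 * c ≤ C) (k : ℕ) : ∑ r ∈ cube m (Λ ^ k), F k r ≤ C * ((Λ : ℝ) ^ k) ^ m := by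
  induction k with
  | zero => simpa using h0
  | succ k ih =>
    have e := sum_cube_pow_add m Λ k 1 (F (k + 1))
    simp only [pow_one] at e
    rw [e]
    calc _ ≤ ∑ r ∈ cube m (Λ ^ k), (Λ : ℝ) ^ m * (3 / 4 * F k r + c) := Finset.sum_le_sum (h k)
      _ = (Λ : ℝ) ^ m * (3 / 4 * ∑ r ∈ cube m (Λ ^ k), F k r + ((Λ : ℝ) ^ k) ^ m * c) := by
        rw [← Finset.mul_sum, Finset.sum_add_distrib, ← Finset.mul_sum, Finset.sum_const, card_cube]
        simp
      _ ≤ (Λ : ℝ) ^ m * (3 / 4 * (C * ((Λ : ℝ) ^ k) ^ m) + ((Λ : ℝ) ^ k) ^ m * (C / 4)) := by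
        gcongr; linarith
      _ = _ := by rw [pow_succ, mul_pow]; ring

end General

variable {P : (Fin 2 → ℝ) → Frame 2} {U : Set (Fin 2 → ℝ)} {K θ : ℝ}
  {B' B : (Fin 2 → ℝ) →ₗ[ℝ] (Fin 2 → ℝ)} {x : Fin 2 → ℝ} {ρ : ℝ} {Λ k : ℕ} {r : Fin 2 → ℕ}

lemma sum_alpha_succ_le (G : GridFrames P U K θ B' B x ρ Λ) (hr : r ∈ cube 2 (Λ ^ k)) :
    ∑ t ∈ cube 2 Λ, (P (node x ρ Λ (k + 1) fun i => Λ * r i + t i)).alpha ((Λ : ℝ) ^ (k + 1))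
      ≤ (Λ : ℝ) ^ 2 * (1 / 2 * (P (node x ρ Λ k r)).alpha ((Λ : ℝ) ^ k)
        + 48 * K * Λ * Real.sqrt ((P (node x ρ Λ k r)).beta ((Λ : ℝ) ^ k))) := by
  have hΛ := G.scale_pos
  have hK := G.one_le
  have hT : 0 < (Λ : ℝ) ^ k := by positivity
  have hT' : 0 < (Λ : ℝ) ^ (k + 1) := by positivity
  obtain ⟨v, hv, hva, hvmin⟩ := (P (node x ρ Λ k r)).exists_alpha_eq hT
  set β := (P (node x ρ Λ k r)).beta ((Λ : ℝ) ^ k) with hβ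
  have hβ0 : 0 < β := Frame.beta_pos _ hT
  have key : ∀ t ∈ cube 2 Λ,
      (P (node x ρ Λ (k + 1) fun i => Λ * r i + t i)).alpha ((Λ : ℝ) ^ (k + 1))
      ≤ 1 / (P (node x ρ Λ (k + 1) fun i => Λ * r i + t i)).size ((Λ : ℝ) ^ (k + 1)) v
        + 48 * K * Λ * Real.sqrt β := by
    intro t ht
    obtain ⟨w, hw, hwa, -⟩ :=
      (P (node x ρ Λ (k + 1) fun i => Λ * r i + t i)).exists_alpha_eq hT'
    rw [hwa]
    have hs1 := (P (node x ρ Λ (k + 1) fun i => Λ * r i + t i)).size_pos hT' hv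
    have hs2 := (P (node x ρ Λ (k + 1) fun i => Λ * r i + t i)).size_pos hT' hw
    by_cases h0 : Biv.wedge v w = 0
    · obtain ⟨a, b, -, hb, hab⟩ := Biv.exists_smul_eq_of_wedge_eq_zero hv hw h0
      have := Frame.size_le_of_smul_eq hb hab (P' := P (node x ρ Λ (k + 1) fun i => Λ * r i + t i))
        hT hT' hv (hvmin w hw)
      have := one_div_le_one_div_of_le hs1 this
      have : 0 ≤ 48 * K * Λ * Real.sqrt β := by positivity
      linarith
    · have h1 := (P (node x ρ Λ k r)).one_le_beta_mul_bsize hT (Biv.dec_wedge v w) h0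
      have h2 := (P (node x ρ Λ k r)).bsize_wedge_le hT v w
      have h3 := G.size_le_size_succ hr ht w
      push_cast at h3
      set s := (P (node x ρ Λ k r)).size ((Λ : ℝ) ^ k) w
      set s' := (P (node x ρ Λ (k + 1) fun i => Λ * r i + t i)).size ((Λ : ℝ) ^ (k + 1)) w
      have hs : 0 < s := Frame.size_pos _ hT hw
      have h4 : 1 ≤ β * (4 * (s * s)) := by
        refine h1.trans (mul_le_mul_of_nonneg_left (h2.trans ?_) hβ0.le)
        have := mul_le_mul_of_nonneg_right (hvmin w hw) hs.le
        linarith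
      have h5 : 1 ≤ Real.sqrt β * (2 * s) := by
        refine one_le_sq_iff₀ (by positivity) |>.1 ?_
        rw [mul_pow, Real.sq_sqrt hβ0.le]
        linarith
      have h6 : 1 / s' ≤ 48 * K * Λ * Real.sqrt β := by
        rw [div_le_iff₀ hs2]
        have := mul_le_mul_of_nonneg_left h3 (by positivity : 0 ≤ Real.sqrt β * 2)
        linarith
      have : 0 < 1 / (P (node x ρ Λ (k + 1) fun i => Λ * r i + t i)).size ((Λ : ℝ) ^ (k + 1)) v :=
        one_div_pos.2 hs1
      linarith
  refine (Finset.sum_le_sum key).trans ?_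
  rw [Finset.sum_add_distrib, Finset.sum_const, card_cube, nsmul_eq_mul, hva]
  have := G.sum_inv_size_succ_le hr hv
  push_cast
  linarith

end GridFrames

/-- Grids of adapted frames in the plane whose refinement factor also contracts the averages of
the inverse square roots of the sizes of bivectors. -/
structure LineFrames (P : (Fin 2 → ℝ) → Frame 2) (U : Set (Fin 2 → ℝ)) (K θ : ℝ)
    (B : (Fin 2 → ℝ) →ₗ[ℝ] (Fin 2 → ℝ)) (x : Fin 2 → ℝ) (ρ : ℝ) (Λ : ℕ) : Prop
    extends GridFrames P U K θ (-LinearMap.id) B x ρ Λ where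
  symm : ∀ h k, B h ⬝ᵥ k = h ⬝ᵥ B k
  xi_eq : ∀ y, (P y).xi = -y
  line_contract : ∀ (y : Fin 2 → ℝ) (T : ℝ), 0 < T → Metric.closedBall y (ρ / T) ⊆ U →
    ∀ l : Biv, l.Dec → l ≠ 0 → ∑ t ∈ cube 2 Λ,
      Real.sqrt (1 / (P (gridPt y (ρ / (T * Λ)) t)).bsize (T * Λ) l)
      ≤ 1 / 2 * (Λ : ℝ) ^ 2 / Real.sqrt ((P y).bsize T l)

namespace LineFrames

variable {P P' : (Fin 2 → ℝ) → Frame 2} {U : Set (Fin 2 → ℝ)} {K θ : ℝ}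
  {B B₁ B₂ : (Fin 2 → ℝ) →ₗ[ℝ] (Fin 2 → ℝ)} {x : Fin 2 → ℝ} {ρ : ℝ} {Λ k : ℕ} {r : Fin 2 → ℕ}

lemma bsize_le_bsize_succ (G : LineFrames P U K θ B x ρ Λ) (hr : r ∈ cube 2 (Λ ^ k))
    {t : Fin 2 → ℕ} (ht : t ∈ cube 2 Λ) (l : Biv) :
    (P (node x ρ Λ k r)).bsize ((Λ : ℝ) ^ k) l ≤ 20 * K * Λ *
      (P (node x ρ Λ (k + 1) fun i => Λ * r i + t i)).bsize ((Λ : ℝ) ^ (k + 1)) l := by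
  have hΛ := G.scale_pos
  have := G.bsize_le_of_near G.xi_eq (G.node_succ_mem hr ht) (G.node_mem hr)
    (T := (Λ : ℝ) ^ k) (L := Λ) (by positivity) (by simpa using G.one_le_scale_pow 1)
    (G.node_succ_sub_le r ht) l
  rwa [← pow_succ] at this

lemma inv_bsize_succ_le (G : LineFrames P U K θ B x ρ Λ) (hr : r ∈ cube 2 (Λ ^ k))
    {t : Fin 2 → ℕ} (ht : t ∈ cube 2 Λ) {l l' : Biv} (hl : l.Dec) (hl0 : l ≠ 0) (hl' : l'.Dec)
    (hl0' : l' ≠ 0) (hle : (P (node x ρ Λ k r)).bsize ((Λ : ℝ) ^ k) l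
      ≤ (P (node x ρ Λ k r)).bsize ((Λ : ℝ) ^ k) l') (hpar : ¬ Biv.Par l l') :
    1 / (P (node x ρ Λ (k + 1) fun i => Λ * r i + t i)).bsize ((Λ : ℝ) ^ (k + 1)) l'
      ≤ 120 * K * Λ * (1 + (P (node x ρ Λ k r)).alpha ((Λ : ℝ) ^ k)
        + (P (node x ρ Λ k r)).dual.alpha ((Λ : ℝ) ^ k)) := by
  have hΛ := G.scale_pos
  have hT : 0 < (Λ : ℝ) ^ k := by positivity
  have hT' : 0 < (Λ : ℝ) ^ (k + 1) := by positivity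
  have h1 := (P (node x ρ Λ k r)).one_le_mul_bsize_of_not_par hT hl hl0 hl' hl0' hle hpar
  have h2 := G.bsize_le_bsize_succ hr ht l'
  have a1 := (P (node x ρ Λ k r)).alpha_pos hT
  have a2 := (P (node x ρ Λ k r)).dual.alpha_pos hT
  rw [div_le_iff₀ (Frame.bsize_pos hT' hl0')]
  have := mul_le_mul_of_nonneg_left h2 (by positivity : 0 ≤
    6 * (1 + (P (node x ρ Λ k r)).alpha ((Λ : ℝ) ^ k)
        + (P (node x ρ Λ k r)).dual.alpha ((Λ : ℝ) ^ k)))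
  linarith

lemma sum_sqrt_inv_bsize_succ_le (G : LineFrames P U K θ B x ρ Λ) (hr : r ∈ cube 2 (Λ ^ k))
    {l : Biv} (hl : l.Dec) (hl0 : l ≠ 0) : ∑ t ∈ cube 2 Λ, Real.sqrt
      (1 / (P (node x ρ Λ (k + 1) fun i => Λ * r i + t i)).bsize ((Λ : ℝ) ^ (k + 1)) l)
      ≤ (Λ : ℝ) ^ 2 * (1 / 2 * Real.sqrt (1 / (P (node x ρ Λ k r)).bsize ((Λ : ℝ) ^ k) l)) := by
  have hΛ := G.scale_pos
  have hΛ1 : 0 < Λ := by exact_mod_cast hΛ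
  have := G.line_contract (node x ρ Λ k r) ((Λ : ℝ) ^ k) (by positivity)
    (G.closedBall_node_subset hr) l hl hl0
  have e : ∀ t : Fin 2 → ℕ, gridPt (node x ρ Λ k r) (ρ / ((Λ : ℝ) ^ k * Λ)) t
      = node x ρ Λ (k + 1) fun i => Λ * r i + t i := fun t => by
    have := node_add x ρ hΛ1 k 1 r t
    simp only [pow_one] at this
    exact this.symm
  simp only [e] at this
  simp only [← pow_succ] at this
  refine this.trans (le_of_eq ?_)
  rw [Real.sqrt_div zero_le_one, Real.sqrt_one]
  ring

lemma sum_sqrt_beta_succ_le (G : LineFrames P U K θ B x ρ Λ) (hr : r ∈ cube 2 (Λ ^ k)) :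
    ∑ t ∈ cube 2 Λ, Real.sqrt
      ((P (node x ρ Λ (k + 1) fun i => Λ * r i + t i)).beta ((Λ : ℝ) ^ (k + 1)))
      ≤ (Λ : ℝ) ^ 2 * (1 / 2 * Real.sqrt ((P (node x ρ Λ k r)).beta ((Λ : ℝ) ^ k))
        + Real.sqrt (120 * K * Λ * (1 + (P (node x ρ Λ k r)).alpha ((Λ : ℝ) ^ k)
          + (P (node x ρ Λ k r)).dual.alpha ((Λ : ℝ) ^ k)))) := by
  have hΛ := G.scale_pos
  have hT : 0 < (Λ : ℝ) ^ k := by positivity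
  have hT' : 0 < (Λ : ℝ) ^ (k + 1) := by positivity
  obtain ⟨l, hl, hl0, hlb, hmin⟩ := (P (node x ρ Λ k r)).exists_beta_eq hT
  set X := 120 * K * Λ * (1 + (P (node x ρ Λ k r)).alpha ((Λ : ℝ) ^ k)
          + (P (node x ρ Λ k r)).dual.alpha ((Λ : ℝ) ^ k)) with hX
  have key : ∀ t ∈ cube 2 Λ, Real.sqrt
      ((P (node x ρ Λ (k + 1) fun i => Λ * r i + t i)).beta ((Λ : ℝ) ^ (k + 1)))
      ≤ Real.sqrt (1 / (P (node x ρ Λ (k + 1) fun i => Λ * r i + t i)).bsize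
        ((Λ : ℝ) ^ (k + 1)) l) + Real.sqrt X := by
    intro t ht
    obtain ⟨l', hl', hl0', hlb', -⟩ :=
      (P (node x ρ Λ (k + 1) fun i => Λ * r i + t i)).exists_beta_eq hT'
    rw [hlb']
    have n1 := Real.sqrt_nonneg X
    have n2 := Real.sqrt_nonneg (1 / (P (node x ρ Λ (k + 1) fun i => Λ * r i + t i)).bsize
        ((Λ : ℝ) ^ (k + 1)) l)
    by_cases hpar : Biv.Par l l'
    · have := Frame.bsize_le_of_par hpar (P' := P (node x ρ Λ (k + 1) fun i => Λ * r i + t i))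
        hT hT' hl0 (hmin l' hl' hl0')
      have := Real.sqrt_le_sqrt (one_div_le_one_div_of_le (Frame.bsize_pos hT' hl0) this)
      linarith
    · have := Real.sqrt_le_sqrt (G.inv_bsize_succ_le hr ht hl hl0 hl' hl0' (hmin l' hl' hl0') hpar)
      linarith
  refine (Finset.sum_le_sum key).trans ?_
  rw [Finset.sum_add_distrib, Finset.sum_const, card_cube, nsmul_eq_mul, hlb]
  have := G.sum_sqrt_inv_bsize_succ_le hr hl hl0
  push_cast
  linarith

theorem exists_sum_alpha_le (G : LineFrames P U K θ B x ρ Λ)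
    (G' : GridFrames P' U K θ B₁ B₂ x ρ Λ) (hd : ∀ y, (P y).dual = P' y) :
    ∃ C : ℝ, 0 ≤ C ∧ ∀ k, ∑ r ∈ cube 2 (Λ ^ k),
      ((P (node x ρ Λ k r)).alpha ((Λ : ℝ) ^ k) + (P (node x ρ Λ k r)).dual.alpha ((Λ : ℝ) ^ k))
      ≤ C * ((Λ : ℝ) ^ k) ^ 2 := by
  have hΛ := G.scale_pos
  have hK := G.one_le
  set M : ℝ := 384 * K * Λ with hM
  set F : ℕ → (Fin 2 → ℕ) → ℝ := fun k r => (P (node x ρ Λ k r)).alpha ((Λ : ℝ) ^ k)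
    + (P (node x ρ Λ k r)).dual.alpha ((Λ : ℝ) ^ k)
    + M * Real.sqrt ((P (node x ρ Λ k r)).beta ((Λ : ℝ) ^ k)) with hF
  set c : ℝ := 1 / 4 + M ^ 2 * (120 * K * Λ) with hc
  have hc0 : 0 ≤ c := by positivity
  have step : ∀ k, ∀ r ∈ cube 2 (Λ ^ k), ∑ t ∈ cube 2 Λ, F (k + 1) (fun i => Λ * r i + t i)
      ≤ (Λ : ℝ) ^ 2 * (3 / 4 * F k r + c) := by
    intro k r hr
    have hT : 0 < (Λ : ℝ) ^ k := by positivity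
    have h1 := G.sum_alpha_succ_le hr
    have h2 := G'.sum_alpha_succ_le hr
    have h3 := G.sum_sqrt_beta_succ_le hr
    have h4 := Real.sqrt_le_sqrt ((P (node x ρ Λ k r)).beta_dual_le hT)
    simp only [hF, Finset.sum_add_distrib, ← Finset.mul_sum]
    simp only [← hd] at h2
    have p1 := (P (node x ρ Λ k r)).alpha_pos hT
    have p2 := (P (node x ρ Λ k r)).dual.alpha_pos hT
    set a := (P (node x ρ Λ k r)).alpha ((Λ : ℝ) ^ k)
    set a' := (P (node x ρ Λ k r)).dual.alpha ((Λ : ℝ) ^ k)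
    set b := Real.sqrt ((P (node x ρ Λ k r)).beta ((Λ : ℝ) ^ k))
    set b' := Real.sqrt ((P (node x ρ Λ k r)).dual.beta ((Λ : ℝ) ^ k))
    set y := Real.sqrt (120 * K * Λ * (1 + a + a')) with hy
    have hy2 : y ^ 2 = 120 * K * Λ * (1 + a + a') := Real.sq_sqrt (by positivity)
    have hMy : M * y ≤ 1 / 4 * (1 + a + a') + M ^ 2 * (120 * K * Λ) := by
      have hs := Real.sqrt_nonneg (120 * K * Λ)
      have e : y = Real.sqrt (120 * K * Λ) * Real.sqrt (1 + a + a') := by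
        rw [hy, Real.sqrt_mul (by positivity)]
      have q1 := Real.sq_sqrt (by positivity : 0 ≤ 120 * K * Λ)
      have q2 := Real.sq_sqrt (by positivity : 0 ≤ 1 + a + a')
      rw [e]
      nlinarith [sq_nonneg (1 / 2 * Real.sqrt (1 + a + a') - M * Real.sqrt (120 * K * Λ))]
    have h3' := mul_le_mul_of_nonneg_left h3 (by positivity : 0 ≤ M)
    have h4' : 48 * K * Λ * b' ≤ 48 * K * Λ * b := by gcongr
    have hb : 48 * K * Λ * b = 1 / 8 * (M * b) := by rw [hM]; ring
    calc _ ≤ (Λ : ℝ) ^ 2 * (1 / 2 * a + 48 * K * Λ * b) +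
          (Λ : ℝ) ^ 2 * (1 / 2 * a' + 48 * K * Λ * b')
          + M * ((Λ : ℝ) ^ 2 * (1 / 2 * b + y)) := add_le_add (add_le_add h1 h2) h3'
      _ = (Λ : ℝ) ^ 2 * (1 / 2 * a + 48 * K * Λ * b + (1 / 2 * a' + 48 * K * Λ * b')
          + (1 / 2 * (M * b) + M * y)) := by ring
      _ ≤ _ := by
        refine mul_le_mul_of_nonneg_left ?_ (by positivity)
        change _ ≤ 3 / 4 * (a + a' + M * b) + c
        linarith
  have hF0 : ∀ k r, (P (node x ρ Λ k r)).alpha ((Λ : ℝ) ^ k)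
      + (P (node x ρ Λ k r)).dual.alpha ((Λ : ℝ) ^ k) ≤ F k r := fun k r => by
    simp only [hF]
    have : 0 ≤ M * Real.sqrt ((P (node x ρ Λ k r)).beta ((Λ : ℝ) ^ k)) := by positivity
    linarith
  refine ⟨max (∑ r ∈ cube 2 (Λ ^ 0), F 0 r) (4 * c), le_max_of_le_right (by positivity),
    fun k => ?_⟩
  exact (Finset.sum_le_sum fun r _ => hF0 k r).trans
    (sum_cube_le_of_contract step (le_max_left _ _) (le_max_right _ _) k)

end LineFrames

/-! ### The sum of the reciprocal minima of bivectors -/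

namespace LineFrames

variable {P P' : (Fin 2 → ℝ) → Frame 2} {U : Set (Fin 2 → ℝ)} {K θ : ℝ}
  {B B₁ B₂ : (Fin 2 → ℝ) →ₗ[ℝ] (Fin 2 → ℝ)} {x : Fin 2 → ℝ} {ρ : ℝ} {Λ : ℕ}

lemma exists_sum_inv_bsize_pow_le (G : LineFrames P U K θ B x ρ Λ) :
    ∃ C : ℝ, 0 ≤ C ∧ ∀ k, ∀ r ∈ cube 2 (Λ ^ k), ∀ j, ∀ l : Biv, l.Dec → l ≠ 0 →
      ∑ t ∈ cube 2 (Λ ^ j), 1 / (P (node x ρ Λ (k + j) fun i => Λ ^ j * r i + t i)).bsize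
        ((Λ : ℝ) ^ (k + j)) l
      ≤ C * ((Λ : ℝ) ^ j) ^ 2 * (1 / (P (node x ρ Λ k r)).bsize ((Λ : ℝ) ^ k) l) := by
  have hΛ := G.scale_pos
  have hΛ1 : 0 < Λ := by exact_mod_cast hΛ
  obtain ⟨C, hC, h⟩ := G.toAdaptedFrames.exists_sum_inv_bsize_le G.symm G.xi_eq G.rho_pos G.rho_le
  refine ⟨C, by linarith, fun k r hr j l hl hl0 => ?_⟩
  have := (h (node x ρ Λ k r) ((Λ : ℝ) ^ k) (by positivity) (G.closedBall_node_subset hr) l hl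
    hl0).1 (Λ ^ j) (Nat.one_le_pow _ _ hΛ1)
  have e : ∀ t : Fin 2 → ℕ, gridPt (node x ρ Λ k r) (ρ / ((Λ : ℝ) ^ k * (Λ ^ j : ℕ))) t
      = node x ρ Λ (k + j) fun i => Λ ^ j * r i + t i :=
    fun t => (node_add x ρ hΛ1 k j r t).symm
  simp only [e] at this
  push_cast at this
  simp only [← pow_add] at this
  rw [mul_one_div]
  convert this using 3

theorem exists_sum_beta_le (G : LineFrames P U K θ B x ρ Λ)
    (G' : GridFrames P' U K θ B₁ B₂ x ρ Λ) (hd : ∀ y, (P y).dual = P' y) :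
    ∃ C : ℝ, 0 ≤ C ∧ ∀ k, ∑ r ∈ cube 2 (Λ ^ k), (P (node x ρ Λ k r)).beta ((Λ : ℝ) ^ k)
      ≤ C * (1 + k) * ((Λ : ℝ) ^ k) ^ 2 := by
  have hΛ := G.scale_pos
  have hK := G.one_le
  obtain ⟨C₁, hC₁, h1⟩ := G.exists_sum_inv_bsize_pow_le
  obtain ⟨C₂, hC₂, h2⟩ := G.exists_sum_alpha_le G' hd
  set C : ℝ := C₁ * ∑ r ∈ cube 2 (Λ ^ 0), (P (node x ρ Λ 0 r)).beta ((Λ : ℝ) ^ 0)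
    + C₁ * (120 * K * Λ * (1 + C₂)) with hC
  have hβ0 : 0 ≤ ∑ r ∈ cube 2 (Λ ^ 0), (P (node x ρ Λ 0 r)).beta ((Λ : ℝ) ^ 0) :=
    Finset.sum_nonneg fun r _ => (Frame.beta_pos _ (by positivity)).le
  have main : ∀ k j, ∀ L : (Fin 2 → ℕ) → Biv, (∀ r, (L r).Dec ∧ L r ≠ 0) →
      ∑ r ∈ cube 2 (Λ ^ k), ∑ t ∈ cube 2 (Λ ^ j),
        1 / (P (node x ρ Λ (k + j) fun i => Λ ^ j * r i + t i)).bsize ((Λ : ℝ) ^ (k + j)) (L r)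
      ≤ C * (1 + k) * ((Λ : ℝ) ^ (k + j)) ^ 2 := by
    intro k
    induction k with
    | zero =>
      intro j L hL
      calc _ ≤ ∑ r ∈ cube 2 (Λ ^ 0), C₁ * ((Λ : ℝ) ^ j) ^ 2
            * (P (node x ρ Λ 0 r)).beta ((Λ : ℝ) ^ 0) := by
            refine Finset.sum_le_sum fun r hr => (h1 0 r hr j _ (hL r).1 (hL r).2).trans ?_
            exact mul_le_mul_of_nonneg_left
              (Frame.one_div_bsize_le_beta _ (by positivity) (hL r).1 (hL r).2) (by positivity)
        _ = C₁ * (∑ r ∈ cube 2 (Λ ^ 0), (P (node x ρ Λ 0 r)).beta ((Λ : ℝ) ^ 0))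
            * ((Λ : ℝ) ^ j) ^ 2 := by rw [← Finset.mul_sum]; ring
        _ ≤ C * ((Λ : ℝ) ^ j) ^ 2 := by
            refine mul_le_mul_of_nonneg_right ?_ (by positivity)
            rw [hC]
            have : 0 ≤ C₁ * (120 * K * Λ * (1 + C₂)) := by positivity
            linarith
        _ = _ := by simp
    | succ k ih =>
      intro j L hL
      have hT : 0 < (Λ : ℝ) ^ k := by positivity
      choose L₀ hd₀ hn₀ _ hm₀ using fun r : Fin 2 → ℕ =>
        (P (node x ρ Λ k r)).exists_beta_eq hT
      have step : ∀ r ∈ cube 2 (Λ ^ k), ∀ s ∈ cube 2 (Λ ^ 1),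
          ∑ t ∈ cube 2 (Λ ^ j), 1 / (P (node x ρ Λ (k + 1 + j) fun i =>
            Λ ^ j * (Λ ^ 1 * r i + s i) + t i)).bsize ((Λ : ℝ) ^ (k + 1 + j))
              (L fun i => Λ ^ 1 * r i + s i)
          ≤ ∑ t ∈ cube 2 (Λ ^ j), 1 / (P (node x ρ Λ (k + 1 + j) fun i =>
            Λ ^ j * (Λ ^ 1 * r i + s i) + t i)).bsize ((Λ : ℝ) ^ (k + 1 + j)) (L₀ r)
            + C₁ * ((Λ : ℝ) ^ j) ^ 2 * (120 * K * Λ * (1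
              + ((P (node x ρ Λ k r)).alpha ((Λ : ℝ) ^ k)
              + (P (node x ρ Λ k r)).dual.alpha ((Λ : ℝ) ^ k)))) := by
        intro r hr s hs
        have a1 := (P (node x ρ Λ k r)).alpha_pos hT
        have a2 := (P (node x ρ Λ k r)).dual.alpha_pos hT
        obtain ⟨hL1, hL2⟩ := hL fun i => Λ ^ 1 * r i + s i
        by_cases hpar : Biv.Par (L₀ r) (L fun i => Λ ^ 1 * r i + s i)
        · refine le_add_of_le_of_nonneg (Finset.sum_le_sum fun t _ => ?_) (by positivity)
          exact one_div_le_one_div_of_le (Frame.bsize_pos (by positivity) (hn₀ r))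
            (Frame.bsize_le_of_par hpar hT (by positivity) (hn₀ r) (hm₀ r _ hL1 hL2))
        · refine le_add_of_nonneg_of_le (Finset.sum_nonneg fun t _ =>
            one_div_nonneg.2 (Frame.bsize_nonneg (by positivity) _)) ?_
          refine (h1 (k + 1) _ (child_mem_cube hr hs) j _ hL1 hL2).trans ?_
          refine mul_le_mul_of_nonneg_left ?_ (by positivity)
          have := G.inv_bsize_succ_le hr (by rwa [pow_one] at hs) (hd₀ r) (hn₀ r) hL1 hL2
            (hm₀ r _ hL1 hL2) hpar
          simp only [pow_one] at this ⊢
          rwa [← add_assoc]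
      have re : ∀ r : Fin 2 → ℕ, ∑ s ∈ cube 2 (Λ ^ 1), ∑ t ∈ cube 2 (Λ ^ j),
          1 / (P (node x ρ Λ (k + 1 + j) fun i =>
            Λ ^ j * (Λ ^ 1 * r i + s i) + t i)).bsize ((Λ : ℝ) ^ (k + 1 + j)) (L₀ r)
          = ∑ t ∈ cube 2 (Λ ^ (1 + j)), 1 / (P (node x ρ Λ (k + (1 + j)) fun i =>
            Λ ^ (1 + j) * r i + t i)).bsize ((Λ : ℝ) ^ (k + (1 + j))) (L₀ r) := fun r => by
        rw [sum_cube_pow_add, add_assoc]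
        refine Finset.sum_congr rfl fun s _ => Finset.sum_congr rfl fun t _ => ?_
        congr 5
        funext i
        ring
      rw [sum_cube_pow_add 2 Λ k 1]
      have ih' := ih (1 + j) L₀ fun r => ⟨hd₀ r, hn₀ r⟩
      have h2' := h2 k
      set A := ∑ r ∈ cube 2 (Λ ^ k), ((P (node x ρ Λ k r)).alpha ((Λ : ℝ) ^ k)
        + (P (node x ρ Λ k r)).dual.alpha ((Λ : ℝ) ^ k)) with hA
      have e : (Λ : ℝ) ^ (k + (1 + j)) = (Λ : ℝ) ^ k * Λ * (Λ : ℝ) ^ j := by ring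
      have e' : (Λ : ℝ) ^ (k + 1 + j) = (Λ : ℝ) ^ k * Λ * (Λ : ℝ) ^ j := by ring
      calc _ ≤ ∑ r ∈ cube 2 (Λ ^ k), ∑ s ∈ cube 2 (Λ ^ 1),
            (∑ t ∈ cube 2 (Λ ^ j), 1 / (P (node x ρ Λ (k + 1 + j) fun i =>
            Λ ^ j * (Λ ^ 1 * r i + s i) + t i)).bsize ((Λ : ℝ) ^ (k + 1 + j)) (L₀ r)
            + C₁ * ((Λ : ℝ) ^ j) ^ 2 * (120 * K * Λ * (1
              + ((P (node x ρ Λ k r)).alpha ((Λ : ℝ) ^ k)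
              + (P (node x ρ Λ k r)).dual.alpha ((Λ : ℝ) ^ k))))) :=
            Finset.sum_le_sum fun r hr => Finset.sum_le_sum fun s hs => step r hr s hs
        _ ≤ C * (1 + k) * ((Λ : ℝ) ^ (k + (1 + j))) ^ 2
            + (Λ : ℝ) ^ 2 * (C₁ * ((Λ : ℝ) ^ j) ^ 2 * (120 * K * Λ
              * (((Λ : ℝ) ^ k) ^ 2 + A))) := by
            simp only [Finset.sum_add_distrib (s := cube 2 (Λ ^ 1)), Finset.sum_const, card_cube,
              re, nsmul_eq_mul]
            rw [Finset.sum_add_distrib]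
            refine add_le_add ih' (le_of_eq ?_)
            simp only [← Finset.mul_sum]
            rw [Finset.sum_add_distrib, Finset.sum_const, card_cube, nsmul_eq_mul, ← hA]
            push_cast
            ring
        _ ≤ C * (1 + k) * ((Λ : ℝ) ^ (k + (1 + j))) ^ 2
            + (Λ : ℝ) ^ 2 * (C₁ * ((Λ : ℝ) ^ j) ^ 2 * (120 * K * Λ
              * (((Λ : ℝ) ^ k) ^ 2 + C₂ * ((Λ : ℝ) ^ k) ^ 2))) := by gcongr
        _ = (C * (1 + k) + C₁ * (120 * K * Λ * (1 + C₂)))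
            * ((Λ : ℝ) ^ k * Λ * (Λ : ℝ) ^ j) ^ 2 := by rw [e]; ring
        _ ≤ C * (1 + (k + 1 : ℕ)) * ((Λ : ℝ) ^ (k + 1 + j)) ^ 2 := by
            rw [e']
            refine mul_le_mul_of_nonneg_right ?_ (by positivity)
            push_cast
            have : C₁ * (120 * K * Λ * (1 + C₂)) ≤ C := by
              rw [hC]
              have := mul_nonneg hC₁ hβ0
              linarith
            linarith
  refine ⟨C, by positivity, fun k => ?_⟩
  have hT : 0 < (Λ : ℝ) ^ k := by positivity
  choose L₀ hd₀ hn₀ hb₀ _ using fun r : Fin 2 → ℕ => (P (node x ρ Λ k r)).exists_beta_eq hT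
  have := main k 0 L₀ fun r => ⟨hd₀ r, hn₀ r⟩
  simp only [add_zero, pow_zero, one_mul] at this
  refine le_trans (Finset.sum_le_sum fun r _ => ?_) this
  rw [hb₀ r]
  refine le_of_eq_of_le ?_ (Finset.single_le_sum (f := fun t : Fin 2 → ℕ =>
    1 / (P (node x ρ Λ k fun i => r i + t i)).bsize ((Λ : ℝ) ^ k) (L₀ r))
    (fun t _ => one_div_nonneg.2 (Frame.bsize_nonneg hT _)) (a := 0) (mem_cube.2 fun i => by simp))
  simp

end LineFrames

/-! ### Counting short vectors in dimension two -/

lemma card_le_of_separated {E : Type*} {S : Finset E} {c : E → ℝ} {X s : ℝ} (hs : 0 < s)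
    (hX0 : 0 ≤ X) (hX : ∀ e ∈ S, |c e| ≤ X) (h : ∀ e ∈ S, ∀ e' ∈ S, e ≠ e' → s ≤ |c e - c e'|) :
    (S.card : ℝ) ≤ 1 + 2 * X / s := by
  have hmap : ∀ e ∈ S, ⌊(c e + X) / s⌋₊ ∈ Finset.range (⌊2 * X / s⌋₊ + 1) := fun e he => by
    rw [Finset.mem_range, Nat.lt_succ_iff]
    refine Nat.floor_le_floor (div_le_div_of_nonneg_right ?_ hs.le)
    have := (abs_le.1 (hX e he)).2
    linarith
  have hinj : Set.InjOn (fun e => ⌊(c e + X) / s⌋₊) S := fun e he e' he' hee => by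
    by_contra hne
    have h1 := h e he e' he' hne
    have p : 0 ≤ (c e + X) / s := div_nonneg (by linarith [(abs_le.1 (hX e he)).1]) hs.le
    have p' : 0 ≤ (c e' + X) / s := div_nonneg (by linarith [(abs_le.1 (hX e' he')).1]) hs.le
    have a1 := Nat.floor_le p
    have a2 := Nat.lt_floor_add_one ((c e + X) / s)
    have a3 := Nat.floor_le p'
    have a4 := Nat.lt_floor_add_one ((c e' + X) / s)
    simp only at hee
    rw [hee] at a1 a2
    have : |(c e + X) / s - (c e' + X) / s| < 1 := by rw [abs_lt]; constructor <;> linarith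
    rw [← sub_div, add_sub_add_right_eq_sub, abs_div, abs_of_pos hs, div_lt_one hs] at this
    linarith
  have h1 := Finset.card_le_card_of_injOn _ hmap hinj
  rw [Finset.card_range] at h1
  have h2 : (S.card : ℝ) ≤ ⌊2 * X / s⌋₊ + 1 := by exact_mod_cast h1
  have h3 := Nat.floor_le (a := 2 * X / s) (by positivity)
  linarith

lemma card_le_of_parallel {E : Type*} [AddCommGroup E] {N : E → ℝ}
    (hN : ∀ (a : ℤ) e, N (a • e) = |(a : ℝ)| * N e) {e₀ : E} (h₀ : 0 < N e₀) {S : Finset E}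
    (hS : ∀ e ∈ S, ∃ a b : ℤ, a ≠ 0 ∧ a • e = b • e₀) {X s : ℝ} (hX0 : 0 ≤ X) (hs : 0 < s)
    (hX : ∀ e ∈ S, N e ≤ X) (h : ∀ e ∈ S, ∀ e' ∈ S, e ≠ e' → s ≤ N (e - e')) :
    (S.card : ℝ) ≤ 1 + 2 * X / s := by
  have hS' : ∀ e, ∃ a b : ℤ, e ∈ S → a ≠ 0 ∧ a • e = b • e₀ := fun e => by
    by_cases he : e ∈ S
    · obtain ⟨a, b, h⟩ := hS e he
      exact ⟨a, b, fun _ => h⟩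
    · exact ⟨0, 0, fun h => absurd h he⟩
  choose a b hab using hS'
  have key : ∀ e ∈ S, ∀ e' ∈ S, N (e - e') = |(b e : ℝ) / a e - b e' / a e'| * N e₀ := by
    intro e he e' he'
    obtain ⟨h1, h2⟩ := hab e he
    obtain ⟨h1', h2'⟩ := hab e' he'
    have q1 : (a e : ℝ) ≠ 0 := by exact_mod_cast h1
    have q2 : (a e' : ℝ) ≠ 0 := by exact_mod_cast h1'
    have e1 : (a e * a e') • (e - e') = (b e * a e' - b e' * a e) • e₀ := by
      rw [smul_sub, sub_smul, mul_comm (a e) (a e'), mul_smul, h2, mul_comm (a e') (a e),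
        mul_smul, h2', smul_smul, smul_smul]
      congr 2 <;> ring
    have e2 := congrArg N e1
    rw [hN, hN] at e2
    push_cast at e2
    rw [div_sub_div _ _ q1 q2, abs_div, div_mul_eq_mul_div, eq_div_iff (by positivity),
      mul_comm (N _), e2, mul_comm (a e : ℝ) (b e' : ℝ)]
  have key0 : ∀ e ∈ S, N e = |(b e : ℝ) / a e| * N e₀ := fun e he => by
    obtain ⟨h1, h2⟩ := hab e he
    have q1 : (a e : ℝ) ≠ 0 := by exact_mod_cast h1
    have e2 := congrArg N h2
    rw [hN, hN] at e2
    rw [abs_div, div_mul_eq_mul_div, eq_div_iff (by positivity), mul_comm, e2]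
  have := card_le_of_separated (S := S) (c := fun e => (b e : ℝ) / a e) (X := X / N e₀)
    (s := s / N e₀) (by positivity) (by positivity)
    (fun e he => by rw [le_div_iff₀ h₀, ← key0 e he]; exact hX e he)
    (fun e he e' he' hne => by
      rw [div_le_iff₀ h₀, ← key e he e' he']; exact h e he e' he' hne)
  refine this.trans_eq ?_
  field_simp

namespace Frame

variable {T : ℝ}

lemma abs_pairing_le {m : ℕ} (P : Frame m) (hT : 0 < T) (v u : IVec m) :
    |((v.1 * u.2.2 + v.2.1 ⬝ᵥ u.2.1 + v.2.2 * u.1 : ℤ) : ℝ)|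
      ≤ (m + 2) * (P.size T v * P.dual.size T u) := by
  have e := P.pairing_eq v.1 (fun i => (v.2.1 i : ℝ)) v.2.2 u.2.2 (fun i => (u.2.1 i : ℝ)) u.1
  have e' : ((v.1 * u.2.2 + v.2.1 ⬝ᵥ u.2.1 + v.2.2 * u.1 : ℤ) : ℝ)
      = v.1 * P.dual.vert u + P.horiz v ⬝ᵥ P.dual.horiz u + P.vert v * u.1 := by
    refine Eq.trans ?_ e
    simp [dotProduct]
  rw [e']
  have n1 := P.size_nonneg hT v
  have n2 := P.dual.size_nonneg hT u
  have a1 := P.abs_div_le_size hT v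
  have a2 := P.dual.abs_div_le_size hT u
  have b1 := P.horiz_le_size hT v
  have b2 := P.dual.horiz_le_size hT u
  have c1 := P.vert_le_size hT v
  have c2 := P.dual.vert_le_size hT u
  have t1 : |(v.1 : ℝ) * P.dual.vert u| ≤ P.size T v * P.dual.size T u := by
    calc |(v.1 : ℝ) * P.dual.vert u| = |(v.1 : ℝ)| / T * (T * |P.dual.vert u|) := by
          rw [abs_mul]; field_simp
      _ ≤ _ := by gcongr
  have t2 : |P.horiz v ⬝ᵥ P.dual.horiz u| ≤ m * (P.size T v * P.dual.size T u) := by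
    refine (abs_dotProduct_le _ _).trans ?_
    gcongr
  have t3 : |P.vert v * (u.1 : ℝ)| ≤ P.size T v * P.dual.size T u := by
    calc |P.vert v * (u.1 : ℝ)| = T * |P.vert v| * (|(u.1 : ℝ)| / T) := by
          rw [abs_mul]; field_simp
      _ ≤ _ := by gcongr
  refine (abs_add_le _ _).trans ((add_le_add ((abs_add_le _ _).trans (add_le_add t1 t2)) t3).trans
    (le_of_eq ?_))
  ring

lemma size_sub_le {m : ℕ} (P : Frame m) (hT : 0 < T) (v w : IVec m) :
    P.size T (v - w) ≤ P.size T v + P.size T w := by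
  have e1 : P.horiz (v - w) = P.horiz v - P.horiz w := by
    ext i
    simp [horiz]
    ring
  have e2 : P.vert (v - w) = P.vert v - P.vert w := by
    simp [vert, sub_mul, dotProduct, Finset.sum_sub_distrib]
    ring
  simp only [size, e1, e2]
  have h1 := norm_sub_le (P.horiz v) (P.horiz w)
  have h2 := mul_le_mul_of_nonneg_left (abs_sub (P.vert v) (P.vert w)) hT.le
  have h3 : |((v - w).1 : ℝ)| / T ≤ |(v.1 : ℝ)| / T + |(w.1 : ℝ)| / T := by
    rw [← add_div]
    gcongr
    simpa using abs_sub (v.1 : ℝ) w.1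
  linarith

lemma card_sizeBall_le_of_parallel (P : Frame 2) (hT : 0 < T) {R : ℝ} (hR : 0 ≤ R)
    (h : ∀ u ∈ P.sizeBall T R, ∀ u' ∈ P.sizeBall T R, Biv.wedge u u' = 0) :
    ((P.sizeBall T R).card : ℝ) ≤ 1 + 2 * R * P.alpha T := by
  have ha := P.alpha_pos hT
  by_cases h0 : ∃ u ∈ P.sizeBall T R, u ≠ 0
  · obtain ⟨u, hu, hu0⟩ := h0
    have := card_le_of_parallel (N := P.size T) (fun a e => P.size_smul a e)
      (P.size_pos hT hu0) (S := P.sizeBall T R) (X := R) (s := 1 / P.alpha T)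
      (fun e he => by
        by_cases he0 : e = 0
        · exact ⟨1, 0, one_ne_zero, by simp [he0]⟩
        · obtain ⟨a, b, ha, -, hab⟩ := Biv.exists_smul_eq_of_wedge_eq_zero he0 hu0 (h e he u hu)
          exact ⟨a, b, ha, hab⟩) hR (by positivity) (fun e he => (mem_sizeBall hT).1 he)
      (fun e _ e' _ hne => by
        rw [div_le_iff₀ ha, mul_comm]
        exact P.one_le_alpha_mul_size hT (sub_ne_zero.2 hne))
    refine this.trans_eq ?_
    field_simp
  · push Not at h0
    have : (P.sizeBall T R).card ≤ 1 :=
      (Finset.card_le_card (t := {0}) fun u hu => Finset.mem_singleton.2 (h0 u hu)).trans (by simp)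
    have : ((P.sizeBall T R).card : ℝ) ≤ 1 := by exact_mod_cast this
    have : 0 ≤ 2 * R * P.alpha T := by positivity
    linarith

lemma card_sizeBall_le_of_not_parallel (P : Frame 2) (hT : 0 < T) {κ : ℝ} (hκ : 1 ≤ κ)
    {u u' : IVec 2} (hu : P.dual.size T u ≤ 1 / (9 * κ)) (hu' : P.dual.size T u' ≤ 1 / (9 * κ))
    (hne : Biv.wedge u u' ≠ 0) :
    ((P.sizeBall T κ).card : ℝ) ≤ 1 + 4 * κ * P.alpha T + 40 * κ ^ 2 * P.beta T := by
  classical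
  have ha := P.alpha_pos hT
  have hb := P.beta_pos hT
  obtain ⟨v, hv, hva, hmin⟩ := P.exists_alpha_eq hT
  have hs := P.size_pos hT hv
  by_cases hvκ : P.size T v ≤ κ
  swap
  · have : (P.sizeBall T κ).card ≤ 1 := (Finset.card_le_card (t := {0}) fun w hw => by
      rw [Finset.mem_singleton]
      by_contra h0
      exact hvκ ((hmin w h0).trans ((mem_sizeBall hT).1 hw))).trans (by simp)
    have : ((P.sizeBall T κ).card : ℝ) ≤ 1 := by exact_mod_cast this
    have : 0 ≤ 4 * κ * P.alpha T := by positivity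
    have : 0 ≤ 40 * κ ^ 2 * P.beta T := by positivity
    linarith
  have horth : ∀ w, P.size T w ≤ 2 * κ → ∀ y ∈ ({u, u'} : Set (IVec 2)),
      w.1 * y.2.2 + w.2.1 ⬝ᵥ y.2.1 + w.2.2 * y.1 = 0 := by
    intro w hw y hy
    have hy' : P.dual.size T y ≤ 1 / (9 * κ) := by
      rcases hy with rfl | rfl <;> assumption
    have h1 := P.abs_pairing_le hT w y
    have h2 : ((2 : ℕ) + 2 : ℝ) * (P.size T w * P.dual.size T y) ≤ 8 / 9 := by
      calc ((2 : ℕ) + 2 : ℝ) * (P.size T w * P.dual.size T y)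
          ≤ ((2 : ℕ) + 2 : ℝ) * (2 * κ * (1 / (9 * κ))) := by
            have := P.dual.size_nonneg hT y
            gcongr
        _ = _ := by field_simp; norm_num
    have h3 : |((w.1 * y.2.2 + w.2.1 ⬝ᵥ y.2.1 + w.2.2 * y.1 : ℤ) : ℝ)| < 1 :=
      (h1.trans h2).trans_lt (by norm_num)
    exact Int.abs_lt_one_iff.1 (by exact_mod_cast h3)
  have hpar : ∀ w, P.size T w ≤ 2 * κ → Biv.wedge v w ≠ 0 →
      Biv.Par (Biv.wedge v w) (Biv.wedge u u').star := by
    intro w hw hw0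
    refine Biv.par_wedge_star_wedge hw0 hne fun x hx y hy => ?_
    rcases hx with rfl | rfl
    · exact horth _ (by linarith) y hy
    · exact horth _ hw y hy
  have hfib : ∀ l ∈ (P.sizeBall T κ).image (Biv.wedge v),
      ((P.sizeBall T κ).filter fun w => Biv.wedge v w = l).card ≤ ⌊1 + 4 * κ * P.alpha T⌋₊ := by
    intro l hl
    obtain ⟨w₀, hw₀, hw₀l⟩ := Finset.mem_image.1 hl
    have hw₀κ := (mem_sizeBall hT).1 hw₀
    have := card_le_of_parallel (N := P.size T) (fun a e => P.size_smul a e) hs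
      (S := ((P.sizeBall T κ).filter fun w => Biv.wedge v w = l).image (· - w₀)) (X := 2 * κ)
      (s := 1 / P.alpha T)
      (fun e he => by
        obtain ⟨w, hw, rfl⟩ := Finset.mem_image.1 he
        by_cases he0 : w - w₀ = 0
        · exact ⟨1, 0, one_ne_zero, by simp [he0]⟩
        · obtain ⟨a, b, ha, hb, hab⟩ := Biv.exists_smul_eq_of_wedge_eq_zero hv he0
            (by rw [Biv.wedge_sub, (Finset.mem_filter.1 hw).2, hw₀l, sub_self])
          exact ⟨b, a, hb, hab.symm⟩) (by positivity) (by positivity)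
      (fun e he => by
        obtain ⟨w, hw, rfl⟩ := Finset.mem_image.1 he
        have := (mem_sizeBall hT).1 (Finset.mem_filter.1 hw).1
        have := P.size_sub_le hT w w₀
        linarith)
      (fun e _ e' _ hne => by
        rw [div_le_iff₀ ha, mul_comm]
        exact P.one_le_alpha_mul_size hT (sub_ne_zero.2 hne))
    rw [Finset.card_image_of_injective _ (sub_left_injective)] at this
    refine Nat.le_floor (this.trans_eq ?_)
    field_simp
    ring
  have hdiff : ∀ l ∈ (P.sizeBall T κ).image (Biv.wedge v),
      ∀ l' ∈ (P.sizeBall T κ).image (Biv.wedge v), l ≠ l' → 1 / P.beta T ≤ P.bsize T (l - l') := by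
    intro l hl l' hl' hll
    obtain ⟨w, hw, rfl⟩ := Finset.mem_image.1 hl
    obtain ⟨w', hw', rfl⟩ := Finset.mem_image.1 hl'
    rw [div_le_iff₀ hb, mul_comm, ← Biv.wedge_sub]
    refine P.one_le_beta_mul_bsize hT (Biv.dec_wedge _ _) ?_
    rw [Biv.wedge_sub]
    exact sub_ne_zero.2 hll
  have hstar : (Biv.wedge u u').star ≠ 0 := by
    intro h0
    have h1 := P.dual.bsize_pos hT hne
    rw [← P.bsize_star, h0] at h1
    have : P.bsize T 0 = 0 := by simpa using P.bsize_smul (T := T) 0 0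
    linarith
  have himg := card_le_of_parallel (N := P.bsize T) (fun a e => P.bsize_smul a e)
    (P.bsize_pos hT hstar) (S := (P.sizeBall T κ).image (Biv.wedge v))
    (X := 4 * (P.size T v * κ)) (s := 1 / P.beta T)
    (fun e he => by
      obtain ⟨w, hw, rfl⟩ := Finset.mem_image.1 he
      have hw' := (mem_sizeBall hT).1 hw
      by_cases h0 : Biv.wedge v w = 0
      · exact ⟨1, 0, one_ne_zero, by simp [h0]⟩
      · obtain ⟨a, b, ha, -, hab⟩ := hpar w (by linarith) h0
        exact ⟨a, b, ha, hab⟩) (by positivity) (by positivity)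
    (fun e he => by
      obtain ⟨w, hw, rfl⟩ := Finset.mem_image.1 he
      refine (P.bsize_wedge_le hT v w).trans ?_
      have := (mem_sizeBall hT).1 hw
      gcongr) hdiff
  have h1 := Finset.card_le_mul_card_image (P.sizeBall T κ) _ hfib
  have h2 : ((P.sizeBall T κ).card : ℝ) ≤ ⌊1 + 4 * κ * P.alpha T⌋₊
      * ((P.sizeBall T κ).image (Biv.wedge v)).card := by exact_mod_cast h1
  have h3 := Nat.floor_le (a := 1 + 4 * κ * P.alpha T) (by positivity)
  calc ((P.sizeBall T κ).card : ℝ) ≤ (1 + 4 * κ * P.alpha T)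
        * (1 + 2 * (4 * (P.size T v * κ)) / (1 / P.beta T)) := by
        refine h2.trans ?_
        gcongr
    _ = 1 + 4 * κ * P.alpha T + 8 * κ * P.beta T * P.size T v + 32 * κ ^ 2 * P.beta T
        * (P.alpha T * P.size T v) := by
        field_simp
        ring
    _ ≤ 1 + 4 * κ * P.alpha T + 8 * κ * P.beta T * κ + 32 * κ ^ 2 * P.beta T * 1 := by
        rw [hva, one_div_mul_cancel hs.ne']
        gcongr
    _ = _ := by ring

lemma card_sizeBall_two_le (P : Frame 2) (hT : 0 < T) {κ : ℝ} (hκ : 1 ≤ κ) :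
    ((P.sizeBall T κ).card : ℝ) ≤ 2 * 72 ^ 4 * (κ ^ 4 + κ ^ 3 * (P.alpha T + P.dual.alpha T)
      + κ ^ 2 * P.beta T) := by
  have ha := P.alpha_pos hT
  have ha' := P.dual.alpha_pos hT
  have hb := P.beta_pos hT
  have h4 : 1 ≤ κ ^ 4 := one_le_pow₀ hκ
  have h3 : κ ≤ κ ^ 3 := le_self_pow₀ hκ (by norm_num)
  by_cases h : ∀ u ∈ P.dual.sizeBall T (1 / (9 * κ)), ∀ u' ∈ P.dual.sizeBall T (1 / (9 * κ)),
      Biv.wedge u u' = 0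
  · have h1 := P.dual.card_sizeBall_le_of_parallel hT (by positivity) h
    have h2 := P.card_sizeBall_le (by norm_num) hT (R := 9 * κ) (by positivity)
    have h5 := Finset.card_le_card (P.sizeBall_mono hT (by linarith : κ ≤ 9 * κ))
    calc ((P.sizeBall T κ).card : ℝ) ≤ ((P.sizeBall T (9 * κ)).card : ℝ) := by exact_mod_cast h5
      _ ≤ 2 * (4 * (2 : ℕ) * (9 * κ)) ^ (2 + 2)
          * (1 + 2 * (1 / (9 * κ)) * P.dual.alpha T) := h2.trans (by gcongr)
      _ = 2 * 72 ^ 4 * (κ ^ 4 + 2 / 9 * (κ ^ 3 * P.dual.alpha T)) := by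
          push_cast
          field_simp
          ring
      _ ≤ _ := by
          have p1 : 0 ≤ κ ^ 3 * P.alpha T := by positivity
          have p2 : 0 ≤ κ ^ 3 * P.dual.alpha T := by positivity
          have p3 : 0 ≤ κ ^ 2 * P.beta T := by positivity
          refine mul_le_mul_of_nonneg_left ?_ (by positivity)
          linarith
  · push Not at h
    obtain ⟨u, hu, u', hu', hne⟩ := h
    have h1 := P.card_sizeBall_le_of_not_parallel hT hκ ((mem_sizeBall hT).1 hu)
      ((mem_sizeBall hT).1 hu') hne
    have h2 := mul_le_mul_of_nonneg_right h3 ha.le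
    have p1 : 0 ≤ κ ^ 3 * P.alpha T := by positivity
    have p2 : 0 ≤ κ ^ 3 * P.dual.alpha T := by positivity
    have p3 : 0 ≤ κ ^ 2 * P.beta T := by positivity
    linarith

end Frame

theorem LineFrames.exists_sum_card_le {P P' : (Fin 2 → ℝ) → Frame 2} {U : Set (Fin 2 → ℝ)}
    {K θ : ℝ} {B B₁ B₂ : (Fin 2 → ℝ) →ₗ[ℝ] (Fin 2 → ℝ)} {x : Fin 2 → ℝ} {ρ : ℝ} {Λ : ℕ}
    (G : LineFrames P U K θ B x ρ Λ) (G' : GridFrames P' U K θ B₁ B₂ x ρ Λ)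
    (hd : ∀ y, (P y).dual = P' y) : ∃ C : ℝ, 0 ≤ C ∧ ∀ (k : ℕ) (κ : ℝ), 1 ≤ κ →
      ∑ r ∈ cube 2 (Λ ^ k), (((P (node x ρ Λ k r)).sizeBall ((Λ : ℝ) ^ k) κ).card : ℝ)
        ≤ C * (((Λ : ℝ) ^ k) ^ 2 * (κ ^ (2 + 2) + (1 + k) * κ ^ 2)) := by
  have hΛ := G.scale_pos
  obtain ⟨C₁, hC₁, h1⟩ := G.exists_sum_alpha_le G' hd
  obtain ⟨C₂, hC₂, h2⟩ := G.exists_sum_beta_le G' hd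
  refine ⟨2 * 72 ^ 4 * (1 + C₁ + C₂), by positivity, fun k κ hκ => ?_⟩
  have hT : 0 < (Λ : ℝ) ^ k := by positivity
  have h34 : κ ^ 3 ≤ κ ^ 4 := pow_le_pow_right₀ hκ (by norm_num)
  calc _ ≤ ∑ r ∈ cube 2 (Λ ^ k), 2 * 72 ^ 4 * (κ ^ 4
        + κ ^ 3 * ((P (node x ρ Λ k r)).alpha ((Λ : ℝ) ^ k)
          + (P (node x ρ Λ k r)).dual.alpha ((Λ : ℝ) ^ k))
        + κ ^ 2 * (P (node x ρ Λ k r)).beta ((Λ : ℝ) ^ k)) :=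
        Finset.sum_le_sum fun r _ => Frame.card_sizeBall_two_le _ hT hκ
    _ = 2 * 72 ^ 4 * (((Λ : ℝ) ^ k) ^ 2 * κ ^ 4
        + κ ^ 3 * (∑ r ∈ cube 2 (Λ ^ k), ((P (node x ρ Λ k r)).alpha ((Λ : ℝ) ^ k)
          + (P (node x ρ Λ k r)).dual.alpha ((Λ : ℝ) ^ k)))
        + κ ^ 2 * ∑ r ∈ cube 2 (Λ ^ k), (P (node x ρ Λ k r)).beta ((Λ : ℝ) ^ k)) := by
        rw [← Finset.mul_sum, Finset.sum_add_distrib, Finset.sum_add_distrib, ← Finset.mul_sum,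
          ← Finset.mul_sum, Finset.sum_const, card_cube]
        simp
    _ ≤ 2 * 72 ^ 4 * (((Λ : ℝ) ^ k) ^ 2 * κ ^ 4 + κ ^ 4 * (C₁ * ((Λ : ℝ) ^ k) ^ 2)
        + κ ^ 2 * (C₂ * (1 + k) * ((Λ : ℝ) ^ k) ^ 2)) := by
        have h1' := h1 k
        have h2' := h2 k
        have := mul_le_mul h34 h1' (Finset.sum_nonneg fun r _ =>
          (add_pos (Frame.alpha_pos _ hT) (Frame.alpha_pos _ hT)).le) (by positivity)
        have := mul_le_mul_of_nonneg_left h2' (by positivity : 0 ≤ κ ^ 2)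
        refine mul_le_mul_of_nonneg_left ?_ (by positivity)
        linarith
    _ ≤ _ := by
        rw [mul_assoc (2 * 72 ^ 4 : ℝ)]
        refine mul_le_mul_of_nonneg_left ?_ (by positivity)
        have q1 : 0 ≤ ((Λ : ℝ) ^ k) ^ 2 * κ ^ 4 := by positivity
        have q2 : 0 ≤ ((Λ : ℝ) ^ k) ^ 2 * ((1 + k) * κ ^ 2) := by positivity
        have q3 := mul_nonneg hC₁ q2
        have q4 := mul_nonneg hC₂ q1
        norm_num
        linarith

/-! ### Rational points near the hypersurface: the local bound -/

theorem exists_grid_sum_card_le {m : ℕ} (hm : 2 ≤ m) {D : Set (Fin m → ℝ)} (hD : IsOpen D)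
    {f : (Fin m → ℝ) → ℝ} (hf : ContDiffOn ℝ 2 f D) {x₀ : Fin m → ℝ} (hx₀ : x₀ ∈ D)
    (hdet : (hess f x₀).det ≠ 0) :
    ∃ (U : Set (Fin m → ℝ)) (K θ : ℝ) (B' B : (Fin m → ℝ) →ₗ[ℝ] (Fin m → ℝ)) (ρ : ℝ) (Λ : ℕ)
      (C : ℝ), Metric.ball x₀ (ρ / 2) ⊆ U ∧
      GridFrames (vecFrame f) U K θ B' B (fun i => x₀ i - ρ / 2) ρ Λ ∧ 0 ≤ C ∧
      ∀ (k : ℕ) (κ : ℝ), 1 ≤ κ → ∑ r ∈ cube m (Λ ^ k),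
        (((vecFrame f (node (fun i => x₀ i - ρ / 2) ρ Λ k r)).sizeBall ((Λ : ℝ) ^ k) κ).card : ℝ)
        ≤ C * (((Λ : ℝ) ^ k) ^ m * (κ ^ (m + 2) + (1 + k) * κ ^ 2)) := by
  obtain ⟨r, hr, K, θ, B, -, F, F', hB⟩ := exists_local_frames (by omega) hD hf hx₀ hdet
  set ρ : ℝ := min 1 (r / 2) with hρdef
  have hρ : 0 < ρ := by positivity
  have hρ1 : ρ ≤ 1 := min_le_left _ _
  have hρr : ρ ≤ r / 2 := min_le_right _ _
  have hd : ∀ y, (vecFrame f y).dual = covecFrame f y := vecFrame_dual f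
  have hball : Metric.closedBall (fun i => x₀ i - ρ / 2) ρ ⊆ Metric.ball x₀ r := by
    refine Metric.closedBall_subset_ball' ?_
    have : dist (fun i => x₀ i - ρ / 2) x₀ ≤ ρ / 2 :=
      (dist_pi_le_iff (by positivity)).2 fun i => by
        rw [Real.dist_eq, sub_sub_cancel_left, abs_neg, abs_of_pos (by positivity)]
    linarith
  obtain ⟨M₁, hM₁, hc₁⟩ := F.exists_contract hm hρ hρ1
  obtain ⟨M₂, hM₂, hc₂⟩ := F'.exists_contract hm hρ hρ1
  have grids : ∀ M, M₁ ≤ M → M₂ ≤ M →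
      GridFrames (vecFrame f) (Metric.ball x₀ r) K θ (-LinearMap.id) (-B)
        (fun i => x₀ i - ρ / 2) ρ (M * M) ∧
      GridFrames (covecFrame f) (Metric.ball x₀ r) K θ B LinearMap.id
        (fun i => x₀ i - ρ / 2) ρ (M * M) := fun M h1 h2 => by
    have h4 : 2 ≤ M * M := by nlinarith
    exact ⟨⟨F, hm, hρ, hρ1, h4, hball, hc₁ M h1⟩, ⟨F', hm, hρ, hρ1, h4, hball, hc₂ M h2⟩⟩
  have hsub : Metric.ball x₀ (ρ / 2) ⊆ Metric.ball x₀ r := Metric.ball_subset_ball (by linarith)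
  rcases hm.eq_or_lt with rfl | hm3
  · have hB' : ∀ h k, (-B) h ⬝ᵥ k = h ⬝ᵥ (-B) k := fun h k => by simp [hB h k]
    obtain ⟨C, hC, hl⟩ := F.exists_sum_inv_bsize_le hB' (fun _ => rfl) hρ hρ1
    obtain ⟨M₃, hM₃⟩ := exists_nat_ge ((2 * C) ^ 2)
    set M := max M₁ (max M₂ M₃) with hM
    obtain ⟨G, G'⟩ := grids M (le_max_left _ _) ((le_max_left _ _).trans (le_max_right _ _))
    have hM1 : 1 ≤ M := by have : M₁ ≤ M := le_max_left _ _; omega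
    have hsq : 2 * C ≤ Real.sqrt M := by
      refine Real.le_sqrt_of_sq_le (hM₃.trans ?_)
      exact_mod_cast (le_max_right _ _).trans (le_max_right _ _)
    have L : LineFrames (vecFrame f) (Metric.ball x₀ r) K θ (-B) (fun i => x₀ i - ρ / 2) ρ
        (M * M) := by
      refine ⟨G, hB', fun _ => rfl, fun y T hT hy l hl1 hl0 => ?_⟩
      have h := (hl y T hT hy l hl1 hl0).2 M hM1
      have hs := Real.sqrt_pos.2 ((vecFrame f y).bsize_pos hT hl0)
      rw [le_div_iff₀ hs] at h ⊢
      set X := ∑ t ∈ cube 2 (M * M), Real.sqrt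
        (1 / (vecFrame f (gridPt y (ρ / (T * (M * M : ℕ))) t)).bsize (T * (M * M : ℕ)) l)
      have hX : 0 ≤ X := Finset.sum_nonneg fun _ _ => Real.sqrt_nonneg _
      have h2 : 2 * C * (X * Real.sqrt ((vecFrame f y).bsize T l))
          ≤ C * ((M * M : ℕ) : ℝ) ^ 2 := by
        refine le_trans ?_ h
        rw [mul_assoc (Real.sqrt M)]
        exact mul_le_mul_of_nonneg_right hsq (by positivity)
      have hC0 : 0 < C := by linarith
      refine le_of_mul_le_mul_left ?_ hC0
      linarith
    obtain ⟨C', hC', h⟩ := L.exists_sum_card_le G' hd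
    exact ⟨_, K, θ, _, _, ρ, M * M, C', hsub, G, hC', h⟩
  · obtain ⟨G, G'⟩ := grids _ (le_max_left M₁ M₂) (le_max_right M₁ M₂)
    obtain ⟨C', hC', h⟩ := G.exists_sum_card_le_of_three_le G' hd hm3
    exact ⟨_, K, θ, _, _, ρ, _, C', hsub, G, hC', h⟩

lemma exists_node_near {m : ℕ} {x₀ y : Fin m → ℝ} {ρ : ℝ} {Λ : ℕ} (hρ : 0 < ρ) (hρ1 : ρ ≤ 1)
    (hΛ : 0 < Λ) (hy : y ∈ Metric.ball x₀ (ρ / 2)) (k : ℕ) : ∃ r ∈ cube m (Λ ^ k),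
      ‖node (fun i => x₀ i - ρ / 2) ρ Λ k r - y‖ ≤ 1 / (Λ : ℝ) ^ k := by
  have hT : 0 < (Λ : ℝ) ^ k := by positivity
  set s : Fin m → ℝ := fun i => (y i - (x₀ i - ρ / 2)) * (Λ : ℝ) ^ k / ρ with hs
  have hyi : ∀ i, -(ρ / 2) < y i - x₀ i ∧ y i - x₀ i < ρ / 2 := fun i => by
    have := (dist_pi_lt_iff (by positivity)).1 hy i
    rwa [Real.dist_eq, abs_lt] at this
  have hs0 : ∀ i, 0 ≤ s i := fun i => by
    have : 0 ≤ y i - (x₀ i - ρ / 2) := by linarith [(hyi i).1]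
    positivity
  refine ⟨fun i => ⌊s i⌋₊, mem_cube.2 fun i => ?_, (pi_norm_le_iff_of_nonneg (by positivity)).2
    fun i => ?_⟩
  · rw [Nat.floor_lt (hs0 i), hs, div_lt_iff₀ hρ]
    push_cast
    rw [mul_comm]
    exact mul_lt_mul_of_pos_left (by linarith [(hyi i).2]) hT
  · have e : node (fun i => x₀ i - ρ / 2) ρ Λ k (fun i => ⌊s i⌋₊) i - y i
        = ρ / (Λ : ℝ) ^ k * (⌊s i⌋₊ - s i) := by
      simp only [node, gridPt, hs]
      field_simp
      ring
    rw [Pi.sub_apply, e, Real.norm_eq_abs, abs_mul,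
      abs_of_pos (by positivity : 0 < ρ / (Λ : ℝ) ^ k)]
    have h1 : |(⌊s i⌋₊ : ℝ) - s i| ≤ 1 := by
      have := Nat.floor_le (hs0 i)
      have := Nat.lt_floor_add_one (s i)
      rw [abs_le]
      constructor <;> linarith
    calc _ ≤ ρ / (Λ : ℝ) ^ k * 1 := by gcongr
      _ ≤ _ := by rw [mul_one]; gcongr

lemma size_vecFrame_le {m : ℕ} (f : (Fin m → ℝ) → ℝ) {q : ℤ} (hq : 1 ≤ q) (a : Fin m → ℤ)
    {T : ℝ} (v : IVec m) (hv : v = ⟨q, a, round ((q : ℝ) * f fun i => (a i : ℝ) / q)⟩) :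
    (vecFrame f fun i => (a i : ℝ) / q).size T v
      = q / T + T * nint ((q : ℝ) * f fun i => (a i : ℝ) / q) := by
  have hq0 : (0 : ℝ) < q := by exact_mod_cast hq
  subst hv
  set x : Fin m → ℝ := fun i => (a i : ℝ) / q with hx
  have e : (fun i => (a i : ℝ)) = (q : ℝ) • x := by
    ext i
    simp only [hx, Pi.smul_apply, smul_eq_mul]
    field_simp
  have h1 : (vecFrame f x).horiz ⟨q, a, round ((q : ℝ) * f x)⟩ = 0 := by
    ext i
    have := congrFun e i
    simp only [Frame.horiz, vecFrame, this]
    simp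
  have h2 : (vecFrame f x).vert ⟨q, a, round ((q : ℝ) * f x)⟩
      = -(q * f x - round ((q : ℝ) * f x)) := by
    simp only [Frame.vert, vecFrame]
    rw [e, smul_dotProduct, dotProduct_neg, smul_eq_mul]
    ring
  rw [Frame.size, h1, h2, abs_neg, norm_zero, add_zero, nint, abs_of_pos hq0]

lemma one_add_le_log {k : ℕ} {Q : ℝ} (hQ : 2 ≤ Q) (h : (2 : ℝ) ^ k ≤ Q) :
    1 + (k : ℝ) ≤ 4 * Real.log Q := by
  have h2 := Real.log_two_gt_d9
  have h3 := Real.log_le_log (by norm_num) hQ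
  have h4 := Real.log_le_log (by positivity) h
  rw [Real.log_pow] at h4
  have : (k : ℝ) * (1 / 2) ≤ k * Real.log 2 := by gcongr; linarith
  linarith

theorem exists_local_card_le {m : ℕ} (hm : 2 ≤ m) {D : Set (Fin m → ℝ)} (hD : IsOpen D)
    {f : (Fin m → ℝ) → ℝ} (hf : ContDiffOn ℝ 2 f D) {x₀ : Fin m → ℝ} (hx₀ : x₀ ∈ D)
    (hdet : (hess f x₀).det ≠ 0) :
    ∃ V ∈ nhds x₀, ∃ C : ℝ, 0 ≤ C ∧ ∀ Q δ : ℝ, 2 ≤ Q → 0 < δ → δ ≤ 1 / 2 →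
      ∀ Z : Finset (ℤ × (Fin m → ℤ)), (∀ p ∈ Z, 1 ≤ p.1 ∧ (p.1 : ℝ) ≤ Q ∧
        nint ((p.1 : ℝ) * f (fun i => (p.2 i : ℝ) / p.1)) < δ ∧
        (fun i => (p.2 i : ℝ) / p.1) ∈ V) →
      (Z.card : ℝ) ≤ C * (δ * Q ^ (m + 1) + Q ^ m * Real.log Q) := by
  classical
  obtain ⟨U, K, θ, B', B, ρ, Λ, C, hU, G, hC, h⟩ := exists_grid_sum_card_le hm hD hf hx₀ hdet
  have hρ := G.rho_pos
  have hΛ := G.scale_pos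
  have hΛ2 : (2 : ℝ) ≤ Λ := by exact_mod_cast G.two_le
  have hK := G.one_le
  have hm' : (2 : ℝ) ≤ m := by exact_mod_cast hm
  set C₁ : ℝ := 18 * m * K * Λ with hC₁
  have hC₁1 : 1 ≤ C₁ := by
    have h1 : 1 ≤ m * K := one_le_mul_of_one_le_of_one_le (by linarith) hK
    have : 1 ≤ m * K * Λ := one_le_mul_of_one_le_of_one_le h1 (by linarith)
    rw [hC₁]; linarith
  refine ⟨Metric.ball x₀ (ρ / 2), Metric.ball_mem_nhds _ (by positivity),
    C * (6 * C₁ ^ (m + 2)), by positivity, fun Q δ hQ hδ hδ2 Z hZ => ?_⟩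
  have hQ0 : 0 < Q := by linarith
  set δ' := max δ (1 / Q) with hδ'
  have hδ'0 : 0 < δ' := lt_max_of_lt_left hδ
  have hδ'1 : δ' ≤ 1 := max_le (by linarith) (by rw [div_le_one hQ0]; linarith)
  have hδQ : 1 ≤ Q * δ' := by
    have : 1 / Q ≤ δ' := le_max_right _ _
    rwa [div_le_iff₀ hQ0, mul_comm] at this
  set κ₀ := Real.sqrt (Q * δ') with hκ₀
  set τ := Real.sqrt (Q / δ') with hτ
  have hκ₀1 : 1 ≤ κ₀ := Real.one_le_sqrt.2 hδQ
  have hκ₀sq : κ₀ ^ 2 = Q * δ' := Real.sq_sqrt (by positivity)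
  have hτ1 : 1 ≤ τ := Real.one_le_sqrt.2 (by rw [one_le_div hδ'0]; linarith)
  have hκτ : κ₀ * τ = Q := by
    rw [hκ₀, hτ, ← Real.sqrt_mul (by positivity),
      show Q * δ' * (Q / δ') = Q ^ 2 by field_simp, Real.sqrt_sq hQ0.le]
  have hδτ : δ' * τ = κ₀ := by
    have : κ₀ * κ₀ = κ₀ * (δ' * τ) := by
      rw [← sq, hκ₀sq, mul_left_comm, hκτ, mul_comm]
    exact (mul_left_cancel₀ (by positivity) this).symm
  obtain ⟨k, hk1, hk2⟩ := exists_nat_pow_near hτ1 (by linarith : (1 : ℝ) < Λ)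
  set T := (Λ : ℝ) ^ k with hTdef
  have hT : 0 < T := by positivity
  have hτT : τ ≤ Λ * T := by rw [pow_succ] at hk2; linarith
  have hTκ : T * κ₀ ≤ Q := by rw [← hκτ, mul_comm]; gcongr
  have hTQ : T ≤ Q := by
    refine le_trans ?_ hTκ
    exact le_mul_of_one_le_right hT.le hκ₀1
  have hQT : Q ≤ κ₀ * Λ * T := by rw [← hκτ, mul_assoc]; gcongr
  have hκ1 : 1 ≤ C₁ * κ₀ := one_le_mul_of_one_le_of_one_le hC₁1 hκ₀1
  set φ : ℤ × (Fin m → ℤ) → IVec m := fun p =>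
    ⟨p.1, p.2, round ((p.1 : ℝ) * f fun i => (p.2 i : ℝ) / p.1)⟩ with hφ
  have hφinj : Function.Injective φ := fun p p' hpp => by
    simp only [hφ, Prod.mk.injEq] at hpp
    exact Prod.ext hpp.1 hpp.2.1
  have hsub : Z.image φ ⊆ (cube m (Λ ^ k)).biUnion fun r =>
      (vecFrame f (node (fun i => x₀ i - ρ / 2) ρ Λ k r)).sizeBall T (C₁ * κ₀) := by
    intro v hv
    obtain ⟨p, hp, rfl⟩ := Finset.mem_image.1 hv
    obtain ⟨hq1, hqQ, hn, hpV⟩ := hZ p hp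
    obtain ⟨r, hr, hnear⟩ := exists_node_near hρ G.rho_le (by exact_mod_cast hΛ) hpV k
    refine Finset.mem_biUnion.2 ⟨r, hr, (Frame.mem_sizeBall hT).2 ?_⟩
    have hsz := size_vecFrame_le f hq1 p.2 (T := T) (φ p) rfl
    have hs : (vecFrame f fun i => (p.2 i : ℝ) / p.1).size T (φ p) ≤ 2 * Λ * κ₀ := by
      rw [hsz]
      have h1 : (p.1 : ℝ) / T ≤ κ₀ * Λ := by rw [div_le_iff₀ hT]; linarith
      have h2 : T * nint ((p.1 : ℝ) * f fun i => (p.2 i : ℝ) / p.1) ≤ κ₀ := by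
        rw [← hδτ, mul_comm δ']
        exact mul_le_mul hk1 (hn.le.trans (le_max_left _ _)) (abs_nonneg _) (by positivity)
      have : κ₀ ≤ Λ * κ₀ := le_mul_of_one_le_left (by positivity) (by linarith)
      linarith
    have hq0 : |((φ p).1 : ℝ)| ≤ κ₀ * Λ * T := by
      have : (0 : ℝ) < p.1 := by exact_mod_cast hq1
      change |(p.1 : ℝ)| ≤ _
      rw [abs_of_pos this]
      linarith
    refine (G.size_le_of_near (by omega) (hU hpV) (G.node_mem hr) hT le_rfl hnear hs hq0).trans
      (le_of_eq ?_)
    rw [hC₁]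
    ring
  have hcard : (Z.card : ℝ) ≤ C * (T ^ m * ((C₁ * κ₀) ^ (m + 2) + (1 + k) * (C₁ * κ₀) ^ 2)) := by
    refine le_trans ?_ (h k (C₁ * κ₀) hκ1)
    rw [← Finset.card_image_of_injective Z hφinj]
    rw [← hTdef, ← Nat.cast_sum, Nat.cast_le]
    exact (Finset.card_le_card hsub).trans Finset.card_biUnion_le
  have hlog2 := Real.log_two_gt_d9
  have hlogQ := Real.log_le_log (by norm_num) hQ
  have b1 : T ^ m * κ₀ ^ (m + 2) ≤ δ * Q ^ (m + 1) + 2 * (Q ^ m * Real.log Q) := by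
    calc T ^ m * κ₀ ^ (m + 2) = (T * κ₀) ^ m * κ₀ ^ 2 := by rw [mul_pow, pow_add]; ring
      _ ≤ Q ^ m * (Q * δ') := by rw [hκ₀sq]; gcongr
      _ ≤ Q ^ m * (Q * (δ + 1 / Q)) := by
          gcongr
          exact max_le (le_add_of_nonneg_right (by positivity)) (le_add_of_nonneg_left hδ.le)
      _ = δ * Q ^ (m + 1) + Q ^ m * 1 := by rw [pow_succ]; field_simp
      _ ≤ δ * Q ^ (m + 1) + Q ^ m * (2 * Real.log Q) := by gcongr; linarith
      _ = _ := by ring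
  have b2 : T ^ m * ((1 + k) * κ₀ ^ 2) ≤ 4 * (Q ^ m * Real.log Q) := by
    have hk := one_add_le_log hQ (((pow_le_pow_left₀ (by norm_num) hΛ2 k)).trans hTQ)
    have e : ∀ X : ℝ, X ^ m = X ^ (m - 2) * X ^ 2 := fun X => by
      rw [← pow_add]; congr 1; omega
    calc T ^ m * ((1 + k) * κ₀ ^ 2) = T ^ (m - 2) * (T * κ₀) ^ 2 * (1 + k) := by
          rw [e T]; ring
      _ ≤ Q ^ (m - 2) * Q ^ 2 * (4 * Real.log Q) := by gcongr
      _ = _ := by rw [← e]; ring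
  have hpow : C₁ ^ 2 ≤ C₁ ^ (m + 2) := pow_le_pow_right₀ hC₁1 (by omega)
  have hlog0 : 0 ≤ Q ^ m * Real.log Q := by
    have : 0 ≤ Real.log Q := by linarith
    positivity
  have hδ0 : 0 ≤ δ * Q ^ (m + 1) := by positivity
  refine hcard.trans ?_
  rw [mul_assoc C]
  refine mul_le_mul_of_nonneg_left ?_ hC
  calc T ^ m * ((C₁ * κ₀) ^ (m + 2) + (1 + k) * (C₁ * κ₀) ^ 2)
      = C₁ ^ (m + 2) * (T ^ m * κ₀ ^ (m + 2)) + C₁ ^ 2 * (T ^ m * ((1 + k) * κ₀ ^ 2)) := by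
        rw [mul_pow C₁ κ₀ (m + 2)]; ring
    _ ≤ C₁ ^ (m + 2) * (δ * Q ^ (m + 1) + 2 * (Q ^ m * Real.log Q))
        + C₁ ^ (m + 2) * (4 * (Q ^ m * Real.log Q)) := by gcongr
    _ ≤ C₁ ^ (m + 2) * (6 * (δ * Q ^ (m + 1) + Q ^ m * Real.log Q)) := by
        rw [← mul_add]
        refine mul_le_mul_of_nonneg_left ?_ (by positivity)
        linarith
    _ = _ := by ring

/-! ### Rational points near the hypersurface: the global bound -/

theorem exists_compact_card_le {m : ℕ} (hm : 2 ≤ m) {D : Set (Fin m → ℝ)} (hD : IsOpen D)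
    {f : (Fin m → ℝ) → ℝ} (hf : ContDiffOn ℝ 2 f D) (hdet : ∀ x ∈ D, (hess f x).det ≠ 0)
    {S : Set (Fin m → ℝ)} (hS : IsCompact S) (hSD : S ⊆ D) :
    ∃ C : ℝ, 0 ≤ C ∧ ∀ Q δ : ℝ, 2 ≤ Q → 0 < δ → δ ≤ 1 / 2 →
      ∀ Z : Finset (ℤ × (Fin m → ℤ)), (∀ p ∈ Z, 1 ≤ p.1 ∧ (p.1 : ℝ) ≤ Q ∧
        nint ((p.1 : ℝ) * f (fun i => (p.2 i : ℝ) / p.1)) < δ ∧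
        (fun i => (p.2 i : ℝ) / p.1) ∈ S) →
      (Z.card : ℝ) ≤ C * (δ * Q ^ (m + 1) + Q ^ m * Real.log Q) := by
  classical
  refine hS.induction_on (p := fun s => ∃ C : ℝ, 0 ≤ C ∧ ∀ Q δ : ℝ, 2 ≤ Q → 0 < δ → δ ≤ 1 / 2 →
      ∀ Z : Finset (ℤ × (Fin m → ℤ)), (∀ p ∈ Z, 1 ≤ p.1 ∧ (p.1 : ℝ) ≤ Q ∧
        nint ((p.1 : ℝ) * f (fun i => (p.2 i : ℝ) / p.1)) < δ ∧
        (fun i => (p.2 i : ℝ) / p.1) ∈ s) →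
      (Z.card : ℝ) ≤ C * (δ * Q ^ (m + 1) + Q ^ m * Real.log Q)) ?_ ?_ ?_ ?_
  · refine ⟨0, le_rfl, fun Q δ _ _ _ Z hZ => ?_⟩
    have : Z = ∅ := Finset.eq_empty_of_forall_notMem fun p hp => (hZ p hp).2.2.2
    simp [this]
  · rintro s t hst ⟨C, hC, h⟩
    exact ⟨C, hC, fun Q δ hQ hδ hδ' Z hZ => h Q δ hQ hδ hδ' Z fun p hp =>
      ⟨(hZ p hp).1, (hZ p hp).2.1, (hZ p hp).2.2.1, hst (hZ p hp).2.2.2⟩⟩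
  · rintro s t ⟨C₁, hC₁, h₁⟩ ⟨C₂, hC₂, h₂⟩
    refine ⟨C₁ + C₂, by positivity, fun Q δ hQ hδ hδ' Z hZ => ?_⟩
    set Z₁ := Z.filter fun p => (fun i => (p.2 i : ℝ) / p.1) ∈ s with hZ₁
    set Z₂ := Z.filter fun p => (fun i => (p.2 i : ℝ) / p.1) ∈ t with hZ₂
    have hsub : Z ⊆ Z₁ ∪ Z₂ := by
      intro p hp
      rcases (hZ p hp).2.2.2 with h | h
      · exact Finset.mem_union_left _ (Finset.mem_filter.2 ⟨hp, h⟩)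
      · exact Finset.mem_union_right _ (Finset.mem_filter.2 ⟨hp, h⟩)
    have hcard : (Z.card : ℝ) ≤ Z₁.card + Z₂.card := by
      exact_mod_cast (Finset.card_le_card hsub).trans (Finset.card_union_le _ _)
    have e₁ := h₁ Q δ hQ hδ hδ' Z₁ fun p hp => by
      obtain ⟨hp, hps⟩ := Finset.mem_filter.1 hp
      exact ⟨(hZ p hp).1, (hZ p hp).2.1, (hZ p hp).2.2.1, hps⟩
    have e₂ := h₂ Q δ hQ hδ hδ' Z₂ fun p hp => by
      obtain ⟨hp, hps⟩ := Finset.mem_filter.1 hp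
      exact ⟨(hZ p hp).1, (hZ p hp).2.1, (hZ p hp).2.2.1, hps⟩
    linarith
  · intro x hx
    obtain ⟨V, hV, C, hC, h⟩ := exists_local_card_le hm hD hf (hSD hx) (hdet x (hSD hx))
    exact ⟨V, mem_nhdsWithin_of_mem_nhds hV, C, hC, h⟩

theorem NSw_eq_sum {m : ℕ} {f w : (Fin m → ℝ) → ℝ} {R : ℝ} (hR : 0 ≤ R)
    (hw : ∀ x, w x ≠ 0 → ∀ i, |x i| ≤ R) (Q δ : ℝ) :
    NSw f w Q δ = ∑ q ∈ Finset.Icc (1 : ℤ) ⌊Q⌋,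
      ∑ a ∈ Fintype.piFinset fun _ : Fin m => Finset.Icc (-⌈Q * R⌉) ⌈Q * R⌉,
      if 1 ≤ q ∧ (q : ℝ) ≤ Q ∧ nint ((q : ℝ) * f (fun i => (a i : ℝ) / (q : ℝ))) < δ
        then w (fun i => (a i : ℝ) / (q : ℝ)) else 0 := by
  have hinner : ∀ q : ℤ, (∑ᶠ a : Fin m → ℤ,
      if 1 ≤ q ∧ (q : ℝ) ≤ Q ∧ nint ((q : ℝ) * f (fun i => (a i : ℝ) / (q : ℝ))) < δ
        then w (fun i => (a i : ℝ) / (q : ℝ)) else 0) =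
      ∑ a ∈ Fintype.piFinset fun _ : Fin m => Finset.Icc (-⌈Q * R⌉) ⌈Q * R⌉,
      if 1 ≤ q ∧ (q : ℝ) ≤ Q ∧ nint ((q : ℝ) * f (fun i => (a i : ℝ) / (q : ℝ))) < δ
        then w (fun i => (a i : ℝ) / (q : ℝ)) else 0 := by
    intro q
    refine finsum_eq_sum_of_support_subset _ fun a ha => ?_
    rw [Function.mem_support, Ne, ite_eq_right_iff, Classical.not_imp] at ha
    obtain ⟨⟨hq, hqQ, -⟩, hwa⟩ := ha
    have hq0 : (0 : ℝ) < q := by exact_mod_cast hq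
    refine Finset.mem_coe.2 (Fintype.mem_piFinset.2 fun i => ?_)
    have h := hw _ hwa i
    rw [abs_div, abs_of_pos hq0, div_le_iff₀ hq0] at h
    have h' : |(a i : ℝ)| ≤ (⌈Q * R⌉ : ℤ) := by
      have := Int.le_ceil (Q * R)
      nlinarith
    exact Finset.mem_Icc.2 (abs_le.1 (by exact_mod_cast h'))
  rw [NSw, finsum_congr hinner]
  refine finsum_eq_sum_of_support_subset _ fun q hq => ?_
  obtain ⟨a, -, ha⟩ := Finset.exists_ne_zero_of_sum_ne_zero hq
  rw [Ne, ite_eq_right_iff, Classical.not_imp] at ha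
  exact Finset.mem_coe.2 (Finset.mem_Icc.2 ⟨ha.1.1, Int.le_floor.2 ha.1.2.1⟩)

theorem exists_NSw_le {m : ℕ} (hm : 2 ≤ m) {D : Set (Fin m → ℝ)} (hD : IsOpen D)
    {f : (Fin m → ℝ) → ℝ} (hf : ContDiffOn ℝ 2 f D) (hdet : ∀ x ∈ D, (hess f x).det ≠ 0)
    {w : (Fin m → ℝ) → ℝ} (hw : Continuous w) (hwc : HasCompactSupport w)
    (hwD : tsupport w ⊆ D) :
    ∃ C : ℝ, 0 ≤ C ∧ ∀ Q δ : ℝ, 2 ≤ Q → 0 < δ → δ ≤ 1 / 2 →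
      NSw f w Q δ ≤ C * (δ * Q ^ (m + 1) + Q ^ m * Real.log Q) := by
  classical
  obtain ⟨W, hW⟩ := hwc.exists_bound_of_continuous hw
  have hW0 : 0 ≤ W := (norm_nonneg _).trans (hW 0)
  obtain ⟨R, hR⟩ := hwc.isBounded.exists_norm_le
  have hsupp : ∀ x, w x ≠ 0 → ∀ i, |x i| ≤ max R 0 := fun x hx i =>
    (norm_le_pi_norm x i).trans ((hR x (subset_tsupport w hx)).trans (le_max_left _ _))
  obtain ⟨C, hC, h⟩ := exists_compact_card_le hm hD hf hdet hwc hwD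
  refine ⟨W * C, by positivity, fun Q δ hQ hδ hδ' => ?_⟩
  rw [NSw_eq_sum (le_max_right R 0) hsupp, ← Finset.sum_product']
  set Z := (Finset.Icc (1 : ℤ) ⌊Q⌋ ×ˢ
    Fintype.piFinset fun _ : Fin m => Finset.Icc (-⌈Q * max R 0⌉) ⌈Q * max R 0⌉).filter fun p =>
      (1 ≤ p.1 ∧ (p.1 : ℝ) ≤ Q ∧ nint ((p.1 : ℝ) * f (fun i => (p.2 i : ℝ) / p.1)) < δ) ∧
        (fun i => (p.2 i : ℝ) / p.1) ∈ tsupport w with hZ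
  have hcard := h Q δ hQ hδ hδ' Z fun p hp => by
    obtain ⟨-, ⟨h1, h2, h3⟩, h4⟩ := Finset.mem_filter.1 hp
    exact ⟨h1, h2, h3, h4⟩
  calc _ ≤ ∑ p ∈ Finset.Icc (1 : ℤ) ⌊Q⌋ ×ˢ
        Fintype.piFinset fun _ : Fin m => Finset.Icc (-⌈Q * max R 0⌉) ⌈Q * max R 0⌉,
        if (1 ≤ p.1 ∧ (p.1 : ℝ) ≤ Q ∧
            nint ((p.1 : ℝ) * f (fun i => (p.2 i : ℝ) / p.1)) < δ) ∧
          (fun i => (p.2 i : ℝ) / p.1) ∈ tsupport w then W else 0 := by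
        refine Finset.sum_le_sum fun p _ => ?_
        by_cases hp : 1 ≤ p.1 ∧ (p.1 : ℝ) ≤ Q ∧
          nint ((p.1 : ℝ) * f (fun i => (p.2 i : ℝ) / p.1)) < δ
        · rw [if_pos hp]
          by_cases hs : (fun i => (p.2 i : ℝ) / p.1) ∈ tsupport w
          · rw [if_pos ⟨hp, hs⟩]
            exact (le_abs_self _).trans (hW _)
          · rw [if_neg fun h => hs h.2, image_eq_zero_of_notMem_tsupport hs]
        · rw [if_neg hp, if_neg fun h => hp h.1]
    _ = Z.card * W := by rw [← Finset.sum_filter, Finset.sum_const, nsmul_eq_mul]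
    _ ≤ W * C * (δ * Q ^ (m + 1) + Q ^ m * Real.log Q) := by
        rw [mul_comm, mul_assoc]
        exact mul_le_mul_of_nonneg_left hcard hW0

theorem statement10 (n : ℕ) (hn : 3 ≤ n) (l : ℕ)
    (hl : l = max ((n - 1) / 2 + 5) (n + 1))
    (D : Set (Fin (n - 1) → ℝ)) (hDopen : IsOpen D)
    (hDbdd : Bornology.IsBounded D) (hDconn : IsConnected D)
    (f : (Fin (n - 1) → ℝ) → ℝ) (hf : ContDiffOn ℝ (l : ℕ∞) f D)
    (c₁ c₂ : ℝ) (hc₁ : 0 < c₁)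
    (hHess : ∀ x ∈ D, c₁ ≤ |(hess f x).det| ∧ |(hess f x).det| ≤ c₂)
    -- `∇f : D → R := ∇f(D)` is a diffeomorphism with inverse `ginv`
    (hinj : Set.InjOn (gradv f) D)
    (ginv : (Fin (n - 1) → ℝ) → (Fin (n - 1) → ℝ))
    (hginvl : ∀ x ∈ D, ginv (gradv f x) = x)
    (hginvr : ∀ y ∈ gradv f '' D, gradv f (ginv y) = y)
    -- dual function `f*(y) = y·(∇f)⁻¹(y) − f((∇f)⁻¹(y))` and dual weight `w*`
    (fstar : (Fin (n - 1) → ℝ) → ℝ)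
    (hfstar : ∀ y, fstar y = (∑ i, y i * ginv y i) - f (ginv y))
    (w : (Fin (n - 1) → ℝ) → ℝ) (hw : ContDiff ℝ (⊤ : ℕ∞) w)
    (hwc : HasCompactSupport w) (hwD : tsupport w ⊆ D)
    (wstar : (Fin (n - 1) → ℝ) → ℝ) (hwstar : ∀ y, wstar y = w (ginv y)) :
    -- `C₀` and `C` depend only on `S` and `w`, not on `A` and `β*`.
    ∃ C₀ > (0 : ℝ), ∃ C > (0 : ℝ), ∀ A βs : ℝ, (n : ℝ) - 1 < βs → 1 ≤ A →
      (∀ Qs δs : ℝ, 1 ≤ Qs → 0 < δs → δs ≤ 1 / 2 →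
        NSw fstar wstar Qs δs ≤ A * (δs * Qs ^ n + Qs ^ βs)) →
      ∀ Q δ : ℝ, 2 ≤ Q → 0 < δ → δ ≤ 1 / 2 →
        NSw f w Q δ ≤ C₀ * δ * Q ^ n + C * A *
          max (Q ^ ((n : ℝ) - ((n : ℝ) - 1) / (2 * βs - (n : ℝ) + 1)))
            (Q ^ (n - 1) * Real.log Q) := by
  obtain ⟨m, rfl⟩ : ∃ m, n = m + 1 := ⟨n - 1, by omega⟩
  have hl2 : 2 ≤ l := by omega
  have hf2 : ContDiffOn ℝ 2 f D := hf.of_le <| by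
    have : ((2 : ℕ) : ℕ∞) ≤ (l : ℕ∞) := Nat.cast_le.2 hl2
    exact WithTop.coe_le_coe.2 this
  have hdet : ∀ x ∈ D, (hess f x).det ≠ 0 := fun x hx =>
    abs_pos.1 (hc₁.trans_le (hHess x hx).1)
  obtain ⟨C, hC, h⟩ := exists_NSw_le (by omega) hDopen hf2 hdet hw.continuous hwc hwD
  refine ⟨C + 1, by positivity, C + 1, by positivity, fun A βs _ hA _ Q δ hQ hδ hδ' => ?_⟩
  refine (h Q δ hQ hδ hδ').trans ?_
  set M := max (Q ^
    (((m + 1 : ℕ) : ℝ) - (((m + 1 : ℕ) : ℝ) - 1) / (2 * βs - ((m + 1 : ℕ) : ℝ) + 1)))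
    (Q ^ (m + 1 - 1) * Real.log Q)
  have hM : Q ^ (m + 1 - 1) * Real.log Q ≤ M := le_max_right _ _
  have hlog : 0 ≤ Q ^ (m + 1 - 1) * Real.log Q :=
    mul_nonneg (by positivity) (Real.log_nonneg (by linarith))
  have hAM : M ≤ A * M := le_mul_of_one_le_left (hlog.trans hM) hA
  have h1 : 0 ≤ δ * Q ^ (m + 1) := by positivity
  have h2 : C * (Q ^ (m + 1 - 1) * Real.log Q) ≤ C * (A * M) :=
    mul_le_mul_of_nonneg_left (hM.trans hAM) hC
  have h3 : 0 ≤ A * M := by linarith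
  calc C * (δ * Q ^ (m + 1 - 1 + 1) + Q ^ (m + 1 - 1) * Real.log Q)
      = C * (δ * Q ^ (m + 1)) + C * (Q ^ (m + 1 - 1) * Real.log Q) := by
        rw [Nat.add_sub_cancel]; ring
    _ ≤ (C + 1) * (δ * Q ^ (m + 1)) + (C + 1) * (A * M) := by nlinarith
    _ = (C + 1) * δ * Q ^ (m + 1) + (C + 1) * A * M := by ring
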